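/- Suppose either d ≥ 4 and 1 ≤ r ≤ d/(d−1), or d = 3 and 4/3 < r ≤ 3/2. Let 𝔔_d(r) be the closed quadrangle in the (1/p,1/q)-plane with vertices Q_1(r) = (1/(rd), 1/(rd)), Q_2(r) = ((r(d−1)−1)/(r(d−1)), (r(d−1)−1)/(r(d−1))), Q_3(r) = ((r(d−1)−1)/(r(d−1)), 1/(r(d−1))), Q_4(r) = (1 − (d+1)/(rd(d−1)), 1/(rd)). Then V_r^I A is bounded from L^p(ℝ^d) to L^q(ℝ^d) for every (1/p,1/q) in the interior of 𝔔_d(r), and unbounded for every (1/p,1/q) not in 𝔔_d(r); moreover, V_r^I A : L^p → L^q is bounded for (1/p,1/q) on the half-open line segments (Q_4(r), Q_1(r)] and [Q_1(r), Q_2(r)). -/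

import Mathlib

open MeasureTheory Metric Set
open scoped ENNReal NNReal FourierTransform

noncomputable section

/-- Euclidean `d`-space. -/
abbrev Euc (d : ℕ) : Type := EuclideanSpace ℝ (Fin d)

/-- The normalized surface measure `σ` on the unit sphere `S^{d-1} ⊆ ℝ^d`. -/
def sphereMeasure (d : ℕ) : Measure (Euc d) :=
  (((volume : Measure (Euc d)).toSphere Set.univ)⁻¹ : ℝ≥0∞) •
    ((volume : Measure (Euc d)).toSphere.map Subtype.val)

/-- The spherical average `A_t f(x) = ∫_{S^{d-1}} f(x - t y) dσ(y)`. -/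
def sphAvg {d : ℕ} (f : Euc d → ℂ) (t : ℝ) (x : Euc d) : ℂ :=
  ∫ y, f (x - t • y) ∂(sphereMeasure d)

/-- The `r`-variation of the family `t ↦ a t` over the set `E ⊆ ℝ`. -/
def rVar (r : ℝ) (E : Set ℝ) (a : ℝ → ℂ) : ℝ≥0∞ :=
  ⨆ (N : ℕ) (t : Fin (N + 1) → ℝ) (_ : StrictMono t) (_ : ∀ i, t i ∈ E),
    (∑ i : Fin N, (‖a (t i.succ) - a (t i.castSucc)‖₊ : ℝ≥0∞) ^ r) ^ (1 / r)

/-- The global variation operator `V_r A` for the spherical means. -/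
def VrA {d : ℕ} (r : ℝ) (f : Euc d → ℂ) (x : Euc d) : ℝ≥0∞ :=
  rVar r (Set.Ioi 0) (fun t => sphAvg f t x)

/-- The local variation operator `V_r^I A`, `I = [1,2]`. -/
def VrIA {d : ℕ} (r : ℝ) (f : Euc d → ℂ) (x : Euc d) : ℝ≥0∞ :=
  rVar r (Set.Icc 1 2) (fun t => sphAvg f t x)

/-- `L^q` norm (with respect to `μ`) of an `ℝ≥0∞`-valued function, `1 ≤ q ≤ ∞`. -/
def lqNorm {α : Type*} [MeasurableSpace α] (q : ℝ≥0∞) (g : α → ℝ≥0∞)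
    (μ : Measure α) : ℝ≥0∞ :=
  if q = ∞ then essSup g μ else (∫⁻ x, g x ^ q.toReal ∂μ) ^ (1 / q.toReal)

/-- Boundedness `L^p → L^q` of an `ℝ≥0∞`-valued operator (exponents in `ℝ≥0∞`). -/
def IsBddLpLq (d : ℕ) (p q : ℝ≥0∞) (T : (Euc d → ℂ) → Euc d → ℝ≥0∞) : Prop :=
  ∃ C : ℝ≥0, ∀ f : Euc d → ℂ, MemLp f p volume →
    lqNorm q (T f) volume ≤ C * eLpNorm f p volume

/-- `V_r^I A` is bounded from `L^p(ℝ^d)` to `L^q(ℝ^d)` (real exponents). -/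
def IsBddR (d : ℕ) (r p q : ℝ) : Prop :=
  ∃ C : ℝ≥0, ∀ f : Euc d → ℂ, MemLp f (ENNReal.ofReal p) volume →
    lqNorm (ENNReal.ofReal q) (VrIA r f) volume ≤
      C * eLpNorm f (ENNReal.ofReal p) volume

/-- The quadrangle `𝔔_d(r)` of Theorem 1.5, with vertices
`Q_1(r), Q_2(r), Q_3(r), Q_4(r)`. -/
def quadSmall (d : ℕ) (r : ℝ) : Set (ℝ × ℝ) :=
  convexHull ℝ ({(1 / (r * (d : ℝ)), 1 / (r * (d : ℝ))),
    ((r * ((d : ℝ) - 1) - 1) / (r * ((d : ℝ) - 1)),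
      (r * ((d : ℝ) - 1) - 1) / (r * ((d : ℝ) - 1))),
    ((r * ((d : ℝ) - 1) - 1) / (r * ((d : ℝ) - 1)), 1 / (r * ((d : ℝ) - 1))),
    (1 - ((d : ℝ) + 1) / (r * (d : ℝ) * ((d : ℝ) - 1)), 1 / (r * (d : ℝ)))} : Set (ℝ × ℝ))

/-! ### The sphere measure -/

/-- total mass of the unnormalized sphere measure -/
def cSph (d : ℕ) : ℝ≥0∞ := (volume : Measure (Euc d)).toSphere Set.univ

lemma cSph_ne_top (d : ℕ) : cSph d ≠ ∞ := measure_ne_top _ _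

lemma cSph_ne_zero (d : ℕ) [NeZero d] : cSph d ≠ 0 := by
  unfold cSph
  rw [Measure.toSphere_apply_univ]
  simp [NeZero.ne d, (measure_ball_pos (volume : Measure (Euc d)) 0 one_pos).ne']

instance sph_prob (d : ℕ) [NeZero d] : IsProbabilityMeasure (sphereMeasure d) := by
  constructor
  unfold sphereMeasure
  rw [Measure.smul_apply, Measure.map_apply measurable_subtype_coe MeasurableSet.univ, preimage_univ, smul_eq_mul]
  exact ENNReal.inv_mul_cancel (cSph_ne_zero d) (cSph_ne_top d)

lemma sph_lintegral {d : ℕ} {F : Euc d → ℝ≥0∞} (hF : Measurable F) :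
    ∫⁻ ω, F ω ∂(sphereMeasure d) =
      (cSph d)⁻¹ * ∫⁻ ω, F (ω : Euc d) ∂((volume : Measure (Euc d)).toSphere) := by
  unfold sphereMeasure
  rw [lintegral_smul_measure, lintegral_map hF measurable_subtype_coe]
  rfl

lemma sph_norm (d : ℕ) : ∀ᵐ ω ∂(sphereMeasure d), ‖ω‖ = 1 := by
  unfold sphereMeasure
  refine Measure.ae_smul_measure ?_ _
  rw [ae_map_iff measurable_subtype_coe.aemeasurable
    (measurableSet_eq_fun (by fun_prop) (by fun_prop))]
  exact Filter.Eventually.of_forall fun x => by simp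

lemma polar_lintegral {d : ℕ} [NeZero d] {F : Euc d → ℝ≥0∞} (hF : Measurable F) :
    ∫⁻ x, F x = cSph d * ∫⁻ t in Ioi (0 : ℝ), ENNReal.ofReal (t ^ (d - 1)) *
      ∫⁻ ω, F (t • ω) ∂(sphereMeasure d) := by
  have h1 : ∫⁻ x, F x = ∫⁻ x in ({0}ᶜ : Set (Euc d)), F x := by
    rw [restrict_compl_singleton]
  have h2 : ∫⁻ x in ({0}ᶜ : Set (Euc d)), F x =
      ∫⁻ x : ({0}ᶜ : Set (Euc d)), F x ∂((volume : Measure (Euc d)).comap (↑)) := by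
    rw [lintegral_subtype_comap (measurableSet_singleton _).compl]
  have hmp := (volume : Measure (Euc d)).measurePreserving_homeomorphUnitSphereProd
  have h3 : ∫⁻ x : ({0}ᶜ : Set (Euc d)), F x ∂((volume : Measure (Euc d)).comap (↑)) =
      ∫⁻ z : sphere (0 : Euc d) 1 × Ioi (0 : ℝ), F ((z.2 : ℝ) • (z.1 : Euc d))
        ∂((volume : Measure (Euc d)).toSphere.prod
          (Measure.volumeIoiPow (Module.finrank ℝ (Euc d) - 1))) := by
    rw [← hmp.lintegral_comp_emb (Homeomorph.measurableEmbedding _)]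
    refine lintegral_congr fun x => ?_
    congr 1
    have := (homeomorphUnitSphereProd (Euc d)).symm_apply_apply x
    nth_rewrite 1 [← this]
    rw [homeomorphUnitSphereProd_symm_apply_coe]
  have hm : Measurable fun z : sphere (0 : Euc d) 1 × Ioi (0 : ℝ) =>
      F ((z.2 : ℝ) • (z.1 : Euc d)) := by
    apply hF.comp; fun_prop
  rw [h1, h2, h3, lintegral_prod_symm _ hm.aemeasurable]
  have h4 : ∀ t : ℝ, ∫⁻ ω : sphere (0 : Euc d) 1, F (t • (ω : Euc d))
      ∂((volume : Measure (Euc d)).toSphere) = cSph d * ∫⁻ ω, F (t • ω) ∂(sphereMeasure d) := by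
    intro t
    rw [sph_lintegral (F := fun ω => F (t • ω)) (by fun_prop), ← mul_assoc,
      ENNReal.mul_inv_cancel (cSph_ne_zero d) (cSph_ne_top d), one_mul]
  simp only [h4]
  have hm2 : Measurable fun t : ℝ => ∫⁻ ω, F (t • ω) ∂(sphereMeasure d) := by
    apply Measurable.lintegral_prod_right' (f := fun z : ℝ × Euc d => F (z.1 • z.2))
    apply hF.comp; fun_prop
  rw [lintegral_const_mul _ (by fun_prop)]
  congr 1
  unfold Measure.volumeIoiPow
  rw [lintegral_withDensity_eq_lintegral_mul _ (by fun_prop) (by fun_prop)]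
  simp only [Pi.mul_apply, finrank_euclideanSpace, Fintype.card_fin]
  rw [← lintegral_subtype_comap measurableSet_Ioi (f := fun t => ENNReal.ofReal (t ^ (d - 1)) *
      ∫⁻ ω, F (t • ω) ∂(sphereMeasure d))]

/-- the radial measure `c t^{d-1} dt` on `(0,∞)` -/
def radM (d : ℕ) : Measure ℝ :=
  (volume.restrict (Ioi (0 : ℝ))).withDensity fun t => cSph d * ENNReal.ofReal (t ^ (d - 1))

lemma radM_lintegral {d : ℕ} {G : ℝ → ℝ≥0∞} (hG : Measurable G) :
    ∫⁻ t, G t ∂(radM d) = cSph d * ∫⁻ t in Ioi (0 : ℝ), ENNReal.ofReal (t ^ (d - 1)) * G t := by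
  unfold radM
  rw [lintegral_withDensity_eq_lintegral_mul _ (by fun_prop) hG,
    ← lintegral_const_mul _ (by fun_prop)]
  refine lintegral_congr fun t => ?_
  simp [mul_assoc]

instance radM_sf (d : ℕ) : SFinite (radM d) := by unfold radM; infer_instance

lemma polar_measure (d : ℕ) [NeZero d] :
    (volume : Measure (Euc d)) =
      ((radM d).prod (sphereMeasure d)).map (fun z : ℝ × Euc d => z.1 • z.2) := by
  refine Measure.ext_of_lintegral _ fun F hF => ?_
  rw [lintegral_map hF (by fun_prop), lintegral_prod _ (by fun_prop), polar_lintegral hF,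
    radM_lintegral (Measurable.lintegral_prod_right' (f := fun z : ℝ × Euc d => F (z.1 • z.2))
      (by fun_prop))]

lemma polar_integral {d : ℕ} [NeZero d] {F : Euc d → ℂ} (hF : Integrable F) :
    ∫ x, F x = ∫ t, ∫ ω, F (t • ω) ∂(sphereMeasure d) ∂(radM d) := by
  have hF' := hF
  rw [polar_measure d] at hF'
  rw [polar_measure d, integral_map (by fun_prop) hF'.1, integral_prod]
  exact hF'.comp_measurable (by fun_prop)

lemma radM_integral {d : ℕ} (G : ℝ → ℂ) :
    ∫ t, G t ∂(radM d) = (cSph d).toReal * ∫ t in Ioi (0 : ℝ), ((t ^ (d - 1) : ℝ) : ℂ) * G t := by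
  unfold radM
  rw [integral_withDensity_eq_integral_toReal_smul (by fun_prop)
    (Filter.Eventually.of_forall fun t => ENNReal.mul_lt_top (cSph_ne_top d).lt_top
      ENNReal.ofReal_lt_top), ← integral_const_mul]
  refine setIntegral_congr_fun measurableSet_Ioi fun t ht => ?_
  have : (0:ℝ) ≤ t ^ (d-1) := pow_nonneg (le_of_lt ht) _
  simp only [ENNReal.toReal_mul, ENNReal.toReal_ofReal this, Complex.real_smul]
  push_cast; ring

open scoped Pointwise in
lemma sph_map (d : ℕ) (L : Euc d ≃ₗᵢ[ℝ] Euc d) :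
    (sphereMeasure d).map L = sphereMeasure d := by
  unfold sphereMeasure
  rw [Measure.map_smul]
  congr 1
  refine Measure.ext fun s hs => ?_
  have hL : Measurable L := L.continuous.measurable
  rw [Measure.map_apply hL hs, Measure.map_apply measurable_subtype_coe (hL hs),
    Measure.map_apply measurable_subtype_coe hs,
    Measure.toSphere_apply' _ (measurable_subtype_coe (hL hs)),
    Measure.toSphere_apply' _ (measurable_subtype_coe hs)]
  congr 1
  rw [← (L.measurePreserving).measure_preimage_equiv (f := L.toMeasurableEquiv)
    (Ioo (0:ℝ) 1 • (Subtype.val '' ((Subtype.val : sphere (0 : Euc d) 1 → Euc d) ⁻¹' s)))]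
  congr 1
  ext x
  simp only [Set.mem_smul, mem_image, mem_preimage, Subtype.exists, mem_sphere_iff_norm, sub_zero,
    exists_and_left, exists_prop, exists_eq_right_right, LinearIsometryEquiv.coe_toMeasurableEquiv]
  constructor
  · rintro ⟨a, ha, y, ⟨hy, hy1⟩, rfl⟩
    exact ⟨a, ha, L y, ⟨hy, by simpa using hy1⟩, by simp⟩
  · rintro ⟨a, ha, y, ⟨hy, hy1⟩, h⟩
    refine ⟨a, ha, L.symm y, ⟨by simpa using hy, by simpa using hy1⟩, ?_⟩
    apply L.injective; simpa using h

lemma sph_integral_comp {d : ℕ} (L : Euc d ≃ₗᵢ[ℝ] Euc d) {E : Type*} [NormedAddCommGroup E]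
    [NormedSpace ℝ E] (F : Euc d → E) :
    ∫ ω, F (L ω) ∂(sphereMeasure d) = ∫ ω, F ω ∂(sphereMeasure d) := by
  conv_rhs => rw [← sph_map d L]
  exact ((L.toMeasurableEquiv).measurableEmbedding.integral_map _).symm

/-- the measure of a spherical cap -/
lemma sph_cap (d : ℕ) [NeZero d] : ∃ c : ℝ, 0 < c ∧ ∀ (e : Euc d), ‖e‖ = 1 → ∀ ρ : ℝ, 0 < ρ → ρ ≤ 1 →
    ENNReal.ofReal (c * ρ ^ (d - 1)) ≤ sphereMeasure d (ball e ρ) := by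
  set V := (volume (ball (0 : Euc d) 1)).toReal with hV
  have hVpos : 0 < V := ENNReal.toReal_pos
    (measure_ball_pos (volume : Measure (Euc d)) 0 one_pos).ne' measure_ball_lt_top.ne
  set S := (cSph d).toReal with hS
  have hSpos : 0 < S := ENNReal.toReal_pos (cSph_ne_zero d) (cSph_ne_top d)
  refine ⟨V / (S * 2 ^ (d - 1) * 2 * 4 ^ (d - 1)), by positivity, fun e he ρ hρ hρ1 => ?_⟩
  set δ := ρ / 4 with hδ
  have hδ0 : 0 < δ := by positivity
  have hd : d = (d - 1) + 1 := by have := NeZero.ne d; omega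
  set m := sphereMeasure d (ball e ρ) with hm
  have h1 : volume (ball e δ) = ENNReal.ofReal (δ ^ d) * volume (ball (0 : Euc d) 1) := by
    rw [Measure.addHaar_ball _ _ hδ0.le]; simp
  have h2 : volume (ball e δ) ≤ cSph d * (ENNReal.ofReal (2 ^ (d - 1) * (2 * δ)) * m) := by
    rw [← setLIntegral_one, ← lintegral_indicator measurableSet_ball,
      polar_lintegral (measurable_const.indicator measurableSet_ball)]
    gcongr
    calc ∫⁻ t in Ioi (0 : ℝ), ENNReal.ofReal (t ^ (d - 1)) *
          ∫⁻ ω, (ball e δ).indicator (fun _ => (1 : ℝ≥0∞)) (t • ω) ∂(sphereMeasure d)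
        ≤ ∫⁻ t, (Ioo (1 - δ) (1 + δ)).indicator
            (fun _ => ENNReal.ofReal (2 ^ (d - 1)) * m) t := by
          refine (setLIntegral_mono' measurableSet_Ioi fun t ht => ?_).trans
            (setLIntegral_le_lintegral (Ioi 0) _)
          have ht : 0 < t := ht
          have key : ∀ ω : Euc d, ‖ω‖ = 1 → t • ω ∈ ball e δ → |t - 1| < δ ∧ ω ∈ ball e ρ := by
            intro ω hω h
            rw [mem_ball, dist_eq_norm] at h
            have h3 : |t - 1| < δ := by
              have := abs_norm_sub_norm_le (t • ω) e
              rw [norm_smul, hω, he, Real.norm_of_nonneg ht.le, mul_one] at this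
              linarith
            refine ⟨h3, ?_⟩
            rw [mem_ball, dist_eq_norm]
            have h4 : ω - e = (1 - t) • ω + (t • ω - e) := by
              rw [sub_smul, one_smul]; abel
            rw [h4]
            refine (norm_add_le _ _).trans_lt ?_
            rw [norm_smul, hω, mul_one, Real.norm_eq_abs, abs_sub_comm]
            linarith
          by_cases htm : t ∈ Ioo (1 - δ) (1 + δ)
          · rw [indicator_of_mem htm]
            gcongr
            · have := htm.2
              have : δ ≤ 1 := by linarith
              linarith
            · rw [hm, ← setLIntegral_one, ← lintegral_indicator measurableSet_ball]
              refine lintegral_mono_ae ?_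
              filter_upwards [sph_norm d] with ω hω
              by_cases h : t • ω ∈ ball e δ
              · rw [indicator_of_mem h, indicator_of_mem (key ω hω h).2]
              · rw [indicator_of_notMem h]; exact zero_le
          · rw [indicator_of_notMem htm, nonpos_iff_eq_zero, mul_eq_zero]
            right
            rw [lintegral_eq_zero_iff' (by
              apply Measurable.aemeasurable
              exact (measurable_const.indicator measurableSet_ball).comp (by fun_prop))]
            filter_upwards [sph_norm d] with ω hω
            refine indicator_of_notMem (fun h => htm ?_) _
            have := abs_lt.1 (key ω hω h).1
            exact ⟨by linarith, by linarith⟩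
      _ = ENNReal.ofReal (2 ^ (d - 1) * (2 * δ)) * m := by
          rw [lintegral_indicator measurableSet_Ioo, setLIntegral_const, Real.volume_Ioo,
            ENNReal.ofReal_mul (by positivity)]
          have : 1 + δ - (1 - δ) = 2 * δ := by ring
          rw [this]; ring
  have hmf : m ≠ ∞ := measure_ne_top _ _
  rw [h1] at h2
  have h3 := ENNReal.toReal_mono (ENNReal.mul_ne_top (cSph_ne_top d)
    (ENNReal.mul_ne_top ENNReal.ofReal_ne_top hmf)) h2
  rw [ENNReal.toReal_mul, ENNReal.toReal_mul, ENNReal.toReal_mul,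
    ENNReal.toReal_ofReal (by positivity), ENNReal.toReal_ofReal (by positivity)] at h3
  rw [ENNReal.ofReal_le_iff_le_toReal hmf]
  rw [← hV, ← hS] at h3
  rw [div_mul_eq_mul_div, div_le_iff₀ (by positivity)]
  have h4 : δ ^ d = δ ^ (d - 1) * δ := by conv_lhs => rw [hd, pow_succ]
  have h5 : ρ ^ (d - 1) = 4 ^ (d - 1) * δ ^ (d - 1) := by rw [← mul_pow]; congr 1; rw [hδ]; ring
  rw [h4] at h3
  have h6 : δ ^ (d - 1) * V ≤ S * (2 ^ (d - 1) * 2 * m.toReal) := by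
    refine le_of_mul_le_mul_right ?_ hδ0
    linarith
  rw [h5]
  nlinarith [show (0:ℝ) < 4 ^ (d - 1) by positivity]

/-! ### The function `φ` -/

lemma sph_int {d : ℕ} [NeZero d] {E : Type*} [NormedAddCommGroup E] {F : Euc d → E}
    (hF : Continuous F) : Integrable F (sphereMeasure d) := by
  obtain ⟨C, hC⟩ := (isCompact_closedBall (0 : Euc d) 1).exists_bound_of_continuousOn
    hF.continuousOn
  refine Integrable.of_bound hF.aestronglyMeasurable C ?_
  filter_upwards [sph_norm d] with ω hω
  exact hC ω (by simp [hω])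

lemma sph_rot {d : ℕ} [NeZero d] {E : Type*} [NormedAddCommGroup E] [NormedSpace ℝ E]
    (F : ℝ → E) (e : Euc d) (he : ‖e‖ = 1) :
    ∫ ω, F (inner ℝ e ω) ∂(sphereMeasure d) = ∫ ω, F (ω 0) ∂(sphereMeasure d) := by
  set e1 : Euc d := EuclideanSpace.single (0 : Fin d) (1 : ℝ) with he1
  have hn : ‖e1‖ = ‖e‖ := by simp [he1, he]
  set L := (ℝ ∙ (e1 - e))ᗮ.reflection with hL
  have hLe : L e1 = e := Submodule.reflection_sub hn
  have h1 : ∀ ω : Euc d, inner ℝ e ω = (L ω) 0 := by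
    intro ω
    have h2 : inner ℝ e1 (L ω) = (L ω) 0 := by
      rw [he1, EuclideanSpace.inner_single_left]; simp
    rw [← h2, ← hLe]
    rw [← LinearIsometryEquiv.inner_map_map L (L e1) ω]
    rw [hL, Submodule.reflection_reflection]
  simp_rw [h1]
  exact sph_integral_comp L (fun ω => F (ω 0))

lemma sph_coord_le {d : ℕ} (ω : Euc d) (h : ‖ω‖ = 1) (i : Fin d) : |ω i| ≤ 1 := by
  rw [← h, ← Real.norm_eq_abs]; exact PiLp.norm_apply_le ω i

/-- `φ(s) = ∫ cos (s ω₁) dσ` -/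
def phi (d : ℕ) [NeZero d] (s : ℝ) : ℝ := ∫ ω, Real.cos (s * ω 0) ∂(sphereMeasure d)
/-- the derivative of `φ` -/
def dphi (d : ℕ) [NeZero d] (s : ℝ) : ℝ := -∫ ω, ω 0 * Real.sin (s * ω 0) ∂(sphereMeasure d)
/-- the second derivative of `φ` -/
def ddphi (d : ℕ) [NeZero d] (s : ℝ) : ℝ := -∫ ω, (ω 0) ^ 2 * Real.cos (s * ω 0) ∂(sphereMeasure d)

lemma sph_deriv {d : ℕ} [NeZero d] {F F' : ℝ → Euc d → ℝ} (B : ℝ)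
    (hF : ∀ s, Continuous (F s)) (hF' : ∀ s, Continuous (F' s))
    (hb : ∀ s ω, ‖ω‖ = 1 → |F' s ω| ≤ B) (hd : ∀ s ω, HasDerivAt (fun s => F s ω) (F' s ω) s)
    (s : ℝ) : HasDerivAt (fun s => ∫ ω, F s ω ∂(sphereMeasure d))
      (∫ ω, F' s ω ∂(sphereMeasure d)) s := by
  refine (hasDerivAt_integral_of_dominated_loc_of_deriv_le (bound := fun _ => B)
    (Filter.univ_mem) (Filter.Eventually.of_forall fun s => (hF s).aestronglyMeasurable)
    (sph_int (hF s)) (hF' s).aestronglyMeasurable ?_ (integrable_const _) ?_).2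
  · filter_upwards [sph_norm d] with ω hω s _ using hb s ω hω
  · exact Filter.Eventually.of_forall fun ω s _ => hd s ω

lemma hasDerivAt_phi (d : ℕ) [NeZero d] (s : ℝ) : HasDerivAt (phi d) (dphi d s) s := by
  have := sph_deriv (d := d) (F := fun s ω => Real.cos (s * ω 0))
    (F' := fun s ω => -(ω 0 * Real.sin (s * ω 0))) 1 (fun s => by fun_prop) (fun s => by fun_prop)
    (fun s ω h => by
      rw [abs_neg, abs_mul]
      exact mul_le_one₀ (sph_coord_le ω h 0) (abs_nonneg _) (Real.abs_sin_le_one _))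
    (fun s ω => by
      have := ((hasDerivAt_id' s).mul_const (ω 0)).cos
      exact this.congr_deriv (by ring)) s
  rw [integral_neg] at this
  exact this

lemma hasDerivAt_dphi (d : ℕ) [NeZero d] (s : ℝ) : HasDerivAt (dphi d) (ddphi d s) s := by
  have := sph_deriv (d := d) (F := fun s ω => ω 0 * Real.sin (s * ω 0))
    (F' := fun s ω => ((ω 0) ^ 2 * Real.cos (s * ω 0))) 1 (fun s => by fun_prop)
    (fun s => by fun_prop)
    (fun s ω h => by
      rw [abs_mul, abs_pow]
      exact mul_le_one₀ (pow_le_one₀ (abs_nonneg _) (sph_coord_le ω h 0)) (abs_nonneg _)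
        (Real.abs_cos_le_one _))
    (fun s ω => by
      have := (((hasDerivAt_id' s).mul_const (ω 0)).sin).const_mul (ω 0)
      exact this.congr_deriv (by ring)) s
  exact this.neg

lemma abs_phi_le (d : ℕ) [NeZero d] (s : ℝ) : |phi d s| ≤ 1 := by
  have := norm_integral_le_of_norm_le_const (μ := sphereMeasure d) (C := 1)
    (f := fun ω : Euc d => Real.cos (s * ω 0))
    (Filter.Eventually.of_forall fun ω => Real.abs_cos_le_one _)
  simpa [phi] using this

lemma abs_dphi_le (d : ℕ) [NeZero d] (s : ℝ) : |dphi d s| ≤ 1 := by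
  have := norm_integral_le_of_norm_le_const (μ := sphereMeasure d) (C := 1)
    (f := fun ω : Euc d => ω 0 * Real.sin (s * ω 0)) (by
      filter_upwards [sph_norm d] with ω hω
      rw [Real.norm_eq_abs, abs_mul]
      exact mul_le_one₀ (sph_coord_le ω hω 0) (abs_nonneg _) (Real.abs_sin_le_one _))
  simpa [dphi] using this

lemma continuous_phi (d : ℕ) [NeZero d] : Continuous (phi d) :=
  continuous_iff_continuousAt.2 fun s => (hasDerivAt_phi d s).continuousAt
lemma continuous_dphi (d : ℕ) [NeZero d] : Continuous (dphi d) :=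
  continuous_iff_continuousAt.2 fun s => (hasDerivAt_dphi d s).continuousAt

lemma phi_zero (d : ℕ) [NeZero d] : phi d 0 = 1 := by simp [phi]

lemma sph_neg {d : ℕ} {E : Type*} [NormedAddCommGroup E] [NormedSpace ℝ E] (F : Euc d → E) :
    ∫ ω, F (-ω) ∂(sphereMeasure d) = ∫ ω, F ω ∂(sphereMeasure d) :=
  sph_integral_comp (LinearIsometryEquiv.neg ℝ) F

lemma sph_cexp_coord (d : ℕ) [NeZero d] (s : ℝ) :
    ∫ ω : Euc d, Complex.exp (((s * ω 0 : ℝ) : ℂ) * Complex.I) ∂(sphereMeasure d) = phi d s := by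
  have h1 : ∀ ω : Euc d, Complex.exp (((s * ω 0 : ℝ) : ℂ) * Complex.I) =
      ((Real.cos (s * ω 0) : ℝ) : ℂ) + ((Real.sin (s * ω 0) : ℝ) : ℂ) * Complex.I := by
    intro ω; rw [Complex.exp_mul_I]; push_cast; rfl
  simp_rw [h1]
  rw [integral_add (sph_int (by fun_prop)) (sph_int (by fun_prop)), integral_mul_const,
    integral_complex_ofReal, integral_complex_ofReal]
  have h2 : ∫ ω : Euc d, Real.sin (s * ω 0) ∂(sphereMeasure d) = 0 := by
    have := sph_neg (fun ω : Euc d => Real.sin (s * ω 0))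
    simp only [PiLp.neg_apply, mul_neg, Real.sin_neg, integral_neg] at this
    linarith
  rw [h2]; simp [phi]

lemma sph_cexp {d : ℕ} [NeZero d] (ξ : Euc d) :
    ∫ ω, Complex.exp (((inner ℝ ξ ω : ℝ) : ℂ) * Complex.I) ∂(sphereMeasure d) = phi d ‖ξ‖ := by
  by_cases h : ξ = 0
  · simp [h, phi_zero]
  have hn : ‖ξ‖ ≠ 0 := norm_ne_zero_iff.2 h
  have h1 := sph_rot (fun a => Complex.exp (((‖ξ‖ * a : ℝ) : ℂ) * Complex.I)) (‖ξ‖⁻¹ • ξ)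
    (by rw [norm_smul, norm_inv, norm_norm, inv_mul_cancel₀ hn])
  rw [sph_cexp_coord] at h1
  rw [← h1]
  congr 1; ext ω
  rw [real_inner_smul_left, ← mul_assoc, mul_inv_cancel₀ hn, one_mul]

lemma sph_dexp {d : ℕ} [NeZero d] (e : Euc d) (he : ‖e‖ = 1) (s : ℝ) :
    ∫ ω, ((inner ℝ e ω : ℝ) : ℂ) * Complex.exp (-((s * inner ℝ e ω : ℝ) : ℂ) * Complex.I)
      ∂(sphereMeasure d) = Complex.I * dphi d s := by
  rw [sph_rot (fun a => (a : ℂ) * Complex.exp (-((s * a : ℝ) : ℂ) * Complex.I)) e he]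
  have h1 : ∀ ω : Euc d, ((ω 0 : ℝ) : ℂ) * Complex.exp (-((s * ω 0 : ℝ) : ℂ) * Complex.I) =
      ((ω 0 * Real.cos (s * ω 0) : ℝ) : ℂ) + ((ω 0 * Real.sin (s * ω 0) : ℝ) : ℂ) * (-Complex.I) := by
    intro ω; rw [Complex.exp_mul_I, Complex.cos_neg, Complex.sin_neg]; push_cast; ring
  simp_rw [h1]
  rw [integral_add (sph_int (by fun_prop)) (sph_int (by fun_prop)), integral_mul_const,
    integral_complex_ofReal, integral_complex_ofReal]
  have h2 : ∫ ω : Euc d, ω 0 * Real.cos (s * ω 0) ∂(sphereMeasure d) = 0 := by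
    have := sph_neg (fun ω : Euc d => ω 0 * Real.cos (s * ω 0))
    simp only [PiLp.neg_apply, mul_neg, Real.cos_neg, neg_mul, integral_neg] at this
    linarith
  rw [h2]; unfold dphi; push_cast; ring

lemma phi_tangent {d : ℕ} [NeZero d] (j : Fin d) (hj : j ≠ 0) (s : ℝ) (hs : 0 < s) :
    ∫ ω : Euc d, (ω j) ^ 2 * Real.cos (s * ω 0) ∂(sphereMeasure d) = - dphi d s / s := by
  -- the constant function
  set Θ : ℝ → ℝ := fun ε => ∫ ω : Euc d, Real.cos (s * (Real.cos ε * ω 0 + Real.sin ε * ω j))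
    ∂(sphereMeasure d) with hΘ
  have hconst : ∀ ε, Θ ε = phi d s := by
    intro ε
    have h := sph_rot (fun a => Real.cos (s * a)) (EuclideanSpace.single (0 : Fin d) (Real.cos ε) +
      EuclideanSpace.single j (Real.sin ε)) (by
        rw [← sq_eq_sq₀ (norm_nonneg _) zero_le_one, norm_add_sq_real]
        simp [EuclideanSpace.inner_single_left, hj.symm])
    rw [phi, ← h]
    refine integral_congr_ae (Filter.Eventually.of_forall fun ω => ?_)
    simp [inner_add_left, EuclideanSpace.inner_single_left]
  have hA : ∀ ε (ω : Euc d), HasDerivAt (fun ε => s * (Real.cos ε * ω 0 + Real.sin ε * ω j))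
      (s * (-Real.sin ε * ω 0 + Real.cos ε * ω j)) ε := fun ε ω =>
    (((Real.hasDerivAt_cos ε).mul_const _).add ((Real.hasDerivAt_sin ε).mul_const _)).const_mul s
  have hA' : ∀ ε (ω : Euc d), HasDerivAt (fun ε => s * (-Real.sin ε * ω 0 + Real.cos ε * ω j))
      (s * (-Real.cos ε * ω 0 + -Real.sin ε * ω j)) ε := fun ε ω =>
    (((Real.hasDerivAt_sin ε).neg.mul_const _).add ((Real.hasDerivAt_cos ε).mul_const _)).const_mul s
  have hbd : ∀ (a b : ℝ) (ω : Euc d), |a| ≤ 1 → |b| ≤ 1 → ‖ω‖ = 1 →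
      |s * (a * ω 0 + b * ω j)| ≤ 2 * s := by
    intro a b ω ha hb h
    rw [abs_mul, abs_of_pos hs]
    have h1 : |a * ω 0| ≤ 1 := by
      rw [abs_mul]; exact mul_le_one₀ ha (abs_nonneg _) (sph_coord_le ω h 0)
    have h2 : |b * ω j| ≤ 1 := by
      rw [abs_mul]; exact mul_le_one₀ hb (abs_nonneg _) (sph_coord_le ω h j)
    have := abs_add_le (a * ω 0) (b * ω j)
    nlinarith
  have hd1 : ∀ ε, HasDerivAt Θ (∫ ω : Euc d, -(Real.sin (s * (Real.cos ε * ω 0 + Real.sin ε * ω j)))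
      * (s * (-Real.sin ε * ω 0 + Real.cos ε * ω j)) ∂(sphereMeasure d)) ε := by
    refine sph_deriv (2 * s) (fun ε => by fun_prop) (fun ε => by fun_prop) (fun ε ω h => ?_)
      (fun ε ω => (hA ε ω).cos)
    rw [abs_mul, abs_neg]
    have := hbd (-Real.sin ε) (Real.cos ε) ω (by rw [abs_neg]; exact Real.abs_sin_le_one _)
      (Real.abs_cos_le_one _) h
    have h3 := Real.abs_sin_le_one (s * (Real.cos ε * ω 0 + Real.sin ε * ω j))
    exact (mul_le_of_le_one_left (abs_nonneg _) h3).trans this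
  have hz : ∀ ε, ∫ ω : Euc d, -(Real.sin (s * (Real.cos ε * ω 0 + Real.sin ε * ω j)))
      * (s * (-Real.sin ε * ω 0 + Real.cos ε * ω j)) ∂(sphereMeasure d) = 0 := by
    intro ε
    have h1 : HasDerivAt Θ 0 ε := by
      have : Θ = fun _ => phi d s := funext hconst
      rw [this]; exact hasDerivAt_const _ _
    exact (hd1 ε).unique h1
  have hd2 := sph_deriv (d := d)
    (F := fun ε ω => -(Real.sin (s * (Real.cos ε * ω 0 + Real.sin ε * ω j)))
      * (s * (-Real.sin ε * ω 0 + Real.cos ε * ω j)))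
    (F' := fun ε ω => -(Real.cos (s * (Real.cos ε * ω 0 + Real.sin ε * ω j)) *
      (s * (-Real.sin ε * ω 0 + Real.cos ε * ω j)))
      * (s * (-Real.sin ε * ω 0 + Real.cos ε * ω j)) +
      -(Real.sin (s * (Real.cos ε * ω 0 + Real.sin ε * ω j))) *
        (s * (-Real.cos ε * ω 0 + -Real.sin ε * ω j))) ((2 * s) * (2 * s) + 2 * s)
    (fun ε => by fun_prop) (fun ε => by fun_prop) (fun ε ω h => by
      have h1 := hbd (-Real.sin ε) (Real.cos ε) ω (by rw [abs_neg]; exact Real.abs_sin_le_one _)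
        (Real.abs_cos_le_one _) h
      have h2 := hbd (-Real.cos ε) (-Real.sin ε) ω (by rw [abs_neg]; exact Real.abs_cos_le_one _)
        (by rw [abs_neg]; exact Real.abs_sin_le_one _) h
      have h3 := Real.abs_sin_le_one (s * (Real.cos ε * ω 0 + Real.sin ε * ω j))
      have h4 := Real.abs_cos_le_one (s * (Real.cos ε * ω 0 + Real.sin ε * ω j))
      refine (abs_add_le _ _).trans (add_le_add ?_ ?_)
      · rw [abs_mul, abs_neg, abs_mul]
        exact mul_le_mul ((mul_le_of_le_one_left (abs_nonneg _) h4).trans h1) h1 (abs_nonneg _)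
          (by positivity)
      · rw [abs_mul, abs_neg]
        exact (mul_le_of_le_one_left (abs_nonneg _) h3).trans h2)
    (fun ε ω => ((hA ε ω).sin.neg).mul (hA' ε ω)) 0
  have hz2 : (fun ε => ∫ ω : Euc d, -(Real.sin (s * (Real.cos ε * ω 0 + Real.sin ε * ω j)))
      * (s * (-Real.sin ε * ω 0 + Real.cos ε * ω j)) ∂(sphereMeasure d)) = fun _ => 0 := funext hz
  rw [hz2] at hd2
  have h0 := (hasDerivAt_const (0:ℝ) (0:ℝ)).unique hd2
  simp only [Real.cos_zero, Real.sin_zero, one_mul, zero_mul, add_zero, neg_zero, zero_add] at h0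
  have h1 : ∀ ω : Euc d, -(Real.cos (s * ω 0) * (s * ω j)) * (s * ω j) + -Real.sin (s * ω 0) *
      (s * (-1 * ω 0)) = s * (ω 0 * Real.sin (s * ω 0)) - s ^ 2 * ((ω j) ^ 2 * Real.cos (s * ω 0)) := by
    intro ω; ring
  simp_rw [h1] at h0
  rw [integral_sub (sph_int (by fun_prop)) (sph_int (by fun_prop)), integral_const_mul,
    integral_const_mul] at h0
  rw [eq_div_iff hs.ne']
  have h2 : s * ((∫ ω : Euc d, (ω j) ^ 2 * Real.cos (s * ω 0) ∂(sphereMeasure d)) * s) =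
      s * (- dphi d s) := by
    unfold dphi; linarith
  exact mul_left_cancel₀ hs.ne' h2

lemma phi_ode {d : ℕ} [NeZero d] (s : ℝ) (hs : 0 < s) :
    ddphi d s = - phi d s - ((d : ℝ) - 1) * dphi d s / s := by
  have h1 : phi d s = ∑ j : Fin d, ∫ ω : Euc d, (ω j) ^ 2 * Real.cos (s * ω 0)
      ∂(sphereMeasure d) := by
    rw [← integral_finsetSum _ (fun j _ => sph_int (by fun_prop))]
    refine integral_congr_ae ?_
    filter_upwards [sph_norm d] with ω hω
    rw [← Finset.sum_mul]
    have : ∑ j, (ω j) ^ 2 = 1 := by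
      have := EuclideanSpace.norm_sq_eq ω
      rw [hω] at this
      simpa using this.symm
    rw [this, one_mul]
  rw [Finset.sum_eq_add_sum_sdiff_singleton_of_mem (Finset.mem_univ (0 : Fin d))] at h1
  rw [Finset.sum_congr rfl (fun j hj => phi_tangent j (by simpa using hj) s hs), Finset.sum_const] at h1
  have hc : (Finset.univ \ {(0 : Fin d)}).card = d - 1 := by
    rw [Finset.card_sdiff_of_subset (by simp)]; simp
  rw [hc, nsmul_eq_mul, Nat.cast_sub (Nat.one_le_iff_ne_zero.2 (NeZero.ne d))] at h1
  unfold ddphi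
  rw [h1]; push_cast; ring

/-- decay of `φ` and its derivative -/
lemma phi_decay (d : ℕ) [NeZero d] : ∃ C : ℝ, 1 ≤ C ∧ ∀ s : ℝ, 0 < s →
    phi d s ^ 2 * s ^ (d - 1) ≤ C ∧ dphi d s ^ 2 * s ^ (d - 1) ≤ C := by
  set n : ℕ := d - 1 with hn
  have hnd : (n : ℝ) = (d : ℝ) - 1 := by
    rw [hn, Nat.cast_sub (Nat.one_le_iff_ne_zero.2 (NeZero.ne d))]; simp
  set c : ℝ := |(n : ℝ) ^ 2 / 4 - n / 2| with hc
  set ψ : ℝ → ℝ := fun s => dphi d s + n / 2 * phi d s / s with hψ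
  set En : ℝ → ℝ := fun s => s ^ n * (ψ s ^ 2 + phi d s ^ 2) with hEn
  set G : ℝ → ℝ := fun s => En s * Real.exp (c / s) with hG
  have hψd : ∀ s, 0 < s → HasDerivAt ψ (-phi d s - n / 2 / s * ψ s +
      ((n : ℝ) ^ 2 / 4 - n / 2) * phi d s / s ^ 2) s := by
    intro s hs
    have h1 := (hasDerivAt_dphi d s).add
      ((((hasDerivAt_phi d s).const_mul ((n : ℝ) / 2)).div (hasDerivAt_id' s) hs.ne'))
    refine HasDerivAt.congr_deriv (f := ψ) h1 ?_
    rw [phi_ode s hs, ← hnd]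
    simp only [hψ]
    field_simp
    ring
  have hEd : ∀ s, 0 < s → HasDerivAt En (s ^ n * (2 * ψ s * phi d s * ((n : ℝ) ^ 2 / 4 - n / 2) / s ^ 2)) s := by
    intro s hs
    have h1 := (hasDerivAt_pow n s).mul (((hψd s hs).pow 2).add ((hasDerivAt_phi d s).pow 2))
    refine HasDerivAt.congr_deriv (f := En) h1 ?_
    have h2 : dphi d s = ψ s - n / 2 * phi d s / s := by simp only [hψ]; ring
    have h3 : (n : ℝ) * s ^ (n - 1) = n * s ^ n / s := by
      rcases Nat.eq_zero_or_pos n with h0 | h0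
      · simp [h0]
      · have : s ^ n = s ^ (n - 1) * s := by rw [← pow_succ]; congr 1; omega
        rw [this]; field_simp
    rw [h3, h2]
    simp only [Pi.add_apply, Pi.pow_apply, Pi.mul_apply]
    push_cast
    field_simp
    ring
  have hGd : ∀ s, 0 < s → HasDerivAt G ((s ^ n * (2 * ψ s * phi d s * ((n : ℝ) ^ 2 / 4 - n / 2) / s ^ 2))
      * Real.exp (c / s) + En s * (Real.exp (c / s) * (-c / s ^ 2))) s := by
    intro s hs
    refine (hEd s hs).mul (HasDerivAt.exp ?_)
    have := (hasDerivAt_const s c).div (hasDerivAt_id' s) hs.ne'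
    exact this.congr_deriv (by ring)
  have hanti : AntitoneOn G (Ici 1) := by
    refine antitoneOn_of_deriv_nonpos (convex_Ici 1) ?_ ?_ ?_
    · intro s hs
      exact (hGd s (lt_of_lt_of_le one_pos hs)).continuousAt.continuousWithinAt
    · intro s hs
      rw [interior_Ici] at hs
      exact (hGd s (lt_trans one_pos hs)).differentiableAt.differentiableWithinAt
    · intro s hs
      rw [interior_Ici] at hs
      have hs0 : 0 < s := lt_trans one_pos hs
      rw [(hGd s hs0).deriv]
      have h1 : 2 * ψ s * phi d s * ((n : ℝ) ^ 2 / 4 - n / 2) ≤ c * (ψ s ^ 2 + phi d s ^ 2) := by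
        have h2 : 2 * ψ s * phi d s * ((n : ℝ) ^ 2 / 4 - n / 2) ≤
            |2 * ψ s * phi d s| * c := by
          rw [hc, ← abs_mul]; exact le_abs_self _
        have h3 : |2 * ψ s * phi d s| ≤ ψ s ^ 2 + phi d s ^ 2 := by
          rw [abs_le]; constructor <;> nlinarith [sq_nonneg (ψ s + phi d s), sq_nonneg (ψ s - phi d s)]
        have : 0 ≤ c := abs_nonneg _
        nlinarith
      have h4 : (s ^ n * (2 * ψ s * phi d s * ((n : ℝ) ^ 2 / 4 - n / 2) / s ^ 2))
          * Real.exp (c / s) + En s * (Real.exp (c / s) * (-c / s ^ 2)) =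
          (s ^ n / s ^ 2 * Real.exp (c / s)) * (2 * ψ s * phi d s * ((n : ℝ) ^ 2 / 4 - n / 2) -
            c * (ψ s ^ 2 + phi d s ^ 2)) := by
        simp only [hEn]; ring
      rw [h4]
      exact mul_nonpos_of_nonneg_of_nonpos (by positivity) (by linarith)
  set B := max 1 (G 1) with hB
  have hB1 : 1 ≤ B := le_max_left _ _
  have hE : ∀ s, 1 ≤ s → En s ≤ B := by
    intro s hs
    have h1 : G s ≤ G 1 := hanti (by simp) hs hs
    have h2 : En s ≤ G s := by
      have : 1 ≤ Real.exp (c / s) := Real.one_le_exp (by positivity)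
      have h0 : 0 ≤ En s := by simp only [hEn]; positivity
      simp only [hG]; nlinarith
    exact (h2.trans h1).trans (le_max_right _ _)
  refine ⟨(2 + (n : ℝ) ^ 2) * B, by nlinarith, fun s hs => ?_⟩
  rcases le_or_gt s 1 with h | h
  · have h1 : s ^ n ≤ 1 := pow_le_one₀ hs.le h
    have h0 : 0 ≤ s ^ n := by positivity
    have h2 : phi d s ^ 2 ≤ 1 := by rw [sq_le_one_iff_abs_le_one]; exact abs_phi_le d s
    have h3 : dphi d s ^ 2 ≤ 1 := by rw [sq_le_one_iff_abs_le_one]; exact abs_dphi_le d s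
    have h4 : 1 ≤ (2 + (n : ℝ) ^ 2) * B := by nlinarith
    exact ⟨(mul_le_one₀ h2 h0 h1).trans h4, (mul_le_one₀ h3 h0 h1).trans h4⟩
  · have hE1 := hE s h.le
    simp only [hEn] at hE1
    have h0 : 0 ≤ s ^ n := by positivity
    have h1 : phi d s ^ 2 * s ^ n ≤ B := by nlinarith [mul_nonneg h0 (sq_nonneg (ψ s))]
    have h2 : ψ s ^ 2 * s ^ n ≤ B := by nlinarith [mul_nonneg h0 (sq_nonneg (phi d s))]
    refine ⟨by nlinarith [sq_nonneg (n : ℝ)], ?_⟩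
    have h3 : dphi d s = ψ s - n / 2 * phi d s / s := by simp only [hψ]; ring
    have h4 : (phi d s / s) ^ 2 ≤ phi d s ^ 2 := by
      rw [div_pow]; exact div_le_self (sq_nonneg _) (by nlinarith)
    have h5 : dphi d s ^ 2 ≤ 2 * ψ s ^ 2 + (n : ℝ) ^ 2 * phi d s ^ 2 := by
      have : dphi d s ^ 2 ≤ 2 * ψ s ^ 2 + 2 * (n / 2) ^ 2 * (phi d s / s) ^ 2 := by
        rw [h3]
        have h9 : n / 2 * phi d s / s = n / 2 * (phi d s / s) := by ring
        rw [h9]; nlinarith [sq_nonneg (ψ s + n / 2 * (phi d s / s))]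
      nlinarith [sq_nonneg (n : ℝ)]
    calc dphi d s ^ 2 * s ^ n ≤ (2 * ψ s ^ 2 + (n : ℝ) ^ 2 * phi d s ^ 2) * s ^ n := by gcongr
      _ = 2 * (ψ s ^ 2 * s ^ n) + (n : ℝ) ^ 2 * (phi d s ^ 2 * s ^ n) := by ring
      _ ≤ (2 + (n : ℝ) ^ 2) * B := by nlinarith [sq_nonneg (n : ℝ)]

/-! ### Fourier transform, Gaussians, Bessel inequality -/

/-- `e(a) = exp (2π i a)` -/
def ee (a : ℝ) : ℂ := Complex.exp (((2 * Real.pi * a : ℝ) : ℂ) * Complex.I)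

lemma ee_add (a b : ℝ) : ee (a + b) = ee a * ee b := by
  unfold ee; rw [← Complex.exp_add]; congr 1; push_cast; ring
lemma norm_ee (a : ℝ) : ‖ee a‖ = 1 := Complex.norm_exp_ofReal_mul_I _
lemma ee_zero : ee 0 = 1 := by simp [ee]
lemma conj_ee (a : ℝ) : (starRingEnd ℂ) (ee a) = ee (-a) := by
  unfold ee; rw [← Complex.exp_conj]; congr 1
  rw [map_mul, Complex.conj_ofReal, Complex.conj_I]; push_cast; ring
@[fun_prop] lemma continuous_ee : Continuous ee := by unfold ee; fun_prop
@[fun_prop] lemma measurable_ee : Measurable ee := continuous_ee.measurable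

/-- Fourier transform -/
def ft {d : ℕ} (f : Euc d → ℂ) (ξ : Euc d) : ℂ := ∫ y, f y * ee (-inner ℝ y ξ)

lemma ee_mul_int {X : Type*} [MeasurableSpace X] {μ : Measure X} {f : X → ℂ} (hf : Integrable f μ) {g : X → ℝ}
    (hg : AEMeasurable g μ) : Integrable (fun y => f y * ee (g y)) μ := by
  refine hf.mul_bdd (c := 1) (continuous_ee.measurable.comp_aemeasurable hg).aestronglyMeasurable
    (Filter.Eventually.of_forall fun x => (norm_ee _).le)

lemma ft_cont {d : ℕ} {f : Euc d → ℂ} (hf : Integrable f) : Continuous (ft f) := by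
  unfold ft
  refine continuous_of_dominated (bound := fun y => ‖f y‖) (fun ξ =>
    (ee_mul_int hf (by fun_prop)).1) (fun ξ => Filter.Eventually.of_forall fun y => ?_) hf.norm
    (Filter.Eventually.of_forall fun y => by fun_prop)
  rw [norm_mul, norm_ee, mul_one]

lemma ft_bound {d : ℕ} (f : Euc d → ℂ) (ξ : Euc d) : ‖ft f ξ‖ ≤ ∫ y, ‖f y‖ := by
  refine (norm_integral_le_integral_norm _).trans (le_of_eq ?_)
  congr 1; ext y; rw [norm_mul, norm_ee, mul_one]

/-- the Gaussian with Fourier transform `exp (-s |ξ|²)` -/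
def gs (d : ℕ) (s : ℝ) (z : Euc d) : ℝ :=
  (Real.pi / s) ^ ((d : ℝ) / 2) * Real.exp (-(Real.pi ^ 2 / s) * ‖z‖ ^ 2)

lemma gs_pos {d : ℕ} {s : ℝ} (hs : 0 < s) (z : Euc d) : 0 < gs d s z := by
  unfold gs; positivity

@[fun_prop] lemma gs_cont {d : ℕ} {s : ℝ} : Continuous (gs d s) := by unfold gs; fun_prop

lemma gauss_integrable {d : ℕ} {s : ℝ} (hs : 0 < s) :
    Integrable (fun v : Euc d => Real.exp (-s * ‖v‖ ^ 2)) := by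
  have := (GaussianFourier.integrable_cexp_neg_mul_sq_norm_add (b := (s : ℂ)) (by simpa using hs)
    0 (0 : Euc d)).re
  refine this.congr (Filter.Eventually.of_forall fun v => ?_)
  simp only [zero_mul, add_zero, RCLike.re_eq_complex_re]
  rw [show (-(s : ℂ) * (‖v‖ : ℂ) ^ 2) = ((-s * ‖v‖ ^ 2 : ℝ) : ℂ) by push_cast; ring,
    Complex.exp_ofReal_re]

lemma gs_integrable {d : ℕ} {s : ℝ} (hs : 0 < s) : Integrable (gs d s) :=
  (gauss_integrable (by positivity)).const_mul _

lemma gauss_integral {d : ℕ} {s : ℝ} (hs : 0 < s) :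
    ∫ v : Euc d, Real.exp (-s * ‖v‖ ^ 2) = (Real.pi / s) ^ ((d : ℝ) / 2) := by
  rw [GaussianFourier.integral_rexp_neg_mul_sq_norm hs]; simp

lemma gs_integral {d : ℕ} {s : ℝ} (hs : 0 < s) : ∫ v, gs d s v = 1 := by
  unfold gs
  rw [integral_const_mul, gauss_integral (by positivity), ← Real.mul_rpow (by positivity) (by positivity)]
  have : Real.pi / s * (Real.pi / (Real.pi ^ 2 / s)) = 1 := by
    have := Real.pi_ne_zero; field_simp
  rw [this, Real.one_rpow]

lemma gauss_ft {d : ℕ} {s : ℝ} (hs : 0 < s) (z : Euc d) :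
    ∫ ξ, (Real.exp (-s * ‖ξ‖ ^ 2) : ℂ) * ee (inner ℝ z ξ) = gs d s z := by
  have h := GaussianFourier.integral_cexp_neg_mul_sq_norm_add (b := (s : ℂ)) (by simpa using hs)
    (2 * Real.pi * Complex.I) z
  have h1 : ∀ ξ : Euc d, (Real.exp (-s * ‖ξ‖ ^ 2) : ℂ) * ee (inner ℝ z ξ) =
      Complex.exp (-(s : ℂ) * ‖ξ‖ ^ 2 + (2 * Real.pi * Complex.I) * (inner ℝ z ξ : ℝ)) := by
    intro ξ
    unfold ee
    rw [Complex.ofReal_exp, ← Complex.exp_add]; congr 1; push_cast; ring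
  simp_rw [h1]
  rw [h]
  unfold gs
  rw [Complex.ofReal_mul, Complex.ofReal_cpow (by positivity), Complex.ofReal_exp]
  congr 1
  · push_cast; simp
  · congr 1
    push_cast
    rw [mul_pow, mul_pow, Complex.I_sq]
    have : (s : ℂ) ≠ 0 := by exact_mod_cast hs.ne'
    field_simp
    ring

lemma gs_ft {d : ℕ} {s : ℝ} (hs : 0 < s) (z : Euc d) :
    ∫ ζ, (gs d s ζ : ℂ) * ee (-inner ℝ z ζ) = Real.exp (-s * ‖z‖ ^ 2) := by
  have h := gauss_ft (d := d) (s := Real.pi ^ 2 / s) (by positivity) (-z)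
  unfold gs at h ⊢
  simp_rw [Complex.ofReal_mul, mul_assoc]
  rw [integral_const_mul]
  simp_rw [inner_neg_left] at h
  rw [h, norm_neg, ← Complex.ofReal_mul]
  congr 1
  rw [← mul_assoc, ← Real.mul_rpow (by positivity) (by positivity)]
  have h1 : Real.pi / s * (Real.pi / (Real.pi ^ 2 / s)) = 1 := by
    have := Real.pi_ne_zero; field_simp
  have h2 : Real.pi ^ 2 / (Real.pi ^ 2 / s) = s := by
    have := Real.pi_ne_zero; field_simp
  rw [h1, Real.one_rpow, h2, one_mul]

lemma ft_sq {d : ℕ} {Ω : Type*} [MeasurableSpace Ω] (ν : Measure Ω) [IsFiniteMeasure ν]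
    (Ξ : Ω → Euc d) (hΞ : Measurable Ξ) {U : Euc d → ℂ} (hU : Integrable U) :
    ((∫ ω, ‖ft U (Ξ ω)‖ ^ 2 ∂ν : ℝ) : ℂ) =
      ∫ z : Euc d × Euc d, U z.1 * (starRingEnd ℂ) (U z.2) *
        (∫ ω, ee (-inner ℝ (z.1 - z.2) (Ξ ω)) ∂ν) ∂(volume.prod volume) := by
  have hU' : Integrable (fun y => (starRingEnd ℂ) (U y)) :=
    (Complex.conjCLE.toContinuousLinearMap).integrable_comp hU
  have h1 : ∀ ξ : Euc d, ((‖ft U ξ‖ ^ 2 : ℝ) : ℂ) = ∫ z : Euc d × Euc d,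
      U z.1 * (starRingEnd ℂ) (U z.2) * ee (-inner ℝ (z.1 - z.2) ξ) ∂(volume.prod volume) := by
    intro ξ
    have h2 : ((‖ft U ξ‖ ^ 2 : ℝ) : ℂ) = ft U ξ * (starRingEnd ℂ) (ft U ξ) := by
      rw [Complex.mul_conj, Complex.normSq_eq_norm_sq]
    rw [h2]
    unfold ft
    rw [← integral_conj, ← integral_prod_mul]
    congr 1; ext z
    rw [map_mul, conj_ee, inner_sub_left, show -(inner ℝ z.1 ξ - inner ℝ z.2 ξ) =
      -inner ℝ z.1 ξ + - -inner ℝ z.2 ξ by ring, ee_add]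
    ring
  rw [← integral_complex_ofReal]
  simp_rw [h1]
  rw [integral_integral_swap]
  · congr 1; ext z
    rw [integral_const_mul]
  · have h3 : Integrable (fun w : Ω × (Euc d × Euc d) => (1 : ℂ) * (U w.2.1 * (starRingEnd ℂ) (U w.2.2)))
        (ν.prod (volume.prod volume)) :=
      Integrable.mul_prod (f := fun _ : Ω => (1:ℂ)) (g := fun z : Euc d × Euc d => U z.1 * (starRingEnd ℂ) (U z.2))
        (integrable_const _) (hU.mul_prod hU')
    have h4 := ee_mul_int h3 (g := fun w => -inner ℝ (w.2.1 - w.2.2) (Ξ w.1)) (by fun_prop)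
    simpa [Function.uncurry_def] using h4

lemma bessel_aux {d : ℕ} {s : ℝ} (hs : 0 < s) {U : Euc d → ℂ} (hU : Integrable U) :
    ∫⁻ ξ, ‖ft U ξ‖ₑ ^ 2 * ENNReal.ofReal (Real.exp (-s * ‖ξ‖ ^ 2)) ≤ ∫⁻ x, ‖U x‖ₑ ^ 2 := by
  set ν : Measure (Euc d) := volume.withDensity fun ξ => ENNReal.ofReal (Real.exp (-s * ‖ξ‖ ^ 2))
    with hν
  have : IsFiniteMeasure ν := by
    refine isFiniteMeasure_withDensity ?_
    exact (gauss_integrable hs).lintegral_lt_top.ne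
  have h1 := ft_sq ν id measurable_id hU
  have h2 : ∀ z : Euc d, ∫ ω, ee (-inner ℝ z (id ω)) ∂ν = gs d s (-z) := by
    intro z
    rw [hν, integral_withDensity_eq_integral_toReal_smul (by fun_prop)
      (Filter.Eventually.of_forall fun _ => ENNReal.ofReal_lt_top), ← gauss_ft hs]
    congr 1; ext ξ
    rw [ENNReal.toReal_ofReal (Real.exp_pos _).le, Complex.real_smul, inner_neg_left]; rfl
  simp_rw [h2] at h1
  have hg : ∀ z : Euc d, gs d s (-z) = gs d s z := fun z => by simp [gs]
  have hgl : ∀ x : Euc d, ∫⁻ y, ENNReal.ofReal (gs d s (x - y)) = 1 := by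
    intro x
    rw [lintegral_sub_left_eq_self (fun y => ENNReal.ofReal (gs d s y)) x,
      ← ofReal_integral_eq_lintegral_ofReal (gs_integrable hs)
        (Filter.Eventually.of_forall fun v => (gs_pos hs v).le), gs_integral hs, ENNReal.ofReal_one]
  have hm : AEMeasurable (fun x => ‖U x‖ₑ) volume := hU.1.enorm
  have h3 : ∫⁻ ξ, ‖ft U ξ‖ₑ ^ 2 * ENNReal.ofReal (Real.exp (-s * ‖ξ‖ ^ 2)) =
      ∫⁻ ξ, ENNReal.ofReal (‖ft U ξ‖ ^ 2) ∂ν := by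
    rw [hν, lintegral_withDensity_eq_lintegral_mul _ (by fun_prop)
      (by have := (ft_cont hU).measurable; fun_prop)]
    refine lintegral_congr fun ξ => ?_
    rw [Pi.mul_apply, mul_comm, ENNReal.ofReal_pow (norm_nonneg _), ofReal_norm]
  have hInt : Integrable (fun ξ => ‖ft U ξ‖ ^ 2) ν := by
    refine Integrable.of_bound ((ft_cont hU).norm.pow 2).aestronglyMeasurable ((∫ y, ‖U y‖) ^ 2)
      (Filter.Eventually.of_forall fun ξ => ?_)
    rw [Real.norm_of_nonneg (by positivity)]
    have := ft_bound U ξ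
    gcongr
  rw [h3, ← ofReal_integral_eq_lintegral_ofReal hInt
    (Filter.Eventually.of_forall fun _ => by positivity)]
  have h4 : ENNReal.ofReal (∫ ξ, ‖ft U ξ‖ ^ 2 ∂ν) = ‖((∫ ξ, ‖ft U ξ‖ ^ 2 ∂ν : ℝ) : ℂ)‖ₑ := by
    rw [← ofReal_norm, Complex.norm_real, Real.norm_of_nonneg (integral_nonneg fun _ => by positivity)]
  rw [h4]
  simp only [id] at h1
  rw [h1]
  have hmU1 : AEMeasurable (fun z : Euc d × Euc d => ‖U z.1‖ₑ) (volume.prod volume) :=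
    hm.comp_quasiMeasurePreserving Measure.quasiMeasurePreserving_fst
  have hmU2 : AEMeasurable (fun z : Euc d × Euc d => ‖U z.2‖ₑ) (volume.prod volume) :=
    hm.comp_quasiMeasurePreserving Measure.quasiMeasurePreserving_snd
  have hmg : Measurable (fun z : Euc d × Euc d => ENNReal.ofReal (gs d s (z.1 - z.2))) := by
    apply Measurable.ennreal_ofReal
    exact (gs_cont.comp (continuous_fst.sub continuous_snd)).measurable
  calc ‖∫ z : Euc d × Euc d, U z.1 * (starRingEnd ℂ) (U z.2) * (gs d s (-(z.1 - z.2)) : ℂ)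
        ∂(volume.prod volume)‖ₑ
      ≤ ∫⁻ z : Euc d × Euc d, ‖U z.1 * (starRingEnd ℂ) (U z.2) * (gs d s (-(z.1 - z.2)) : ℂ)‖ₑ
        ∂(volume.prod volume) := enorm_integral_le_lintegral_enorm _
    _ ≤ ∫⁻ z : Euc d × Euc d, (2⁻¹ * (‖U z.1‖ₑ ^ 2 * ENNReal.ofReal (gs d s (z.1 - z.2))) +
        2⁻¹ * (‖U z.2‖ₑ ^ 2 * ENNReal.ofReal (gs d s (z.1 - z.2)))) ∂(volume.prod volume) := by
        refine lintegral_mono fun z => ?_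
        have e1 : ‖(gs d s (-(z.1 - z.2)) : ℂ)‖ₑ = ENNReal.ofReal (gs d s (z.1 - z.2)) := by
          rw [hg, ← ofReal_norm, Complex.norm_real, Real.norm_of_nonneg (gs_pos hs _).le]
        simp only [enorm_mul, e1]
        have e2 : ‖(starRingEnd ℂ) (U z.2)‖ₑ = ‖U z.2‖ₑ := by
          rw [← ofReal_norm, ← ofReal_norm, RCLike.norm_conj]
        rw [e2, ← mul_add, ← add_mul, ← mul_assoc]
        refine mul_le_mul' ?_ le_rfl
        rw [← ofReal_norm, ← ofReal_norm, ← ENNReal.ofReal_mul (norm_nonneg _),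
          ← ENNReal.ofReal_pow (norm_nonneg _), ← ENNReal.ofReal_pow (norm_nonneg _),
          ← ENNReal.ofReal_add (by positivity) (by positivity),
          show (2⁻¹ : ℝ≥0∞) = ENNReal.ofReal 2⁻¹ by
            rw [ENNReal.ofReal_inv_of_pos (by norm_num)]; simp,
          ← ENNReal.ofReal_mul (by norm_num)]
        apply ENNReal.ofReal_le_ofReal
        nlinarith [sq_nonneg (‖U z.1‖ - ‖U z.2‖)]
    _ = 2⁻¹ * (∫⁻ x, ‖U x‖ₑ ^ 2) + 2⁻¹ * (∫⁻ x, ‖U x‖ₑ ^ 2) := by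
        rw [lintegral_add_left' (by fun_prop), lintegral_const_mul'' _ (by fun_prop),
          lintegral_const_mul'' _ (by fun_prop)]
        congr 2
        · rw [lintegral_prod _ (by fun_prop)]
          refine lintegral_congr fun x => ?_
          dsimp only
          rw [lintegral_const_mul _ (by
            apply Measurable.ennreal_ofReal
            exact (gs_cont.comp (continuous_const.sub continuous_id)).measurable), hgl, mul_one]
        · rw [lintegral_prod_symm _ (by fun_prop)]
          refine lintegral_congr fun y => ?_
          dsimp only
          rw [lintegral_const_mul _ (by
            apply Measurable.ennreal_ofReal
            exact (gs_cont.comp (continuous_id.sub continuous_const)).measurable)]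
          have : ∫⁻ x, ENNReal.ofReal (gs d s (x - y)) = 1 := by
            rw [← hgl y]; refine lintegral_congr fun x => ?_
            rw [← hg, neg_sub]
          rw [this, mul_one]
    _ = ∫⁻ x, ‖U x‖ₑ ^ 2 := by
        rw [← add_mul, ENNReal.inv_two_add_inv_two, one_mul]

/-- Bessel's inequality -/
lemma bessel {d : ℕ} {U : Euc d → ℂ} (hU : Integrable U) :
    ∫⁻ ξ, ‖ft U ξ‖ₑ ^ 2 ≤ ∫⁻ x, ‖U x‖ₑ ^ 2 := by
  have hmeas : Measurable (fun ξ => ‖ft U ξ‖ₑ) := (ft_cont hU).measurable.enorm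
  have h1 : ∀ ξ : Euc d, Filter.Tendsto (fun n : ℕ => ‖ft U ξ‖ₑ ^ 2 *
      ENNReal.ofReal (Real.exp (-(1 / ((n : ℝ) + 1)) * ‖ξ‖ ^ 2))) Filter.atTop
      (nhds (‖ft U ξ‖ₑ ^ 2)) := by
    intro ξ
    have h2 : Filter.Tendsto (fun n : ℕ => ENNReal.ofReal (Real.exp (-(1 / ((n : ℝ) + 1)) * ‖ξ‖ ^ 2)))
        Filter.atTop (nhds 1) := by
      rw [← ENNReal.ofReal_one]
      refine ENNReal.tendsto_ofReal ?_
      have h3 := ((tendsto_one_div_add_atTop_nhds_zero_nat (𝕜 := ℝ)).neg.mul_const (‖ξ‖ ^ 2))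
      have := (Real.continuous_exp.tendsto _).comp h3
      simpa [Function.comp_def] using this
    have := ENNReal.Tendsto.const_mul (a := ‖ft U ξ‖ₑ ^ 2) h2 (Or.inr (by simp))
    simpa using this
  calc ∫⁻ ξ, ‖ft U ξ‖ₑ ^ 2 = ∫⁻ ξ, Filter.liminf (fun n : ℕ => ‖ft U ξ‖ₑ ^ 2 *
      ENNReal.ofReal (Real.exp (-(1 / ((n : ℝ) + 1)) * ‖ξ‖ ^ 2))) Filter.atTop := by
        refine lintegral_congr fun ξ => ((h1 ξ).liminf_eq).symm
    _ ≤ Filter.liminf (fun n : ℕ => ∫⁻ ξ, ‖ft U ξ‖ₑ ^ 2 *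
      ENNReal.ofReal (Real.exp (-(1 / ((n : ℝ) + 1)) * ‖ξ‖ ^ 2))) Filter.atTop :=
        lintegral_liminf_le (fun n => by fun_prop)
    _ ≤ Filter.liminf (fun n : ℕ => ∫⁻ x, ‖U x‖ₑ ^ 2) Filter.atTop := by
        refine Filter.liminf_le_liminf (Filter.Eventually.of_forall fun n => ?_)
        exact bessel_aux (by positivity) hU
    _ = _ := by simp

lemma gs_lintegral {d : ℕ} {s : ℝ} (hs : 0 < s) (z : Euc d) :
    ∫⁻ y, ENNReal.ofReal (gs d s (z - y)) = 1 := by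
  rw [lintegral_sub_left_eq_self (fun y => ENNReal.ofReal (gs d s y)) z,
      ← ofReal_integral_eq_lintegral_ofReal (gs_integrable hs)
        (Filter.Eventually.of_forall fun v => (gs_pos hs v).le), gs_integral hs, ENNReal.ofReal_one]

lemma gauss_sph (d : ℕ) [NeZero d] : ∃ C : ℝ, 0 < C ∧ ∀ s ρ : ℝ, 0 < s → 0 < ρ → ∀ z : Euc d,
    ∫⁻ ω, ENNReal.ofReal (gs d s (z - ρ • ω)) ∂(sphereMeasure d) ≤
      ENNReal.ofReal (C / (√s * ρ ^ (d - 1))) := by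
  set K : ℝ := Real.exp (Real.pi ^ 2) * 2 ^ ((d : ℝ) / 2) with hK
  have hK0 : 0 < K := by positivity
  have hc : 0 < (cSph d).toReal := ENNReal.toReal_pos (cSph_ne_zero d) (cSph_ne_top d)
  refine ⟨K / (cSph d).toReal, by positivity, fun s ρ hs hρ z => ?_⟩
  have hpt : ∀ t ∈ Icc ρ (ρ + √s), ∀ ω : Euc d, ‖ω‖ = 1 →
      gs d s (z - ρ • ω) ≤ K * gs d (2 * s) (z - t • ω) := by
    intro t ht ω hω
    have h1 : ‖z - t • ω‖ ≤ ‖z - ρ • ω‖ + √s := by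
      have : z - t • ω = (z - ρ • ω) - (t - ρ) • ω := by rw [sub_smul]; abel
      rw [this]
      refine (norm_sub_le _ _).trans ?_
      rw [norm_smul, hω, mul_one, Real.norm_of_nonneg (by linarith [ht.1])]
      linarith [ht.2]
    have h2 : ‖z - t • ω‖ ^ 2 ≤ 2 * ‖z - ρ • ω‖ ^ 2 + 2 * s := by
      have h3 : ‖z - t • ω‖ ^ 2 ≤ (‖z - ρ • ω‖ + √s) ^ 2 := by gcongr
      nlinarith [Real.sq_sqrt hs.le, sq_nonneg (‖z - ρ • ω‖ - √s)]
    unfold gs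
    have e1 : (Real.pi / s) ^ ((d : ℝ) / 2) = 2 ^ ((d : ℝ) / 2) * (Real.pi / (2 * s)) ^ ((d : ℝ) / 2) := by
      rw [← Real.mul_rpow (by positivity) (by positivity)]; congr 1; field_simp
    have e2 : Real.exp (-(Real.pi ^ 2 / s) * ‖z - ρ • ω‖ ^ 2) ≤
        Real.exp (Real.pi ^ 2) * Real.exp (-(Real.pi ^ 2 / (2 * s)) * ‖z - t • ω‖ ^ 2) := by
      rw [← Real.exp_add]
      apply Real.exp_le_exp.2
      have : Real.pi ^ 2 / (2 * s) * ‖z - t • ω‖ ^ 2 ≤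
          Real.pi ^ 2 / (2 * s) * (2 * ‖z - ρ • ω‖ ^ 2 + 2 * s) := by gcongr
      have e3 : Real.pi ^ 2 / (2 * s) * (2 * ‖z - ρ • ω‖ ^ 2 + 2 * s) =
          Real.pi ^ 2 / s * ‖z - ρ • ω‖ ^ 2 + Real.pi ^ 2 := by field_simp
      linarith
    rw [e1, hK]
    calc _ ≤ 2 ^ ((d : ℝ) / 2) * (Real.pi / (2 * s)) ^ ((d : ℝ) / 2) * (Real.exp (Real.pi ^ 2) *
        Real.exp (-(Real.pi ^ 2 / (2 * s)) * ‖z - t • ω‖ ^ 2)) := by gcongr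
      _ = _ := by ring
  set A := ∫⁻ ω, ENNReal.ofReal (gs d s (z - ρ • ω)) ∂(sphereMeasure d) with hA
  have key : cSph d * (ENNReal.ofReal (√s * ρ ^ (d - 1)) * A) ≤ ENNReal.ofReal K := by
    calc cSph d * (ENNReal.ofReal (√s * ρ ^ (d - 1)) * A)
        = cSph d * ∫⁻ t in Icc ρ (ρ + √s), ENNReal.ofReal (ρ ^ (d - 1)) * A := by
          rw [setLIntegral_const, Real.volume_Icc, add_sub_cancel_left,
            ENNReal.ofReal_mul (Real.sqrt_nonneg _)]
          ring
      _ ≤ cSph d * ∫⁻ t in Icc ρ (ρ + √s), ENNReal.ofReal (t ^ (d - 1)) *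
          ∫⁻ ω, ENNReal.ofReal K * ENNReal.ofReal (gs d (2 * s) (z - t • ω)) ∂(sphereMeasure d) := by
          gcongr cSph d * ?_
          refine setLIntegral_mono' measurableSet_Icc fun t ht => ?_
          refine mul_le_mul' (ENNReal.ofReal_le_ofReal (by gcongr; exact ht.1)) ?_
          refine lintegral_mono_ae ((sph_norm d).mono fun ω hω => ?_)
          rw [← ENNReal.ofReal_mul hK0.le]
          exact ENNReal.ofReal_le_ofReal (hpt t ht ω hω)
      _ ≤ cSph d * ∫⁻ t in Ioi 0, ENNReal.ofReal (t ^ (d - 1)) *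
          ∫⁻ ω, ENNReal.ofReal K * ENNReal.ofReal (gs d (2 * s) (z - t • ω)) ∂(sphereMeasure d) := by
          gcongr cSph d * ?_
          exact lintegral_mono_set (fun t ht => lt_of_lt_of_le hρ ht.1)
      _ = ∫⁻ x, ENNReal.ofReal K * ENNReal.ofReal (gs d (2 * s) (z - x)) := by
          rw [polar_lintegral]
          have : Continuous (gs d (2 * s)) := gs_cont
          fun_prop
      _ = ENNReal.ofReal K := by
          rw [lintegral_const_mul' _ _ ENNReal.ofReal_ne_top, gs_lintegral (by positivity), mul_one]
  have hX : cSph d * (ENNReal.ofReal (√s * ρ ^ (d - 1)) * A) =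
      ENNReal.ofReal ((cSph d).toReal * (√s * ρ ^ (d - 1))) * A := by
    rw [ENNReal.ofReal_mul hc.le, ENNReal.ofReal_toReal (cSph_ne_top d)]; ring
  rw [hX] at key
  have hp : 0 < (cSph d).toReal * (√s * ρ ^ (d - 1)) := by positivity
  rw [div_div, ENNReal.ofReal_div_of_pos hp, ENNReal.le_div_iff_mul_le (Or.inl (ENNReal.ofReal_pos.2 hp).ne') (Or.inl ENNReal.ofReal_ne_top)]
  rwa [mul_comm]

lemma ft_sq_l {d : ℕ} {Ω : Type*} [MeasurableSpace Ω] (ν : Measure Ω) [IsFiniteMeasure ν]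
    (Ξ : Ω → Euc d) (hΞ : Measurable Ξ) {U : Euc d → ℂ} (hU : Integrable U) :
    ∫⁻ ω, ‖ft U (Ξ ω)‖ₑ ^ 2 ∂ν = ENNReal.ofReal (∫ ω, ‖ft U (Ξ ω)‖ ^ 2 ∂ν) := by
  have hInt : Integrable (fun ω => ‖ft U (Ξ ω)‖ ^ 2) ν := by
    refine Integrable.of_bound
      (((ft_cont hU).measurable.comp hΞ).norm.pow_const 2).aestronglyMeasurable ((∫ y, ‖U y‖) ^ 2)
      (Filter.Eventually.of_forall fun ξ => ?_)
    rw [Real.norm_of_nonneg (by positivity)]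
    have := ft_bound U (Ξ ξ)
    gcongr
  rw [ofReal_integral_eq_lintegral_ofReal hInt (Filter.Eventually.of_forall fun _ => by positivity)]
  refine lintegral_congr fun ω => ?_
  rw [ENNReal.ofReal_pow (norm_nonneg _), ofReal_norm]

lemma sph_ee {d : ℕ} [NeZero d] (ρ : ℝ) (hρ : 0 ≤ ρ) (z : Euc d) :
    ∫ ω, ee (-inner ℝ z (ρ • ω)) ∂(sphereMeasure d) = phi d (2 * Real.pi * ρ * ‖z‖) := by
  have h := sph_cexp (-(2 * Real.pi * ρ) • z)
  rw [norm_smul, norm_neg, Real.norm_of_nonneg (by positivity)] at h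
  rw [← h]; congr 1; ext ω
  unfold ee
  congr 3
  rw [inner_smul_right, inner_smul_left]; simp; ring

lemma pow_one_sub (E : ℂ) (M : ℕ) : (1 : ℂ) = (1 - E) ^ M -
    ∑ j ∈ Finset.range M, ((-1) ^ (j + 1) * (M.choose (j + 1) : ℂ)) * E ^ (j + 1) := by
  have h := add_pow (-E) 1 M
  rw [Finset.sum_range_succ'] at h
  simp only [one_pow, mul_one, pow_zero, Nat.choose_zero_right, Nat.cast_one] at h
  rw [sub_eq_neg_add 1 E, h, add_sub_right_comm, ← Finset.sum_sub_distrib]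
  rw [Finset.sum_eq_zero, zero_add]
  intro j _
  rw [neg_pow E]; ring

/-- decay of the far part of the kernel -/
lemma far_kernel (d : ℕ) [NeZero d] : ∃ C : ℝ, 0 < C ∧ ∀ ρ R x : ℝ, 0 < ρ → 0 < R → 0 ≤ x →
    |phi d (2 * Real.pi * ρ * x)| * (1 - Real.exp (-(1 / R ^ 2) * x ^ 2)) ^ d ≤
      C * (ρ * R) ^ (-((d : ℝ) - 1) / 2) := by
  obtain ⟨C, hC1, hC⟩ := phi_decay d
  have hd1 : (1 : ℝ) ≤ d := by exact_mod_cast Nat.one_le_iff_ne_zero.2 (NeZero.ne d)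
  refine ⟨√C, by positivity, fun ρ R x hρ hR hx => ?_⟩
  have hRR : 0 ≤ √C * (ρ * R) ^ (-((d : ℝ) - 1) / 2) := by positivity
  rcases hx.eq_or_lt with h0 | h0
  · rw [← h0]
    refine le_trans (le_of_eq ?_) hRR
    simp [NeZero.ne d]
  have hE1 : 0 ≤ 1 - Real.exp (-(1 / R ^ 2) * x ^ 2) := by
    rw [sub_nonneg, Real.exp_le_one_iff]
    have : 0 ≤ (1 / R ^ 2) * x ^ 2 := by positivity
    linarith
  have hE2 : 1 - Real.exp (-(1 / R ^ 2) * x ^ 2) ≤ 1 := by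
    linarith [Real.exp_pos (-(1 / R ^ 2) * x ^ 2)]
  have hE3 : 1 - Real.exp (-(1 / R ^ 2) * x ^ 2) ≤ (x / R) ^ 2 := by
    have := Real.add_one_le_exp (-(1 / R ^ 2) * x ^ 2)
    have e : (x / R) ^ 2 = (1 / R ^ 2) * x ^ 2 := by rw [div_pow]; ring
    rw [e]; linarith
  have hphi : |phi d (2 * Real.pi * ρ * x)| ≤ √C * (ρ * x) ^ (-((d : ℝ) - 1) / 2) := by
    have h1 := (hC (ρ * x) (by positivity)).1
    have h2 := (hC (2 * Real.pi * ρ * x) (by positivity)).1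
    have hpow : (ρ * x) ^ (d - 1) ≤ (2 * Real.pi * ρ * x) ^ (d - 1) := by
      gcongr
      nlinarith [Real.pi_gt_three, mul_pos hρ h0]
    have h3 : phi d (2 * Real.pi * ρ * x) ^ 2 * (ρ * x) ^ (d - 1) ≤ C :=
      le_trans (by gcongr) h2
    have e : ((ρ * x) ^ (-((d : ℝ) - 1) / 2)) ^ 2 = ((ρ * x) ^ (d - 1))⁻¹ := by
      rw [← Real.rpow_natCast, ← Real.rpow_mul (by positivity), ← Real.rpow_natCast,
        ← Real.rpow_neg (by positivity), Nat.cast_sub (Nat.one_le_iff_ne_zero.2 (NeZero.ne d))]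
      congr 1; push_cast; ring
    apply abs_le_of_sq_le_sq _ (by positivity)
    rw [mul_pow, Real.sq_sqrt (by linarith), e, ← div_eq_mul_inv, le_div_iff₀ (by positivity)]
    exact h3
  calc _ ≤ √C * (ρ * x) ^ (-((d : ℝ) - 1) / 2) * (1 - Real.exp (-(1 / R ^ 2) * x ^ 2)) ^ d := by
        gcongr
    _ = √C * (ρ * R) ^ (-((d : ℝ) - 1) / 2) * ((x / R) ^ (-((d : ℝ) - 1) / 2) *
        (1 - Real.exp (-(1 / R ^ 2) * x ^ 2)) ^ d) := by
        have : ρ * x = (ρ * R) * (x / R) := by field_simp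
        rw [this, Real.mul_rpow (by positivity) (by positivity)]; ring
    _ ≤ √C * (ρ * R) ^ (-((d : ℝ) - 1) / 2) * 1 := by
        gcongr
        rcases le_total R x with h | h
        · have h1 : 1 ≤ x / R := by rwa [le_div_iff₀ hR, one_mul]
          have h2 := Real.rpow_le_one_of_one_le_of_nonpos h1 (z := -((d : ℝ) - 1) / 2) (by linarith)
          have h3 : (1 - Real.exp (-(1 / R ^ 2) * x ^ 2)) ^ d ≤ 1 := pow_le_one₀ hE1 hE2
          calc _ ≤ (1 : ℝ) * 1 := by gcongr
            _ = 1 := by norm_num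
        · have h1 : x / R ≤ 1 := by rwa [div_le_iff₀ hR, one_mul]
          have hp : 0 < x / R := by positivity
          calc _ ≤ (x / R) ^ (-((d : ℝ) - 1) / 2) * ((x / R) ^ 2) ^ d := by gcongr
            _ = (x / R) ^ (-((d : ℝ) - 1) / 2 + 2 * d) := by
              rw [Real.rpow_add hp, ← pow_mul, ← Real.rpow_natCast]; push_cast; rfl
            _ ≤ 1 := Real.rpow_le_one hp.le h1 (by linarith)
    _ = _ := by rw [mul_one]

/-- averaged near part -/
lemma near_part (d : ℕ) [NeZero d] : ∃ C : ℝ, 0 < C ∧ ∀ U : Euc d → ℂ, Integrable U →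
    ∀ s ρ : ℝ, 0 < s → 0 < ρ →
    ‖∫ z : Euc d × Euc d, U z.1 * (starRingEnd ℂ) (U z.2) *
      ((phi d (2 * Real.pi * ρ * ‖z.1 - z.2‖) : ℂ) * (Real.exp (-s * ‖z.1 - z.2‖ ^ 2) : ℂ))
      ∂(volume.prod volume)‖ₑ ≤ ENNReal.ofReal (C / (√s * ρ ^ (d - 1))) * ∫⁻ x, ‖U x‖ₑ ^ 2 := by
  obtain ⟨C, hC0, hC⟩ := gauss_sph d
  refine ⟨C, hC0, fun U hU s ρ hs hρ => ?_⟩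
  set μ : Measure (Euc d) := volume.withDensity fun ξ => ENNReal.ofReal (gs d s ξ) with hμ
  have hμ1 : IsFiniteMeasure μ := by
    refine isFiniteMeasure_withDensity ?_
    exact (gs_integrable hs).lintegral_lt_top.ne
  set Ξ : Euc d × Euc d → Euc d := fun w => ρ • w.1 + w.2 with hΞ
  have hΞm : Measurable Ξ := by fun_prop
  have h1 := ft_sq ((sphereMeasure d).prod μ) Ξ hΞm hU
  have h2 : ∀ z : Euc d, ∫ w, ee (-inner ℝ z (Ξ w)) ∂((sphereMeasure d).prod μ) =
      (phi d (2 * Real.pi * ρ * ‖z‖) : ℂ) * (Real.exp (-s * ‖z‖ ^ 2) : ℂ) := by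
    intro z
    have : ∀ w : Euc d × Euc d, ee (-inner ℝ z (Ξ w)) =
        ee (-inner ℝ z (ρ • w.1)) * ee (-inner ℝ z w.2) := by
      intro w
      rw [← ee_add, hΞ, inner_add_right]; congr 1; ring
    simp_rw [this]
    rw [integral_prod_mul (fun ω => ee (-inner ℝ z (ρ • ω))) (fun ζ => ee (-inner ℝ z ζ)),
      sph_ee ρ hρ.le z, ← gs_ft hs z]
    congr 1
    rw [hμ, integral_withDensity_eq_integral_toReal_smul
      (by have : Continuous (gs d s) := gs_cont
          fun_prop)
      (Filter.Eventually.of_forall fun _ => ENNReal.ofReal_lt_top)]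
    congr 1; ext ξ
    rw [ENNReal.toReal_ofReal (gs_pos hs _).le, Complex.real_smul]
  simp_rw [h2] at h1
  rw [← h1]
  have h4 : ∀ A : ℝ, 0 ≤ A → ‖(A : ℂ)‖ₑ = ENNReal.ofReal A := fun A hA => by
    rw [← ofReal_norm, Complex.norm_real, Real.norm_of_nonneg hA]
  rw [h4 _ (integral_nonneg fun _ => by positivity), ← ft_sq_l _ _ hΞm hU]
  have hm := (ft_cont hU).measurable
  have hmg : Measurable (gs d s) := gs_cont.measurable
  calc ∫⁻ w, ‖ft U (Ξ w)‖ₑ ^ 2 ∂((sphereMeasure d).prod μ)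
      = ∫⁻ ω, ∫⁻ ζ, ‖ft U (ρ • ω + ζ)‖ₑ ^ 2 ∂μ ∂(sphereMeasure d) := by
        rw [lintegral_prod _ (by fun_prop)]
    _ = ∫⁻ ω, ∫⁻ ζ, ENNReal.ofReal (gs d s ζ) * ‖ft U (ρ • ω + ζ)‖ₑ ^ 2 ∂volume ∂(sphereMeasure d) := by
        refine lintegral_congr fun ω => ?_
        rw [hμ, lintegral_withDensity_eq_lintegral_mul _ (by fun_prop) (by fun_prop)]
        rfl
    _ = ∫⁻ ω, ∫⁻ η, ENNReal.ofReal (gs d s (η - ρ • ω)) * ‖ft U η‖ₑ ^ 2 ∂volume ∂(sphereMeasure d) := by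
        refine lintegral_congr fun ω => ?_
        rw [← lintegral_add_left_eq_self (fun η => ENNReal.ofReal (gs d s (η - ρ • ω)) * ‖ft U η‖ₑ ^ 2) (ρ • ω)]
        refine lintegral_congr fun ζ => ?_
        rw [add_sub_cancel_left]
    _ = ∫⁻ η, ∫⁻ ω, ENNReal.ofReal (gs d s (η - ρ • ω)) * ‖ft U η‖ₑ ^ 2 ∂(sphereMeasure d) := by
        rw [lintegral_lintegral_swap]
        exact Measurable.aemeasurable (by unfold Function.uncurry; fun_prop)
    _ ≤ ∫⁻ η, ENNReal.ofReal (C / (√s * ρ ^ (d - 1))) * ‖ft U η‖ₑ ^ 2 := by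
        refine lintegral_mono fun η => ?_
        rw [lintegral_mul_const _ (by fun_prop)]
        gcongr
        exact hC s ρ hs hρ η
    _ = ENNReal.ofReal (C / (√s * ρ ^ (d - 1))) * ∫⁻ η, ‖ft U η‖ₑ ^ 2 :=
        lintegral_const_mul' _ _ ENNReal.ofReal_ne_top
    _ ≤ _ := by
        exact mul_le_mul' le_rfl (bessel hU)

set_option maxHeartbeats 1000000 in
/-- Tomas-type estimate -/
lemma tomas (d : ℕ) [NeZero d] : ∃ C : ℝ, 0 < C ∧ ∀ U : Euc d → ℂ, Integrable U →
    ∀ ρ R : ℝ, 0 < ρ → 0 < R →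
    ∫⁻ ω, ‖ft U (ρ • ω)‖ₑ ^ 2 ∂(sphereMeasure d) ≤
      ENNReal.ofReal (C * (ρ * R) ^ (-((d : ℝ) - 1) / 2)) * (∫⁻ x, ‖U x‖ₑ) ^ 2 +
      ENNReal.ofReal (C * (R / ρ ^ (d - 1))) * ∫⁻ x, ‖U x‖ₑ ^ 2 := by
  obtain ⟨C1, hC1, h1⟩ := far_kernel d
  obtain ⟨C2, hC2, h2⟩ := near_part d
  refine ⟨C1 + 2 ^ d * C2, by positivity, fun U hU ρ R hρ hR => ?_⟩
  have hmr : Measurable (fun ω : Euc d => ρ • ω) := by fun_prop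
  rw [ft_sq_l _ _ hmr hU]
  have hsq := ft_sq (sphereMeasure d) _ hmr hU
  simp_rw [sph_ee ρ hρ.le] at hsq
  have h4 : ∀ A : ℝ, 0 ≤ A → ‖(A : ℂ)‖ₑ = ENNReal.ofReal A := fun A hA => by
    rw [← ofReal_norm, Complex.norm_real, Real.norm_of_nonneg hA]
  rw [← h4 _ (integral_nonneg fun _ => by positivity), hsq]
  have hU' : Integrable (fun y => (starRingEnd ℂ) (U y)) :=
    (Complex.conjCLE.toContinuousLinearMap).integrable_comp hU
  have hP : Integrable (fun z : Euc d × Euc d => U z.1 * (starRingEnd ℂ) (U z.2))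
      (volume.prod volume) := hU.mul_prod hU'
  set E : Euc d × Euc d → ℝ := fun z => Real.exp (-(1 / R ^ 2) * ‖z.1 - z.2‖ ^ 2) with hE
  have hE01 : ∀ z, 0 < E z ∧ E z ≤ 1 := fun z => ⟨Real.exp_pos _, by
    rw [hE, Real.exp_le_one_iff]
    have : 0 ≤ (1 / R ^ 2) * ‖z.1 - z.2‖ ^ 2 := by positivity
    linarith⟩
  have hEc : Continuous E := by fun_prop
  have hphic : Continuous (fun z : Euc d × Euc d => phi d (2 * Real.pi * ρ * ‖z.1 - z.2‖)) :=
    (continuous_phi (d := d)).comp (by fun_prop)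
  have hInt : ∀ (g : Euc d × Euc d → ℂ), Continuous g → (∀ z, ‖g z‖ ≤ 1) →
      Integrable (fun z : Euc d × Euc d => U z.1 * (starRingEnd ℂ) (U z.2) *
        ((phi d (2 * Real.pi * ρ * ‖z.1 - z.2‖) : ℂ) * g z)) (volume.prod volume) := by
    intro g hg hgb
    refine hP.mul_bdd (c := 1) (Continuous.aestronglyMeasurable (by fun_prop))
      (Filter.Eventually.of_forall fun z => ?_)
    rw [norm_mul, Complex.norm_real, Real.norm_eq_abs]
    calc _ ≤ (1 : ℝ) * 1 := by
          gcongr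
          · exact abs_phi_le d _
          · exact hgb z
      _ = 1 := by norm_num
  have hEj : ∀ (j : ℕ) z, ((Real.exp (-((j + 1 : ℝ) / R ^ 2) * ‖z.1 - z.2‖ ^ 2) : ℝ) : ℂ) =
      ((E z : ℝ) : ℂ) ^ (j + 1) := by
    intro j z
    rw [hE, ← Complex.ofReal_pow, ← Real.exp_nat_mul]; congr 2; push_cast; ring
  have hid : ∀ z : Euc d × Euc d, U z.1 * (starRingEnd ℂ) (U z.2) *
      (phi d (2 * Real.pi * ρ * ‖z.1 - z.2‖) : ℂ) =
      U z.1 * (starRingEnd ℂ) (U z.2) * ((phi d (2 * Real.pi * ρ * ‖z.1 - z.2‖) : ℂ) *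
        (((1 - E z) ^ d : ℝ) : ℂ)) -
      ∑ j ∈ Finset.range d, ((-1) ^ (j + 1) * (d.choose (j + 1) : ℂ)) *
        (U z.1 * (starRingEnd ℂ) (U z.2) * ((phi d (2 * Real.pi * ρ * ‖z.1 - z.2‖) : ℂ) *
        ((Real.exp (-((j + 1 : ℝ) / R ^ 2) * ‖z.1 - z.2‖ ^ 2) : ℝ) : ℂ))) := by
    intro z
    have h := pow_one_sub (E z : ℂ) d
    simp_rw [hEj]
    have e : ∀ j ∈ Finset.range d, ((-1) ^ (j + 1) * (d.choose (j + 1) : ℂ)) *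
        (U z.1 * (starRingEnd ℂ) (U z.2) * ((phi d (2 * Real.pi * ρ * ‖z.1 - z.2‖) : ℂ) *
        ((E z : ℝ) : ℂ) ^ (j + 1))) = (U z.1 * (starRingEnd ℂ) (U z.2) * (phi d (2 * Real.pi * ρ * ‖z.1 - z.2‖) : ℂ))
        * (((-1) ^ (j + 1) * (d.choose (j + 1) : ℂ)) * ((E z : ℝ) : ℂ) ^ (j + 1)) := by
      intro j _; ring
    rw [Finset.sum_congr rfl e, ← Finset.mul_sum]
    push_cast
    linear_combination (U z.1 * (starRingEnd ℂ) (U z.2) * (phi d (2 * Real.pi * ρ * ‖z.1 - z.2‖) : ℂ)) * h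
  simp_rw [hid]
  have hI1 : ∀ j : ℕ, Integrable (fun z : Euc d × Euc d =>
      ((-1) ^ (j + 1) * (d.choose (j + 1) : ℂ)) *
        (U z.1 * (starRingEnd ℂ) (U z.2) * ((phi d (2 * Real.pi * ρ * ‖z.1 - z.2‖) : ℂ) *
        ((Real.exp (-((j + 1 : ℝ) / R ^ 2) * ‖z.1 - z.2‖ ^ 2) : ℝ) : ℂ)))) (volume.prod volume) := by
    intro j
    refine (hInt _ (by fun_prop) fun z => ?_).const_mul _
    rw [hEj, norm_pow, Complex.norm_real, Real.norm_of_nonneg (hE01 z).1.le]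
    exact pow_le_one₀ (hE01 z).1.le (hE01 z).2
  rw [integral_sub (hInt _ (by fun_prop) fun z => ?_) (integrable_finsetSum _ fun j _ => hI1 j),
    integral_finsetSum _ fun j _ => hI1 j]
  swap
  · rw [Complex.norm_real, Real.norm_of_nonneg (pow_nonneg (by linarith [(hE01 z).2]) _)]
    exact pow_le_one₀ (by linarith [(hE01 z).2]) (by linarith [(hE01 z).1])
  simp_rw [integral_const_mul]
  refine (enorm_sub_le).trans ?_
  have hfar : ‖∫ z : Euc d × Euc d, U z.1 * (starRingEnd ℂ) (U z.2) *
      ((phi d (2 * Real.pi * ρ * ‖z.1 - z.2‖) : ℂ) * (((1 - E z) ^ d : ℝ) : ℂ)) ∂(volume.prod volume)‖ₑ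
      ≤ ENNReal.ofReal (C1 * (ρ * R) ^ (-((d : ℝ) - 1) / 2)) * (∫⁻ x, ‖U x‖ₑ) ^ 2 := by
    calc _ ≤ ∫⁻ z : Euc d × Euc d, ‖U z.1 * (starRingEnd ℂ) (U z.2) *
      ((phi d (2 * Real.pi * ρ * ‖z.1 - z.2‖) : ℂ) * (((1 - E z) ^ d : ℝ) : ℂ))‖ₑ ∂(volume.prod volume) :=
          enorm_integral_le_lintegral_enorm _
      _ ≤ ∫⁻ z : Euc d × Euc d, ENNReal.ofReal (C1 * (ρ * R) ^ (-((d : ℝ) - 1) / 2)) *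
          (‖U z.1‖ₑ * ‖U z.2‖ₑ) ∂(volume.prod volume) := by
          refine lintegral_mono fun z => ?_
          rw [enorm_mul, enorm_mul]
          have e2 : ‖(starRingEnd ℂ) (U z.2)‖ₑ = ‖U z.2‖ₑ := by
            rw [← ofReal_norm, ← ofReal_norm, RCLike.norm_conj]
          rw [e2, mul_comm]
          refine mul_le_mul' ?_ le_rfl
          rw [← ofReal_norm, norm_mul, Complex.norm_real, Complex.norm_real, Real.norm_eq_abs,
            Real.norm_of_nonneg (pow_nonneg (by linarith [(hE01 z).2]) _)]
          exact ENNReal.ofReal_le_ofReal (h1 ρ R _ hρ hR (norm_nonneg _))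
      _ = _ := by
          rw [lintegral_const_mul' _ _ ENNReal.ofReal_ne_top, lintegral_prod_mul hU.1.enorm hU.1.enorm, sq]
  have hnear : ‖∑ j ∈ Finset.range d, ((-1) ^ (j + 1) * (d.choose (j + 1) : ℂ)) *
      ∫ z : Euc d × Euc d, U z.1 * (starRingEnd ℂ) (U z.2) *
        ((phi d (2 * Real.pi * ρ * ‖z.1 - z.2‖) : ℂ) *
        ((Real.exp (-((j + 1 : ℝ) / R ^ 2) * ‖z.1 - z.2‖ ^ 2) : ℝ) : ℂ)) ∂(volume.prod volume)‖ₑ ≤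
      ENNReal.ofReal (2 ^ d * C2 * (R / ρ ^ (d - 1))) * ∫⁻ x, ‖U x‖ₑ ^ 2 := by
    calc _ ≤ ∑ j ∈ Finset.range d, ENNReal.ofReal ((d.choose (j + 1) : ℝ) * (C2 * (R / ρ ^ (d - 1)))) *
          ∫⁻ x, ‖U x‖ₑ ^ 2 := by
          refine (enorm_sum_le _ _).trans (Finset.sum_le_sum fun j _ => ?_)
          rw [enorm_mul, ENNReal.ofReal_mul (by positivity), mul_assoc (ENNReal.ofReal _)]
          refine mul_le_mul' (le_of_eq ?_) ?_
          · rw [← ofReal_norm, norm_mul, norm_pow, norm_neg, norm_one, one_pow, one_mul, Complex.norm_natCast]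
          · refine (h2 U hU ((j + 1 : ℝ) / R ^ 2) ρ (by positivity) hρ).trans ?_
            gcongr
            have : 1 / R ≤ √((j + 1 : ℝ) / R ^ 2) := by
              apply Real.le_sqrt_of_sq_le
              rw [div_pow, one_pow]
              gcongr
              linarith [(Nat.cast_nonneg j : (0:ℝ) ≤ j)]
            calc C2 / (√((j + 1 : ℝ) / R ^ 2) * ρ ^ (d - 1)) ≤ C2 / (1 / R * ρ ^ (d - 1)) := by gcongr
              _ = _ := by field_simp
      _ ≤ _ := by
          rw [← Finset.sum_mul]
          gcongr
          rw [← ENNReal.ofReal_sum_of_nonneg (fun j _ => by positivity), ← Finset.sum_mul, mul_assoc]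
          apply ENNReal.ofReal_le_ofReal
          gcongr
          have h := Nat.sum_range_choose d
          rw [Finset.sum_range_succ'] at h
          have : (∑ k ∈ Finset.range d, d.choose (k + 1)) ≤ 2 ^ d := by omega
          exact_mod_cast this
  refine (add_le_add hfar hnear).trans ?_
  gcongr
  · have : 0 < (2 : ℝ) ^ d * C2 := by positivity
    linarith
  · linarith

/-- the Plancherel-type property of a radial multiplier `m` -/
def MPl (d : ℕ) (m : ℝ → ℝ) : Prop := ∃ A : ℝ, 0 < A ∧ ∀ g : ℝ → ℂ, Continuous g →
  ∫⁻ ρ in Ioi (0 : ℝ), ENNReal.ofReal (ρ ^ (d - 1)) *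
    ‖∫ t in Icc (1 : ℝ) 2, (m (2 * Real.pi * (t * ρ)) : ℂ) * g t‖ₑ ^ 2 ≤
  ENNReal.ofReal A * ∫⁻ t in Icc (1 : ℝ) 2, ‖g t‖ₑ ^ 2

set_option maxHeartbeats 1000000 in
lemma mpl_gen {d n : ℕ} [NeZero d] (hn : 0 < n) (h : Fin n → Euc d → ℂ) (hm : ∀ j, Measurable (h j))
    (hb : ∀ j y, ‖h j y‖ ≤ 1) (hhom : ∀ j y (t : ℝ), 0 < t → h j (t • y) = h j y)
    (co : Euc d → Fin n → ℂ) (hco : ∀ e : Euc d, ‖e‖ = 1 → ∀ j, ‖co e j‖ ≤ 1)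
    (m : ℝ → ℝ) (hmm : Measurable m) (u : ℂ) (hu : ‖u‖ = 1)
    (hS : ∀ e : Euc d, ‖e‖ = 1 → ∀ s : ℝ, 0 ≤ s →
      ∫ ω, (∑ j, co e j * h j ω) * ee (-(s * inner ℝ ω e)) ∂(sphereMeasure d) =
        u * m (2 * Real.pi * s)) : MPl d m := by
  have hc : 0 < (cSph d).toReal := ENNReal.toReal_pos (cSph_ne_zero d) (cSph_ne_top d)
  set c := (cSph d).toReal with hcdef
  have hcE : cSph d = ENNReal.ofReal c := (ENNReal.ofReal_toReal (cSph_ne_top d)).symm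
  refine ⟨(n : ℝ) ^ 2 / c ^ 2, by positivity, fun g hg => ?_⟩
  set g0 : ℝ → ℂ := fun t => if t ∈ Icc (1 : ℝ) 2 then g t * ((t ^ (d - 1))⁻¹ : ℝ) else 0 with hg0
  have hg0m : Measurable g0 := by
    refine Measurable.ite measurableSet_Icc ?_ measurable_const
    have := hg.measurable
    fun_prop
  have hg0b : ∀ t, ‖g0 t‖ ≤ if t ∈ Icc (1 : ℝ) 2 then ‖g t‖ else 0 := by
    intro t
    simp only [hg0]
    split_ifs with ht
    · rw [norm_mul, Complex.norm_real, norm_inv, norm_pow]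
      refine mul_le_of_le_one_right (norm_nonneg _) ?_
      apply inv_le_one_of_one_le₀
      apply one_le_pow₀
      rw [Real.norm_of_nonneg (by linarith [ht.1])]; exact ht.1
    · simp
  set G : Fin n → Euc d → ℂ := fun j y => g0 ‖y‖ * h j y with hG
  have hGm : ∀ j, Measurable (G j) := fun j => by
    have := hm j
    fun_prop
  have hGb : ∀ j y, ‖G j y‖ₑ ≤ ‖g0 ‖y‖‖ₑ := by
    intro j y
    rw [hG, enorm_mul]
    calc _ ≤ ‖g0 ‖y‖‖ₑ * 1 := by
          gcongr
          rw [← ofReal_norm]; exact ENNReal.ofReal_le_one.2 (hb j y)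
      _ = _ := mul_one _
  obtain ⟨B, hB⟩ := (isCompact_Icc (a := (1 : ℝ)) (b := 2)).exists_bound_of_continuousOn hg.continuousOn
  have hGi : ∀ j, Integrable (G j) := by
    intro j
    have h1 : IntegrableOn (G j) (closedBall 0 2) := by
      refine IntegrableOn.of_bound measure_closedBall_lt_top (hGm j).aestronglyMeasurable (max B 0)
        (Filter.Eventually.of_forall fun y => ?_)
      rw [hG, norm_mul]
      refine (mul_le_of_le_one_right (norm_nonneg _) (hb j y)).trans ((hg0b _).trans ?_)
      split_ifs with ht
      · exact (hB _ ht).trans (le_max_left _ _)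
      · exact le_max_right _ _
    refine (integrableOn_iff_integrable_of_support_subset fun y hy => ?_).1 h1
    by_contra hy2
    apply hy
    have : ‖y‖ ∉ Icc (1 : ℝ) 2 := fun h => hy2 (by simpa using h.2)
    simp only [hG, hg0, if_neg this, zero_mul]
  have hGft : ∀ j, ∀ ξ : Euc d, ft (G j) ξ = c * ∫ t in Ioi (0 : ℝ), ((t ^ (d - 1) : ℝ) : ℂ) *
      ∫ ω, G j (t • ω) * ee (-inner ℝ (t • ω) ξ) ∂(sphereMeasure d) := by
    intro j ξ
    unfold ft
    rw [polar_integral (ee_mul_int (hGi j) (by fun_prop)), radM_integral]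
  -- main identity
  have hId : ∀ e : Euc d, ‖e‖ = 1 → ∀ ρ : ℝ, 0 < ρ → ∑ j, co e j * ft (G j) (ρ • e) =
      c * (u * ∫ t in Icc (1 : ℝ) 2, (m (2 * Real.pi * (t * ρ)) : ℂ) * g t) := by
    intro e he ρ hρ
    have h1 : ∑ j, co e j * ft (G j) (ρ • e) = ft (fun y => ∑ j, co e j * G j y) (ρ • e) := by
      unfold ft
      simp_rw [Finset.sum_mul]
      rw [integral_finsetSum]
      · refine Finset.sum_congr rfl fun j _ => ?_
        rw [← integral_const_mul]; congr 1; ext y; ring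
      · intro j _
        have := ((ee_mul_int (hGi j) (g := fun y => -inner ℝ y (ρ • e)) (by fun_prop)).const_mul (co e j))
        refine this.congr (Filter.Eventually.of_forall fun y => ?_)
        simp only; ring
    have hGs : Integrable (fun y => ∑ j, co e j * G j y) :=
      integrable_finsetSum _ fun j _ => (hGi j).const_mul _
    rw [h1]
    unfold ft
    rw [polar_integral (ee_mul_int hGs (by fun_prop)), radM_integral]
    congr 1
    rw [← integral_const_mul, ← integral_indicator measurableSet_Ioi,
      ← integral_indicator measurableSet_Icc]
    congr 1; ext t
    by_cases ht : t ∈ Icc (1 : ℝ) 2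
    · have ht0 : 0 < t := by linarith [ht.1]
      rw [indicator_of_mem (by exact ht0), indicator_of_mem ht]
      have h2 : ∫ ω, (∑ j, co e j * G j (t • ω)) * ee (-inner ℝ (t • ω) (ρ • e)) ∂(sphereMeasure d) =
          g0 t * ∫ ω, (∑ j, co e j * h j ω) * ee (-((t * ρ) * inner ℝ ω e)) ∂(sphereMeasure d) := by
        rw [← integral_const_mul]
        refine integral_congr_ae ((sph_norm d).mono fun ω hω => ?_)
        simp only [hG]
        rw [norm_smul, hω, mul_one, Real.norm_of_nonneg ht0.le, inner_smul_left, inner_smul_right]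
        simp_rw [hhom _ _ t ht0]
        rw [← mul_assoc (g0 t), Finset.mul_sum]
        congr 1
        · exact Finset.sum_congr rfl fun j _ => by ring
        · congr 2; simp; ring
      rw [h2, hS e he _ (by positivity)]
      simp only [hg0, if_pos ht]
      have : ((t ^ (d - 1) : ℝ) : ℂ) ≠ 0 := by
        rw [Complex.ofReal_ne_zero]; positivity
      push_cast at this ⊢
      field_simp
    · rw [indicator_of_notMem ht]
      rw [indicator_apply]
      split_ifs with ht0
      · have ht0' : (0 : ℝ) < t := ht0
        rw [integral_eq_zero_of_ae, mul_zero]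
        filter_upwards [sph_norm d] with ω hω
        simp only [hG]
        rw [norm_smul, hω, mul_one, Real.norm_of_nonneg ht0'.le]
        have hz : g0 t = 0 := if_neg ht
        simp [hz]
      · rfl
  have hI2 : ∀ e : Euc d, ‖e‖ = 1 → ∀ ρ : ℝ, 0 < ρ →
      ENNReal.ofReal (c ^ 2) * ‖∫ t in Icc (1 : ℝ) 2, (m (2 * Real.pi * (t * ρ)) : ℂ) * g t‖ₑ ^ 2 ≤
      ENNReal.ofReal n * ∑ j, ‖ft (G j) (ρ • e)‖ₑ ^ 2 := by
    intro e he ρ hρ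
    have h1 := hId e he ρ hρ
    simp_rw [← ofReal_norm]
    simp_rw [← ENNReal.ofReal_pow (norm_nonneg _)]
    rw [← ENNReal.ofReal_sum_of_nonneg (fun _ _ => by positivity), ← ENNReal.ofReal_mul (by positivity),
      ← ENNReal.ofReal_mul (by positivity)]
    apply ENNReal.ofReal_le_ofReal
    calc c ^ 2 * ‖∫ t in Icc (1 : ℝ) 2, (m (2 * Real.pi * (t * ρ)) : ℂ) * g t‖ ^ 2 =
        ‖∑ j, co e j * ft (G j) (ρ • e)‖ ^ 2 := by
          rw [h1, norm_mul, norm_mul, hu, one_mul, Complex.norm_real, Real.norm_of_nonneg hc.le, mul_pow]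
      _ ≤ (∑ j, ‖ft (G j) (ρ • e)‖) ^ 2 := by
          gcongr
          refine (norm_sum_le _ _).trans (Finset.sum_le_sum fun j _ => ?_)
          rw [norm_mul]
          exact mul_le_of_le_one_left (norm_nonneg _) (hco e he j)
      _ ≤ _ := by
          have := sq_sum_le_card_mul_sum_sq (s := Finset.univ) (f := fun j => ‖ft (G j) (ρ • e)‖)
          simpa using this
  have hftm : ∀ j, Measurable (ft (G j)) := fun j => (ft_cont (hGi j)).measurable
  have hmain : cSph d * (ENNReal.ofReal (c ^ 2) * ∫⁻ ρ in Ioi (0 : ℝ), ENNReal.ofReal (ρ ^ (d - 1)) *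
    ‖∫ t in Icc (1 : ℝ) 2, (m (2 * Real.pi * (t * ρ)) : ℂ) * g t‖ₑ ^ 2) ≤
      ENNReal.ofReal n * ∑ j, ∫⁻ x, ‖G j x‖ₑ ^ 2 := by
    calc _ = cSph d * (∫⁻ ρ in Ioi (0 : ℝ), ENNReal.ofReal (ρ ^ (d - 1)) *
        (ENNReal.ofReal (c ^ 2) * ‖∫ t in Icc (1 : ℝ) 2, (m (2 * Real.pi * (t * ρ)) : ℂ) * g t‖ₑ ^ 2)) := by
          rw [← lintegral_const_mul' _ _ ENNReal.ofReal_ne_top]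
          congr 1
          refine lintegral_congr fun ρ => by ring
      _ ≤ cSph d * (∫⁻ ρ in Ioi (0 : ℝ), ENNReal.ofReal (ρ ^ (d - 1)) *
        ∫⁻ ω, ENNReal.ofReal n * ∑ j, ‖ft (G j) (ρ • ω)‖ₑ ^ 2 ∂(sphereMeasure d)) := by
          gcongr cSph d * ?_
          refine setLIntegral_mono' measurableSet_Ioi fun ρ hρ => ?_
          gcongr
          calc _ = ∫⁻ ω, ENNReal.ofReal (c ^ 2) *
              ‖∫ t in Icc (1 : ℝ) 2, (m (2 * Real.pi * (t * ρ)) : ℂ) * g t‖ₑ ^ 2 ∂(sphereMeasure d) := by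
                rw [lintegral_const, measure_univ, mul_one]
            _ ≤ _ := lintegral_mono_ae ((sph_norm d).mono fun ω hω => hI2 ω hω ρ hρ)
      _ = ∫⁻ ξ, ENNReal.ofReal n * ∑ j, ‖ft (G j) ξ‖ₑ ^ 2 := by
          rw [polar_lintegral (by fun_prop)]
      _ = ENNReal.ofReal n * ∑ j, ∫⁻ ξ, ‖ft (G j) ξ‖ₑ ^ 2 := by
          rw [lintegral_const_mul' _ _ ENNReal.ofReal_ne_top, lintegral_finsetSum _ (fun j _ => by fun_prop)]
      _ ≤ _ := mul_le_mul' le_rfl (Finset.sum_le_sum fun j _ => bessel (hGi j))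
  have hG2 : ∀ j, ∫⁻ x, ‖G j x‖ₑ ^ 2 ≤ cSph d * ∫⁻ t in Icc (1 : ℝ) 2, ‖g t‖ₑ ^ 2 := by
    intro j
    calc _ ≤ ∫⁻ x : Euc d, ‖g0 ‖x‖‖ₑ ^ 2 := by
          refine lintegral_mono fun x => ?_
          gcongr
          exact hGb j x
      _ = cSph d * ∫⁻ t in Ioi (0 : ℝ), ENNReal.ofReal (t ^ (d - 1)) * ‖g0 t‖ₑ ^ 2 := by
          rw [polar_lintegral (by fun_prop)]
          congr 1
          refine setLIntegral_congr_fun measurableSet_Ioi fun t ht => ?_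
          have ht' : (0 : ℝ) < t := ht
          congr 1
          rw [← mul_one (‖g0 t‖ₑ ^ 2), ← measure_univ (μ := sphereMeasure d), ← lintegral_const]
          refine lintegral_congr_ae ((sph_norm d).mono fun ω hω => ?_)
          dsimp only
          rw [norm_smul, hω, mul_one, Real.norm_of_nonneg ht'.le]
      _ ≤ _ := by
          gcongr cSph d * ?_
          rw [← lintegral_indicator measurableSet_Ioi, ← lintegral_indicator measurableSet_Icc]
          refine lintegral_mono fun t => ?_
          by_cases ht : t ∈ Icc (1 : ℝ) 2
          · have ht0 : 0 < t := by linarith [ht.1]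
            rw [indicator_of_mem (by exact ht0), indicator_of_mem ht]
            simp only [hg0, if_pos ht]
            rw [← ofReal_norm, ← ofReal_norm, norm_mul, ← ENNReal.ofReal_pow (by positivity),
              ← ENNReal.ofReal_pow (by positivity), ← ENNReal.ofReal_mul (by positivity)]
            apply ENNReal.ofReal_le_ofReal
            rw [Complex.norm_real, norm_inv, Real.norm_of_nonneg (by positivity)]
            have hp : 1 ≤ t ^ (d - 1) := one_le_pow₀ ht.1
            have : t ^ (d - 1) * (‖g t‖ * (t ^ (d - 1))⁻¹) ^ 2 = ‖g t‖ ^ 2 * (t ^ (d - 1))⁻¹ := by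
              field_simp
            rw [this]
            exact mul_le_of_le_one_right (by positivity) (inv_le_one_of_one_le₀ hp)
          · have hz : g0 t = 0 := if_neg ht
            simp [indicator_apply, hz]
  have hfin : cSph d * (ENNReal.ofReal (c ^ 2) * ∫⁻ ρ in Ioi (0 : ℝ), ENNReal.ofReal (ρ ^ (d - 1)) *
    ‖∫ t in Icc (1 : ℝ) 2, (m (2 * Real.pi * (t * ρ)) : ℂ) * g t‖ₑ ^ 2) ≤
      cSph d * (ENNReal.ofReal (n ^ 2) * ∫⁻ t in Icc (1 : ℝ) 2, ‖g t‖ₑ ^ 2) := by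
    refine hmain.trans ?_
    calc _ ≤ ENNReal.ofReal n * ∑ j : Fin n, cSph d * ∫⁻ t in Icc (1 : ℝ) 2, ‖g t‖ₑ ^ 2 :=
          mul_le_mul' le_rfl (Finset.sum_le_sum fun j _ => hG2 j)
      _ = _ := by
          rw [Finset.sum_const, Finset.card_univ, Fintype.card_fin, nsmul_eq_mul,
            ENNReal.ofReal_pow (by positivity), ENNReal.ofReal_natCast]
          ring
  rw [ENNReal.mul_le_mul_iff_right (cSph_ne_zero d) (cSph_ne_top d)] at hfin
  have hc2 : (0 : ℝ) < c ^ 2 := by positivity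
  rw [ENNReal.ofReal_div_of_pos hc2, ENNReal.mul_comm_div]
  rw [← mul_div_assoc, ENNReal.le_div_iff_mul_le (Or.inl (ENNReal.ofReal_pos.2 hc2).ne')
    (Or.inl ENNReal.ofReal_ne_top), mul_comm]
  exact hfin

lemma mpl_phi (d : ℕ) [NeZero d] : MPl d (phi d) := by
  refine mpl_gen (n := 1) one_pos (fun _ _ => 1) (fun _ => measurable_const) (by simp) (by simp)
    (fun _ _ => 1) (by simp) _ (continuous_phi d).measurable 1 (by simp) fun e he s hs => ?_
  have := sph_ee s hs e
  rw [he, mul_one] at this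
  refine Eq.trans ?_ (this.trans (one_mul _).symm)
  refine integral_congr_ae (Filter.Eventually.of_forall fun ω => ?_)
  simp [inner_smul_right, real_inner_comm]

lemma mpl_dphi (d : ℕ) [NeZero d] : MPl d (dphi d) := by
  refine mpl_gen (n := d) (Nat.pos_of_ne_zero (NeZero.ne d)) (fun j y => ((y j / ‖y‖ : ℝ) : ℂ))
    (fun j => by fun_prop) (fun j y => ?_) (fun j y t ht => ?_) (fun e j => ((e j : ℝ) : ℂ))
    (fun e he j => ?_) _ (continuous_dphi d).measurable Complex.I (by simp) fun e he s hs => ?_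
  · rw [Complex.norm_real, norm_div, norm_norm]
    exact div_le_one_of_le₀ (PiLp.norm_apply_le y j) (norm_nonneg _)
  · congr 1
    rw [norm_smul, Real.norm_of_nonneg ht.le, PiLp.smul_apply, smul_eq_mul]
    rw [mul_div_mul_left _ _ ht.ne']
  · rw [Complex.norm_real, ← he]; exact PiLp.norm_apply_le e j
  · rw [← sph_dexp e he]
    refine integral_congr_ae ((sph_norm d).mono fun ω hω => ?_)
    dsimp only
    congr 1
    · rw [hω, PiLp.inner_apply]; push_cast
      exact Finset.sum_congr rfl fun j _ => by simp [mul_comm]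
    · unfold ee; congr 1; push_cast; rw [real_inner_comm]; ring

/-- radial Fourier multiplier operator, `G` playing the role of the Fourier transform of `f` -/
def opA {d : ℕ} (G : Euc d → ℂ) (W m : ℝ → ℝ) (t : ℝ) (x : Euc d) : ℂ :=
  ∫ ξ, (G ξ * ((W ‖ξ‖ * m (2 * Real.pi * (t * ‖ξ‖)) : ℝ) : ℂ)) * ee (inner ℝ x ξ)

/-- standing hypotheses -/
structure OpH {d : ℕ} (G : Euc d → ℂ) (W m : ℝ → ℝ) : Prop where
  Gc : Continuous G
  Gb : ∃ B : ℝ, ∀ ξ, ‖G ξ‖ ≤ B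
  Wm : Measurable W
  Wi : Integrable (fun ξ : Euc d => W ‖ξ‖)
  mc : Continuous m
  mb : ∀ s, |m s| ≤ 1

/-- squared `L²` norm in `t` -/
def al2 {d : ℕ} (G : Euc d → ℂ) (W m : ℝ → ℝ) (x : Euc d) : ℝ≥0∞ :=
  ∫⁻ t in Icc (1 : ℝ) 2, ‖opA G W m t x‖ₑ ^ 2

/-- squared weighted `L²` norm -/
def bb2 {d : ℕ} (G : Euc d → ℂ) (w : ℝ → ℝ) : ℝ≥0∞ := ∫⁻ ξ, ENNReal.ofReal (w ‖ξ‖) * ‖G ξ‖ₑ ^ 2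

lemma OpH.meas {d : ℕ} {G : Euc d → ℂ} {W m : ℝ → ℝ} (h : OpH G W m) (t : ℝ) :
    Measurable (fun ξ => G ξ * ((W ‖ξ‖ * m (2 * Real.pi * (t * ‖ξ‖)) : ℝ) : ℂ)) := by
  have h1 := h.Gc.measurable
  have h2 := h.Wm
  have h3 := h.mc.measurable
  fun_prop

lemma OpH.bound {d : ℕ} {G : Euc d → ℂ} {W m : ℝ → ℝ} (h : OpH G W m) {B : ℝ} (hB : ∀ ξ, ‖G ξ‖ ≤ B)
    (t : ℝ) (ξ : Euc d) : ‖G ξ * ((W ‖ξ‖ * m (2 * Real.pi * (t * ‖ξ‖)) : ℝ) : ℂ)‖ ≤ B * ‖W ‖ξ‖‖ := by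
  rw [norm_mul, Complex.norm_real, norm_mul]
  have hB0 : 0 ≤ B := (norm_nonneg _).trans (hB ξ)
  have : ‖W ‖ξ‖‖ * ‖m (2 * Real.pi * (t * ‖ξ‖))‖ ≤ ‖W ‖ξ‖‖ * 1 := by
    gcongr; exact h.mb _
  rw [mul_one] at this
  gcongr
  exact hB ξ

lemma OpH.int {d : ℕ} {G : Euc d → ℂ} {W m : ℝ → ℝ} (h : OpH G W m) (t : ℝ) :
    Integrable (fun ξ => G ξ * ((W ‖ξ‖ * m (2 * Real.pi * (t * ‖ξ‖)) : ℝ) : ℂ)) := by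
  obtain ⟨B, hB⟩ := h.Gb
  exact (h.Wi.norm.const_mul B).mono' (h.meas t).aestronglyMeasurable
    (Filter.Eventually.of_forall fun ξ => h.bound hB t ξ)

lemma OpH.cont {d : ℕ} {G : Euc d → ℂ} {W m : ℝ → ℝ} (h : OpH G W m) :
    Continuous (fun z : ℝ × Euc d => opA G W m z.1 z.2) := by
  obtain ⟨B, hB⟩ := h.Gb
  unfold opA
  have hmc := h.mc
  refine continuous_of_dominated (bound := fun ξ => B * ‖W ‖ξ‖‖) (fun z =>
    (ee_mul_int (h.int z.1) (by fun_prop)).1) (fun z => Filter.Eventually.of_forall fun ξ => ?_)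
    (h.Wi.norm.const_mul B) (Filter.Eventually.of_forall fun ξ => by fun_prop)
  rw [norm_mul, norm_ee, mul_one]; exact h.bound hB _ ξ

lemma OpH.bdd {d : ℕ} {G : Euc d → ℂ} {W m : ℝ → ℝ} (h : OpH G W m) :
    ∃ B : ℝ, ∀ t x, ‖opA G W m t x‖ ≤ B := by
  obtain ⟨B, hB⟩ := h.Gb
  refine ⟨∫ ξ : Euc d, B * ‖W ‖ξ‖‖, fun t x => ?_⟩
  unfold opA
  refine norm_integral_le_of_norm_le (h.Wi.norm.const_mul B) (Filter.Eventually.of_forall fun ξ => ?_)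
  rw [norm_mul, norm_ee, mul_one]; exact h.bound hB _ ξ

lemma OpH.al2_meas {d : ℕ} {G : Euc d → ℂ} {W m : ℝ → ℝ} (h : OpH G W m) : Measurable (al2 G W m) := by
  unfold al2
  refine Measurable.lintegral_prod_right' (f := fun z : Euc d × ℝ => ‖opA G W m z.2 z.1‖ₑ ^ 2) ?_
  have := h.cont.measurable.comp (measurable_swap (α := Euc d) (β := ℝ))
  exact (this.enorm).pow_const 2

lemma cs_lin {X : Type*} [MeasurableSpace X] {μ : Measure X} {f g : X → ℝ≥0∞} (hf : AEMeasurable f μ)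
    (hg : AEMeasurable g μ) : (∫⁻ x, f x * g x ∂μ) ^ 2 ≤ (∫⁻ x, f x ^ 2 ∂μ) * ∫⁻ x, g x ^ 2 ∂μ := by
  have h := ENNReal.lintegral_mul_le_Lp_mul_Lq μ (p := 2) (q := 2)
    ((Real.holderConjugate_iff).2 ⟨by norm_num, by norm_num⟩) hf hg
  have h2 := pow_le_pow_left' h 2
  simp only [Pi.mul_apply, mul_pow] at h2
  refine h2.trans (le_of_eq ?_)
  rw [← ENNReal.rpow_natCast, ← ENNReal.rpow_natCast, ← ENNReal.rpow_mul, ← ENNReal.rpow_mul]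
  simp

lemma cs_one {X : Type*} [MeasurableSpace X] {μ : Measure X} {f : X → ℝ≥0∞} (hf : AEMeasurable f μ) :
    (∫⁻ x, f x ∂μ) ^ 2 ≤ μ univ * ∫⁻ x, f x ^ 2 ∂μ := by
  have := cs_lin (μ := μ) (f := fun _ => 1) (g := f) (by fun_prop) hf
  simpa using this

/-- duality step -/
lemma dual_aux {d : ℕ} {G : Euc d → ℂ} {W m : ℝ → ℝ} (h : OpH G W m) {w v : ℝ → ℝ}
    (hw : Measurable w) (hv : Measurable v) (hwv : ∀ ρ, 0 ≤ ρ → |W ρ| ≤ √(w ρ) * √(v ρ))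
    (μ : Measure (Euc d)) [IsFiniteMeasure μ] :
    (∫⁻ x, al2 G W m x ∂μ) ^ 2 ≤ bb2 G w * ∫⁻ ξ, ENNReal.ofReal (v ‖ξ‖) *
      ‖∫ x, (∫ t in Icc (1 : ℝ) 2, (m (2 * Real.pi * (t * ‖ξ‖)) : ℂ) * opA G W m t x) *
        ee (-inner ℝ x ξ) ∂μ‖ₑ ^ 2 := by
  obtain ⟨B, hB⟩ := h.Gb
  obtain ⟨D, hD⟩ := h.bdd
  have hD0 : 0 ≤ D := (norm_nonneg _).trans (hD 0 0)
  have hB0 : 0 ≤ B := (norm_nonneg _).trans (hB 0)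
  set I : Measure ℝ := volume.restrict (Icc (1 : ℝ) 2) with hI
  have hIf : IsFiniteMeasure I := by rw [hI]; infer_instance
  set ν : Measure (Euc d × ℝ) := μ.prod I with hν
  have hac : Continuous (fun y : Euc d × ℝ => opA G W m y.2 y.1) := h.cont.comp continuous_swap
  have hGm := h.Gc.measurable
  have hWm := h.Wm
  have hmc := h.mc
  have hmm := h.mc.measurable
  -- D ξ
  set Dx : Euc d → ℂ := fun ξ => ∫ x, (∫ t in Icc (1 : ℝ) 2,
    (m (2 * Real.pi * (t * ‖ξ‖)) : ℂ) * opA G W m t x) * ee (-inner ℝ x ξ) ∂μ with hDx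
  have hIbd : ∀ ξ : Euc d, Integrable (fun y : Euc d × ℝ => (m (2 * Real.pi * (y.2 * ‖ξ‖)) : ℂ) *
      opA G W m y.2 y.1 * ee (-inner ℝ y.1 ξ)) ν := by
    intro ξ
    refine Integrable.of_bound (Continuous.aestronglyMeasurable (by fun_prop)) D
      (Filter.Eventually.of_forall fun y => ?_)
    rw [norm_mul, norm_ee, mul_one, norm_mul, Complex.norm_real]
    calc _ ≤ 1 * D := by
          gcongr
          · exact h.mb _
          · exact hD _ _
      _ = D := one_mul _
  have hDx2 : ∀ ξ, Dx ξ = ∫ y, (m (2 * Real.pi * (y.2 * ‖ξ‖)) : ℂ) *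
      opA G W m y.2 y.1 * ee (-inner ℝ y.1 ξ) ∂ν := by
    intro ξ
    rw [hν, integral_prod _ (hIbd ξ), hDx]
    refine integral_congr_ae (Filter.Eventually.of_forall fun x => ?_)
    dsimp only
    rw [← integral_mul_const]
  have hDm : Measurable Dx := by
    have : StronglyMeasurable (fun ξ : Euc d => ∫ y, (m (2 * Real.pi * (y.2 * ‖ξ‖)) : ℂ) *
      opA G W m y.2 y.1 * ee (-inner ℝ y.1 ξ) ∂ν) := by
      refine StronglyMeasurable.integral_prod_right (f := fun (ξ : Euc d) (y : Euc d × ℝ) =>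
        (m (2 * Real.pi * (y.2 * ‖ξ‖)) : ℂ) * opA G W m y.2 y.1 * ee (-inner ℝ y.1 ξ)) ?_
      refine Continuous.stronglyMeasurable ?_
      have : Continuous (fun z : Euc d × (Euc d × ℝ) => opA G W m z.2.2 z.2.1) :=
        hac.comp continuous_snd
      unfold Function.uncurry
      fun_prop
    rw [show Dx = _ from funext hDx2]
    exact this.measurable
  -- X as real integral
  have hX : ∫⁻ x, al2 G W m x ∂μ = ‖∫ y, (starRingEnd ℂ) (opA G W m y.2 y.1) * opA G W m y.2 y.1 ∂ν‖ₑ := by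
    have e1 : ∀ z : ℂ, (starRingEnd ℂ) z * z = ((‖z‖ ^ 2 : ℝ) : ℂ) := fun z => by
      rw [Complex.conj_mul']; push_cast; rfl
    simp_rw [e1]
    have hmq : AEMeasurable (fun y : Euc d × ℝ => ENNReal.ofReal (‖opA G W m y.2 y.1‖ ^ 2))
        (μ.prod (volume.restrict (Icc (1 : ℝ) 2))) :=
      (Measurable.ennreal_ofReal (hac.norm.measurable.pow_const 2)).aemeasurable
    rw [integral_complex_ofReal, ← ofReal_norm, Complex.norm_real, Real.norm_of_nonneg (integral_nonneg fun _ => by positivity),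
      ofReal_integral_eq_lintegral_ofReal _ (Filter.Eventually.of_forall fun _ => by positivity), hν,
      lintegral_prod _ hmq]
    · refine lintegral_congr fun x => ?_
      refine lintegral_congr fun t => ?_
      rw [ENNReal.ofReal_pow (norm_nonneg _), ofReal_norm]
    · refine Integrable.of_bound (Continuous.aestronglyMeasurable (by fun_prop)) (D ^ 2)
        (Filter.Eventually.of_forall fun y => ?_)
      rw [Real.norm_of_nonneg (by positivity)]
      have := hD y.2 y.1
      gcongr
  have hswap : ∫ y, (starRingEnd ℂ) (opA G W m y.2 y.1) * opA G W m y.2 y.1 ∂ν =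
      ∫ ξ, (G ξ * (W ‖ξ‖ : ℂ)) * (starRingEnd ℂ) (Dx ξ) := by
    have e1 : ∀ y : Euc d × ℝ, (starRingEnd ℂ) (opA G W m y.2 y.1) * opA G W m y.2 y.1 =
        ∫ ξ, (starRingEnd ℂ) (opA G W m y.2 y.1) *
          ((G ξ * ((W ‖ξ‖ * m (2 * Real.pi * (y.2 * ‖ξ‖)) : ℝ) : ℂ)) * ee (inner ℝ y.1 ξ)) := by
      intro y
      rw [integral_const_mul]; rfl
    simp_rw [e1]
    rw [integral_integral_swap]
    · congr 1; ext ξ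
      rw [hDx2, ← integral_conj, ← integral_const_mul]
      congr 1; ext y
      simp only [map_mul, conj_ee, Complex.conj_ofReal, neg_neg]
      push_cast; ring
    · have hdom : Integrable (fun p : (Euc d × ℝ) × Euc d => (D : ℝ) * (B * ‖W ‖p.2‖‖)) (ν.prod volume) :=
        Integrable.mul_prod (f := fun _ => D) (g := fun ξ : Euc d => B * ‖W ‖ξ‖‖)
          (integrable_const D) (h.Wi.norm.const_mul B)
      refine hdom.mono' (Measurable.aestronglyMeasurable ?_) (Filter.Eventually.of_forall fun p => ?_)
      · have h1 : Measurable (fun p : (Euc d × ℝ) × Euc d => opA G W m p.1.2 p.1.1) :=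
          hac.measurable.comp measurable_fst
        unfold Function.uncurry
        refine Measurable.mul (Complex.continuous_conj.measurable.comp h1) ?_
        fun_prop
      · simp only [Function.uncurry]
        rw [norm_mul, RCLike.norm_conj, norm_mul, norm_ee, mul_one]
        gcongr
        · exact hD _ _
        · exact h.bound hB _ _
  rw [hX, hswap]
  calc _ ≤ (∫⁻ ξ, (ENNReal.ofReal (√(w ‖ξ‖)) * ‖G ξ‖ₑ) * (ENNReal.ofReal (√(v ‖ξ‖)) * ‖Dx ξ‖ₑ)) ^ 2 := by
        refine pow_le_pow_left' ((enorm_integral_le_lintegral_enorm _).trans (lintegral_mono fun ξ => ?_)) 2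
        dsimp only
        rw [enorm_mul, enorm_mul]
        have e2 : ‖(starRingEnd ℂ) (Dx ξ)‖ₑ = ‖Dx ξ‖ₑ := by
          rw [← ofReal_norm, ← ofReal_norm, RCLike.norm_conj]
        have e3 : ‖(W ‖ξ‖ : ℂ)‖ₑ ≤ ENNReal.ofReal (√(w ‖ξ‖)) * ENNReal.ofReal (√(v ‖ξ‖)) := by
          rw [← ofReal_norm, Complex.norm_real, ← ENNReal.ofReal_mul (Real.sqrt_nonneg _)]
          exact ENNReal.ofReal_le_ofReal (hwv _ (norm_nonneg _))
        rw [e2]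
        calc _ ≤ ‖G ξ‖ₑ * (ENNReal.ofReal (√(w ‖ξ‖)) * ENNReal.ofReal (√(v ‖ξ‖))) * ‖Dx ξ‖ₑ := by gcongr
          _ = _ := by ring
    _ ≤ _ := by
        refine (cs_lin (by fun_prop) (by fun_prop)).trans (le_of_eq ?_)
        have e : ∀ (a : ℝ) (z : ℂ), (ENNReal.ofReal (√a) * ‖z‖ₑ) ^ 2 = ENNReal.ofReal a * ‖z‖ₑ ^ 2 := by
          intro a z
          rw [mul_pow, ← ENNReal.ofReal_pow (Real.sqrt_nonneg _)]
          congr 1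
          rcases le_total 0 a with ha | ha
          · rw [Real.sq_sqrt ha]
          · rw [Real.sqrt_eq_zero_of_nonpos ha, ENNReal.ofReal_of_nonpos ha]; simp
        simp_rw [e]; rfl

lemma sq_le_mul_self {X Y : ℝ≥0∞} (hX : X ≠ ∞) (h : X ^ 2 ≤ Y * X) : X ≤ Y := by
  rcases eq_or_ne X 0 with h0 | h0
  · simp [h0]
  · rwa [sq, ENNReal.mul_le_mul_iff_left h0 hX] at h

lemma OpH.al2_fin {d : ℕ} {G : Euc d → ℂ} {W m : ℝ → ℝ} (h : OpH G W m) :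
    ∃ D : ℝ, ∀ x, al2 G W m x ≤ ENNReal.ofReal D := by
  obtain ⟨D, hD⟩ := h.bdd
  refine ⟨D ^ 2, fun x => ?_⟩
  calc al2 G W m x ≤ ∫⁻ t in Icc (1 : ℝ) 2, ENNReal.ofReal (D ^ 2) := by
        refine lintegral_mono fun t => ?_
        rw [← ofReal_norm, ← ENNReal.ofReal_pow (norm_nonneg _)]
        apply ENNReal.ofReal_le_ofReal
        have := hD t x
        gcongr
    _ = _ := by rw [setLIntegral_const, Real.volume_Icc]; norm_num

/-- pointwise bound -/
lemma al2_point {d : ℕ} [NeZero d] {m : ℝ → ℝ} (hm : MPl d m) (A : ℝ) (hA : 0 < A) :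
    ∃ C : ℝ, 0 < C ∧ ∀ (G : Euc d → ℂ) (W w v : ℝ → ℝ), OpH G W m → Measurable w → Measurable v →
      (∀ ρ, 0 ≤ ρ → |W ρ| ≤ √(w ρ) * √(v ρ)) → (∀ ρ, 0 ≤ ρ → v ρ ≤ A) →
      ∀ x, al2 G W m x ≤ ENNReal.ofReal C * bb2 G w := by
  obtain ⟨A1, hA1, hP⟩ := hm
  have hc : 0 < (cSph d).toReal := ENNReal.toReal_pos (cSph_ne_zero d) (cSph_ne_top d)
  refine ⟨A * (cSph d).toReal * A1, by positivity, fun G W w v h hw hv hwv hvA x => ?_⟩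
  obtain ⟨D, hD⟩ := h.al2_fin
  have h1 := dual_aux h hw hv hwv (Measure.dirac x)
  rw [lintegral_dirac] at h1
  have hac : Continuous (fun t : ℝ => opA G W m t x) := h.cont.comp (by fun_prop : Continuous fun t : ℝ => (t, x))
  have hmc := h.mc
  have hmeas : Measurable (fun ρ : ℝ => ∫ t in Icc (1 : ℝ) 2, (m (2 * Real.pi * (t * ρ)) : ℂ) * opA G W m t x) := by
    have : StronglyMeasurable (fun ρ : ℝ => ∫ t in Icc (1 : ℝ) 2, (m (2 * Real.pi * (t * ρ)) : ℂ) * opA G W m t x) := by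
      refine StronglyMeasurable.integral_prod_right (f := fun (ρ : ℝ) (t : ℝ) =>
        (m (2 * Real.pi * (t * ρ)) : ℂ) * opA G W m t x) ?_
      refine Continuous.stronglyMeasurable ?_
      unfold Function.uncurry
      fun_prop
    exact this.measurable
  refine sq_le_mul_self (ne_top_of_le_ne_top ENNReal.ofReal_ne_top (hD x)) ?_
  refine h1.trans ?_
  have h2 : ∫⁻ ξ : Euc d, ENNReal.ofReal (v ‖ξ‖) *
      ‖∫ x, (∫ t in Icc (1 : ℝ) 2, (m (2 * Real.pi * (t * ‖ξ‖)) : ℂ) * opA G W m t x) *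
        ee (-inner ℝ x ξ) ∂(Measure.dirac x)‖ₑ ^ 2 ≤
      ENNReal.ofReal (A * (cSph d).toReal * A1) * al2 G W m x := by
    calc _ ≤ ∫⁻ ξ : Euc d, ENNReal.ofReal A *
      ‖∫ t in Icc (1 : ℝ) 2, (m (2 * Real.pi * (t * ‖ξ‖)) : ℂ) * opA G W m t x‖ₑ ^ 2 := by
          refine lintegral_mono fun ξ => ?_
          refine mul_le_mul' (ENNReal.ofReal_le_ofReal (hvA _ (norm_nonneg _))) ?_
          rw [integral_dirac, enorm_mul]
          refine le_of_eq ?_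
          congr 1
          rw [← ofReal_norm (ee _), norm_ee]; simp
      _ = ENNReal.ofReal A * (cSph d * ∫⁻ ρ in Ioi (0 : ℝ), ENNReal.ofReal (ρ ^ (d - 1)) *
        ‖∫ t in Icc (1 : ℝ) 2, (m (2 * Real.pi * (t * ρ)) : ℂ) * opA G W m t x‖ₑ ^ 2) := by
          rw [lintegral_const_mul' _ _ ENNReal.ofReal_ne_top]
          congr 1
          have hmm : Measurable (fun ξ : Euc d => ‖∫ t in Icc (1 : ℝ) 2, (m (2 * Real.pi * (t * ‖ξ‖)) : ℂ) * opA G W m t x‖ₑ ^ 2) :=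
            ((hmeas.comp measurable_norm).enorm).pow_const 2
          rw [polar_lintegral hmm]
          congr 1
          refine setLIntegral_congr_fun measurableSet_Ioi fun ρ hρ => ?_
          have hρ' : (0 : ℝ) < ρ := hρ
          try dsimp only
          congr 1
          rw [← mul_one (‖∫ t in Icc (1 : ℝ) 2, (m (2 * Real.pi * (t * ρ)) : ℂ) * opA G W m t x‖ₑ ^ 2),
            ← measure_univ (μ := sphereMeasure d), ← lintegral_const]
          refine lintegral_congr_ae ((sph_norm d).mono fun ω hω => ?_)
          dsimp only
          rw [norm_smul, hω, mul_one, Real.norm_of_nonneg hρ'.le]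
      _ ≤ ENNReal.ofReal A * (cSph d * (ENNReal.ofReal A1 * al2 G W m x)) := by
          gcongr
          exact hP _ hac
      _ = _ := by
          rw [ENNReal.ofReal_mul (by positivity), ENNReal.ofReal_mul hA.le, ENNReal.ofReal_toReal (cSph_ne_top d)]
          ring
  calc _ ≤ bb2 G w * (ENNReal.ofReal (A * (cSph d).toReal * A1) * al2 G W m x) := by gcongr
    _ = _ := by ring

/-- the restricted bound over sets of finite measure -/
lemma al2_set {d : ℕ} [NeZero d] {m : ℝ → ℝ} (hm : MPl d m) (A : ℝ) (hA : 0 < A) :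
    ∃ C : ℝ, 0 < C ∧ ∀ (G : Euc d → ℂ) (W w v : ℝ → ℝ) (K : ℝ), 0 < K → OpH G W m → Measurable w → Measurable v →
      (∀ ρ, 0 ≤ ρ → |W ρ| ≤ √(w ρ) * √(v ρ)) →
      (∀ ρ, 0 < ρ → v ρ ≤ A * (ρ / K) ^ (((d : ℝ) - 1) / 2)) →
      (∀ ρ, 0 < ρ → v ρ ≤ A * (ρ / K) ^ (d - 1)) →
      ∀ H : Set (Euc d), MeasurableSet H → volume H ≠ ∞ → ∀ R : ℝ, 0 < R →
      ∫⁻ x in H, al2 G W m x ≤ ENNReal.ofReal C * (ENNReal.ofReal ((K * R) ^ (-((d : ℝ) - 1) / 2)) * volume H +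
        ENNReal.ofReal (R / K ^ (d - 1))) * bb2 G w := by
  obtain ⟨A1, hA1, hP⟩ := hm
  obtain ⟨C1, hC1, hT⟩ := tomas d
  have hc : 0 < (cSph d).toReal := ENNReal.toReal_pos (cSph_ne_zero d) (cSph_ne_top d)
  refine ⟨A * C1 * (cSph d).toReal * A1, by positivity, fun G W w v K hK h hw hv hwv hv1 hv2 H hH hHf R hR => ?_⟩
  obtain ⟨D, hD⟩ := h.bdd
  obtain ⟨D2, hD2⟩ := h.al2_fin
  have hfm : IsFiniteMeasure (volume.restrict H) := ⟨by simpa using hHf.lt_top⟩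
  have h1 := dual_aux h hw hv hwv (volume.restrict H)
  have hmc := h.mc
  have hXfin : ∫⁻ x in H, al2 G W m x ≠ ∞ := by
    refine ne_top_of_le_ne_top (b := ENNReal.ofReal D2 * volume H) (ENNReal.mul_ne_top ENNReal.ofReal_ne_top hHf) ?_
    rw [← setLIntegral_const]
    exact lintegral_mono fun x => hD2 x
  refine sq_le_mul_self hXfin (h1.trans ?_)
  set V : ℝ → Euc d → ℂ := fun ρ x => ∫ t in Icc (1 : ℝ) 2, (m (2 * Real.pi * (t * ρ)) : ℂ) * opA G W m t x with hV
  have hVc : Continuous (fun z : ℝ × Euc d => V z.1 z.2) := by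
    refine continuous_of_dominated (bound := fun _ => D) (fun z => ?_)
      (fun z => Filter.Eventually.of_forall fun t => ?_) (integrable_const D)
      (Filter.Eventually.of_forall fun t => ?_)
    · refine Continuous.aestronglyMeasurable ?_
      have : Continuous (fun t : ℝ => opA G W m t z.2) := h.cont.comp (by fun_prop : Continuous fun t : ℝ => (t, z.2))
      fun_prop
    · rw [norm_mul, Complex.norm_real]
      calc _ ≤ 1 * D := by
            gcongr
            · exact h.mb _
            · exact hD _ _
        _ = D := one_mul _
    · have : Continuous (fun z : ℝ × Euc d => opA G W m t z.2) :=
        h.cont.comp (by fun_prop : Continuous fun z : ℝ × Euc d => (t, z.2))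
      fun_prop
  have hVb : ∀ ρ x, ‖V ρ x‖ ≤ D := by
    intro ρ x
    have : ‖∫ t in Icc (1 : ℝ) 2, (m (2 * Real.pi * (t * ρ)) : ℂ) * opA G W m t x‖ ≤
        D * (volume.restrict (Icc (1 : ℝ) 2)).real univ := by
      refine norm_integral_le_of_norm_le_const (Filter.Eventually.of_forall fun t => ?_)
      rw [norm_mul, Complex.norm_real]
      calc _ ≤ 1 * D := by
            gcongr
            · exact h.mb _
            · exact hD _ _
        _ = D := one_mul _
    refine this.trans (le_of_eq ?_)
    simp [Measure.real]
    norm_num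
  have hUi : ∀ ρ, Integrable (fun x => H.indicator (V ρ) x) := by
    intro ρ
    rw [integrable_indicator_iff hH]
    refine Integrable.of_bound (Continuous.aestronglyMeasurable ?_) D (Filter.Eventually.of_forall fun x => hVb ρ x)
    exact hVc.comp (by fun_prop : Continuous fun x : Euc d => (ρ, x))
  have hft : ∀ ξ : Euc d, ∫ x in H, V ‖ξ‖ x * ee (-inner ℝ x ξ) = ft (H.indicator (V ‖ξ‖)) ξ := by
    intro ξ
    unfold ft
    rw [← integral_indicator hH]
    congr 1; ext x
    by_cases hx : x ∈ H <;> simp [hx]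
  have hN2 : ∀ ρ, ∫⁻ x, ‖H.indicator (V ρ) x‖ₑ ^ 2 = ∫⁻ x in H, ‖V ρ x‖ₑ ^ 2 := by
    intro ρ
    rw [← lintegral_indicator hH]
    refine lintegral_congr fun x => ?_
    by_cases hx : x ∈ H <;> simp [hx]
  have hN1 : ∀ ρ, (∫⁻ x, ‖H.indicator (V ρ) x‖ₑ) ^ 2 ≤ volume H * ∫⁻ x in H, ‖V ρ x‖ₑ ^ 2 := by
    intro ρ
    have e : ∫⁻ x, ‖H.indicator (V ρ) x‖ₑ = ∫⁻ x in H, ‖V ρ x‖ₑ := by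
      rw [← lintegral_indicator hH]
      refine lintegral_congr fun x => ?_
      by_cases hx : x ∈ H <;> simp [hx]
    rw [e]
    have := cs_one (μ := volume.restrict H) (f := fun x => ‖V ρ x‖ₑ)
      ((hVc.comp (by fun_prop : Continuous fun x : Euc d => (ρ, x))).measurable.enorm.aemeasurable)
    simpa using this
  set Q : ℝ≥0∞ := ENNReal.ofReal ((K * R) ^ (-((d : ℝ) - 1) / 2)) * volume H + ENNReal.ofReal (R / K ^ (d - 1)) with hQ
  have hmeasD : Measurable (fun ξ : Euc d => ENNReal.ofReal (v ‖ξ‖) * ‖∫ x in H, V ‖ξ‖ x * ee (-inner ℝ x ξ)‖ₑ ^ 2) := by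
    have : StronglyMeasurable (fun ξ : Euc d => ∫ x in H, V ‖ξ‖ x * ee (-inner ℝ x ξ)) := by
      refine StronglyMeasurable.integral_prod_right (f := fun (ξ : Euc d) (x : Euc d) => V ‖ξ‖ x * ee (-inner ℝ x ξ)) ?_
      refine Continuous.stronglyMeasurable ?_
      have : Continuous (fun z : Euc d × Euc d => V ‖z.1‖ z.2) :=
        hVc.comp (by fun_prop : Continuous fun z : Euc d × Euc d => (‖z.1‖, z.2))
      unfold Function.uncurry
      fun_prop
    have := this.measurable
    fun_prop
  have h2 : ∫⁻ ξ : Euc d, ENNReal.ofReal (v ‖ξ‖) * ‖∫ x in H, V ‖ξ‖ x * ee (-inner ℝ x ξ)‖ₑ ^ 2 ≤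
      ENNReal.ofReal (A * C1 * (cSph d).toReal * A1) * Q * ∫⁻ x in H, al2 G W m x := by
    rw [polar_lintegral hmeasD]
    calc _ ≤ cSph d * ∫⁻ ρ in Ioi (0 : ℝ), ENNReal.ofReal (A * C1) * Q *
          (∫⁻ x in H, ENNReal.ofReal (ρ ^ (d - 1)) * ‖V ρ x‖ₑ ^ 2) := by
          gcongr cSph d * ?_
          refine setLIntegral_mono' measurableSet_Ioi fun ρ hρ => ?_
          have hρ' : (0 : ℝ) < ρ := hρ
          rw [lintegral_const_mul' _ _ ENNReal.ofReal_ne_top, mul_left_comm]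
          refine mul_le_mul' le_rfl ?_
          calc _ = ∫⁻ ω, ENNReal.ofReal (v ρ) * ‖ft (H.indicator (V ρ)) (ρ • ω)‖ₑ ^ 2 ∂(sphereMeasure d) := by
                refine lintegral_congr_ae ((sph_norm d).mono fun ω hω => ?_)
                dsimp only
                rw [hft, norm_smul, hω, mul_one, Real.norm_of_nonneg hρ'.le]
            _ = ENNReal.ofReal (v ρ) * ∫⁻ ω, ‖ft (H.indicator (V ρ)) (ρ • ω)‖ₑ ^ 2 ∂(sphereMeasure d) :=
                lintegral_const_mul' _ _ ENNReal.ofReal_ne_top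
            _ ≤ ENNReal.ofReal (v ρ) * (ENNReal.ofReal (C1 * (ρ * R) ^ (-((d : ℝ) - 1) / 2)) *
                  (volume H * ∫⁻ x in H, ‖V ρ x‖ₑ ^ 2) +
                ENNReal.ofReal (C1 * (R / ρ ^ (d - 1))) * ∫⁻ x in H, ‖V ρ x‖ₑ ^ 2) := by
                refine mul_le_mul' le_rfl ((hT _ (hUi ρ) ρ R hρ' hR).trans ?_)
                rw [hN2]
                gcongr
                exact hN1 ρ
            _ = (ENNReal.ofReal (v ρ) * ENNReal.ofReal (C1 * (ρ * R) ^ (-((d : ℝ) - 1) / 2)) * volume H +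
                 ENNReal.ofReal (v ρ) * ENNReal.ofReal (C1 * (R / ρ ^ (d - 1)))) * ∫⁻ x in H, ‖V ρ x‖ₑ ^ 2 := by ring
            _ ≤ _ := by
                refine mul_le_mul' ?_ le_rfl
                rw [hQ, mul_add, ← mul_assoc]
                refine add_le_add (mul_le_mul' ?_ le_rfl) ?_
                · rw [← ENNReal.ofReal_mul (p := A * C1) (by positivity), ← ENNReal.ofReal_mul' (by positivity)]
                  apply ENNReal.ofReal_le_ofReal
                  calc v ρ * (C1 * (ρ * R) ^ (-((d : ℝ) - 1) / 2)) ≤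
                      (A * (ρ / K) ^ (((d : ℝ) - 1) / 2)) * (C1 * (ρ * R) ^ (-((d : ℝ) - 1) / 2)) := by
                        gcongr
                        exact hv1 ρ hρ'
                    _ = A * C1 * ((ρ / K) ^ (((d : ℝ) - 1) / 2) * (ρ * R) ^ (-((d : ℝ) - 1) / 2)) := by ring
                    _ = _ := by
                        congr 1
                        have e1 : ρ / K = (K * R)⁻¹ * (ρ * R) := by field_simp
                        rw [e1, Real.mul_rpow (by positivity) (by positivity), mul_assoc,
                          ← Real.rpow_add (by positivity), Real.inv_rpow (by positivity),
                          ← Real.rpow_neg (by positivity)]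
                        have e2 : ((d : ℝ) - 1) / 2 + -((d : ℝ) - 1) / 2 = 0 := by ring
                        rw [e2, Real.rpow_zero, mul_one, neg_div]
                · rw [← ENNReal.ofReal_mul (p := A * C1) (by positivity), ← ENNReal.ofReal_mul' (by positivity)]
                  apply ENNReal.ofReal_le_ofReal
                  calc v ρ * (C1 * (R / ρ ^ (d - 1))) ≤ (A * (ρ / K) ^ (d - 1)) * (C1 * (R / ρ ^ (d - 1))) := by
                        gcongr
                        exact hv2 ρ hρ'
                    _ = _ := by rw [div_pow]; field_simp
      _ = cSph d * (ENNReal.ofReal (A * C1) * Q * ∫⁻ x in H, ∫⁻ ρ in Ioi (0 : ℝ), ENNReal.ofReal (ρ ^ (d - 1)) * ‖V ρ x‖ₑ ^ 2) := by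
          congr 1
          have hmm : Measurable (fun z : ℝ × Euc d => ENNReal.ofReal (z.1 ^ (d - 1)) * ‖V z.1 z.2‖ₑ ^ 2) := by
            have := hVc.measurable
            fun_prop
          rw [lintegral_const_mul]
          · congr 1
            rw [lintegral_lintegral_swap]
            exact hmm.aemeasurable
          · exact Measurable.lintegral_prod_right' hmm
      _ ≤ cSph d * (ENNReal.ofReal (A * C1) * Q * ∫⁻ x in H, ENNReal.ofReal A1 * al2 G W m x) := by
          gcongr with x
          exact hP _ (h.cont.comp (by fun_prop : Continuous fun t : ℝ => (t, x)))
      _ = _ := by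
          rw [lintegral_const_mul' _ _ ENNReal.ofReal_ne_top, ENNReal.ofReal_mul (by positivity) (q := A1),
            ENNReal.ofReal_mul (by positivity) (q := (cSph d).toReal), ENNReal.ofReal_toReal (cSph_ne_top d)]
          ring
  calc _ ≤ bb2 G w * (ENNReal.ofReal (A * C1 * (cSph d).toReal * A1) * Q * ∫⁻ x in H, al2 G W m x) := by
        gcongr
    _ = _ := by ring

/-- `L²` bound -/
lemma al2_L2 {d : ℕ} [NeZero d] {m : ℝ → ℝ} {G : Euc d → ℂ} {W w v : ℝ → ℝ} (h : OpH G W m)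
    (hwv : ∀ ρ, 0 ≤ ρ → |W ρ| ≤ √(w ρ) * √(v ρ)) (hw : Measurable w) (hw0 : ∀ ρ, 0 ≤ ρ → 0 ≤ w ρ)
    (hv0 : ∀ ρ, 0 ≤ ρ → 0 ≤ v ρ) (B : ℝ) (hB : 0 ≤ B)
    (hvB : ∀ ρ t, 0 ≤ ρ → t ∈ Icc (1 : ℝ) 2 → v ρ * m (2 * Real.pi * (t * ρ)) ^ 2 ≤ B) :
    ∫⁻ x, al2 G W m x ≤ ENNReal.ofReal B * bb2 G w := by
  unfold al2
  have hmm : Measurable (fun z : Euc d × ℝ => ‖opA G W m z.2 z.1‖ₑ ^ 2) :=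
    ((h.cont.comp continuous_swap).measurable.enorm).pow_const 2
  rw [lintegral_lintegral_swap hmm.aemeasurable]
  calc _ ≤ ∫⁻ t in Icc (1 : ℝ) 2, ENNReal.ofReal B * bb2 G w := by
        refine setLIntegral_mono' measurableSet_Icc fun t ht => ?_
        have e1 : ∀ x : Euc d, opA G W m t x =
            ft (fun ξ => G ξ * ((W ‖ξ‖ * m (2 * Real.pi * (t * ‖ξ‖)) : ℝ) : ℂ)) (-x) := by
          intro x
          unfold opA ft
          congr 1; ext ξ
          rw [inner_neg_right, neg_neg, real_inner_comm]
        simp_rw [e1]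
        rw [lintegral_neg_eq_self (fun x => ‖ft (fun ξ => G ξ * ((W ‖ξ‖ * m (2 * Real.pi * (t * ‖ξ‖)) : ℝ) : ℂ)) x‖ₑ ^ 2)]
        refine (bessel (h.int t)).trans ?_
        unfold bb2
        rw [← lintegral_const_mul' _ _ ENNReal.ofReal_ne_top]
        refine lintegral_mono fun ξ => ?_
        dsimp only
        rw [← ofReal_norm, ← ofReal_norm, ← ENNReal.ofReal_pow (norm_nonneg _), ← ENNReal.ofReal_pow (norm_nonneg _),
          ← ENNReal.ofReal_mul (hw0 _ (norm_nonneg _)), ← ENNReal.ofReal_mul hB]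
        apply ENNReal.ofReal_le_ofReal
        rw [norm_mul, Complex.norm_real, norm_mul, Real.norm_eq_abs, Real.norm_eq_abs, mul_pow, mul_pow, sq_abs (m _)]
        have h3 : |W ‖ξ‖| ^ 2 ≤ w ‖ξ‖ * v ‖ξ‖ := by
          have := pow_le_pow_left₀ (abs_nonneg _) (hwv ‖ξ‖ (norm_nonneg _)) 2
          rwa [mul_pow, Real.sq_sqrt (hw0 _ (norm_nonneg _)), Real.sq_sqrt (hv0 _ (norm_nonneg _))] at this
        have h4 := hvB ‖ξ‖ t (norm_nonneg _) ht
        calc ‖G ξ‖ ^ 2 * (|W ‖ξ‖| ^ 2 * m (2 * Real.pi * (t * ‖ξ‖)) ^ 2) ≤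
            ‖G ξ‖ ^ 2 * ((w ‖ξ‖ * v ‖ξ‖) * m (2 * Real.pi * (t * ‖ξ‖)) ^ 2) := by gcongr
          _ = (‖G ξ‖ ^ 2 * w ‖ξ‖) * (v ‖ξ‖ * m (2 * Real.pi * (t * ‖ξ‖)) ^ 2) := by ring
          _ ≤ (‖G ξ‖ ^ 2 * w ‖ξ‖) * B := by
            have := hw0 ‖ξ‖ (norm_nonneg _)
            gcongr
          _ = _ := by ring
    _ = _ := by rw [setLIntegral_const, Real.volume_Icc]; norm_num

lemma weak_strong {X : Type*} [MeasurableSpace X] (μ : Measure X) (f : X → ℝ) (hf : Measurable f)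
    (h0 : ∀ x, 0 ≤ f x) (B : ℝ) (hB : 0 < B) (hfB : ∀ x, f x ≤ B) (D s0 s : ℝ) (hD : 0 ≤ D) (hs0 : 0 < s0) (hs : s0 < s)
    (hw : ∀ t, 0 < t → μ {x | t < f x} ≤ ENNReal.ofReal (D * t ^ (-s0))) :
    ∫⁻ x, ENNReal.ofReal (f x ^ s) ∂μ ≤ ENNReal.ofReal (s * (D * (B ^ (s - s0) / (s - s0)))) := by
  have hs' : 0 < s := hs0.trans hs
  rw [lintegral_rpow_eq_lintegral_meas_lt_mul μ (Filter.Eventually.of_forall h0) hf.aemeasurable hs',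
    ENNReal.ofReal_mul hs'.le]
  refine mul_le_mul' le_rfl ?_
  have e : ∀ t ∈ Ioi (0 : ℝ), μ {a | t < f a} * ENNReal.ofReal (t ^ (s - 1)) ≤
      (Ioc 0 B).indicator (fun t => ENNReal.ofReal (D * t ^ (s - s0 - 1))) t := by
    intro t ht
    have ht' : (0 : ℝ) < t := ht
    by_cases htB : t ≤ B
    · rw [indicator_of_mem (show t ∈ Ioc 0 B from ⟨ht, htB⟩)]
      calc _ ≤ ENNReal.ofReal (D * t ^ (-s0)) * ENNReal.ofReal (t ^ (s - 1)) := by gcongr; exact hw t ht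
        _ = _ := by
          rw [← ENNReal.ofReal_mul (by positivity), mul_assoc, ← Real.rpow_add ht']
          congr 3; ring
    · have : {a | t < f a} = ∅ := by
        ext a; simp only [mem_setOf_eq, mem_empty_iff_false, iff_false, not_lt]
        exact (hfB a).trans (not_le.1 htB).le
      rw [this]; simp
  have hInt : IntegrableOn (fun t : ℝ => D * t ^ (s - s0 - 1)) (Ioc 0 B) := by
    rw [← intervalIntegrable_iff_integrableOn_Ioc_of_le hB.le]
    exact (intervalIntegral.intervalIntegrable_rpow' (by linarith)).const_mul D
  calc _ ≤ ∫⁻ t in Ioi (0 : ℝ), (Ioc 0 B).indicator (fun t => ENNReal.ofReal (D * t ^ (s - s0 - 1))) t :=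
        setLIntegral_mono' measurableSet_Ioi e
    _ ≤ ∫⁻ t : ℝ, (Ioc 0 B).indicator (fun t => ENNReal.ofReal (D * t ^ (s - s0 - 1))) t :=
        setLIntegral_le_lintegral _ _
    _ = ∫⁻ t in Ioc 0 B, ENNReal.ofReal (D * t ^ (s - s0 - 1)) := lintegral_indicator measurableSet_Ioc _
    _ = ENNReal.ofReal (∫ t in Ioc 0 B, D * t ^ (s - s0 - 1)) := by
        rw [ofReal_integral_eq_lintegral_ofReal hInt]
        refine (ae_restrict_iff' measurableSet_Ioc).2 (Filter.Eventually.of_forall fun t ht => ?_)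
        have := ht.1
        dsimp only [Pi.zero_apply]
        positivity
    _ = _ := by
        rw [← intervalIntegral.integral_of_le hB.le, intervalIntegral.integral_const_mul,
          integral_rpow (Or.inl (by linarith)), Real.zero_rpow (by linarith)]
        congr 3; · ring_nf
        · ring

lemma weak_alg (γ K C b lam h : ℝ) (hγ : 0 < γ) (hK : 0 < K) (hC : 0 < C) (hb : 0 < b) (hl : 0 < lam) (hh : 0 < h)
    (H : ∀ R, 0 < R → lam * h ≤ C * ((K * R) ^ (-γ) * h + R / K ^ (2 * γ)) * b) :
    h ≤ (2 * C * b / lam) ^ (1 + 1 / γ) * K ^ (-(2 * γ + 1)) := by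
  set Y := 2 * C * b / lam with hY
  have hYp : 0 < Y := by positivity
  have hK2 : 0 < K ^ (2 * γ) := by positivity
  set R := h * K ^ (2 * γ) / Y with hR
  have hRp : 0 < R := by positivity
  have h1 := H R hRp
  have e1 : C * (R / K ^ (2 * γ)) * b = lam * h / 2 := by
    rw [hR, hY]; field_simp
  have h2 : lam * h / 2 ≤ C * ((K * R) ^ (-γ) * h) * b := by
    have : C * ((K * R) ^ (-γ) * h + R / K ^ (2 * γ)) * b = C * ((K * R) ^ (-γ) * h) * b + C * (R / K ^ (2 * γ)) * b := by ring
    linarith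
  have hKR : 0 < (K * R) ^ γ := by positivity
  have h3 : (K * R) ^ γ ≤ Y := by
    rw [Real.rpow_neg (by positivity)] at h2
    rw [hY, le_div_iff₀ hl]
    have : lam * h / 2 * (K * R) ^ γ ≤ C * h * b := by
      calc _ ≤ C * (((K * R) ^ γ)⁻¹ * h) * b * (K * R) ^ γ := by gcongr
        _ = _ := by field_simp
    have h4 : (K * R) ^ γ * lam * h ≤ 2 * C * b * h := by nlinarith
    exact le_of_mul_le_mul_right h4 hh
  have h4 : K * R ≤ Y ^ (1 / γ) := by
    have := Real.rpow_le_rpow hKR.le h3 (z := 1 / γ) (by positivity)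
    rwa [← Real.rpow_mul (by positivity), mul_one_div_cancel hγ.ne', Real.rpow_one] at this
  rw [Real.rpow_neg hK.le, Real.rpow_add hK, Real.rpow_one, Real.rpow_add hYp, Real.rpow_one]
  have e2 : h = Y * (K * R) * (K ^ (2 * γ) * K)⁻¹ := by
    rw [hR]; field_simp
  calc h = Y * (K * R) * (K ^ (2 * γ) * K)⁻¹ := e2
    _ ≤ _ := by gcongr

lemma al2_strong {d : ℕ} [NeZero d] (hd : 2 ≤ d) {m : ℝ → ℝ} (hm : MPl d m) (A : ℝ) (hA : 0 < A) (s : ℝ)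
    (hs : ((d : ℝ) + 1) / ((d : ℝ) - 1) < s) :
    ∃ C : ℝ, 0 < C ∧ ∀ (G : Euc d → ℂ) (W w v : ℝ → ℝ) (K : ℝ), 0 < K → OpH G W m → Measurable w → Measurable v →
      (∀ ρ, 0 ≤ ρ → |W ρ| ≤ √(w ρ) * √(v ρ)) → (∀ ρ, 0 ≤ ρ → v ρ ≤ A) →
      (∀ ρ, 0 < ρ → v ρ ≤ A * (ρ / K) ^ (((d : ℝ) - 1) / 2)) →
      (∀ ρ, 0 < ρ → v ρ ≤ A * (ρ / K) ^ (d - 1)) →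
      ∫⁻ x, al2 G W m x ^ s ≤ ENNReal.ofReal (C * K ^ (-(d : ℝ))) * bb2 G w ^ s := by
  obtain ⟨C1, hC1, hpt⟩ := al2_point hm A hA
  obtain ⟨C2, hC2, hset⟩ := al2_set hm A hA
  have hd' : (2 : ℝ) ≤ d := by exact_mod_cast hd
  set s0 : ℝ := ((d : ℝ) + 1) / ((d : ℝ) - 1) with hs0
  have hs0p : 0 < s0 := by apply div_pos <;> linarith
  have hsp : 0 < s := hs0p.trans hs
  refine ⟨s * ((2 * C2) ^ s0 * (C1 ^ (s - s0) / (s - s0))), ?_, fun G W w v K hK h hw hv hwv hvA hv1 hv2 => ?_⟩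
  · have : 0 < s - s0 := by linarith
    positivity
  rcases eq_or_ne (bb2 G w) ∞ with hbt | hbt
  · rw [hbt, ENNReal.top_rpow_of_pos hsp, ENNReal.mul_top]
    · exact le_top
    · rw [Ne, ENNReal.ofReal_eq_zero, not_le]
      have : 0 < s - s0 := by linarith
      positivity
  have hp := hpt G W w v h hw hv hwv hvA
  rcases eq_or_ne (bb2 G w) 0 with hb0 | hb0
  · have : ∀ x, al2 G W m x = 0 := by
      intro x; have := hp x; rw [hb0, mul_zero] at this; exact le_antisymm this bot_le
    simp [this, ENNReal.zero_rpow_of_pos hsp]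
  set b := (bb2 G w).toReal with hb
  have hbp : 0 < b := ENNReal.toReal_pos hb0 hbt
  have hbe : bb2 G w = ENNReal.ofReal b := (ENNReal.ofReal_toReal hbt).symm
  have hfin : ∀ x, al2 G W m x ≠ ∞ := fun x => ne_top_of_le_ne_top (ENNReal.mul_ne_top ENNReal.ofReal_ne_top hbt) (hp x)
  have hmeas : Measurable (fun x => (al2 G W m x).toReal) := h.al2_meas.ennreal_toReal
  have hfB : ∀ x, (al2 G W m x).toReal ≤ C1 * b := by
    intro x
    refine ENNReal.toReal_le_of_le_ofReal (by positivity) ?_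
    rw [ENNReal.ofReal_mul hC1.le, ← hbe]; exact hp x
  have hweak : ∀ t, 0 < t → volume {x | t < (al2 G W m x).toReal} ≤
      ENNReal.ofReal (((2 * C2 * b) ^ s0 * K ^ (-(d : ℝ))) * t ^ (-s0)) := by
    intro t ht
    set S := {x | t < (al2 G W m x).toReal} with hS
    have hSm : MeasurableSet S := measurableSet_lt measurable_const hmeas
    have hn : ∀ n : ℕ, volume (S ∩ ball 0 n) ≤ ENNReal.ofReal (((2 * C2 * b) ^ s0 * K ^ (-(d : ℝ))) * t ^ (-s0)) := by
      intro n
      have hHm : MeasurableSet (S ∩ ball (0 : Euc d) n) := hSm.inter measurableSet_ball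
      have hHf : volume (S ∩ ball (0 : Euc d) n) ≠ ∞ :=
        ne_top_of_le_ne_top measure_ball_lt_top.ne (measure_mono inter_subset_right)
      rcases eq_or_ne (volume (S ∩ ball (0 : Euc d) n)) 0 with h0 | h0
      · rw [h0]; exact bot_le
      set hh := (volume (S ∩ ball (0 : Euc d) n)).toReal with hhh
      have hhp : 0 < hh := ENNReal.toReal_pos h0 hHf
      have hhe : volume (S ∩ ball (0 : Euc d) n) = ENNReal.ofReal hh := (ENNReal.ofReal_toReal hHf).symm
      have key := weak_alg (((d : ℝ) - 1) / 2) K C2 b t hh (by linarith) hK hC2 hbp ht hhp (by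
        intro R hR
        have h1 := hset G W w v K hK h hw hv hwv hv1 hv2 _ hHm hHf R hR
        have h2 : ENNReal.ofReal t * volume (S ∩ ball (0 : Euc d) n) ≤ ∫⁻ x in S ∩ ball (0 : Euc d) n, al2 G W m x := by
          rw [← setLIntegral_const]
          refine setLIntegral_mono' hHm fun x hx => ?_
          have : t < (al2 G W m x).toReal := hx.1
          rw [← ENNReal.ofReal_toReal (hfin x)]
          exact ENNReal.ofReal_le_ofReal this.le
        have h3 := h2.trans h1
        rw [hhe, hbe, ← ENNReal.ofReal_mul ht.le, ← ENNReal.ofReal_mul (by positivity),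
          ← ENNReal.ofReal_add (by positivity) (by positivity), ← ENNReal.ofReal_mul hC2.le,
          ← ENNReal.ofReal_mul (by positivity), ENNReal.ofReal_le_ofReal_iff (by positivity)] at h3
        have e1 : K ^ (2 * (((d : ℝ) - 1) / 2)) = K ^ (d - 1) := by
          rw [← Real.rpow_natCast]; congr 1
          rw [Nat.cast_sub (by omega)]; push_cast; ring
        rw [e1, ← neg_div]
        exact h3)
      rw [hhe]
      apply ENNReal.ofReal_le_ofReal
      refine key.trans (le_of_eq ?_)
      have e2 : 1 + 1 / (((d : ℝ) - 1) / 2) = s0 := by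
        have : (d : ℝ) - 1 ≠ 0 := by linarith
        rw [hs0]; field_simp; ring
      have e3 : -(2 * (((d : ℝ) - 1) / 2) + 1) = -(d : ℝ) := by ring
      rw [e2, e3, Real.div_rpow (by positivity) ht.le, Real.rpow_neg ht.le]
      ring
    have hU : S = ⋃ n : ℕ, S ∩ ball (0 : Euc d) n := by
      rw [← inter_iUnion, iUnion_ball_nat, inter_univ]
    rw [hU, Monotone.measure_iUnion]
    · exact iSup_le hn
    · intro i j hij
      exact inter_subset_inter_right _ (ball_subset_ball (by exact_mod_cast hij))
  have key := weak_strong volume (fun x => (al2 G W m x).toReal) hmeas (fun x => ENNReal.toReal_nonneg) (C1 * b)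
    (by positivity) hfB ((2 * C2 * b) ^ s0 * K ^ (-(d : ℝ))) s0 s (by positivity) hs0p hs hweak
  calc _ = ∫⁻ x, ENNReal.ofReal ((al2 G W m x).toReal ^ s) := by
        refine lintegral_congr fun x => ?_
        rw [← ENNReal.ofReal_rpow_of_nonneg ENNReal.toReal_nonneg hsp.le, ENNReal.ofReal_toReal (hfin x)]
    _ ≤ _ := key
    _ = _ := by
        rw [hbe, ENNReal.ofReal_rpow_of_nonneg hbp.le hsp.le, ← ENNReal.ofReal_mul]
        · congr 1
          rw [Real.mul_rpow (by positivity) hbp.le, Real.mul_rpow hC1.le hbp.le]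
          have : b ^ s = b ^ s0 * b ^ (s - s0) := by rw [← Real.rpow_add hbp]; congr 1; ring
          rw [this]; ring
        · have : 0 < s - s0 := by linarith
          positivity

/-- low frequency cutoff -/
def uk (d k : ℕ) (ρ : ℝ) : ℝ := 1 - (1 - Real.exp (-(ρ / 2 ^ k) ^ 2)) ^ d

/-- frequency pieces -/
def wk (d : ℕ) : ℕ → ℝ → ℝ
  | 0 => uk d 0
  | (k + 1) => fun ρ => uk d (k + 1) ρ - uk d k ρ

/-- cutoff for the piece and its derivative -/
def Wk (d : ℕ) (i : Bool) (k : ℕ) (ρ : ℝ) : ℝ := if i then wk d k ρ * (2 * Real.pi * (ρ / 2 ^ k)) else wk d k ρ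

/-- weights -/
def vk (d : ℕ) (i : Bool) (k : ℕ) (ρ : ℝ) : ℝ := if i then wk d k ρ * (2 * Real.pi * (ρ / 2 ^ k)) ^ 2 else wk d k ρ

/-- multipliers -/
def mf (d : ℕ) [NeZero d] (i : Bool) : ℝ → ℝ := if i then dphi d else phi d

@[fun_prop] lemma uk_cont (d k : ℕ) : Continuous (uk d k) := by unfold uk; fun_prop
@[fun_prop] lemma wk_cont (d k : ℕ) : Continuous (wk d k) := by
  cases k with
  | zero => exact uk_cont d 0
  | succ k => exact (uk_cont d (k + 1)).sub (uk_cont d k)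
lemma Wk_cont (d : ℕ) (i : Bool) (k : ℕ) : Continuous (Wk d i k) := by
  unfold Wk; cases i <;> simp <;> fun_prop
lemma vk_cont (d : ℕ) (i : Bool) (k : ℕ) : Continuous (vk d i k) := by
  unfold vk; cases i <;> simp <;> fun_prop
lemma mf_cont (d : ℕ) [NeZero d] (i : Bool) : Continuous (mf d i) := by
  cases i
  · exact continuous_phi d
  · exact continuous_dphi d
lemma mf_le (d : ℕ) [NeZero d] (i : Bool) (s : ℝ) : |mf d i s| ≤ 1 := by
  cases i
  · exact abs_phi_le d s
  · exact abs_dphi_le d s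
lemma mf_mpl (d : ℕ) [NeZero d] (i : Bool) : MPl d (mf d i) := by
  cases i
  · exact mpl_phi d
  · exact mpl_dphi d

lemma exp01 (x : ℝ) : 0 ≤ 1 - Real.exp (-x ^ 2) ∧ 1 - Real.exp (-x ^ 2) ≤ 1 := by
  have h1 : Real.exp (-x ^ 2) ≤ 1 := Real.exp_le_one_iff.2 (by nlinarith [sq_nonneg x])
  have h2 := Real.exp_pos (-x ^ 2)
  constructor <;> linarith

lemma uk_le_one (d k : ℕ) (ρ : ℝ) : uk d k ρ ≤ 1 := by
  have := pow_nonneg (exp01 (ρ / 2 ^ k)).1 d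
  unfold uk; linarith

lemma uk_nonneg (d k : ℕ) (ρ : ℝ) : 0 ≤ uk d k ρ := by
  have := pow_le_one₀ (n := d) (exp01 (ρ / 2 ^ k)).1 (exp01 (ρ / 2 ^ k)).2
  unfold uk; linarith

lemma uk_le_gauss (d k : ℕ) (ρ : ℝ) : uk d k ρ ≤ d * Real.exp (-(ρ / 2 ^ k) ^ 2) := by
  have := one_add_mul_le_pow (a := -Real.exp (-(ρ / 2 ^ k) ^ 2)) (by
    have := (exp01 (ρ / 2 ^ k)).1; linarith) d
  rw [← sub_eq_add_neg] at this
  unfold uk; linarith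

lemma wk_nonneg (d k : ℕ) (ρ : ℝ) : 0 ≤ wk d k ρ := by
  cases k with
  | zero => exact uk_nonneg d 0 ρ
  | succ k =>
    simp only [wk, uk]
    have h : (ρ / 2 ^ (k + 1)) ^ 2 ≤ (ρ / 2 ^ k) ^ 2 := by
      rw [pow_succ (2 : ℝ) k, ← div_div, div_pow _ (2 : ℝ)]
      have := sq_nonneg (ρ / 2 ^ k)
      linarith
    have h2 : (1 - Real.exp (-(ρ / 2 ^ (k + 1)) ^ 2)) ^ d ≤ (1 - Real.exp (-(ρ / 2 ^ k) ^ 2)) ^ d := by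
      refine pow_le_pow_left₀ (exp01 _).1 ?_ d
      have : Real.exp (-(ρ / 2 ^ k) ^ 2) ≤ Real.exp (-(ρ / 2 ^ (k + 1)) ^ 2) := Real.exp_le_exp.2 (by linarith)
      linarith
    linarith

lemma wk_le_uk (d k : ℕ) (ρ : ℝ) : wk d k ρ ≤ uk d k ρ := by
  cases k with
  | zero => exact le_rfl
  | succ k => have := uk_nonneg d k ρ; simp only [wk]; linarith

lemma wk_le_gauss (d k : ℕ) (ρ : ℝ) : wk d k ρ ≤ d * Real.exp (-(ρ / 2 ^ k) ^ 2) :=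
  (wk_le_uk d k ρ).trans (uk_le_gauss d k ρ)

lemma wk_le_pow (d k : ℕ) (ρ : ℝ) : wk d (k + 1) ρ ≤ (4 * (ρ / 2 ^ (k + 1)) ^ 2) ^ d := by
  have h1 : wk d (k + 1) ρ ≤ (1 - Real.exp (-(ρ / 2 ^ k) ^ 2)) ^ d := by
    have := uk_le_one d (k + 1) ρ
    simp only [wk]; simp only [uk] at this ⊢; linarith
  refine h1.trans (pow_le_pow_left₀ (exp01 _).1 ?_ d)
  have := Real.add_one_le_exp (-(ρ / 2 ^ k) ^ 2)
  rw [pow_succ (2 : ℝ) k, ← div_div, div_pow _ (2 : ℝ)]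
  linarith

lemma wk_sum (d n : ℕ) (ρ : ℝ) : ∑ k ∈ Finset.range (n + 1), wk d k ρ = uk d n ρ := by
  induction n with
  | zero => simp [wk]
  | succ n ih => rw [Finset.sum_range_succ, ih]; simp [wk]

/-- the constant -/
def Ad (d : ℕ) : ℝ := 4 * Real.pi ^ 2 * (4 ^ d * d)

lemma Ad_pos (d : ℕ) [NeZero d] : 0 < Ad d := by
  have : (0 : ℝ) < d := by exact_mod_cast Nat.pos_of_ne_zero (NeZero.ne d)
  unfold Ad; positivity

lemma vk_nonneg (d : ℕ) (i : Bool) (k : ℕ) (ρ : ℝ) : 0 ≤ vk d i k ρ := by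
  have := wk_nonneg d k ρ
  cases i <;> simp only [vk, if_true, if_false, Bool.false_eq_true] <;> positivity

lemma vk_le1 (d : ℕ) [NeZero d] (i : Bool) (k : ℕ) (ρ : ℝ) :
    vk d i k ρ ≤ 4 * Real.pi ^ 2 * (wk d k ρ * max 1 ((ρ / 2 ^ k) ^ 2)) := by
  have h0 := wk_nonneg d k ρ
  have hpi := Real.pi_gt_three
  have h1 : wk d k ρ * 1 ≤ wk d k ρ * max 1 ((ρ / 2 ^ k) ^ 2) := by gcongr; exact le_max_left _ _
  have h2 : wk d k ρ * (ρ / 2 ^ k) ^ 2 ≤ wk d k ρ * max 1 ((ρ / 2 ^ k) ^ 2) := by gcongr; exact le_max_right _ _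
  cases i <;> simp only [vk, if_true, if_false, Bool.false_eq_true]
  · have h3 : 0 ≤ wk d k ρ * max 1 ((ρ / 2 ^ k) ^ 2) := by positivity
    nlinarith [mul_nonneg h3 (show (0:ℝ) ≤ 4 * Real.pi ^ 2 - 1 by nlinarith)]
  · calc _ = 4 * Real.pi ^ 2 * (wk d k ρ * (ρ / 2 ^ k) ^ 2) := by ring
      _ ≤ _ := by gcongr

lemma vk_le_A (d : ℕ) [NeZero d] (i : Bool) (k : ℕ) (ρ : ℝ) : vk d i k ρ ≤ Ad d := by
  refine (vk_le1 d i k ρ).trans ?_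
  unfold Ad
  refine mul_le_mul_of_nonneg_left ?_ (by positivity)
  have h1 := wk_le_gauss d k ρ
  set x := (ρ / 2 ^ k) ^ 2 with hx
  have hx0 : 0 ≤ x := sq_nonneg _
  have h2 : Real.exp (-x) * max 1 x ≤ 1 := by
    rw [Real.exp_neg, inv_mul_le_iff₀ (Real.exp_pos _), mul_one]
    refine max_le (Real.one_le_exp hx0) ?_
    have := Real.add_one_le_exp x; linarith
  calc _ ≤ d * Real.exp (-x) * max 1 x := by gcongr
    _ = d * (Real.exp (-x) * max 1 x) := by ring
    _ ≤ d * 1 := by gcongr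
    _ = 1 * d := by ring
    _ ≤ 4 ^ d * d := by gcongr; exact one_le_pow₀ (by norm_num)

lemma vk_le_Apow (d : ℕ) [NeZero d] (i : Bool) (k : ℕ) (ρ : ℝ) (hρ : 0 < ρ) (a : ℝ) (ha : 0 ≤ a) (had : a ≤ 2 * d) :
    vk d i (k + 1) ρ ≤ Ad d * (ρ / 2 ^ (k + 1)) ^ a := by
  have hd : (1 : ℝ) ≤ d := by exact_mod_cast Nat.one_le_iff_ne_zero.2 (NeZero.ne d)
  have hτ : 0 < ρ / 2 ^ (k + 1) := by positivity
  rcases le_total 1 (ρ / 2 ^ (k + 1)) with h | h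
  · calc _ ≤ Ad d * 1 := by rw [mul_one]; exact vk_le_A d i _ ρ
      _ ≤ _ := by
        have := (Ad_pos d).le
        gcongr
        exact Real.one_le_rpow h ha
  · refine (vk_le1 d i _ ρ).trans ?_
    have h1 := wk_le_pow d k ρ
    set x := ρ / 2 ^ (k + 1) with hx
    rw [max_eq_left (by nlinarith), mul_one]
    unfold Ad
    rw [mul_assoc (4 * Real.pi ^ 2)]
    gcongr
    refine h1.trans ?_
    rw [mul_pow, ← pow_mul]
    have h2 : x ^ (2 * d) ≤ x ^ a := by
      rw [← Real.rpow_natCast]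
      exact Real.rpow_le_rpow_of_exponent_ge hτ h (by push_cast; exact had)
    calc (4 : ℝ) ^ d * x ^ (2 * d) ≤ 4 ^ d * x ^ a := by gcongr
      _ = 4 ^ d * 1 * x ^ a := by ring
      _ ≤ _ := by gcongr

lemma Wk_le (d : ℕ) (i : Bool) (k : ℕ) (ρ : ℝ) (hρ : 0 ≤ ρ) : |Wk d i k ρ| ≤ √(wk d k ρ) * √(vk d i k ρ) := by
  have h0 := wk_nonneg d k ρ
  cases i <;> simp only [Wk, vk, if_true, if_false, Bool.false_eq_true]
  · rw [Real.mul_self_sqrt h0, abs_of_nonneg h0]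
  · rw [Real.sqrt_mul h0, Real.sqrt_sq (by positivity), ← mul_assoc √(wk d k ρ), Real.mul_self_sqrt h0, abs_of_nonneg (by positivity)]

lemma exp_le_half (x : ℝ) : Real.exp (-x ^ 2) ≤ Real.exp (-(x ^ 2 / 2)) :=
    Real.exp_le_exp.2 (by nlinarith [sq_nonneg x])

lemma x_exp_le (x : ℝ) : |x| * Real.exp (-x ^ 2) ≤ Real.exp (-(x ^ 2 / 2)) := by
  have h1 := Real.add_one_le_exp (x ^ 2 / 2)
  have h2 : |x| ≤ Real.exp (x ^ 2 / 2) := by nlinarith [sq_nonneg (|x| - 1), sq_abs x]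
  calc _ ≤ Real.exp (x ^ 2 / 2) * Real.exp (-x ^ 2) := by gcongr
    _ = _ := by rw [← Real.exp_add]; congr 1; ring

lemma Wk_int (d : ℕ) (i : Bool) (k : ℕ) : Integrable (fun ξ : Euc d => Wk d i k ‖ξ‖) := by
  have hg : Integrable (fun ξ : Euc d => 2 * Real.pi * d * Real.exp (-(1 / (2 * (2 ^ k) ^ 2)) * ‖ξ‖ ^ 2)) :=
    (gauss_integrable (by positivity)).const_mul _
  refine hg.mono' ((Wk_cont d i k).comp continuous_norm).aestronglyMeasurable (Filter.Eventually.of_forall fun ξ => ?_)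
  have h0 := wk_nonneg d k ‖ξ‖
  have h1 := wk_le_gauss d k ‖ξ‖
  have h2 := x_exp_le (‖ξ‖ / 2 ^ k)
  have h3 := exp_le_half (‖ξ‖ / 2 ^ k)
  have e : Real.exp (-(1 / (2 * (2 ^ k) ^ 2)) * ‖ξ‖ ^ 2) = Real.exp (-((‖ξ‖ / 2 ^ k) ^ 2 / 2)) := by
    congr 1; field_simp
  rw [e]
  have hpi := Real.pi_gt_three
  set x := ‖ξ‖ / 2 ^ k with hx
  have hx0 : 0 ≤ x := by positivity
  rw [abs_of_nonneg hx0] at h2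
  cases i <;> simp only [Wk, if_true, if_false, Bool.false_eq_true]
  · rw [Real.norm_of_nonneg h0]
    calc _ ≤ d * Real.exp (-(x ^ 2 / 2)) := by refine h1.trans ?_; gcongr
      _ = 1 * d * Real.exp (-(x ^ 2 / 2)) := by ring
      _ ≤ _ := by gcongr; linarith
  · rw [← hx, Real.norm_of_nonneg (by positivity)]
    calc _ ≤ d * Real.exp (-x ^ 2) * (2 * Real.pi * x) := by gcongr
      _ = 2 * Real.pi * d * (x * Real.exp (-x ^ 2)) := by ring
      _ ≤ _ := by gcongr

lemma opH_k {d : ℕ} [NeZero d] {f : Euc d → ℂ} (hf : Integrable f) (i : Bool) (k : ℕ) :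
    OpH (ft f) (Wk d i k) (mf d i) where
  Gc := ft_cont hf
  Gb := ⟨_, ft_bound f⟩
  Wm := (Wk_cont d i k).measurable
  Wi := Wk_int d i k
  mc := mf_cont d i
  mb := mf_le d i

/-- squared `L²` norm of the piece -/
def bk {d : ℕ} (f : Euc d → ℂ) (k : ℕ) : ℝ≥0∞ := bb2 (ft f) (wk d k)

/-- the `L²` function of the piece -/
def ak {d : ℕ} [NeZero d] (f : Euc d → ℂ) (i : Bool) (k : ℕ) (x : Euc d) : ℝ≥0∞ :=
  al2 (ft f) (Wk d i k) (mf d i) x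

lemma ak_meas {d : ℕ} [NeZero d] {f : Euc d → ℂ} (hf : Integrable f) (i : Bool) (k : ℕ) : Measurable (ak f i k) :=
  (opH_k hf i k).al2_meas

lemma bk_sum {d : ℕ} {f : Euc d → ℂ} (hf : Integrable f) : ∑' k, bk f k ≤ ∫⁻ x, ‖f x‖ₑ ^ 2 := by
  refine le_trans ?_ (bessel hf)
  have hm := (ft_cont hf).measurable
  rw [ENNReal.tsum_eq_iSup_nat' (N := fun n => n + 1) (Filter.tendsto_add_atTop_nat 1)]
  refine iSup_le fun n => ?_
  unfold bk bb2
  rw [← lintegral_finsetSum _ (fun k _ => by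
    have := (wk_cont d k).measurable
    fun_prop)]
  refine lintegral_mono fun ξ => ?_
  rw [← Finset.sum_mul, ← ENNReal.ofReal_sum_of_nonneg (fun k _ => wk_nonneg d k _), wk_sum]
  calc _ ≤ 1 * ‖ft f ξ‖ₑ ^ 2 := by
        gcongr
        rw [← ENNReal.ofReal_one]
        exact ENNReal.ofReal_le_ofReal (uk_le_one d n _)
    _ = _ := one_mul _

lemma ak_point (d : ℕ) [NeZero d] : ∃ C : ℝ, 0 < C ∧ ∀ (f : Euc d → ℂ), Integrable f → ∀ i k x,
    ak f i k x ≤ ENNReal.ofReal C * bk f k := by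
  have h : ∀ i, ∃ C : ℝ, 0 < C ∧ ∀ (f : Euc d → ℂ), Integrable f → ∀ k x,
    ak f i k x ≤ ENNReal.ofReal C * bk f k := by
    intro i
    obtain ⟨C, hC, h⟩ := al2_point (mf_mpl d i) (Ad d) (Ad_pos d)
    exact ⟨C, hC, fun f hf k x => h _ _ _ _ (opH_k hf i k) (wk_cont d k).measurable (vk_cont d i k).measurable
      (Wk_le d i k) (fun ρ _ => vk_le_A d i k ρ) x⟩
  choose C hC h using h
  refine ⟨C true + C false, add_pos (hC _) (hC _), fun f hf i k x => (h i f hf k x).trans ?_⟩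
  gcongr
  have h1 := hC true
  have h2 := hC false
  cases i <;> linarith

lemma ak_L2 (d : ℕ) [NeZero d] : ∃ C : ℝ, 0 < C ∧ ∀ (f : Euc d → ℂ), Integrable f → ∀ i k,
    ∫⁻ x, ak f i k x ≤ ENNReal.ofReal (C / (2 ^ k) ^ (d - 1)) * bk f k := by
  obtain ⟨C0, hC0, h0⟩ := phi_decay d
  have hA := Ad_pos d
  refine ⟨Ad d * C0, by positivity, fun f hf i k => ?_⟩
  refine al2_L2 (v := vk d i k) (opH_k hf i k) (Wk_le d i k) (wk_cont d k).measurable (fun ρ _ => wk_nonneg d k ρ)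
    (fun ρ _ => vk_nonneg d i k ρ) _ (by positivity) (fun ρ t hρ ht => ?_)
  have hm2 : mf d i (2 * Real.pi * (t * ρ)) ^ 2 ≤ 1 := by
    rw [sq_le_one_iff_abs_le_one]; exact mf_le d i _
  have hv0 := vk_nonneg d i k ρ
  cases k with
  | zero =>
    simp only [pow_zero, one_pow, div_one]
    calc _ ≤ Ad d * 1 := by gcongr; exact vk_le_A d i 0 ρ
      _ ≤ _ := by gcongr
  | succ k =>
    have hd1 : 1 ≤ d := Nat.one_le_iff_ne_zero.2 (NeZero.ne d)
    rcases hρ.eq_or_lt with h | hρ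
    · have : vk d i (k + 1) ρ = 0 := by
        have h1 : wk d (k + 1) ρ = 0 := by
          refine le_antisymm ((wk_le_pow d k ρ).trans ?_) (wk_nonneg _ _ _)
          rw [← h]; simp [NeZero.ne d]
        unfold vk; rw [h1]; simp
      rw [this, zero_mul]; positivity
    have hv := vk_le_Apow d i k ρ hρ ((d - 1 : ℕ) : ℝ) (by positivity) (by
      have : ((d - 1 : ℕ) : ℝ) ≤ d := by exact_mod_cast Nat.sub_le d 1
      linarith)
    rw [Real.rpow_natCast] at hv
    set s := 2 * Real.pi * (t * ρ) with hs
    have ht1 := ht.1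
    have hsρ : ρ ≤ s := by
      have := Real.pi_gt_three
      have h1 : 1 * ρ ≤ t * ρ := by gcongr
      nlinarith
    have hsp : 0 < s := hρ.trans_le hsρ
    have hm : mf d i s ^ 2 * s ^ (d - 1) ≤ C0 := by
      cases i
      · exact (h0 s hsp).1
      · exact (h0 s hsp).2
    calc _ ≤ (Ad d * (ρ / 2 ^ (k + 1)) ^ (d - 1)) * mf d i s ^ 2 := by gcongr
      _ = Ad d * (mf d i s ^ 2 * ρ ^ (d - 1)) / (2 ^ (k + 1)) ^ (d - 1) := by rw [div_pow]; ring
      _ ≤ _ := by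
        gcongr
        refine le_trans ?_ hm
        gcongr

lemma ak_strong (d : ℕ) [NeZero d] (hd : 2 ≤ d) (s : ℝ) (hs : ((d : ℝ) + 1) / ((d : ℝ) - 1) < s) :
    ∃ C : ℝ, 0 < C ∧ ∀ (f : Euc d → ℂ), Integrable f → ∀ i k,
    ∫⁻ x, ak f i k x ^ s ≤ ENNReal.ofReal (C * (2 ^ k) ^ (-(d : ℝ))) * bk f k ^ s := by
  obtain ⟨C1, hC1, hpt⟩ := ak_point d
  obtain ⟨C2, hC2, hL2⟩ := ak_L2 d
  have hd' : (2 : ℝ) ≤ d := by exact_mod_cast hd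
  have hs1 : 1 < s := by
    refine lt_trans ?_ hs
    rw [lt_div_iff₀ (by linarith)]; linarith
  have h : ∀ i, ∃ C : ℝ, 0 < C ∧ ∀ (f : Euc d → ℂ), Integrable f → ∀ k,
    ∫⁻ x, ak f i (k + 1) x ^ s ≤ ENNReal.ofReal (C * (2 ^ (k + 1)) ^ (-(d : ℝ))) * bk f (k + 1) ^ s := by
    intro i
    obtain ⟨C, hC, h⟩ := al2_strong hd (mf_mpl d i) (Ad d) (Ad_pos d) s hs
    exact ⟨C, hC, fun f hf k => h _ _ _ (vk d i (k + 1)) _ (by positivity) (opH_k hf i _) (wk_cont d _).measurable (vk_cont d i _).measurable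
      (Wk_le d i _) (fun ρ _ => vk_le_A d i _ ρ)
      (fun ρ hρ => vk_le_Apow d i k ρ hρ _ (by linarith) (by linarith))
      (fun ρ hρ => by
        have := vk_le_Apow d i k ρ hρ ((d - 1 : ℕ) : ℝ) (by positivity) (by
          have : ((d - 1 : ℕ) : ℝ) ≤ d := by exact_mod_cast Nat.sub_le d 1
          linarith)
        rwa [Real.rpow_natCast] at this)⟩
  choose C hC h using h
  refine ⟨C true + C false + C1 ^ (s - 1) * C2, add_pos (add_pos (hC _) (hC _)) (by positivity), fun f hf i k => ?_⟩
  have h1 := hC true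
  have h2 := hC false
  have h3 : 0 < C1 ^ (s - 1) * C2 := by positivity
  cases k with
  | succ k =>
    refine (h i f hf k).trans ?_
    gcongr
    cases i <;> linarith
  | zero =>
    calc _ ≤ ∫⁻ x, (ENNReal.ofReal C1 * bk f 0) ^ (s - 1) * ak f i 0 x := by
          refine lintegral_mono fun x => ?_
          have e : ak f i 0 x ^ s = ak f i 0 x ^ (s - 1) * ak f i 0 x := by
            have := ENNReal.rpow_add_of_nonneg (x := ak f i 0 x) (s - 1) 1 (by linarith) zero_le_one
            rwa [ENNReal.rpow_one, sub_add_cancel] at this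
          rw [e]
          gcongr
          exact hpt f hf i 0 x
      _ = (ENNReal.ofReal C1 * bk f 0) ^ (s - 1) * ∫⁻ x, ak f i 0 x := lintegral_const_mul _ (ak_meas hf i 0)
      _ ≤ (ENNReal.ofReal C1 * bk f 0) ^ (s - 1) * (ENNReal.ofReal (C2 / (2 ^ 0) ^ (d - 1)) * bk f 0) := by
          gcongr; exact hL2 f hf i 0
      _ = ENNReal.ofReal (C1 ^ (s - 1) * C2) * bk f 0 ^ s := by
          have e : bk f 0 ^ s = bk f 0 ^ (s - 1) * bk f 0 := by
            have := ENNReal.rpow_add_of_nonneg (x := bk f 0) (s - 1) 1 (by linarith) zero_le_one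
            rwa [ENNReal.rpow_one, sub_add_cancel] at this
          rw [ENNReal.mul_rpow_of_nonneg _ _ (by linarith), e, ENNReal.ofReal_mul (by positivity),
            ENNReal.ofReal_rpow_of_nonneg hC1.le (by linarith)]
          simp only [pow_zero, one_pow, div_one]
          ring
      _ ≤ _ := by
          refine mul_le_mul' (ENNReal.ofReal_le_ofReal ?_) le_rfl
          rw [show ((2 : ℝ) ^ 0) ^ (-(d : ℝ)) = 1 by simp, mul_one]
          linarith

lemma opA_hasDerivAt {d : ℕ} [NeZero d] {G : Euc d → ℂ} {W W' : ℝ → ℝ} (h : OpH G W (phi d))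
    (h' : OpH G W' (dphi d)) (hW : ∀ ρ, W' ρ = W ρ * (2 * Real.pi * ρ)) (t : ℝ) (x : Euc d) :
    HasDerivAt (fun t => opA G W (phi d) t x) (opA G W' (dphi d) t x) t := by
  obtain ⟨B, hB⟩ := h.Gb
  unfold opA
  refine (hasDerivAt_integral_of_dominated_loc_of_deriv_le (s := univ) (x₀ := t) (μ := volume)
    (F := fun t ξ => (G ξ * ((W ‖ξ‖ * phi d (2 * Real.pi * (t * ‖ξ‖)) : ℝ) : ℂ)) * ee (inner ℝ x ξ))
    (F' := fun t ξ => (G ξ * ((W' ‖ξ‖ * dphi d (2 * Real.pi * (t * ‖ξ‖)) : ℝ) : ℂ)) * ee (inner ℝ x ξ))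
    (bound := fun ξ => B * ‖W' ‖ξ‖‖) Filter.univ_mem
    (Filter.Eventually.of_forall fun t => (ee_mul_int (h.int t) (by fun_prop)).1)
    (ee_mul_int (h.int t) (by fun_prop)) (ee_mul_int (h'.int t) (by fun_prop)).1
    (Filter.Eventually.of_forall fun ξ t _ => ?_) (h'.Wi.norm.const_mul B)
    (Filter.Eventually.of_forall fun ξ t _ => ?_)).2
  · rw [norm_mul, norm_ee, mul_one]; exact h'.bound hB t ξ
  · have h1 : HasDerivAt (fun t : ℝ => 2 * Real.pi * (t * ‖ξ‖)) (2 * Real.pi * ‖ξ‖) t := by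
      have := ((hasDerivAt_id t).mul_const ‖ξ‖).const_mul (2 * Real.pi)
      simpa using this
    have h2 : HasDerivAt (fun t : ℝ => W ‖ξ‖ * phi d (2 * Real.pi * (t * ‖ξ‖)))
        (W' ‖ξ‖ * dphi d (2 * Real.pi * (t * ‖ξ‖))) t := by
      refine (((hasDerivAt_phi d _).comp t h1).const_mul (W ‖ξ‖)).congr_deriv ?_
      rw [hW]; ring
    exact (h2.ofReal_comp.const_mul (G ξ)).mul_const _

lemma opA_gauss {d : ℕ} [NeZero d] {f : Euc d → ℂ} (hf : Integrable f) {s : ℝ} (hs : 0 < s) {t : ℝ} (ht : 0 ≤ t)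
    (x : Euc d) : opA (ft f) (fun ρ => Real.exp (-s * ρ ^ 2)) (phi d) t x =
      ∫ p : Euc d × Euc d, f p.1 * (gs d s (x - p.1 - t • p.2) : ℂ) ∂(volume.prod (sphereMeasure d)) := by
  have e1 : ∀ ξ : Euc d, (ft f ξ * ((Real.exp (-s * ‖ξ‖ ^ 2) * phi d (2 * Real.pi * (t * ‖ξ‖)) : ℝ) : ℂ)) * ee (inner ℝ x ξ) =
      ∫ p : Euc d × Euc d, (Real.exp (-s * ‖ξ‖ ^ 2) : ℂ) * f p.1 * ee (inner ℝ (x - p.1 - t • p.2) ξ)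
        ∂(volume.prod (sphereMeasure d)) := by
    intro ξ
    have h1 := sph_ee t ht ξ
    rw [mul_assoc (2 * Real.pi)] at h1
    have h2 := integral_prod_mul (μ := (volume : Measure (Euc d))) (ν := sphereMeasure d)
      (fun y => f y * ee (-inner ℝ y ξ)) (fun ω => ee (-inner ℝ ξ (t • ω)))
    rw [h1] at h2
    have h3 : (ft f ξ * ((Real.exp (-s * ‖ξ‖ ^ 2) * phi d (2 * Real.pi * (t * ‖ξ‖)) : ℝ) : ℂ)) * ee (inner ℝ x ξ) =
        (Real.exp (-s * ‖ξ‖ ^ 2) : ℂ) * ee (inner ℝ x ξ) * (ft f ξ * phi d (2 * Real.pi * (t * ‖ξ‖))) := by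
      push_cast; ring
    rw [h3]
    unfold ft
    rw [← h2, ← integral_const_mul]
    refine integral_congr_ae (Filter.Eventually.of_forall fun p => ?_)
    dsimp only
    rw [inner_sub_left, inner_sub_left, sub_eq_add_neg, sub_eq_add_neg, ee_add, ee_add, real_inner_comm ξ (t • p.2)]
    ring
  unfold opA
  simp_rw [e1]
  rw [integral_integral_swap]
  · refine integral_congr_ae (Filter.Eventually.of_forall fun p => ?_)
    dsimp only
    rw [← gauss_ft hs, ← integral_const_mul]
    refine integral_congr_ae (Filter.Eventually.of_forall fun ξ => ?_)
    dsimp only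
    ring
  · have h1 : Integrable (fun z : Euc d × (Euc d × Euc d) => (Real.exp (-s * ‖z.1‖ ^ 2) : ℂ) * (f z.2.1 * 1))
        (volume.prod (volume.prod (sphereMeasure d))) :=
      Integrable.mul_prod (f := fun ξ : Euc d => (Real.exp (-s * ‖ξ‖ ^ 2) : ℂ))
        (g := fun p : Euc d × Euc d => f p.1 * 1) (gauss_integrable hs).ofReal
        (Integrable.mul_prod (f := f) (g := fun _ : Euc d => (1 : ℂ)) hf (integrable_const 1))
    have := ee_mul_int (g := fun z : Euc d × (Euc d × Euc d) => inner ℝ (x - z.2.1 - t • z.2.2) z.1) h1 (by fun_prop)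
    simpa only [mul_one, Function.uncurry_def] using this

lemma gs_dbound {d : ℕ} {s : ℝ} (hs : 0 < s) (u : Euc d) :
    2 * (Real.pi ^ 2 / s) * ‖u‖ * gs d s u ≤ (2 * Real.pi * 2 ^ ((d : ℝ) / 2)) / √s * gs d (2 * s) u := by
  have h := x_exp_le (Real.pi / √s * ‖u‖)
  rw [abs_of_nonneg (by positivity)] at h
  have hss : √s ^ 2 = s := Real.sq_sqrt hs.le
  have hsp : 0 < √s := Real.sqrt_pos.2 hs
  have e1 : (Real.pi / √s * ‖u‖) ^ 2 = (Real.pi ^ 2 / s) * ‖u‖ ^ 2 := by rw [mul_pow, div_pow, hss]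
  rw [e1] at h
  unfold gs
  have e2 : (Real.pi / s) ^ ((d : ℝ) / 2) = 2 ^ ((d : ℝ) / 2) * (Real.pi / (2 * s)) ^ ((d : ℝ) / 2) := by
    rw [← Real.mul_rpow (by positivity) (by positivity)]; congr 1; field_simp
  have e3 : -(Real.pi ^ 2 / (2 * s)) * ‖u‖ ^ 2 = -(Real.pi ^ 2 / s * ‖u‖ ^ 2 / 2) := by field_simp
  rw [e2, e3, neg_mul]
  have e4 : Real.pi ^ 2 / s = Real.pi / √s * (Real.pi / √s) := by rw [div_mul_div_comm, ← sq, ← sq, hss]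
  calc _ = (2 * Real.pi * 2 ^ ((d : ℝ) / 2)) / √s * ((Real.pi / (2 * s)) ^ ((d : ℝ) / 2) *
        (Real.pi / √s * ‖u‖ * Real.exp (-(Real.pi ^ 2 / s * ‖u‖ ^ 2)))) := by
        rw [show 2 * (Real.pi ^ 2 / s) * ‖u‖ = 2 * (Real.pi / √s * (Real.pi / √s)) * ‖u‖ by rw [e4]]
        ring
    _ ≤ _ := by gcongr

lemma gs_hasDerivAt {d : ℕ} {s : ℝ} (z ω : Euc d) (t : ℝ) :
    HasDerivAt (fun t => gs d s (z - t • ω)) (gs d s (z - t • ω) * (2 * (Real.pi ^ 2 / s) * inner ℝ (z - t • ω) ω)) t := by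
  unfold gs
  have h0 : HasDerivAt (fun t : ℝ => z - t • ω) (-ω) t := by
    have := ((hasDerivAt_id t).smul_const ω).const_sub z
    simpa using this
  have h1 := h0.norm_sq
  have h2 := ((h1.const_mul (-(Real.pi ^ 2 / s))).exp).const_mul ((Real.pi / s) ^ ((d : ℝ) / 2))
  refine h2.congr_deriv ?_
  rw [inner_neg_right]
  ring

/-- Gaussian pieces -/
def Gs (i : Bool) (s : ℝ) (ρ : ℝ) : ℝ := if i then Real.exp (-s * ρ ^ 2) * (2 * Real.pi * ρ) else Real.exp (-s * ρ ^ 2)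

lemma Gs_cont (i : Bool) (s : ℝ) : Continuous (Gs i s) := by
  unfold Gs; cases i <;> simp <;> fun_prop

lemma Gs_int (d : ℕ) (i : Bool) {s : ℝ} (hs : 0 < s) : Integrable (fun ξ : Euc d => Gs i s ‖ξ‖) := by
  cases i
  · simp only [Gs, if_false, Bool.false_eq_true]; exact gauss_integrable hs
  · simp only [Gs, if_true]
    have hg : Integrable (fun ξ : Euc d => 2 * Real.pi / √s * Real.exp (-(s / 2) * ‖ξ‖ ^ 2)) :=
      (gauss_integrable (by positivity)).const_mul _
    refine hg.mono' (Continuous.aestronglyMeasurable (by fun_prop)) (Filter.Eventually.of_forall fun ξ => ?_)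
    have h := x_exp_le (√s * ‖ξ‖)
    have hsp : 0 < √s := Real.sqrt_pos.2 hs
    rw [abs_of_nonneg (by positivity), mul_pow, Real.sq_sqrt hs.le] at h
    rw [Real.norm_of_nonneg (by positivity)]
    calc _ = 2 * Real.pi / √s * (√s * ‖ξ‖ * Real.exp (-(s * ‖ξ‖ ^ 2))) := by
          rw [neg_mul]; field_simp
      _ ≤ _ := by
          refine mul_le_mul_of_nonneg_left (h.trans (le_of_eq ?_)) (by positivity)
          congr 1; ring

lemma opH_G {d : ℕ} [NeZero d] {f : Euc d → ℂ} (hf : Integrable f) (i : Bool) {s : ℝ} (hs : 0 < s) :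
    OpH (ft f) (Gs i s) (mf d i) where
  Gc := ft_cont hf
  Gb := ⟨_, ft_bound f⟩
  Wm := (Gs_cont i s).measurable
  Wi := Gs_int d i hs
  mc := mf_cont d i
  mb := mf_le d i

lemma gs_le {d : ℕ} {s : ℝ} (hs : 0 < s) (z : Euc d) : gs d s z ≤ (Real.pi / s) ^ ((d : ℝ) / 2) := by
  unfold gs
  have : Real.exp (-(Real.pi ^ 2 / s) * ‖z‖ ^ 2) ≤ 1 := by
    rw [Real.exp_le_one_iff, neg_mul, neg_nonpos]; positivity
  exact mul_le_of_le_one_right (by positivity) this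

lemma prod_norm (d : ℕ) [NeZero d] : ∀ᵐ p : Euc d × Euc d ∂(volume.prod (sphereMeasure d)), ‖p.2‖ = 1 :=
  (Measure.quasiMeasurePreserving_snd (μ := (volume : Measure (Euc d))) (ν := sphereMeasure d)).ae (sph_norm d)

lemma opA_dgauss {d : ℕ} [NeZero d] {f : Euc d → ℂ} (hf : Integrable f) {s : ℝ} (hs : 0 < s) {t : ℝ} (ht : 0 < t)
    (x : Euc d) : opA (ft f) (Gs true s) (dphi d) t x =
      ∫ p : Euc d × Euc d, f p.1 * ((gs d s (x - p.1 - t • p.2) * (2 * (Real.pi ^ 2 / s) * inner ℝ (x - p.1 - t • p.2) p.2) : ℝ) : ℂ)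
        ∂(volume.prod (sphereMeasure d)) := by
  have h1 := opA_hasDerivAt (opH_G hf false hs) (opH_G hf true hs) (fun ρ => by simp [Gs]) t x
  set D : ℝ := (2 * Real.pi * 2 ^ ((d : ℝ) / 2)) / √s * (Real.pi / (2 * s)) ^ ((d : ℝ) / 2) with hD
  have hfp : Integrable (fun p : Euc d × Euc d => f p.1) (volume.prod (sphereMeasure d)) := by
    have := Integrable.mul_prod (f := f) (g := fun _ : Euc d => (1 : ℂ)) (ν := sphereMeasure d) hf (integrable_const 1)
    simpa using this
  have hgb : ∀ z : Euc d, ‖(gs d s z : ℂ)‖ ≤ (Real.pi / s) ^ ((d : ℝ) / 2) := by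
    intro z
    rw [Complex.norm_real, Real.norm_of_nonneg (gs_pos hs z).le]; exact gs_le hs z
  have h2 := (hasDerivAt_integral_of_dominated_loc_of_deriv_le (s := univ) (x₀ := t)
    (μ := (volume : Measure (Euc d)).prod (sphereMeasure d))
    (F := fun t p => f p.1 * (gs d s (x - p.1 - t • p.2) : ℂ))
    (F' := fun t p => f p.1 * ((gs d s (x - p.1 - t • p.2) * (2 * (Real.pi ^ 2 / s) * inner ℝ (x - p.1 - t • p.2) p.2) : ℝ) : ℂ))
    (bound := fun p => ‖f p.1‖ * D) Filter.univ_mem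
    (Filter.Eventually.of_forall fun t => hfp.1.mul (Continuous.aestronglyMeasurable (by fun_prop)))
    (hfp.mul_bdd (c := (Real.pi / s) ^ ((d : ℝ) / 2)) (Continuous.aestronglyMeasurable (by fun_prop)) (Filter.Eventually.of_forall fun p => hgb _))
    (hfp.1.mul (Continuous.aestronglyMeasurable (by fun_prop)))
    ((prod_norm d).mono fun p hp t _ => ?_) (hfp.norm.mul_const D)
    (Filter.Eventually.of_forall fun p t _ => ?_)).2
  · have h3 : (fun t => opA (ft f) (Gs false s) (mf d false) t x) =ᶠ[nhds t]
        fun t => ∫ p : Euc d × Euc d, f p.1 * (gs d s (x - p.1 - t • p.2) : ℂ) ∂(volume.prod (sphereMeasure d)) := by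
      filter_upwards [lt_mem_nhds ht] with t' ht'
      rw [← opA_gauss hf hs ht'.le]
      rfl
    exact h1.unique (h2.congr_of_eventuallyEq h3)
  · rw [norm_mul, Complex.norm_real]
    refine mul_le_mul_of_nonneg_left ?_ (norm_nonneg _)
    set u := x - p.1 - t • p.2 with hu
    rw [norm_mul, Real.norm_of_nonneg (gs_pos hs u).le, norm_mul, Real.norm_of_nonneg (by positivity)]
    have hin : ‖inner ℝ u p.2‖ ≤ ‖u‖ := by
      have := norm_inner_le_norm (𝕜 := ℝ) u p.2
      rwa [hp, mul_one] at this
    have hg := (gs_pos hs u).le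
    calc _ ≤ gs d s u * (2 * (Real.pi ^ 2 / s) * ‖u‖) := by gcongr
      _ = 2 * (Real.pi ^ 2 / s) * ‖u‖ * gs d s u := by ring
      _ ≤ _ := gs_dbound hs u
      _ ≤ D := by
        rw [hD]
        gcongr
        exact gs_le (by positivity) u
  · exact ((gs_hasDerivAt (x - p.1) p.2 t).ofReal_comp).const_mul (f p.1)

lemma l1_ker {d : ℕ} [NeZero d] {f : Euc d → ℂ} (hfm : Measurable f) {s : ℝ} (hs : 0 < s) (x : Euc d) :
    ∫⁻ t in Icc (1 : ℝ) 2, ∫⁻ p : Euc d × Euc d, ‖f p.1‖ₑ * ENNReal.ofReal (gs d s (x - p.1 - t • p.2))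
      ∂(volume.prod (sphereMeasure d)) ≤ (cSph d)⁻¹ * ∫⁻ y, ‖f y‖ₑ := by
  have hg : Continuous (gs d s) := gs_cont
  have hgm := hg.measurable
  have hz : ∀ z : Euc d, ∫⁻ t in Icc (1 : ℝ) 2, ∫⁻ ω, ENNReal.ofReal (gs d s (z - t • ω)) ∂(sphereMeasure d) ≤ (cSph d)⁻¹ := by
    intro z
    rw [← one_mul (cSph d)⁻¹, ← gs_lintegral hs z, polar_lintegral (by fun_prop), mul_comm (cSph d), mul_assoc,
      ENNReal.mul_inv_cancel (cSph_ne_zero d) (cSph_ne_top d), mul_one]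
    calc _ ≤ ∫⁻ t in Icc (1 : ℝ) 2, ENNReal.ofReal (t ^ (d - 1)) * ∫⁻ ω, ENNReal.ofReal (gs d s (z - t • ω)) ∂(sphereMeasure d) := by
          refine setLIntegral_mono' measurableSet_Icc fun t ht => ?_
          calc _ = 1 * ∫⁻ ω, ENNReal.ofReal (gs d s (z - t • ω)) ∂(sphereMeasure d) := (one_mul _).symm
            _ ≤ _ := by
              gcongr
              rw [← ENNReal.ofReal_one]
              exact ENNReal.ofReal_le_ofReal (one_le_pow₀ ht.1)
      _ ≤ _ := lintegral_mono_set (fun t ht => lt_of_lt_of_le one_pos ht.1)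
  have hm2 : Measurable (fun q : ℝ × (Euc d × Euc d) => ‖f q.2.1‖ₑ * ENNReal.ofReal (gs d s (x - q.2.1 - q.1 • q.2.2))) := by
    fun_prop
  rw [lintegral_lintegral_swap hm2.aemeasurable]
  have hm3 : Measurable (fun p : Euc d × Euc d => ∫⁻ t in Icc (1 : ℝ) 2, ‖f p.1‖ₑ * ENNReal.ofReal (gs d s (x - p.1 - t • p.2))) :=
    Measurable.lintegral_prod_right' (f := fun q : (Euc d × Euc d) × ℝ => ‖f q.1.1‖ₑ * ENNReal.ofReal (gs d s (x - q.1.1 - q.2 • q.1.2))) (by fun_prop)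
  rw [lintegral_prod _ hm3.aemeasurable, ← lintegral_const_mul _ (by fun_prop)]
  refine lintegral_mono fun y => ?_
  calc _ = ∫⁻ ω, ‖f y‖ₑ * (∫⁻ t in Icc (1 : ℝ) 2, ENNReal.ofReal (gs d s (x - y - t • ω))) ∂(sphereMeasure d) := by
        refine lintegral_congr fun ω => ?_
        rw [lintegral_const_mul _ (by fun_prop)]
    _ = ‖f y‖ₑ * ∫⁻ ω, (∫⁻ t in Icc (1 : ℝ) 2, ENNReal.ofReal (gs d s (x - y - t • ω))) ∂(sphereMeasure d) :=
        lintegral_const_mul _ (Measurable.lintegral_prod_right' (f := fun q : Euc d × ℝ => ENNReal.ofReal (gs d s (x - y - q.2 • q.1))) (by fun_prop))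
    _ = ‖f y‖ₑ * ∫⁻ t in Icc (1 : ℝ) 2, ∫⁻ ω, ENNReal.ofReal (gs d s (x - y - t • ω)) ∂(sphereMeasure d) := by
        rw [lintegral_lintegral_swap]
        exact (by fun_prop : Measurable (fun q : Euc d × ℝ => ENNReal.ofReal (gs d s (x - y - q.2 • q.1)))).aemeasurable
    _ ≤ ‖f y‖ₑ * (cSph d)⁻¹ := by gcongr; exact hz _
    _ = _ := mul_comm _ _

lemma l1_G (d : ℕ) [NeZero d] : ∃ C : ℝ, 0 < C ∧ ∀ (f : Euc d → ℂ), Measurable f → Integrable f → ∀ i s, 0 < s → ∀ x : Euc d,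
    ∫⁻ t in Icc (1 : ℝ) 2, ‖opA (ft f) (Gs i s) (mf d i) t x‖ₑ ≤
      ENNReal.ofReal (C * (if i then 1 / √s else 1)) * ∫⁻ y, ‖f y‖ₑ := by
  set D : ℝ := 2 * Real.pi * 2 ^ ((d : ℝ) / 2) with hD
  have hDp : 0 < D := by positivity
  obtain ⟨c, hc, hce⟩ : ∃ c : ℝ, 0 < c ∧ (cSph d)⁻¹ = ENNReal.ofReal c :=
    ⟨(cSph d)⁻¹.toReal, ENNReal.toReal_pos (ENNReal.inv_ne_zero.2 (cSph_ne_top d)) (ENNReal.inv_ne_top.2 (cSph_ne_zero d)),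
      (ENNReal.ofReal_toReal (ENNReal.inv_ne_top.2 (cSph_ne_zero d))).symm⟩
  refine ⟨(1 + D) * c, by positivity, fun f hfm hf i s hs x => ?_⟩
  have hsp : 0 < √s := Real.sqrt_pos.2 hs
  cases i
  · simp only [if_false, Bool.false_eq_true, mul_one]
    calc _ ≤ ∫⁻ t in Icc (1 : ℝ) 2, ∫⁻ p : Euc d × Euc d, ‖f p.1‖ₑ * ENNReal.ofReal (gs d s (x - p.1 - t • p.2))
      ∂(volume.prod (sphereMeasure d)) := by
          refine setLIntegral_mono' measurableSet_Icc fun t ht => ?_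
          have := opA_gauss hf hs (zero_le_one.trans ht.1) x
          rw [show opA (ft f) (Gs false s) (mf d false) t x = _ from this]
          refine (enorm_integral_le_lintegral_enorm _).trans (lintegral_mono fun p => ?_)
          rw [enorm_mul, ← ofReal_norm (gs _ _ _ : ℂ), Complex.norm_real, Real.norm_of_nonneg (gs_pos hs _).le]
      _ ≤ _ := l1_ker hfm hs x
      _ ≤ _ := by
          rw [hce]
          refine mul_le_mul' (ENNReal.ofReal_le_ofReal ?_) le_rfl
          nlinarith [mul_pos hDp hc]
  · simp only [if_true]
    calc _ ≤ ∫⁻ t in Icc (1 : ℝ) 2, ENNReal.ofReal (D / √s) * ∫⁻ p : Euc d × Euc d, ‖f p.1‖ₑ * ENNReal.ofReal (gs d (2 * s) (x - p.1 - t • p.2))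
      ∂(volume.prod (sphereMeasure d)) := by
          refine setLIntegral_mono' measurableSet_Icc fun t ht => ?_
          have := opA_dgauss hf hs (zero_lt_one.trans_le ht.1) x
          rw [show opA (ft f) (Gs true s) (mf d true) t x = _ from this,
            ← lintegral_const_mul' _ _ ENNReal.ofReal_ne_top]
          refine (enorm_integral_le_lintegral_enorm _).trans (lintegral_mono_ae ((prod_norm d).mono fun p hp => ?_))
          rw [enorm_mul, mul_left_comm (ENNReal.ofReal _)]
          refine mul_le_mul' le_rfl ?_
          rw [← ofReal_norm, Complex.norm_real, ← ENNReal.ofReal_mul (by positivity)]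
          apply ENNReal.ofReal_le_ofReal
          set u := x - p.1 - t • p.2 with hu
          rw [norm_mul, Real.norm_of_nonneg (gs_pos hs u).le, norm_mul, Real.norm_of_nonneg (by positivity)]
          have hin : ‖inner ℝ u p.2‖ ≤ ‖u‖ := by
            have := norm_inner_le_norm (𝕜 := ℝ) u p.2
            rwa [hp, mul_one] at this
          have hg := (gs_pos hs u).le
          calc _ ≤ gs d s u * (2 * (Real.pi ^ 2 / s) * ‖u‖) := by gcongr
            _ = 2 * (Real.pi ^ 2 / s) * ‖u‖ * gs d s u := by ring
            _ ≤ _ := gs_dbound hs u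
      _ = ENNReal.ofReal (D / √s) * ∫⁻ t in Icc (1 : ℝ) 2, ∫⁻ p : Euc d × Euc d, ‖f p.1‖ₑ * ENNReal.ofReal (gs d (2 * s) (x - p.1 - t • p.2))
      ∂(volume.prod (sphereMeasure d)) := lintegral_const_mul' _ _ ENNReal.ofReal_ne_top
      _ ≤ ENNReal.ofReal (D / √s) * ((cSph d)⁻¹ * ∫⁻ y, ‖f y‖ₑ) := by
          gcongr
          exact l1_ker hfm (by positivity) x
      _ ≤ _ := by
          rw [hce, ← mul_assoc, ← ENNReal.ofReal_mul (by positivity)]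
          refine mul_le_mul' (ENNReal.ofReal_le_ofReal ?_) le_rfl
          rw [div_eq_mul_one_div]
          have : 0 < 1 / √s := by positivity
          have h5 := mul_pos this hc
          nlinarith [mul_pos hDp h5]

lemma opA_sum {d : ℕ} {G : Euc d → ℂ} {m : ℝ → ℝ} {ι : Type*} (S : Finset ι) (c : ι → ℝ) (W : ι → ℝ → ℝ)
    (h : ∀ j ∈ S, OpH G (W j) m) (t : ℝ) (x : Euc d) :
    opA G (fun ρ => ∑ j ∈ S, c j * W j ρ) m t x = ∑ j ∈ S, (c j : ℂ) * opA G (W j) m t x := by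
  unfold opA
  simp_rw [← integral_const_mul]
  rw [← integral_finsetSum]
  · refine integral_congr_ae (Filter.Eventually.of_forall fun ξ => ?_)
    dsimp only
    push_cast
    rw [Finset.sum_mul, Finset.mul_sum, Finset.sum_mul]
    refine Finset.sum_congr rfl fun j _ => by ring
  · intro j hj
    exact (ee_mul_int ((h j hj).int t) (by fun_prop)).const_mul _

/-- binomial coefficients with sign -/
def cj (d j : ℕ) : ℝ := -((-1) ^ (j + 1) * (d.choose (j + 1) : ℝ))

/-- scale factor -/
def sc (i : Bool) (k : ℕ) : ℝ := if i then 1 / 2 ^ k else 1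

/-- low frequency cutoffs -/
def Uk (d : ℕ) (i : Bool) (k : ℕ) (ρ : ℝ) : ℝ := if i then uk d k ρ * (2 * Real.pi * (ρ / 2 ^ k)) else uk d k ρ

lemma uk_eq (d k : ℕ) (ρ : ℝ) : uk d k ρ = ∑ j ∈ Finset.range d, cj d j * Real.exp (-(((j : ℝ) + 1) / (2 ^ k) ^ 2) * ρ ^ 2) := by
  have h := pow_one_sub (Real.exp (-(ρ / 2 ^ k) ^ 2) : ℂ) d
  have h2 : (1 : ℝ) = (1 - Real.exp (-(ρ / 2 ^ k) ^ 2)) ^ d -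
    ∑ j ∈ Finset.range d, ((-1) ^ (j + 1) * (d.choose (j + 1) : ℝ)) * Real.exp (-(ρ / 2 ^ k) ^ 2) ^ (j + 1) := by
    exact_mod_cast h
  have h3 : ∀ j : ℕ, Real.exp (-(ρ / 2 ^ k) ^ 2) ^ (j + 1) = Real.exp (-(((j : ℝ) + 1) / (2 ^ k) ^ 2) * ρ ^ 2) := by
    intro j
    rw [← Real.exp_nat_mul]; congr 1; push_cast; field_simp
  simp_rw [h3] at h2
  unfold uk cj
  simp_rw [neg_mul, Finset.sum_neg_distrib] at h2 ⊢
  linarith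

lemma Uk_eq (d : ℕ) (i : Bool) (k : ℕ) (ρ : ℝ) :
    Uk d i k ρ = ∑ j ∈ Finset.range d, (cj d j * sc i k) * Gs i (((j : ℝ) + 1) / (2 ^ k) ^ 2) ρ := by
  unfold Uk
  rw [uk_eq]
  cases i <;> simp only [sc, Gs, if_true, if_false, Bool.false_eq_true]
  · simp
  · rw [Finset.sum_mul]
    refine Finset.sum_congr rfl fun j _ => ?_
    field_simp

lemma cj_sum (d : ℕ) [NeZero d] : ∑ j ∈ Finset.range d, cj d j = 1 := by
  have := uk_eq d 0 0
  simp [uk, NeZero.ne d] at this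
  exact this.symm

lemma l1_U (d : ℕ) [NeZero d] : ∃ C : ℝ, 0 < C ∧ ∀ (f : Euc d → ℂ), Measurable f → Integrable f → ∀ i k, ∀ x : Euc d,
    ∫⁻ t in Icc (1 : ℝ) 2, ‖opA (ft f) (Uk d i k) (mf d i) t x‖ₑ ≤ ENNReal.ofReal C * ∫⁻ y, ‖f y‖ₑ := by
  obtain ⟨C, hC, h⟩ := l1_G d
  refine ⟨(∑ j ∈ Finset.range d, |cj d j|) * C + 1, ?_, fun f hfm hf i k x => ?_⟩
  · have : 0 ≤ ∑ j ∈ Finset.range d, |cj d j| := Finset.sum_nonneg fun _ _ => abs_nonneg _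
    positivity
  have e : ∀ t, opA (ft f) (Uk d i k) (mf d i) t x = ∑ j ∈ Finset.range d, ((cj d j * sc i k : ℝ) : ℂ) *
      opA (ft f) (Gs i (((j : ℝ) + 1) / (2 ^ k) ^ 2)) (mf d i) t x := by
    intro t
    rw [← opA_sum (Finset.range d) (fun j => cj d j * sc i k) (fun j : ℕ => Gs i (((j : ℝ) + 1) / (2 ^ k) ^ 2))
      (fun j _ => opH_G hf i (by positivity))]
    congr 1; ext ρ; exact Uk_eq d i k ρ
  have hcm : ∀ j : ℕ, Measurable (fun t => ‖opA (ft f) (Gs i (((j : ℝ) + 1) / (2 ^ k) ^ 2)) (mf d i) t x‖ₑ) := by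
    intro j
    exact ((opH_G hf i (s := ((j : ℝ) + 1) / (2 ^ k) ^ 2) (by positivity)).cont.comp
      (by fun_prop : Continuous fun t : ℝ => (t, x))).measurable.enorm
  calc _ ≤ ∫⁻ t in Icc (1 : ℝ) 2, ∑ j ∈ Finset.range d, ENNReal.ofReal (|cj d j| * sc i k) *
        ‖opA (ft f) (Gs i (((j : ℝ) + 1) / (2 ^ k) ^ 2)) (mf d i) t x‖ₑ := by
        refine lintegral_mono fun t => ?_
        dsimp only
        rw [e]
        refine (enorm_sum_le _ _).trans (Finset.sum_le_sum fun j _ => ?_)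
        rw [enorm_mul, ← ofReal_norm, Complex.norm_real, norm_mul, Real.norm_eq_abs, Real.norm_of_nonneg]
        unfold sc; positivity
    _ = ∑ j ∈ Finset.range d, ENNReal.ofReal (|cj d j| * sc i k) *
        ∫⁻ t in Icc (1 : ℝ) 2, ‖opA (ft f) (Gs i (((j : ℝ) + 1) / (2 ^ k) ^ 2)) (mf d i) t x‖ₑ := by
        rw [lintegral_finsetSum _ (fun j _ => (hcm j).const_mul _)]
        refine Finset.sum_congr rfl fun j _ => lintegral_const_mul _ (hcm j)
    _ ≤ ∑ j ∈ Finset.range d, ENNReal.ofReal (|cj d j| * C) * ∫⁻ y, ‖f y‖ₑ := by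
        refine Finset.sum_le_sum fun j _ => ?_
        refine (mul_le_mul' le_rfl (h f hfm hf i (((j : ℝ) + 1) / (2 ^ k) ^ 2) (by positivity) x)).trans ?_
        rw [← mul_assoc, ← ENNReal.ofReal_mul (by unfold sc; positivity)]
        refine mul_le_mul' (ENNReal.ofReal_le_ofReal ?_) le_rfl
        rw [mul_assoc]
        refine mul_le_mul_of_nonneg_left ?_ (abs_nonneg _)
        cases i <;> simp only [sc, if_true, if_false, Bool.false_eq_true]
        · linarith
        · rw [Real.sqrt_div (by positivity), Real.sqrt_sq (by positivity)]
          have h1 : 1 ≤ √((j : ℝ) + 1) := by rw [Real.one_le_sqrt]; linarith [Nat.cast_nonneg (α := ℝ) j]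
          calc _ = C / √((j : ℝ) + 1) := by field_simp
            _ ≤ C / 1 := by gcongr
            _ = C := div_one _
    _ = ENNReal.ofReal ((∑ j ∈ Finset.range d, |cj d j|) * C) * ∫⁻ y, ‖f y‖ₑ := by
        rw [← Finset.sum_mul, ← ENNReal.ofReal_sum_of_nonneg (fun j _ => by positivity), ← Finset.sum_mul]
    _ ≤ _ := by gcongr; linarith

lemma opH_U {d : ℕ} [NeZero d] {f : Euc d → ℂ} (hf : Integrable f) (i : Bool) (k : ℕ) :
    OpH (ft f) (Uk d i k) (mf d i) where
  Gc := ft_cont hf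
  Gb := ⟨_, ft_bound f⟩
  Wm := by
    have := (uk_cont d k).measurable
    unfold Uk; cases i <;> simp <;> fun_prop
  Wi := by
    simp_rw [Uk_eq]
    exact integrable_finsetSum _ fun j _ => (Gs_int d i (by positivity)).const_mul _
  mc := mf_cont d i
  mb := mf_le d i

lemma Wk_succ (d : ℕ) (i : Bool) (k : ℕ) (ρ : ℝ) : Wk d i (k + 1) ρ =
    ∑ j : Bool, (if j then 1 else -(if i then 1 / 2 else 1 : ℝ)) * (Uk d i (if j then k + 1 else k) ρ) := by
  rw [Fintype.sum_bool]
  cases i <;> simp [Wk, Uk, wk]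
  · ring
  · field_simp; ring

lemma l1_W (d : ℕ) [NeZero d] : ∃ C : ℝ, 0 < C ∧ ∀ (f : Euc d → ℂ), Measurable f → Integrable f → ∀ i k, ∀ x : Euc d,
    ∫⁻ t in Icc (1 : ℝ) 2, ‖opA (ft f) (Wk d i k) (mf d i) t x‖ₑ ≤ ENNReal.ofReal C * ∫⁻ y, ‖f y‖ₑ := by
  obtain ⟨C, hC, h⟩ := l1_U d
  refine ⟨2 * C, by positivity, fun f hfm hf i k x => ?_⟩
  cases k with
  | zero =>
    have e : Wk d i 0 = Uk d i 0 := by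
      ext ρ; cases i <;> simp [Wk, Uk, wk]
    rw [e]
    refine (h f hfm hf i 0 x).trans ?_
    gcongr; linarith
  | succ k =>
    have e : ∀ t, ‖opA (ft f) (Wk d i (k + 1)) (mf d i) t x‖ₑ ≤ ‖opA (ft f) (Uk d i (k + 1)) (mf d i) t x‖ₑ +
        ‖opA (ft f) (Uk d i k) (mf d i) t x‖ₑ := by
      intro t
      rw [show Wk d i (k + 1) = fun ρ => _ from funext (Wk_succ d i k),
        opA_sum _ _ _ (fun j _ => opH_U hf i _), Fintype.sum_bool]
      refine (enorm_add_le _ _).trans (add_le_add ?_ ?_)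
      · simp
      · simp only [Bool.false_eq_true, if_false]
        rw [enorm_mul]
        refine mul_le_of_le_one_left' ?_
        rw [← ofReal_norm, Complex.norm_real, ← ENNReal.ofReal_one]
        apply ENNReal.ofReal_le_ofReal
        cases i <;> norm_num
    have hm := ((opH_U hf i (k + 1)).cont.comp (by fun_prop : Continuous fun t : ℝ => (t, x))).measurable.enorm
    calc _ ≤ _ := lintegral_mono e
      _ = _ := lintegral_add_left hm _
      _ ≤ _ := add_le_add (h f hfm hf i (k + 1) x) (h f hfm hf i k x)
      _ = _ := by rw [← two_mul, ← mul_assoc, ENNReal.ofReal_mul (by norm_num)]; norm_num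

/-- the pieces as functions of `t` -/
def pk {d : ℕ} [NeZero d] (f : Euc d → ℂ) (i : Bool) (k : ℕ) (x : Euc d) (t : ℝ) : ℂ :=
  opA (ft f) (Wk d i k) (mf d i) t x

lemma pk_cont {d : ℕ} [NeZero d] {f : Euc d → ℂ} (hf : Integrable f) (i : Bool) (k : ℕ) :
    Continuous (fun z : Euc d × ℝ => pk f i k z.1 z.2) :=
  (opH_k hf i k).cont.comp continuous_swap

lemma pk_deriv {d : ℕ} [NeZero d] {f : Euc d → ℂ} (hf : Integrable f) (k : ℕ) (x : Euc d) (t : ℝ) :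
    HasDerivAt (pk f false k x) (2 ^ k * pk f true k x t) t := by
  have h2 : OpH (ft f) (fun ρ => ∑ j ∈ ({0} : Finset ℕ), (2 ^ k : ℝ) * Wk d true k ρ) (dphi d) :=
    { Gc := ft_cont hf
      Gb := ⟨_, ft_bound f⟩
      Wm := by
        have := (Wk_cont d true k).measurable
        simp only [Finset.sum_singleton]; fun_prop
      Wi := by simp only [Finset.sum_singleton]; exact (Wk_int d true k).const_mul _
      mc := continuous_dphi d
      mb := abs_dphi_le d }
  have h1 := opA_hasDerivAt (opH_k hf false k) h2 (fun ρ => by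
    simp only [Finset.sum_singleton, Wk, if_true, if_false, Bool.false_eq_true]; field_simp) t x
  rw [opA_sum _ _ _ (fun j _ => (show OpH (ft f) (Wk d true k) (dphi d) from opH_k hf true k))] at h1
  simp only [Finset.sum_singleton] at h1
  refine h1.congr_deriv ?_
  push_cast; rfl

lemma pk_sum {d : ℕ} [NeZero d] {f : Euc d → ℂ} (hf : Integrable f) (n : ℕ) (x : Euc d) (t : ℝ) :
    ∑ k ∈ Finset.range (n + 1), pk f false k x t = opA (ft f) (Uk d false n) (mf d false) t x := by
  have h := opA_sum (Finset.range (n + 1)) (fun _ => 1) (fun k => Wk d false k) (fun k _ => opH_k hf false k) t x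
  simp only [Complex.ofReal_one, one_mul] at h
  unfold pk
  rw [← h]
  congr 1; ext ρ
  simp only [Wk, Uk, if_false, Bool.false_eq_true]
  exact wk_sum d n ρ

lemma gs_scale {d : ℕ} {s : ℝ} (hs : 0 < s) (f : Euc d → ℂ) (z : Euc d) :
    ∫ y, f y * (gs d s (z - y) : ℂ) = ∫ v, f (z - √s • v) * (gs d 1 v : ℂ) := by
  have hsp : 0 < √s := Real.sqrt_pos.2 hs
  have h1 : ∫ y, f y * (gs d s (z - y) : ℂ) = ∫ u, f (z - u) * (gs d s u : ℂ) := by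
    rw [← integral_sub_left_eq_self (fun u => f (z - u) * (gs d s u : ℂ)) volume z]
    simp
  rw [h1]
  have h2 := Measure.integral_comp_smul (μ := (volume : Measure (Euc d))) (fun u => f (z - u) * (gs d s u : ℂ)) √s
  have h3 : ∀ v : Euc d, (gs d 1 v : ℂ) = ((√s ^ d : ℝ) : ℂ) * (gs d s (√s • v) : ℂ) := by
    intro v
    rw [← Complex.ofReal_mul]
    congr 1
    unfold gs
    rw [norm_smul, Real.norm_of_nonneg hsp.le, mul_pow, Real.sq_sqrt hs.le, div_one, div_one, ← mul_assoc]
    have e1 : √s ^ d * (Real.pi / s) ^ ((d : ℝ) / 2) = Real.pi ^ ((d : ℝ) / 2) := by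
      rw [← Real.rpow_natCast, Real.sqrt_eq_rpow, ← Real.rpow_mul hs.le, show 1 / 2 * (d : ℝ) = (d : ℝ) / 2 by ring,
        ← Real.mul_rpow hs.le (by positivity)]
      congr 1; field_simp
    rw [e1]
    congr 2; field_simp
  have h4 : ∫ v, f (z - √s • v) * (gs d 1 v : ℂ) = ((√s ^ d : ℝ) : ℂ) * ∫ v, f (z - √s • v) * (gs d s (√s • v) : ℂ) := by
    rw [← integral_const_mul]
    refine integral_congr_ae (Filter.Eventually.of_forall fun v => ?_)
    dsimp only
    rw [h3]; ring
  rw [h4, h2, finrank_euclideanSpace_fin, abs_of_nonneg (by positivity), Complex.real_smul, ← mul_assoc, ← Complex.ofReal_mul,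
    mul_inv_cancel₀ (by positivity), Complex.ofReal_one, one_mul]

lemma gauss_lim {d : ℕ} [NeZero d] {f : Euc d → ℂ} (hfc : Continuous f) (hf : Integrable f) {B : ℝ} (hB : ∀ x, ‖f x‖ ≤ B)
    {s : ℕ → ℝ} (hs : ∀ n, 0 < s n) (hs0 : Filter.Tendsto s Filter.atTop (nhds 0)) {t : ℝ} (ht : 0 ≤ t) (x : Euc d) :
    Filter.Tendsto (fun n => opA (ft f) (Gs false (s n)) (mf d false) t x) Filter.atTop (nhds (sphAvg f t x)) := by
  have hfp : Integrable (fun p : Euc d × Euc d => f p.1) (volume.prod (sphereMeasure d)) := by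
    have := Integrable.mul_prod (f := f) (g := fun _ : Euc d => (1 : ℂ)) (ν := sphereMeasure d) hf (integrable_const 1)
    simpa using this
  have hgp : Integrable (fun p : Euc d × Euc d => B * gs d 1 p.1) (volume.prod (sphereMeasure d)) := by
    have := Integrable.mul_prod (f := fun v : Euc d => B * gs d 1 v) (g := fun _ : Euc d => (1 : ℝ)) (ν := sphereMeasure d)
      ((gs_integrable one_pos).const_mul B) (integrable_const 1)
    simpa using this
  have hbd : ∀ n, ∀ p : Euc d × Euc d, ‖f (x - t • p.2 - √(s n) • p.1) * (gs d 1 p.1 : ℂ)‖ ≤ B * gs d 1 p.1 := by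
    intro n p
    rw [norm_mul, Complex.norm_real, Real.norm_of_nonneg (gs_pos one_pos _).le]
    have := (gs_pos one_pos p.1).le
    gcongr; exact hB _
  have e1 : ∀ n, opA (ft f) (Gs false (s n)) (mf d false) t x =
      ∫ p : Euc d × Euc d, f (x - t • p.2 - √(s n) • p.1) * (gs d 1 p.1 : ℂ) ∂(volume.prod (sphereMeasure d)) := by
    intro n
    rw [show opA (ft f) (Gs false (s n)) (mf d false) t x = _ from opA_gauss hf (hs n) ht x,
      integral_prod_symm, integral_prod_symm]
    · refine integral_congr_ae (Filter.Eventually.of_forall fun ω => ?_)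
      dsimp only
      rw [← gs_scale (hs n) f (x - t • ω)]
      simp_rw [sub_right_comm x _ (t • ω)]
    · refine hgp.mono' (Continuous.aestronglyMeasurable (by fun_prop)) (Filter.Eventually.of_forall fun p => hbd n p)
    · refine hfp.mul_bdd (c := (Real.pi / s n) ^ ((d : ℝ) / 2)) (Continuous.aestronglyMeasurable (by fun_prop)) (Filter.Eventually.of_forall fun p => ?_)
      rw [Complex.norm_real, Real.norm_of_nonneg (gs_pos (hs n) _).le]; exact gs_le (hs n) _
  simp_rw [e1]
  have e2 : sphAvg f t x = ∫ p : Euc d × Euc d, f (x - t • p.2) * (gs d 1 p.1 : ℂ) ∂(volume.prod (sphereMeasure d)) := by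
    have := integral_prod_mul (μ := (volume : Measure (Euc d))) (ν := sphereMeasure d)
      (fun v => (gs d 1 v : ℂ)) (fun ω => f (x - t • ω))
    rw [integral_complex_ofReal, gs_integral one_pos, Complex.ofReal_one, one_mul] at this
    unfold sphAvg
    rw [← this]
    refine integral_congr_ae (Filter.Eventually.of_forall fun p => mul_comm _ _)
  rw [e2]
  refine tendsto_integral_of_dominated_convergence (fun p : Euc d × Euc d => B * gs d 1 p.1)
    (fun n => Continuous.aestronglyMeasurable (by fun_prop)) hgp
    (fun n => Filter.Eventually.of_forall fun p => hbd n p) (Filter.Eventually.of_forall fun p => ?_)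
  refine Filter.Tendsto.mul_const _ ?_
  have h0 : Filter.Tendsto (fun n => √(s n)) Filter.atTop (nhds 0) := by
    have := (Real.continuous_sqrt.tendsto 0).comp hs0
    rw [Real.sqrt_zero] at this
    exact this
  have h1 : Filter.Tendsto (fun n => x - t • p.2 - √(s n) • p.1) Filter.atTop (nhds (x - t • p.2)) := by
    have := (tendsto_const_nhds (x := x - t • p.2)).sub (h0.smul_const p.1)
    simpa using this
  exact (hfc.tendsto _).comp h1

lemma pk_lim {d : ℕ} [NeZero d] {f : Euc d → ℂ} (hfc : Continuous f) (hf : Integrable f) {B : ℝ} (hB : ∀ x, ‖f x‖ ≤ B)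
    {t : ℝ} (ht : 0 ≤ t) (x : Euc d) :
    Filter.Tendsto (fun n => ∑ k ∈ Finset.range (n + 1), pk f false k x t) Filter.atTop (nhds (sphAvg f t x)) := by
  have e : ∀ n, ∑ k ∈ Finset.range (n + 1), pk f false k x t = ∑ j ∈ Finset.range d, ((cj d j : ℝ) : ℂ) *
      opA (ft f) (Gs false (((j : ℝ) + 1) / (2 ^ n) ^ 2)) (mf d false) t x := by
    intro n
    rw [pk_sum hf, ← opA_sum (Finset.range d) (fun j => cj d j) (fun j : ℕ => Gs false (((j : ℝ) + 1) / (2 ^ n) ^ 2))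
      (fun j _ => opH_G hf false (by positivity))]
    congr 1; ext ρ; rw [Uk_eq]; simp [sc]
  simp_rw [e]
  have h1 : sphAvg f t x = ∑ j ∈ Finset.range d, ((cj d j : ℝ) : ℂ) * sphAvg f t x := by
    rw [← Finset.sum_mul, ← Complex.ofReal_sum, cj_sum]; simp
  rw [h1]
  refine tendsto_finsetSum _ fun j _ => Filter.Tendsto.const_mul _ ?_
  refine gauss_lim hfc hf hB (s := fun n => ((j : ℝ) + 1) / (2 ^ n) ^ 2) (fun n => by positivity) ?_ ht x
  have : Filter.Tendsto (fun n : ℕ => ((2 : ℝ) ^ n) ^ 2) Filter.atTop Filter.atTop :=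
    (Filter.tendsto_pow_atTop (by norm_num)).comp (tendsto_pow_atTop_atTop_of_one_lt (by norm_num))
  exact this.const_div_atTop _

lemma rVar_ge {r : ℝ} {E : Set ℝ} (a : ℝ → ℂ) {N : ℕ} (t : Fin (N + 1) → ℝ) (ht : StrictMono t) (hE : ∀ i, t i ∈ E) :
    (∑ i : Fin N, ‖a (t i.succ) - a (t i.castSucc)‖ₑ ^ r) ^ (1 / r) ≤ rVar r E a :=
  le_iSup_of_le N (le_iSup_of_le t (le_iSup_of_le ht (le_iSup_of_le hE le_rfl)))

lemma rVar_le {r : ℝ} {E : Set ℝ} {a : ℝ → ℂ} {M : ℝ≥0∞}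
    (h : ∀ (N : ℕ) (t : Fin (N + 1) → ℝ), StrictMono t → (∀ i, t i ∈ E) →
      (∑ i : Fin N, ‖a (t i.succ) - a (t i.castSucc)‖ₑ ^ r) ^ (1 / r) ≤ M) : rVar r E a ≤ M :=
  iSup_le fun N => iSup_le fun t => iSup_le fun ht => iSup_le fun hE => h N t ht hE

lemma rVar_add {r : ℝ} (hr : 1 ≤ r) (E : Set ℝ) (a b : ℝ → ℂ) :
    rVar r E (fun t => a t + b t) ≤ rVar r E a + rVar r E b := by
  refine rVar_le fun N t ht hE => ?_
  refine le_trans ?_ (add_le_add (rVar_ge a t ht hE) (rVar_ge b t ht hE))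
  refine le_trans ?_ (ENNReal.Lp_add_le _ _ _ hr)
  refine ENNReal.rpow_le_rpow (Finset.sum_le_sum fun i _ => ENNReal.rpow_le_rpow ?_ (by linarith)) (by positivity)
  rw [add_sub_add_comm]
  exact enorm_add_le _ _

lemma rVar_zero {r : ℝ} (hr : 1 ≤ r) (E : Set ℝ) : rVar r E (fun _ => 0) = 0 := by
  refine le_antisymm (rVar_le fun N t _ _ => ?_) bot_le
  have h0 : r ≠ 0 := by linarith
  have : 0 < r := by linarith
  simp [this]

lemma rVar_sum {r : ℝ} (hr : 1 ≤ r) (E : Set ℝ) {ι : Type*} (s : Finset ι) (a : ι → ℝ → ℂ) :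
    rVar r E (fun t => ∑ k ∈ s, a k t) ≤ ∑ k ∈ s, rVar r E (a k) := by
  classical
  induction s using Finset.induction_on with
  | empty => simp [rVar_zero hr]
  | insert i s hi ih =>
    simp_rw [Finset.sum_insert hi]
    exact (rVar_add hr E _ _).trans (by gcongr)

lemma rVar_tendsto {ι : Type*} {l : Filter ι} [l.NeBot] {r : ℝ} (hr : 1 ≤ r) {E : Set ℝ} {a : ι → ℝ → ℂ} {b : ℝ → ℂ}
    (h : ∀ t ∈ E, Filter.Tendsto (fun n => a n t) l (nhds (b t))) :
    rVar r E b ≤ Filter.liminf (fun n => rVar r E (a n)) l := by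
  refine rVar_le fun N t ht hE => ?_
  have h1 : Filter.Tendsto (fun n => (∑ i : Fin N, ‖a n (t i.succ) - a n (t i.castSucc)‖ₑ ^ r) ^ (1 / r)) l
      (nhds ((∑ i : Fin N, ‖b (t i.succ) - b (t i.castSucc)‖ₑ ^ r) ^ (1 / r))) := by
    refine (ENNReal.continuous_rpow_const.tendsto _).comp (tendsto_finsetSum _ fun i _ => ?_)
    refine (ENNReal.continuous_rpow_const.tendsto _).comp ?_
    exact ((continuous_enorm.tendsto _).comp ((h _ (hE _)).sub (h _ (hE _))))
  rw [← h1.liminf_eq]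
  exact Filter.liminf_le_liminf (Filter.Eventually.of_forall fun n => rVar_ge (a n) t ht hE)

lemma rVar_tsum {r : ℝ} (hr : 1 ≤ r) {E : Set ℝ} {a : ℕ → ℝ → ℂ} {b : ℝ → ℂ}
    (h : ∀ t ∈ E, Filter.Tendsto (fun n => ∑ k ∈ Finset.range (n + 1), a k t) Filter.atTop (nhds (b t))) :
    rVar r E b ≤ ∑' k, rVar r E (a k) := by
  refine (rVar_tendsto hr h).trans ?_
  refine (Filter.liminf_le_liminf (v := fun _ => ∑' k, rVar r E (a k)) (Filter.Eventually.of_forall fun n => ?_)).trans ?_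
  · exact (rVar_sum hr E _ a).trans (ENNReal.sum_le_tsum _)
  · simp

lemma rVar_hasSum {r : ℝ} (hr : 1 ≤ r) {E : Set ℝ} {ι : Type*} {a : ι → ℝ → ℂ} {b : ℝ → ℂ}
    (h : ∀ t ∈ E, HasSum (fun k => a k t) (b t)) :
    rVar r E b ≤ ∑' k, rVar r E (a k) := by
  refine (rVar_tendsto hr h).trans ?_
  refine (Filter.liminf_le_liminf (v := fun _ => ∑' k, rVar r E (a k)) (Filter.Eventually.of_forall fun n => ?_)).trans ?_
  · exact (rVar_sum hr E _ a).trans (ENNReal.sum_le_tsum _)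
  · simp

lemma rVar_lsc {X : Type*} [TopologicalSpace X] {r : ℝ} (hr : 1 ≤ r) {E : Set ℝ} {a : X → ℝ → ℂ}
    (h : ∀ t ∈ E, Continuous fun x => a x t) : LowerSemicontinuous fun x => rVar r E (a x) := by
  unfold rVar
  refine lowerSemicontinuous_iSup fun N => lowerSemicontinuous_iSup fun t => lowerSemicontinuous_iSup fun ht =>
    lowerSemicontinuous_iSup fun hE => Continuous.lowerSemicontinuous ?_
  refine ENNReal.continuous_rpow_const.comp (continuous_finsetSum _ fun i _ => ENNReal.continuous_rpow_const.comp ?_)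
  exact continuous_enorm.comp ((h _ (hE _)).sub (h _ (hE _)))

lemma pow_jensen {r L : ℝ} (hr : 1 ≤ r) {K : ℝ} (hK : 0 < K) (hL : L ≤ 1 / K) {g : ℝ → ℝ≥0∞} (hg : Measurable g) {s : ℝ} :
    (ENNReal.ofReal K * ∫⁻ t in Ioc s (s + L), g t) ^ r ≤ ENNReal.ofReal K * ∫⁻ t in Ioc s (s + L), g t ^ r := by
  have h := ENNReal.lintegral_mul_norm_pow_le (μ := volume.restrict (Ioc s (s + L))) (f := fun t => g t ^ r) (g := fun _ => 1)
    (by fun_prop) (by fun_prop) (p := 1 / r) (q := 1 - 1 / r) (by positivity)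
    (by rw [sub_nonneg, div_le_one (by linarith)]; exact hr) (by ring)
  have hr0 : r ≠ 0 := by linarith
  simp only [one_div, ENNReal.rpow_rpow_inv hr0, ENNReal.one_rpow, mul_one, lintegral_const, Measure.restrict_apply MeasurableSet.univ,
    univ_inter, Real.volume_Ioc, one_mul, add_sub_cancel_left] at h
  calc _ ≤ (ENNReal.ofReal K * ((∫⁻ t in Ioc s (s + L), g t ^ r) ^ r⁻¹ * ENNReal.ofReal L ^ (1 - r⁻¹))) ^ r := by gcongr
    _ ≤ (ENNReal.ofReal K * ((∫⁻ t in Ioc s (s + L), g t ^ r) ^ r⁻¹ * ENNReal.ofReal (1 / K) ^ (1 - r⁻¹))) ^ r := by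
        gcongr
        rw [sub_nonneg]; exact inv_le_one_of_one_le₀ hr
    _ = _ := by
        rw [ENNReal.mul_rpow_of_nonneg _ _ (by linarith), ENNReal.mul_rpow_of_nonneg _ _ (by linarith), ENNReal.rpow_inv_rpow hr0,
          ← ENNReal.rpow_mul, mul_comm (∫⁻ _ in _, _) _, ← mul_assoc, ENNReal.ofReal_rpow_of_pos hK,
          ENNReal.ofReal_rpow_of_pos (by positivity), ← ENNReal.ofReal_mul (by positivity)]
        congr 2
        rw [one_div, Real.inv_rpow hK.le, ← Real.rpow_neg hK.le, ← Real.rpow_add hK]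
        have : r + -((1 - r⁻¹) * r) = 1 := by field_simp; ring
        rw [this, Real.rpow_one]

lemma c1_diff {a b : ℝ → ℂ} {K : ℝ} (hK : 0 < K) (hb : Continuous b)
    (hd : ∀ t, HasDerivAt a (K * b t) t) {s t : ℝ} (hst : s ≤ t) :
    ‖a t - a s‖ₑ ≤ ENNReal.ofReal K * ∫⁻ u in Ioc s t, ‖b u‖ₑ := by
  have h := intervalIntegral.integral_eq_sub_of_hasDerivAt (a := s) (b := t) (fun x _ => hd x)
    (Continuous.intervalIntegrable (by fun_prop) _ _)
  rw [← h, intervalIntegral.integral_of_le hst]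
  refine (enorm_integral_le_lintegral_enorm _).trans (le_of_eq ?_)
  simp_rw [enorm_mul]
  rw [lintegral_const_mul _ (by have := hb.measurable; fun_prop)]
  congr 1
  rw [← ofReal_norm, Complex.norm_real, Real.norm_of_nonneg hK.le]

lemma c1_point {a b : ℝ → ℂ} {K : ℝ} (hK : 0 < K) (ha : Continuous a) (hb : Continuous b)
    (hd : ∀ t, HasDerivAt a (K * b t) t) {s u : ℝ} (hu : u ∈ Icc s (s + 1 / K)) :
    ‖a u‖ₑ ≤ ENNReal.ofReal K * ∫⁻ t in Ioc s (s + 1 / K), (‖a t‖ₑ + ‖b t‖ₑ) := by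
  set B := ENNReal.ofReal K * ∫⁻ u in Ioc s (s + 1 / K), ‖b u‖ₑ with hB
  have h1 : ∀ t ∈ Ioc s (s + 1 / K), ‖a u‖ₑ ≤ ‖a t‖ₑ + B := by
    intro t ht
    have h2 : ‖a u - a t‖ₑ ≤ B := by
      rcases le_total t u with h | h
      · refine (c1_diff hK hb hd h).trans ?_
        rw [hB]; gcongr
        · exact ht.1.le
        · exact hu.2
      · rw [← enorm_neg, neg_sub]
        refine (c1_diff hK hb hd h).trans ?_
        rw [hB]; gcongr
        · exact hu.1
        · exact ht.2
    calc ‖a u‖ₑ = ‖a t + (a u - a t)‖ₑ := by ring_nf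
      _ ≤ _ := (enorm_add_le _ _).trans (by gcongr)
  have h3 : ∫⁻ t in Ioc s (s + 1 / K), ‖a u‖ₑ ≤ ∫⁻ t in Ioc s (s + 1 / K), (‖a t‖ₑ + B) :=
    setLIntegral_mono (by have := ha.measurable; fun_prop) h1
  have hm := ha.measurable
  have hm2 := hb.measurable
  rw [lintegral_add_right _ (by fun_prop)] at h3
  simp only [lintegral_const, Measure.restrict_apply MeasurableSet.univ, univ_inter, Real.volume_Ioc, add_sub_cancel_left] at h3
  have hKK : ENNReal.ofReal K * ENNReal.ofReal (1 / K) = 1 := by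
    rw [← ENNReal.ofReal_mul hK.le, mul_one_div_cancel hK.ne', ENNReal.ofReal_one]
  calc ‖a u‖ₑ = ENNReal.ofReal K * (‖a u‖ₑ * ENNReal.ofReal (1 / K)) := by
        rw [mul_comm ‖a u‖ₑ, ← mul_assoc, hKK, one_mul]
    _ ≤ _ := mul_le_mul' le_rfl h3
    _ = _ := by
      rw [lintegral_add_right _ (by fun_prop), mul_add, mul_add, mul_comm B, ← mul_assoc, hKK, one_mul]

lemma c1_incr {r : ℝ} (hr : 1 ≤ r) {a b : ℝ → ℂ} {K : ℝ} (hK : 0 < K) (ha : Continuous a) (hb : Continuous b)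
    (hd : ∀ t, HasDerivAt a (K * b t) t) {s t : ℝ} (hst : s ≤ t) :
    ‖a t - a s‖ₑ ^ r ≤ 2 ^ r * ENNReal.ofReal K * ∫⁻ u in Ioc s t, (‖a u‖ₑ + ‖b u‖ₑ) ^ r := by
  have hm := ha.measurable
  have hm2 := hb.measurable
  have h12 : (1 : ℝ≥0∞) ≤ 2 ^ r := ENNReal.one_le_rpow (by norm_num) (by linarith)
  rcases le_total (t - s) (1 / K) with h | h
  · calc ‖a t - a s‖ₑ ^ r ≤ (ENNReal.ofReal K * ∫⁻ u in Ioc s (s + (t - s)), (‖a u‖ₑ + ‖b u‖ₑ)) ^ r := by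
          refine ENNReal.rpow_le_rpow ((c1_diff hK hb hd hst).trans (mul_le_mul' le_rfl ?_)) (by linarith)
          rw [add_sub_cancel]
          exact lintegral_mono fun u => le_add_self
      _ ≤ _ := pow_jensen hr hK h (by fun_prop)
      _ ≤ _ := by
        rw [add_sub_cancel, mul_assoc]
        exact le_mul_of_one_le_left' h12
  · have key : ∀ s' u, s ≤ s' → s' + 1 / K ≤ t → u ∈ Icc s' (s' + 1 / K) →
        ‖a u‖ₑ ^ r ≤ ENNReal.ofReal K * ∫⁻ u in Ioc s t, (‖a u‖ₑ + ‖b u‖ₑ) ^ r := by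
      intro s' u h1 h2 hu
      calc ‖a u‖ₑ ^ r ≤ _ := ENNReal.rpow_le_rpow (c1_point hK ha hb hd hu) (by linarith)
        _ ≤ _ := pow_jensen hr hK le_rfl (by fun_prop)
        _ ≤ _ := by gcongr
    have hK1 : 0 < 1 / K := by positivity
    have k1 := key s s le_rfl (by linarith) ⟨le_rfl, by linarith⟩
    have k2 := key (t - 1 / K) t (by linarith) (by linarith) ⟨by linarith, by linarith⟩
    calc ‖a t - a s‖ₑ ^ r ≤ (2 * max ‖a t‖ₑ ‖a s‖ₑ) ^ r := by
          refine ENNReal.rpow_le_rpow ?_ (by linarith)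
          refine (enorm_sub_le).trans ?_
          rw [two_mul]
          exact add_le_add (le_max_left _ _) (le_max_right _ _)
      _ ≤ _ := by
        rw [ENNReal.mul_rpow_of_nonneg _ _ (by linarith), mul_assoc]
        refine mul_le_mul' le_rfl ?_
        rcases max_choice ‖a t‖ₑ ‖a s‖ₑ with h | h <;> rw [h]
        · exact k2
        · exact k1

lemma c1_rVar {r : ℝ} (hr : 1 ≤ r) {a b : ℝ → ℂ} {K : ℝ} (hK : 0 < K) (ha : Continuous a) (hb : Continuous b)
    (hd : ∀ t, HasDerivAt a (K * b t) t) :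
    rVar r (Icc 1 2) a ≤ (2 ^ r * ENNReal.ofReal K * ∫⁻ u in Icc 1 2, (‖a u‖ₑ + ‖b u‖ₑ) ^ r) ^ (1 / r) := by
  refine rVar_le fun N t ht hE => ENNReal.rpow_le_rpow ?_ (by positivity)
  calc _ ≤ ∑ i : Fin N, 2 ^ r * ENNReal.ofReal K * ∫⁻ u in Ioc (t i.castSucc) (t i.succ), (‖a u‖ₑ + ‖b u‖ₑ) ^ r :=
        Finset.sum_le_sum fun i _ => c1_incr hr hK ha hb hd (ht.monotone (Fin.castSucc_le_succ i))
    _ = 2 ^ r * ENNReal.ofReal K * ∫⁻ u in ⋃ i ∈ (Finset.univ : Finset (Fin N)), Ioc (t i.castSucc) (t i.succ), (‖a u‖ₑ + ‖b u‖ₑ) ^ r := by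
        rw [← Finset.mul_sum, lintegral_biUnion_finset _ (fun _ _ => measurableSet_Ioc)]
        intro i _ j _ hij
        rw [Function.onFun, Set.Ioc_disjoint_Ioc]
        rcases lt_or_gt_of_ne hij with h | h
        · refine (min_le_left _ _).trans (le_trans ?_ (le_max_right _ _))
          exact ht.monotone (by rw [Fin.le_def]; simp; omega)
        · refine (min_le_right _ _).trans (le_trans ?_ (le_max_left _ _))
          exact ht.monotone (by rw [Fin.le_def]; simp; omega)
    _ ≤ _ := by
        refine mul_le_mul' le_rfl (lintegral_mono_set ?_)
        refine iUnion₂_subset fun i _ u hu => ⟨(hE _).1.trans hu.1.le, hu.2.trans (hE _).2⟩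

lemma holder3 {r θ : ℝ} (hr : 1 ≤ r) (h0 : 0 ≤ θ) (h1 : θ ≤ 1) (h : r * (1 - θ / 2) ≤ 1) {g : ℝ → ℝ≥0∞} (hg : Measurable g) :
    (∫⁻ t in Icc (1 : ℝ) 2, g t ^ r) ^ (1 / r) ≤ (∫⁻ t in Icc (1 : ℝ) 2, g t) ^ (1 - θ) * (∫⁻ t in Icc (1 : ℝ) 2, g t ^ 2) ^ (θ / 2) := by
  have hr0 : 0 < r := by linarith
  have H := ENNReal.lintegral_prod_norm_pow_le (μ := volume.restrict (Icc (1 : ℝ) 2)) (Finset.univ : Finset (Fin 3))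
    (f := ![g, fun t => g t ^ 2, fun _ => 1]) (by intro i _; fin_cases i <;> simp <;> fun_prop)
    (p := ![r * (1 - θ), r * θ / 2, 1 - r * (1 - θ / 2)]) (by simp [Fin.sum_univ_three]; ring)
    (by intro i _; fin_cases i <;> simp <;> nlinarith)
  simp only [Fin.prod_univ_three, Matrix.cons_val_zero, Matrix.cons_val_one, Matrix.cons_val_two, Matrix.head_cons, Matrix.tail_cons,
    ENNReal.one_rpow, mul_one, lintegral_const, Measure.restrict_apply MeasurableSet.univ, univ_inter, Real.volume_Icc, Matrix.cons_val] at H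
  norm_num at H
  have e : ∀ t, g t ^ (r * (1 - θ)) * (g t ^ 2) ^ (r * θ / 2) = g t ^ r := by
    intro t
    rw [← ENNReal.rpow_natCast, ← ENNReal.rpow_mul, ← ENNReal.rpow_add_of_nonneg]
    · congr 1; push_cast; ring
    · nlinarith
    · push_cast; positivity
  simp_rw [e] at H
  refine (ENNReal.rpow_le_rpow H (by positivity)).trans (le_of_eq ?_)
  rw [ENNReal.mul_rpow_of_nonneg _ _ (by positivity), ← ENNReal.rpow_mul, ← ENNReal.rpow_mul]
  congr 2 <;> field_simp

/-- sum of the two square functions -/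
def sk {d : ℕ} [NeZero d] (f : Euc d → ℂ) (k : ℕ) (x : Euc d) : ℝ≥0∞ := ak f false k x + ak f true k x

/-- variation of the pieces -/
def gk {d : ℕ} [NeZero d] (r : ℝ) (f : Euc d → ℂ) (k : ℕ) (x : Euc d) : ℝ≥0∞ := rVar r (Icc 1 2) (pk f false k x)

lemma gk_meas {d : ℕ} [NeZero d] {r : ℝ} (hr : 1 ≤ r) {f : Euc d → ℂ} (hf : Integrable f) (k : ℕ) : Measurable (gk r f k) :=
  (rVar_lsc hr fun t _ => (pk_cont hf false k).comp (by fun_prop : Continuous fun x : Euc d => (x, t))).measurable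

lemma gk_le (d : ℕ) [NeZero d] {r θ : ℝ} (hr : 1 ≤ r) (h0 : 0 ≤ θ) (h1 : θ ≤ 1) (h : r * (1 - θ / 2) ≤ 1) :
    ∃ C : ℝ, 0 < C ∧ ∀ f : Euc d → ℂ, Measurable f → Integrable f → ∀ k x,
      gk r f k x ≤ ENNReal.ofReal (C * (2 ^ k) ^ (1 / r)) * (∫⁻ y, ‖f y‖ₑ) ^ (1 - θ) * sk f k x ^ (θ / 2) := by
  obtain ⟨C, hC, hl⟩ := l1_W d
  have hr0 : r ≠ 0 := by linarith
  refine ⟨2 * (2 * C) ^ (1 - θ) * 2 ^ (θ / 2), by positivity, fun f hfm hf k x => ?_⟩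
  have hc : ∀ i, Continuous (pk f i k x) := fun i => (pk_cont hf i k).comp (by fun_prop : Continuous fun t : ℝ => (x, t))
  have hm : ∀ i, Measurable (pk f i k x) := fun i => (hc i).measurable
  have hm0 := hm false
  have hm1 := hm true
  set g : ℝ → ℝ≥0∞ := fun u => ‖pk f false k x u‖ₑ + ‖pk f true k x u‖ₑ with hg
  have hgm : Measurable g := by fun_prop
  have A1 : ∫⁻ t in Icc (1 : ℝ) 2, g t ≤ ENNReal.ofReal (2 * C) * ∫⁻ y, ‖f y‖ₑ := by
    rw [hg, lintegral_add_left (by fun_prop)]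
    refine (add_le_add (hl f hfm hf false k x) (hl f hfm hf true k x)).trans (le_of_eq ?_)
    rw [← two_mul, ← mul_assoc, ENNReal.ofReal_mul (by norm_num)]; norm_num
  have A2 : ∫⁻ t in Icc (1 : ℝ) 2, g t ^ 2 ≤ 2 * sk f k x := by
    unfold sk ak al2
    rw [← lintegral_add_left (by change Measurable fun t => ‖pk f false k x t‖ₑ ^ 2; fun_prop), ← lintegral_const_mul]
    · refine lintegral_mono fun t => ?_
      have := ENNReal.rpow_add_le_mul_rpow_add_rpow ‖pk f false k x t‖ₑ ‖pk f true k x t‖ₑ (p := 2) (by norm_num)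
      norm_num at this
      exact this
    · change Measurable fun t => ‖pk f false k x t‖ₑ ^ 2 + ‖pk f true k x t‖ₑ ^ 2
      fun_prop
  have B := c1_rVar hr (a := pk f false k x) (b := pk f true k x) (K := 2 ^ k) (by positivity) (hc _) (hc _)
    (fun t => by simpa using pk_deriv hf k x t)
  refine B.trans ?_
  rw [ENNReal.mul_rpow_of_nonneg _ _ (by positivity)]
  calc _ ≤ (2 ^ r * ENNReal.ofReal (2 ^ k)) ^ (1 / r) * ((ENNReal.ofReal (2 * C) * ∫⁻ y, ‖f y‖ₑ) ^ (1 - θ) * (2 * sk f k x) ^ (θ / 2)) := by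
        refine mul_le_mul' le_rfl ((holder3 hr h0 h1 h hgm).trans ?_)
        refine mul_le_mul' (ENNReal.rpow_le_rpow A1 (by linarith)) (ENNReal.rpow_le_rpow A2 (by linarith))
    _ = _ := by
        rw [ENNReal.mul_rpow_of_nonneg _ _ (by positivity), ENNReal.mul_rpow_of_nonneg _ _ (by linarith),
          ENNReal.mul_rpow_of_nonneg _ _ (by positivity), ← ENNReal.rpow_mul, mul_one_div_cancel hr0, ENNReal.rpow_one,
          ENNReal.ofReal_rpow_of_pos (by positivity), ENNReal.ofReal_rpow_of_pos (by positivity), ENNReal.ofReal_mul (by positivity),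
          ENNReal.ofReal_mul (by positivity), ENNReal.ofReal_mul (by positivity)]
        have e2 : ENNReal.ofReal 2 = 2 := by simp
        rw [← ENNReal.ofReal_rpow_of_pos (x := 2) (p := θ / 2) (by norm_num), e2]
        ring

/-- `L^{1/v}` norm -/
def nv {α : Type*} [MeasurableSpace α] (μ : Measure α) (v : ℝ) (g : α → ℝ≥0∞) : ℝ≥0∞ := (∫⁻ x, g x ^ (1 / v) ∂μ) ^ v

lemma nv_mono {α : Type*} [MeasurableSpace α] {μ : Measure α} {v : ℝ} (hv : 0 < v) {g h : α → ℝ≥0∞} (hgh : ∀ x, g x ≤ h x) :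
    nv μ v g ≤ nv μ v h :=
  ENNReal.rpow_le_rpow (lintegral_mono fun x => ENNReal.rpow_le_rpow (hgh x) (by positivity)) hv.le

lemma nv_mono_ae {α : Type*} [MeasurableSpace α] {μ : Measure α} {v : ℝ} (hv : 0 < v) {g h : α → ℝ≥0∞} (hgh : ∀ᵐ x ∂μ, g x ≤ h x) :
    nv μ v g ≤ nv μ v h :=
  ENNReal.rpow_le_rpow (lintegral_mono_ae (hgh.mono fun x hx => ENNReal.rpow_le_rpow hx (by positivity))) hv.le

lemma nv_const_mul {α : Type*} [MeasurableSpace α] {μ : Measure α} {v : ℝ} (hv : 0 < v) {c : ℝ≥0∞} {g : α → ℝ≥0∞} (hg : Measurable g) :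
    nv μ v (fun x => c * g x) = c * nv μ v g := by
  unfold nv
  simp_rw [ENNReal.mul_rpow_of_nonneg _ _ (show 0 ≤ 1 / v by positivity)]
  rw [lintegral_const_mul _ (by fun_prop), ENNReal.mul_rpow_of_nonneg _ _ hv.le, ← ENNReal.rpow_mul, one_div_mul_cancel hv.ne', ENNReal.rpow_one]

lemma nv_add {α : Type*} [MeasurableSpace α] {μ : Measure α} {v : ℝ} (hv : 0 < v) (hv1 : v ≤ 1) {g h : α → ℝ≥0∞}
    (hg : Measurable g) (hh : Measurable h) : nv μ v (fun x => g x + h x) ≤ nv μ v g + nv μ v h := by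
  have := ENNReal.lintegral_Lp_add_le (μ := μ) hg.aemeasurable hh.aemeasurable (p := 1 / v) (one_le_one_div hv hv1)
  simp only [one_div_one_div] at this
  exact this

lemma nv_sum {α : Type*} [MeasurableSpace α] {μ : Measure α} {v : ℝ} (hv : 0 < v) (hv1 : v ≤ 1) {ι : Type*} (s : Finset ι) {g : ι → α → ℝ≥0∞}
    (hg : ∀ i, Measurable (g i)) : nv μ v (fun x => ∑ i ∈ s, g i x) ≤ ∑ i ∈ s, nv μ v (g i) := by
  classical
  induction s using Finset.induction_on with
  | empty =>
    simp only [nv, Finset.sum_empty]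
    rw [ENNReal.zero_rpow_of_pos (by positivity), lintegral_zero, ENNReal.zero_rpow_of_pos hv]
  | insert i s hi ih =>
    simp_rw [Finset.sum_insert hi]
    exact (nv_add hv hv1 (hg i) (by fun_prop)).trans (by gcongr)

lemma nv_iSup {α : Type*} [MeasurableSpace α] {μ : Measure α} {v : ℝ} (hv : 0 < v) {ι : Type*} [Countable ι] {g : ι → α → ℝ≥0∞}
    (hg : ∀ i, Measurable (g i)) (hd : Directed (· ≤ ·) g) : nv μ v (fun x => ⨆ i, g i x) = ⨆ i, nv μ v (g i) := by
  unfold nv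
  have hv' : 0 < 1 / v := by positivity
  have e1 : ∀ h : ι → ℝ≥0∞, (⨆ i, h i) ^ (1 / v) = ⨆ i, h i ^ (1 / v) := fun h => (ENNReal.orderIsoRpow (1 / v) hv').map_iSup h
  have e2 : ∀ h : ι → ℝ≥0∞, (⨆ i, h i) ^ v = ⨆ i, h i ^ v := fun h => (ENNReal.orderIsoRpow v hv).map_iSup h
  simp_rw [e1]
  rw [lintegral_iSup_directed, e2]
  · intro b; have := hg b; fun_prop
  · intro i j
    obtain ⟨k, h1, h2⟩ := hd i j
    exact ⟨k, fun x => ENNReal.rpow_le_rpow (h1 x) hv'.le, fun x => ENNReal.rpow_le_rpow (h2 x) hv'.le⟩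

lemma nv_tsum {α : Type*} [MeasurableSpace α] {μ : Measure α} {v : ℝ} (hv : 0 < v) (hv1 : v ≤ 1) {ι : Type*} [Countable ι] {g : ι → α → ℝ≥0∞}
    (hg : ∀ i, Measurable (g i)) : nv μ v (fun x => ∑' i, g i x) ≤ ∑' i, nv μ v (g i) := by
  classical
  simp_rw [ENNReal.tsum_eq_iSup_sum]
  rw [nv_iSup hv (fun s => Finset.measurable_sum s fun i _ => hg i)]
  · exact iSup_mono fun s => nv_sum hv hv1 s hg
  · intro s t
    exact ⟨s ∪ t, fun x => Finset.sum_le_sum_of_subset Finset.subset_union_left, fun x => Finset.sum_le_sum_of_subset Finset.subset_union_right⟩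

lemma nv_interp {α : Type*} [MeasurableSpace α] {μ : Measure α} {v0 v1 l : ℝ} (h0 : 0 < v0) (h1 : 0 < v1) (l0 : 0 ≤ l) (l1 : l ≤ 1)
    {g : α → ℝ≥0∞} (hg : Measurable g) : nv μ ((1 - l) * v0 + l * v1) g ≤ nv μ v0 g ^ (1 - l) * nv μ v1 g ^ l := by
  set v := (1 - l) * v0 + l * v1 with hv
  have hl : 0 ≤ 1 - l := by linarith
  have hvp : 0 < v := by
    rcases eq_or_lt_of_le l0 with h | h
    · rw [hv, ← h]; simpa using h0
    · have := mul_pos h h1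
      have := mul_nonneg hl h0.le
      linarith
  have H := ENNReal.lintegral_mul_norm_pow_le (μ := μ) (f := fun x => g x ^ (1 / v0)) (g := fun x => g x ^ (1 / v1)) (by fun_prop) (by fun_prop)
    (p := (1 - l) * v0 / v) (q := l * v1 / v) (by positivity) (by positivity) (by rw [← add_div, ← hv]; field_simp)
  have e : ∀ x, (g x ^ (1 / v0)) ^ ((1 - l) * v0 / v) * (g x ^ (1 / v1)) ^ (l * v1 / v) = g x ^ (1 / v) := by
    intro x
    rw [← ENNReal.rpow_mul, ← ENNReal.rpow_mul, ← ENNReal.rpow_add_of_nonneg _ _ (by positivity) (by positivity)]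
    congr 1; field_simp; ring
  simp_rw [e] at H
  unfold nv
  refine (ENNReal.rpow_le_rpow H hvp.le).trans (le_of_eq ?_)
  rw [ENNReal.mul_rpow_of_nonneg _ _ hvp.le]
  simp_rw [← ENNReal.rpow_mul]
  congr 2 <;> field_simp

/-- geometric series -/
def geo (δ : ℝ) : ℝ≥0∞ := ∑' j : ℕ, (2 : ℝ≥0∞) ^ (-(δ * j))

lemma geo_lt_top {δ : ℝ} (h : 0 < δ) : geo δ < ∞ := by
  unfold geo
  have e : ∀ j : ℕ, (2 : ℝ≥0∞) ^ (-(δ * j)) = ((2 : ℝ≥0∞) ^ (-δ)) ^ j := by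
    intro j
    rw [← ENNReal.rpow_natCast, ← ENNReal.rpow_mul]; congr 1; ring
  simp_rw [e]
  rw [ENNReal.tsum_geometric, ENNReal.inv_lt_top, tsub_pos_iff_lt]
  exact ENNReal.rpow_lt_one_of_one_lt_of_neg (by norm_num) (by linarith)

lemma two_add (a b : ℝ) : (2 : ℝ≥0∞) ^ (a + b) = 2 ^ a * 2 ^ b := ENNReal.rpow_add a b (by norm_num) (by norm_num)

lemma geo_fin (δ : ℝ) (k : ℕ) : ∑ j ∈ Finset.range (k + 1), (2 : ℝ≥0∞) ^ (-(δ * ((k : ℝ) - j))) ≤ geo δ := by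
  rw [← Finset.sum_range_reflect]
  refine le_trans (le_of_eq ?_) (ENNReal.sum_le_tsum (Finset.range (k + 1)))
  refine Finset.sum_congr rfl fun j hj => ?_
  have : j ≤ k := by simp at hj; omega
  congr 3
  rw [show k + 1 - 1 - j = k - j by omega]
  push_cast [this]; ring

lemma geo_abs (δ : ℝ) (hδ : 0 < δ) (j : ℕ) : ∑' k : ℕ, (2 : ℝ≥0∞) ^ (-(δ * |(j : ℝ) - k|)) ≤ 2 * geo δ := by
  rw [← Summable.sum_add_tsum_nat_add' (k := j + 1) ENNReal.summable, two_mul]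
  refine add_le_add ?_ ?_
  · refine le_trans (le_of_eq ?_) (geo_fin δ j)
    refine Finset.sum_congr rfl fun k hk => ?_
    have : k ≤ j := by simp at hk; omega
    rw [abs_of_nonneg]
    have : (k : ℝ) ≤ j := by exact_mod_cast this
    linarith
  · unfold geo
    refine ENNReal.tsum_le_tsum fun i => ?_
    refine ENNReal.rpow_le_rpow_of_exponent_le (by norm_num) ?_
    have : (i : ℝ) ≤ |(j : ℝ) - ((i + (j + 1) : ℕ) : ℝ)| := by
      push_cast
      rw [abs_sub_comm]
      refine le_trans ?_ (le_abs_self _)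
      linarith
    have := mul_le_mul_of_nonneg_left this hδ.le
    linarith

lemma half_point {q q1 : ℝ} (hq1 : 0 < q1) (hq : q1 < q) {X : ℕ → ℝ≥0∞} (hS : ∑' k, X k ≠ ∞) :
    (∑' k, X k) ^ q ≤ 2 ^ q * ∑' k, (∑ j ∈ Finset.range (k + 1), X j) ^ (q - q1) * (∑' j, X (j + k)) ^ q1 := by
  classical
  set S := ∑' k, X k with hSd
  rcases eq_or_ne S 0 with h0 | h0
  · rw [h0, ENNReal.zero_rpow_of_pos (by linarith)]; exact bot_le
  have hex : ∃ k, S ≤ 2 * ∑ j ∈ Finset.range (k + 1), X j := by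
    have h2 : S / 2 < S := ENNReal.half_lt_self h0 hS
    have h3 : S = ⨆ n, ∑ j ∈ Finset.range n, X j := ENNReal.tsum_eq_iSup_nat
    rw [h3] at h2
    rw [← h3] at h2
    nth_rewrite 2 [h3] at h2
    obtain ⟨n, hn⟩ := lt_iSup_iff.1 h2
    refine ⟨n, ?_⟩
    have h4 : S / 2 ≤ ∑ j ∈ Finset.range (n + 1), X j := hn.le.trans (Finset.sum_le_sum_of_subset (by simp))
    rw [mul_comm]
    exact (ENNReal.div_le_iff_le_mul (by norm_num) (by norm_num)).1 h4
  obtain ⟨k, hk1, hk2⟩ : ∃ k, S ≤ 2 * ∑ j ∈ Finset.range (k + 1), X j ∧ S ≤ 2 * ∑' j, X (j + k) := by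
    refine ⟨Nat.find hex, Nat.find_spec hex, ?_⟩
    rcases hk : Nat.find hex with _ | m
    · simp only [add_zero]
      rw [two_mul]; exact le_self_add
    · have h5 : ¬ (S ≤ 2 * ∑ j ∈ Finset.range (m + 1), X j) := Nat.find_min hex (by omega)
      push Not at h5
      have h6 : ∑ j ∈ Finset.range (m + 1), X j + ∑' j, X (j + (m + 1)) = S :=
        Summable.sum_add_tsum_nat_add' (k := m + 1) ENNReal.summable
      have h7 : ∑ j ∈ Finset.range (m + 1), X j ≠ ∞ := by
        intro h; rw [h] at h6; exact hS (by rw [← h6]; simp)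
      rw [two_mul] at h5 ⊢
      rw [← h6] at h5 ⊢
      have h8 := (ENNReal.add_lt_add_iff_left h7).1 h5
      gcongr
  calc S ^ q = S ^ (q - q1) * S ^ q1 := by
        rw [← ENNReal.rpow_add _ _ h0 hS]; congr 1; ring
    _ ≤ (2 * ∑ j ∈ Finset.range (k + 1), X j) ^ (q - q1) * (2 * ∑' j, X (j + k)) ^ q1 := by
        refine mul_le_mul' (ENNReal.rpow_le_rpow hk1 (by linarith)) (ENNReal.rpow_le_rpow hk2 hq1.le)
    _ = 2 ^ q * ((∑ j ∈ Finset.range (k + 1), X j) ^ (q - q1) * (∑' j, X (j + k)) ^ q1) := by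
        rw [ENNReal.mul_rpow_of_nonneg _ _ (by linarith), ENNReal.mul_rpow_of_nonneg _ _ hq1.le]
        rw [show (2 : ℝ≥0∞) ^ q = 2 ^ (q - q1) * 2 ^ q1 by rw [← two_add]; congr 1; ring]
        ring
    _ ≤ _ := mul_le_mul' le_rfl (ENNReal.le_tsum k)

set_option maxHeartbeats 1000000 in
lemma sum_lemma0 {β q q1 : ℝ} (hβ : 0 < β) (hq1 : 1 ≤ q1) (hq : q1 < q) : ∃ C : ℝ≥0∞, C ≠ ∞ ∧
    ∀ {α : Type} [MeasurableSpace α] (μ : Measure α) (X : ℕ → α → ℝ≥0∞) (c : ℕ → ℝ≥0∞), (∀ k, Measurable (X k)) →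
      (∀ k x, X k x ≤ 2 ^ (k * β) * c k) → (∀ k, ∫⁻ x, X k x ^ q1 ∂μ ≤ 2 ^ (k * (β * (q1 - q))) * c k ^ q1) →
      (∀ x, ∑' k, X k x ≠ ∞) → ∫⁻ x, (∑' k, X k x) ^ q ∂μ ≤ C * ∑' k, c k ^ q := by
  have hq0 : 0 < q := by linarith
  have hq10 : 0 < q1 := by linarith
  set γ := β * (q - q1) / q1 with hγ
  have hγ0 : 0 < γ := by rw [hγ]; have : 0 < q - q1 := by linarith
                         positivity
  obtain ⟨ε, hε, hεβ, hεγ⟩ : ∃ ε, 0 < ε ∧ ε < β ∧ ε < γ := ⟨min β γ / 2, by positivity,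
    by have := min_le_left β γ; linarith, by have := min_le_right β γ; linarith⟩
  have g1 : geo (β - ε) ≠ ∞ := (geo_lt_top (by linarith)).ne
  have g2 : geo (γ - ε) ≠ ∞ := (geo_lt_top (by linarith)).ne
  have g3 : geo (ε * q) ≠ ∞ := (geo_lt_top (by positivity)).ne
  refine ⟨2 ^ q * (geo (β - ε) ^ (q - q1) * geo (γ - ε) ^ q1 * (2 * geo (ε * q))), ?_, ?_⟩
  · have h1 : q - q1 ≠ 0 := by linarith
    exact ENNReal.mul_ne_top (by simp [hq0.le]) (ENNReal.mul_ne_top (ENNReal.mul_ne_top (ENNReal.rpow_ne_top_of_nonneg (by linarith) g1)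
      (ENNReal.rpow_ne_top_of_nonneg (by linarith) g2)) (ENNReal.mul_ne_top (by simp) g3))
  intro α _ μ X c hX hpt hInt hfin
  set E : ℕ → ℝ≥0∞ := fun k => ∑' j : ℕ, (2 : ℝ≥0∞) ^ (-(ε * q * |(j : ℝ) - k|)) * c j ^ q with hE
  set e : ℕ → ℝ≥0∞ := fun k => E k ^ (1 / q) with he
  have hce : ∀ j k : ℕ, c j ≤ 2 ^ (ε * |(j : ℝ) - k|) * e k := by
    intro j k
    have h1 : (2 : ℝ≥0∞) ^ (-(ε * q * |(j : ℝ) - k|)) * c j ^ q ≤ E k := ENNReal.le_tsum (f := fun j : ℕ => (2 : ℝ≥0∞) ^ (-(ε * q * |(j : ℝ) - k|)) * c j ^ q) j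
    have h2 : c j ^ q ≤ 2 ^ (ε * q * |(j : ℝ) - k|) * E k := by
      calc c j ^ q = 2 ^ (ε * q * |(j : ℝ) - k|) * ((2 : ℝ≥0∞) ^ (-(ε * q * |(j : ℝ) - k|)) * c j ^ q) := by
            rw [← mul_assoc, ← two_add, add_neg_cancel, ENNReal.rpow_zero, one_mul]
        _ ≤ _ := by gcongr
    have h3 := ENNReal.rpow_le_rpow h2 (z := 1 / q) (by positivity)
    rw [ENNReal.mul_rpow_of_nonneg _ _ (by positivity), ← ENNReal.rpow_mul, ← ENNReal.rpow_mul, mul_one_div_cancel hq0.ne', ENNReal.rpow_one] at h3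
    refine h3.trans (le_of_eq ?_)
    congr 2; field_simp
  have hlow : ∀ k x, ∑ j ∈ Finset.range (k + 1), X j x ≤ geo (β - ε) * (2 ^ (k * β) * e k) := by
    intro k x
    calc _ ≤ ∑ j ∈ Finset.range (k + 1), (2 : ℝ≥0∞) ^ (-((β - ε) * ((k : ℝ) - j))) * (2 ^ (k * β) * e k) := by
          refine Finset.sum_le_sum fun j hj => (hpt j x).trans ?_
          refine (mul_le_mul' le_rfl (hce j k)).trans (le_of_eq ?_)
          have : (j : ℝ) ≤ k := by simp at hj; exact_mod_cast (by omega : j ≤ k)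
          rw [← mul_assoc, ← mul_assoc, ← two_add, ← two_add, abs_sub_comm, abs_of_nonneg (by linarith)]
          congr 2; ring
      _ ≤ _ := by
          rw [← Finset.sum_mul]; gcongr; exact geo_fin _ _
  have hhigh : ∀ k, ∫⁻ x, (∑' j, X (j + k) x) ^ q1 ∂μ ≤ geo (γ - ε) ^ q1 * (2 ^ (k * (β * (q1 - q))) * e k ^ q1) := by
    intro k
    have h1 : ∀ j, nv μ (1 / q1) (X j) ≤ 2 ^ (-(j * γ)) * c j := by
      intro j
      unfold nv
      rw [one_div_one_div]
      refine (ENNReal.rpow_le_rpow (hInt j) (by positivity)).trans (le_of_eq ?_)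
      rw [ENNReal.mul_rpow_of_nonneg _ _ (by positivity), ← ENNReal.rpow_mul, ← ENNReal.rpow_mul, mul_one_div_cancel hq10.ne', ENNReal.rpow_one]
      congr 2; rw [hγ]; field_simp; ring
    have h2 := nv_tsum (μ := μ) (v := 1 / q1) (by positivity) (by rw [div_le_one hq10]; exact hq1) (g := fun j => X (j + k)) (fun j => hX _)
    have h3 : ∑' j, nv μ (1 / q1) (X (j + k)) ≤ geo (γ - ε) * (2 ^ (-(k * γ)) * e k) := by
      unfold geo
      rw [← ENNReal.tsum_mul_right]
      refine ENNReal.tsum_le_tsum fun j => (h1 (j + k)).trans ?_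
      refine (mul_le_mul' le_rfl (hce (j + k) k)).trans (le_of_eq ?_)
      push_cast
      rw [← mul_assoc, ← mul_assoc, ← two_add, ← two_add, add_sub_cancel_right, abs_of_nonneg (by positivity)]
      congr 2; ring
    have h4 := ENNReal.rpow_le_rpow (h2.trans h3) hq10.le
    unfold nv at h4
    rw [← ENNReal.rpow_mul, one_div_mul_cancel hq10.ne', ENNReal.rpow_one, one_div_one_div, ENNReal.mul_rpow_of_nonneg _ _ hq10.le,
      ENNReal.mul_rpow_of_nonneg _ _ hq10.le, ← ENNReal.rpow_mul] at h4
    refine h4.trans (le_of_eq ?_)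
    congr 3; rw [hγ]; field_simp; ring
  have hm : ∀ k, Measurable fun x => (∑ j ∈ Finset.range (k + 1), X j x) ^ (q - q1) * (∑' j, X (j + k) x) ^ q1 := by
    intro k
    have h1 : Measurable fun x => ∑ j ∈ Finset.range (k + 1), X j x := Finset.measurable_sum _ fun j _ => hX j
    have h2 : Measurable fun x => ∑' j, X (j + k) x := Measurable.ennreal_tsum fun j => hX _
    fun_prop
  calc _ ≤ ∫⁻ x, 2 ^ q * ∑' k, (∑ j ∈ Finset.range (k + 1), X j x) ^ (q - q1) * (∑' j, X (j + k) x) ^ q1 ∂μ :=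
        lintegral_mono fun x => half_point hq10 hq (hfin x)
    _ = 2 ^ q * ∑' k, ∫⁻ x, (∑ j ∈ Finset.range (k + 1), X j x) ^ (q - q1) * (∑' j, X (j + k) x) ^ q1 ∂μ := by
        rw [lintegral_const_mul _ (Measurable.ennreal_tsum hm), lintegral_tsum fun k => (hm k).aemeasurable]
    _ ≤ 2 ^ q * ∑' k, geo (β - ε) ^ (q - q1) * geo (γ - ε) ^ q1 * E k := by
        refine mul_le_mul' le_rfl (ENNReal.tsum_le_tsum fun k => ?_)
        have h2 : Measurable fun x => ∑' j, X (j + k) x := Measurable.ennreal_tsum fun j => hX _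
        calc _ ≤ ∫⁻ x, (geo (β - ε) * (2 ^ (k * β) * e k)) ^ (q - q1) * (∑' j, X (j + k) x) ^ q1 ∂μ := by
              refine lintegral_mono fun x => mul_le_mul' (ENNReal.rpow_le_rpow (hlow k x) (by linarith)) le_rfl
          _ ≤ (geo (β - ε) * (2 ^ (k * β) * e k)) ^ (q - q1) * (geo (γ - ε) ^ q1 * (2 ^ (k * (β * (q1 - q))) * e k ^ q1)) := by
              rw [lintegral_const_mul _ (by fun_prop)]
              exact mul_le_mul' le_rfl (hhigh k)
          _ = geo (β - ε) ^ (q - q1) * geo (γ - ε) ^ q1 * ((2 ^ (k * β * (q - q1)) * 2 ^ (k * (β * (q1 - q)))) * (e k ^ (q - q1) * e k ^ q1)) := by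
              rw [ENNReal.mul_rpow_of_nonneg _ _ (by linarith), ENNReal.mul_rpow_of_nonneg _ _ (by linarith), ← ENNReal.rpow_mul]
              ring
          _ = _ := by
              rw [← two_add, ← ENNReal.rpow_add_of_nonneg _ _ (by linarith) (by linarith), he]
              dsimp only
              rw [← ENNReal.rpow_mul, show k * β * (q - q1) + k * (β * (q1 - q)) = 0 by ring, show 1 / q * (q - q1 + q1) = 1 by field_simp; ring]
              simp
    _ ≤ _ := by
        rw [ENNReal.tsum_mul_left, mul_assoc (2 ^ q), mul_assoc (geo _ ^ (q - q1) * _)]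
        refine mul_le_mul' le_rfl (mul_le_mul' le_rfl ?_)
        rw [hE, ENNReal.tsum_comm, ← ENNReal.tsum_mul_left]
        refine ENNReal.tsum_le_tsum fun j => ?_
        rw [ENNReal.tsum_mul_right]
        exact mul_le_mul' (geo_abs _ (by positivity) j) le_rfl

lemma sum_lemma {β q q1 : ℝ} (hβ : 0 < β) (hq1 : 1 ≤ q1) (hq : q1 < q) : ∃ C : ℝ≥0∞, C ≠ ∞ ∧
    ∀ {α : Type} [MeasurableSpace α] (μ : Measure α) (X : ℕ → α → ℝ≥0∞) (c : ℕ → ℝ≥0∞), (∀ k, Measurable (X k)) →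
      (∀ k x, X k x ≤ 2 ^ (k * β) * c k) → (∀ k, ∫⁻ x, X k x ^ q1 ∂μ ≤ 2 ^ (k * (β * (q1 - q))) * c k ^ q1) →
      (∀ k, c k ≠ ∞) → ∫⁻ x, (∑' k, X k x) ^ q ∂μ ≤ C * ∑' k, c k ^ q := by
  obtain ⟨C, hC, h⟩ := sum_lemma0 hβ hq1 hq
  refine ⟨C, hC, fun {α} _ μ X c hX hpt hInt hc => ?_⟩
  have key : ∀ n : ℕ, ∫⁻ x, (∑ k ∈ Finset.range n, X k x) ^ q ∂μ ≤ C * ∑' k, c k ^ q := by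
    intro n
    have e : ∀ x, ∑' k, (if k < n then X k x else 0) = ∑ k ∈ Finset.range n, X k x := by
      intro x
      rw [tsum_eq_sum (s := Finset.range n) (by intro b hb; simp at hb; simp [hb])]
      exact Finset.sum_congr rfl fun k hk => if_pos (by simpa using hk)
    have := h μ (fun k x => if k < n then X k x else 0) c (fun k => by split_ifs <;> [exact hX k; exact measurable_const])
      (fun k x => by split_ifs; exacts [hpt k x, bot_le])
      (fun k => by
        split_ifs
        · exact hInt k
        · rw [ENNReal.zero_rpow_of_pos (by linarith)]; simp)
      (fun x => by
        rw [e]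
        refine (ENNReal.sum_lt_top.2 fun k _ => (hpt k x).trans_lt (ENNReal.mul_lt_top (ENNReal.rpow_lt_top_of_nonneg (by positivity) (by norm_num))
          (hc k).lt_top)).ne)
    simp_rw [e] at this
    exact this
  have e1 : ∀ h : ℕ → ℝ≥0∞, (⨆ i, h i) ^ q = ⨆ i, h i ^ q := fun h => (ENNReal.orderIsoRpow q (by linarith)).map_iSup h
  simp_rw [ENNReal.tsum_eq_iSup_nat (f := fun k => X k _), e1]
  rw [lintegral_iSup]
  · exact iSup_le key
  · intro n
    have := Finset.measurable_sum (Finset.range n) fun j _ => hX j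
    fun_prop
  · intro n m hnm x
    exact ENNReal.rpow_le_rpow (Finset.sum_le_sum_of_subset (by simpa using hnm)) (by linarith)

/-- the sum of the variations of the pieces -/
def gS {d : ℕ} [NeZero d] (r : ℝ) (f : Euc d → ℂ) (x : Euc d) : ℝ≥0∞ := ∑' k, gk r f k x

lemma gS_meas {d : ℕ} [NeZero d] {r : ℝ} (hr : 1 ≤ r) {f : Euc d → ℂ} (hf : Integrable f) : Measurable (gS r f) :=
  Measurable.ennreal_tsum fun k => gk_meas hr hf k

/-- interpolation type estimate -/
def Est (d : ℕ) [NeZero d] (r θ v : ℝ) : Prop := ∃ C : ℝ≥0∞, C ≠ ∞ ∧ ∀ f : Euc d → ℂ, Measurable f → Integrable f → ∫⁻ x, ‖f x‖ₑ ^ 2 ≠ ∞ →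
  nv volume v (gS r f) ≤ C * ((∫⁻ x, ‖f x‖ₑ) ^ (1 - θ) * (∫⁻ x, ‖f x‖ₑ ^ 2) ^ (θ / 2))

lemma ofReal_two_pow (k : ℕ) (a : ℝ) : ENNReal.ofReal (((2 : ℝ) ^ k) ^ a) = 2 ^ (k * a) := by
  rw [← Real.rpow_natCast, ← Real.rpow_mul (by norm_num), ← ENNReal.ofReal_rpow_of_pos (by norm_num)]
  simp

lemma tsum_rpow_le {p : ℝ} (hp : 1 ≤ p) (a : ℕ → ℝ≥0∞) : ∑' k, a k ^ p ≤ (∑' k, a k) ^ p := by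
  have e : ∀ x : ℝ≥0∞, x ^ p = x * x ^ (p - 1) := by
    intro x
    have := ENNReal.rpow_add_of_nonneg (x := x) 1 (p - 1) (by norm_num) (by linarith)
    rw [ENNReal.rpow_one] at this
    rw [← this]; congr 1; ring
  rw [e (∑' k, a k), ← ENNReal.tsum_mul_right]
  refine ENNReal.tsum_le_tsum fun k => ?_
  rw [e]
  exact mul_le_mul' le_rfl (ENNReal.rpow_le_rpow (ENNReal.le_tsum k) (by linarith))

lemma sk_meas {d : ℕ} [NeZero d] {f : Euc d → ℂ} (hf : Integrable f) (k : ℕ) : Measurable (sk f k) :=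
  (ak_meas hf false k).add (ak_meas hf true k)

set_option maxHeartbeats 1000000 in
lemma estA (d : ℕ) [NeZero d] (hd : 2 ≤ d) {r θ : ℝ} (hr : 1 ≤ r) (h0 : 0 < θ) (h1 : θ ≤ 1) (h : r * (1 - θ / 2) ≤ 1)
    (hq : 2 * (((d : ℝ) + 1) / ((d : ℝ) - 1)) < θ * (r * d)) : Est d r θ (1 / (r * d)) := by
  have hd' : (2 : ℝ) ≤ d := by exact_mod_cast hd
  have hr0 : 0 < r := by linarith
  set q := r * d with hqd
  set Q := 2 * (((d : ℝ) + 1) / ((d : ℝ) - 1)) / θ with hQ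
  have hQ2 : 2 ≤ Q := by
    rw [hQ, le_div_iff₀ h0]
    have : 1 ≤ ((d : ℝ) + 1) / ((d : ℝ) - 1) := by rw [le_div_iff₀ (by linarith)]; linarith
    nlinarith
  have hQq : Q < q := by rw [hQ, div_lt_iff₀ h0]; linarith
  set q1 := (Q + q) / 2 with hq1
  have hq1a : Q < q1 := by rw [hq1]; linarith
  have hq1b : q1 < q := by rw [hq1]; linarith
  set s := θ * q1 / 2 with hs
  have hs1 : ((d : ℝ) + 1) / ((d : ℝ) - 1) < s := by
    rw [hQ, div_lt_iff₀ h0] at hq1a; rw [hs]; linarith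
  have hs2 : 1 ≤ s := by
    have : 1 ≤ ((d : ℝ) + 1) / ((d : ℝ) - 1) := by rw [le_div_iff₀ (by linarith)]; linarith
    linarith
  obtain ⟨C, hC, hgk⟩ := gk_le d hr h0.le h1 h
  obtain ⟨C1, hC1, hpt⟩ := ak_point d
  obtain ⟨C2, hC2, hst⟩ := ak_strong d hd s hs1
  obtain ⟨C3, hC3, hsum⟩ := sum_lemma (β := 1 / r) (q := q) (q1 := q1) (by positivity) (by linarith) hq1b
  set B : ℝ≥0∞ := 1 + 2 ^ s * ENNReal.ofReal C2 + (2 * ENNReal.ofReal C1) ^ (θ / 2) with hB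
  have hBt : B ≠ ∞ := by
    rw [hB]
    refine ENNReal.add_ne_top.2 ⟨ENNReal.add_ne_top.2 ⟨by simp, ENNReal.mul_ne_top ?_ (by simp)⟩, ?_⟩
    · exact ENNReal.rpow_ne_top_of_nonneg (by linarith) (by simp)
    · exact ENNReal.rpow_ne_top_of_nonneg (by linarith) (ENNReal.mul_ne_top (by simp) (by simp))
  set A := ENNReal.ofReal C * B with hA
  have hAt : A ≠ ∞ := ENNReal.mul_ne_top (by simp) hBt
  have hq0 : 0 < q := by linarith
  refine ⟨C3 ^ (1 / q) * A, ENNReal.mul_ne_top (ENNReal.rpow_ne_top_of_nonneg (by positivity) hC3) hAt, fun f hfm hf hf2 => ?_⟩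
  set L := ∫⁻ x, ‖f x‖ₑ with hL
  have hLt : L ≠ ∞ := hf.2.ne
  have hbs := bk_sum hf
  have hbt : ∀ k, bk f k ≠ ∞ := fun k => ((ENNReal.le_tsum k).trans hbs).trans_lt hf2.lt_top |>.ne
  have H := hsum (volume : Measure (Euc d)) (gk r f) (fun k => A * L ^ (1 - θ) * bk f k ^ (θ / 2)) (fun k => gk_meas hr hf k) ?_ ?_ ?_
  · have e : ∀ k, (A * L ^ (1 - θ) * bk f k ^ (θ / 2)) ^ q = (A * L ^ (1 - θ)) ^ q * bk f k ^ (θ * q / 2) := by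
      intro k
      rw [ENNReal.mul_rpow_of_nonneg _ _ hq0.le, ← ENNReal.rpow_mul (bk f k)]; congr 2; ring
    simp_rw [e] at H
    rw [ENNReal.tsum_mul_left] at H
    have hp : 1 ≤ θ * q / 2 := by nlinarith
    have H2 := H.trans (mul_le_mul' le_rfl (mul_le_mul' le_rfl ((tsum_rpow_le hp _).trans (ENNReal.rpow_le_rpow hbs (by linarith)))))
    have H3 := ENNReal.rpow_le_rpow H2 (z := 1 / q) (by positivity)
    unfold nv gS
    rw [one_div_one_div]
    refine H3.trans (le_of_eq ?_)
    rw [ENNReal.mul_rpow_of_nonneg _ _ (by positivity), ENNReal.mul_rpow_of_nonneg _ _ (by positivity), ← ENNReal.rpow_mul, ← ENNReal.rpow_mul,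
      mul_one_div_cancel hq0.ne', ENNReal.rpow_one, show θ * q / 2 * (1 / q) = θ / 2 by field_simp]
    ring
  · intro k x
    refine (hgk f hfm hf k x).trans ?_
    have hsk : sk f k x ≤ 2 * ENNReal.ofReal C1 * bk f k := by
      unfold sk
      refine (add_le_add (hpt f hf _ _ _) (hpt f hf _ _ _)).trans (le_of_eq (by ring))
    rw [ENNReal.ofReal_mul hC.le, ofReal_two_pow]
    calc _ ≤ ENNReal.ofReal C * 2 ^ (k * (1 / r)) * L ^ (1 - θ) * (2 * ENNReal.ofReal C1 * bk f k) ^ (θ / 2) := by gcongr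
      _ = 2 ^ (k * (1 / r)) * (ENNReal.ofReal C * (2 * ENNReal.ofReal C1) ^ (θ / 2) * L ^ (1 - θ) * bk f k ^ (θ / 2)) := by
        rw [ENNReal.mul_rpow_of_nonneg _ _ (by positivity)]; ring
      _ ≤ _ := by
        refine mul_le_mul' le_rfl (mul_le_mul' (mul_le_mul' ?_ le_rfl) le_rfl)
        rw [hA, hB]
        exact mul_le_mul' le_rfl le_add_self
  · intro k
    have hsm := sk_meas hf k
    have hsk : ∫⁻ x, sk f k x ^ s ≤ 2 ^ s * (ENNReal.ofReal C2 * 2 ^ (k * (-(d : ℝ))) * bk f k ^ s) := by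
      have hm0 := ak_meas hf false k
      have hm1 := ak_meas hf true k
      calc _ ≤ ∫⁻ x, 2 ^ (s - 1) * (ak f false k x ^ s + ak f true k x ^ s) :=
            lintegral_mono fun x => ENNReal.rpow_add_le_mul_rpow_add_rpow _ _ hs2
        _ ≤ 2 ^ (s - 1) * (2 * (ENNReal.ofReal C2 * 2 ^ (k * (-(d : ℝ))) * bk f k ^ s)) := by
            rw [lintegral_const_mul _ (by fun_prop), lintegral_add_left (by fun_prop), two_mul]
            refine mul_le_mul' le_rfl (add_le_add ?_ ?_)
            all_goals
              refine (hst f hf _ k).trans (le_of_eq ?_)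
              rw [ENNReal.ofReal_mul hC2.le, ofReal_two_pow]
        _ = _ := by
            rw [← mul_assoc]
            congr 1
            nth_rewrite 2 [← ENNReal.rpow_one 2]
            rw [← two_add]; congr 1; ring
    calc _ ≤ ∫⁻ x, (ENNReal.ofReal (C * (2 ^ k) ^ (1 / r)) * L ^ (1 - θ)) ^ q1 * sk f k x ^ s := by
          refine lintegral_mono fun x => ?_
          refine (ENNReal.rpow_le_rpow (hgk f hfm hf k x) (by linarith)).trans (le_of_eq ?_)
          rw [ENNReal.mul_rpow_of_nonneg _ _ (by linarith), ← ENNReal.rpow_mul (sk f k x)]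
          congr 2; rw [hs]; ring
      _ ≤ (ENNReal.ofReal (C * (2 ^ k) ^ (1 / r)) * L ^ (1 - θ)) ^ q1 * (2 ^ s * (ENNReal.ofReal C2 * 2 ^ (k * (-(d : ℝ))) * bk f k ^ s)) := by
          rw [lintegral_const_mul _ (by fun_prop)]
          exact mul_le_mul' le_rfl hsk
      _ = (2 ^ (k * (1 / r) * q1) * 2 ^ (k * (-(d : ℝ)))) * (ENNReal.ofReal C ^ q1 * (2 ^ s * ENNReal.ofReal C2) * (L ^ (1 - θ)) ^ q1 * bk f k ^ s) := by
          rw [ENNReal.ofReal_mul hC.le, ofReal_two_pow, ENNReal.mul_rpow_of_nonneg _ _ (by linarith), ENNReal.mul_rpow_of_nonneg _ _ (by linarith),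
            ← ENNReal.rpow_mul 2]
          ring
      _ ≤ _ := by
          rw [← two_add, ENNReal.mul_rpow_of_nonneg _ _ (by linarith), ENNReal.mul_rpow_of_nonneg _ _ (by linarith), ← ENNReal.rpow_mul (bk f k),
            hA, ENNReal.mul_rpow_of_nonneg _ _ (by linarith), show θ / 2 * q1 = s by rw [hs]; ring,
            show (k : ℝ) * (1 / r) * q1 + k * (-(d : ℝ)) = k * (1 / r * (q1 - q)) by rw [hqd]; field_simp; ring]
          refine mul_le_mul' le_rfl (mul_le_mul' (mul_le_mul' (mul_le_mul' le_rfl ?_) le_rfl) le_rfl)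
          have hB1 : 1 ≤ B := by rw [hB, add_assoc]; exact le_self_add
          calc _ ≤ B := by rw [hB, add_comm 1, add_assoc]; exact le_self_add
            _ = B ^ (1 : ℝ) := (ENNReal.rpow_one _).symm
            _ ≤ _ := ENNReal.rpow_le_rpow_of_exponent_le hB1 (by linarith)
  · intro k
    exact ENNReal.mul_ne_top (ENNReal.mul_ne_top hAt (ENNReal.rpow_ne_top_of_nonneg (by linarith) hLt))
      (ENNReal.rpow_ne_top_of_nonneg (by linarith) (hbt k))

lemma estB (d : ℕ) [NeZero d] (hd : 2 ≤ d) {r v : ℝ} (hr : 1 ≤ r) (h0 : 1 / (r * ((d : ℝ) - 1)) < v) (h1 : v ≤ 1 / 2) (h : r * (1 - v) ≤ 1) :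
    Est d r (2 * v) v := by
  have hd' : (2 : ℝ) ≤ d := by exact_mod_cast hd
  have hr0 : 0 < r := by linarith
  have hd1 : 0 < (d : ℝ) - 1 := by linarith
  have hv0 : 0 < v := lt_trans (by positivity) h0
  obtain ⟨C, hC, hgk⟩ := gk_le d (θ := 2 * v) hr (by linarith) (by linarith) (by rw [mul_div_cancel_left₀ _ (by norm_num)]; exact h)
  obtain ⟨C1, hC1, hl2⟩ := ak_L2 d
  set δ := (d - 1) * v - 1 / r with hδ
  have hδ0 : 0 < δ := by
    rw [div_lt_iff₀ (by positivity)] at h0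
    rw [hδ, sub_pos, div_lt_iff₀ hr0]; linarith
  refine ⟨ENNReal.ofReal C * (2 * ENNReal.ofReal C1) ^ v * geo δ, ?_, fun f hfm hf hf2 => ?_⟩
  · exact ENNReal.mul_ne_top (ENNReal.mul_ne_top (by simp) (ENNReal.rpow_ne_top_of_nonneg hv0.le (ENNReal.mul_ne_top (by simp) (by simp))))
      (geo_lt_top hδ0).ne
  set L := ∫⁻ x, ‖f x‖ₑ with hL
  have hbs := bk_sum hf
  have hbt : ∀ k, bk f k ≤ ∫⁻ x, ‖f x‖ₑ ^ 2 := fun k => (ENNReal.le_tsum k).trans hbs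
  have key : ∀ k, nv volume v (gk r f k) ≤ (ENNReal.ofReal C * (2 * ENNReal.ofReal C1) ^ v * L ^ (1 - 2 * v) * (∫⁻ x, ‖f x‖ₑ ^ 2) ^ v) * 2 ^ (-(δ * k)) := by
    intro k
    have hsm := sk_meas hf k
    have hsk : ∫⁻ x, sk f k x ≤ 2 * ENNReal.ofReal C1 * 2 ^ (k * (-((d : ℝ) - 1))) * (∫⁻ x, ‖f x‖ₑ ^ 2) := by
      unfold sk
      rw [lintegral_add_left (ak_meas hf false k)]
      refine (add_le_add (hl2 f hf _ k) (hl2 f hf _ k)).trans ?_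
      rw [← two_mul, div_eq_mul_inv, ENNReal.ofReal_mul hC1.le, ← mul_assoc, ← mul_assoc]
      refine mul_le_mul' (mul_le_mul' le_rfl ?_) (hbt k)
      rw [← ofReal_two_pow, Real.rpow_neg (by positivity), ← Real.rpow_natCast]
      push_cast [show 1 ≤ d by omega]
      exact le_rfl
    calc _ ≤ nv volume v (fun x => (ENNReal.ofReal (C * (2 ^ k) ^ (1 / r)) * L ^ (1 - 2 * v)) * sk f k x ^ v) := by
          refine nv_mono hv0 fun x => (hgk f hfm hf k x).trans (le_of_eq ?_)
          congr 2; ring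
      _ = (ENNReal.ofReal (C * (2 ^ k) ^ (1 / r)) * L ^ (1 - 2 * v)) * (∫⁻ x, sk f k x) ^ v := by
          rw [nv_const_mul hv0 (by fun_prop)]
          unfold nv
          simp_rw [← ENNReal.rpow_mul, mul_one_div_cancel hv0.ne', ENNReal.rpow_one]
      _ ≤ _ := mul_le_mul' le_rfl (ENNReal.rpow_le_rpow hsk hv0.le)
      _ = _ := by
          rw [ENNReal.ofReal_mul hC.le, ofReal_two_pow, ENNReal.mul_rpow_of_nonneg _ _ hv0.le, ENNReal.mul_rpow_of_nonneg _ _ hv0.le, ← ENNReal.rpow_mul 2,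
            show -(δ * k) = k * (1 / r) + k * (-((d : ℝ) - 1)) * v by rw [hδ]; ring, two_add]
          ring
  calc _ ≤ ∑' k, nv volume v (gk r f k) := nv_tsum hv0 (by linarith) fun k => gk_meas hr hf k
    _ ≤ _ := ENNReal.tsum_le_tsum key
    _ = _ := by
        rw [ENNReal.tsum_mul_left, geo, mul_div_cancel_left₀ _ (by norm_num : (2 : ℝ) ≠ 0)]; ring

lemma est_interp {d : ℕ} [NeZero d] {r θ0 θ1 v0 v1 l : ℝ} (hr : 1 ≤ r) (h0 : 0 < v0) (h1 : 0 < v1) (l0 : 0 ≤ l) (l1 : l ≤ 1)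
    (t0 : 0 ≤ θ0) (t0' : θ0 ≤ 1) (t1 : 0 ≤ θ1) (t1' : θ1 ≤ 1)
    (H0 : Est d r θ0 v0) (H1 : Est d r θ1 v1) : Est d r ((1 - l) * θ0 + l * θ1) ((1 - l) * v0 + l * v1) := by
  obtain ⟨C0, hC0, H0⟩ := H0
  obtain ⟨C1, hC1, H1⟩ := H1
  have hl : 0 ≤ 1 - l := by linarith
  refine ⟨C0 ^ (1 - l) * C1 ^ l, ENNReal.mul_ne_top (ENNReal.rpow_ne_top_of_nonneg hl hC0) (ENNReal.rpow_ne_top_of_nonneg l0 hC1), fun f hfm hf hf2 => ?_⟩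
  refine (nv_interp h0 h1 l0 l1 (gS_meas hr hf)).trans ?_
  refine (mul_le_mul' (ENNReal.rpow_le_rpow (H0 f hfm hf hf2) hl) (ENNReal.rpow_le_rpow (H1 f hfm hf hf2) l0)).trans (le_of_eq ?_)
  set L := ∫⁻ x, ‖f x‖ₑ
  set M := ∫⁻ x, ‖f x‖ₑ ^ 2
  have e1 : L ^ (1 - ((1 - l) * θ0 + l * θ1)) = L ^ ((1 - θ0) * (1 - l)) * L ^ ((1 - θ1) * l) := by
    rw [← ENNReal.rpow_add_of_nonneg _ _ (mul_nonneg (by linarith) hl) (mul_nonneg (by linarith) l0)]; congr 1; ring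
  have e2 : M ^ (((1 - l) * θ0 + l * θ1) / 2) = M ^ (θ0 / 2 * (1 - l)) * M ^ (θ1 / 2 * l) := by
    rw [← ENNReal.rpow_add_of_nonneg _ _ (mul_nonneg (by linarith) hl) (mul_nonneg (by linarith) l0)]; congr 1; ring
  rw [e1, e2]
  simp_rw [ENNReal.mul_rpow_of_nonneg _ _ hl, ENNReal.mul_rpow_of_nonneg _ _ l0, ← ENNReal.rpow_mul]
  ring

/-- level sets -/
def lev {d : ℕ} (f : Euc d → ℂ) (M : ℝ) (j : ℤ) : Set (Euc d) := {x | ‖f x‖ / M ∈ Ico ((2 : ℝ) ^ j) (2 ^ (j + 1))}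

/-- level pieces -/
def levf {d : ℕ} (f : Euc d → ℂ) (M : ℝ) (j : ℤ) : Euc d → ℂ := (lev f M j).indicator f

lemma lev_meas {d : ℕ} {f : Euc d → ℂ} (hf : Measurable f) (M : ℝ) (j : ℤ) : MeasurableSet (lev f M j) :=
  measurableSet_Ico.preimage (by fun_prop)

lemma lev_disj {d : ℕ} (f : Euc d → ℂ) (M : ℝ) : Pairwise (Function.onFun Disjoint (lev f M)) := by
  intro i j hij
  rw [Function.onFun, Set.disjoint_left]
  intro x hi hj
  have h1 := hi.1.trans_lt hj.2
  have h2 := hj.1.trans_lt hi.2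
  rw [zpow_lt_zpow_iff_right₀ (by norm_num)] at h1 h2
  omega

lemma lev_union {d : ℕ} (f : Euc d → ℂ) {M : ℝ} (hM : 0 < M) {x : Euc d} (hx : x ∉ ⋃ j, lev f M j) : f x = 0 := by
  by_contra h
  obtain ⟨n, hn⟩ := exists_mem_Ico_zpow (x := ‖f x‖ / M) (y := 2) (by have := norm_pos_iff.2 h; positivity) (by norm_num)
  exact hx (mem_iUnion.2 ⟨n, hn⟩)

lemma lev_hasSum {d : ℕ} {f : Euc d → ℂ} (hfm : Measurable f) {M : ℝ} (hM : 0 < M) {E : Type*} [NormedAddCommGroup E] [NormedSpace ℝ E]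
    {g : Euc d → E} (hg : Integrable g) (hfg : ∀ x, f x = 0 → g x = 0) :
    HasSum (fun j => ∫ x in lev f M j, g x) (∫ x, g x) := by
  have := hasSum_integral_iUnion (fun j => lev_meas hfm M j) (lev_disj f M) (hg.integrableOn (s := ⋃ j, lev f M j))
  rwa [setIntegral_eq_integral_of_forall_compl_eq_zero (fun x hx => hfg x (lev_union f hM hx))] at this

lemma levf_ft {d : ℕ} {f : Euc d → ℂ} (hfm : Measurable f) (hf : Integrable f) {M : ℝ} (hM : 0 < M) (ξ : Euc d) :
    HasSum (fun j => ft (levf f M j) ξ) (ft f ξ) := by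
  have := lev_hasSum hfm hM (ee_mul_int hf (g := fun y => -inner ℝ y ξ) (by fun_prop)) (fun x hx => by simp [hx])
  have e : (fun j => ft (levf f M j) ξ) = fun j => ∫ x in lev f M j, f x * ee (-inner ℝ x ξ) := by
    funext j
    unfold ft levf
    rw [← integral_indicator (lev_meas hfm M j)]
    congr 1; ext y
    by_cases hy : y ∈ lev f M j <;> simp [hy]
  rw [e]; exact this

lemma levf_int {d : ℕ} {f : Euc d → ℂ} (hfm : Measurable f) (hf : Integrable f) (M : ℝ) (j : ℤ) : Integrable (levf f M j) :=
  hf.indicator (lev_meas hfm M j)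

lemma levf_summ {d : ℕ} {f : Euc d → ℂ} (hfm : Measurable f) (hf : Integrable f) {M : ℝ} (hM : 0 < M) :
    Summable (fun j => ∫ x, ‖levf f M j x‖) := by
  have := (lev_hasSum hfm hM hf.norm (fun x hx => by simp [hx])).summable
  refine this.congr fun j => ?_
  rw [← integral_indicator (lev_meas hfm M j)]
  congr 1; ext y
  unfold levf
  by_cases hy : y ∈ lev f M j <;> simp [hy]

lemma levf_pk {d : ℕ} [NeZero d] {f : Euc d → ℂ} (hfm : Measurable f) (hf : Integrable f) {M : ℝ} (hM : 0 < M) (i : Bool) (k : ℕ) (x : Euc d) (t : ℝ) :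
    HasSum (fun j => pk (levf f M j) i k x t) (pk f i k x t) := by
  have h := fun j => opH_k (levf_int hfm hf M j) i k
  have H := hasSum_integral_of_summable_integral_norm (μ := (volume : Measure (Euc d)))
    (F := fun j ξ => (ft (levf f M j) ξ * ((Wk d i k ‖ξ‖ * mf d i (2 * Real.pi * (t * ‖ξ‖)) : ℝ) : ℂ)) * ee (inner ℝ x ξ))
    (fun j => ee_mul_int ((h j).int t) (by fun_prop)) ?_
  · have e : pk f i k x t = ∫ ξ : Euc d, ∑' j, (ft (levf f M j) ξ * ((Wk d i k ‖ξ‖ * mf d i (2 * Real.pi * (t * ‖ξ‖)) : ℝ) : ℂ)) * ee (inner ℝ x ξ) := by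
      unfold pk opA
      congr 1; ext ξ
      exact (((levf_ft hfm hf hM ξ).mul_right _).mul_right _).tsum_eq.symm
    rw [e]; exact H
  · refine Summable.of_nonneg_of_le (fun j => integral_nonneg fun _ => norm_nonneg _) (fun j => ?_)
      ((levf_summ hfm hf hM).mul_right (∫ ξ : Euc d, ‖Wk d i k ‖ξ‖‖))
    rw [← integral_const_mul]
    refine integral_mono (ee_mul_int ((h j).int t) (by fun_prop)).norm ((h j).Wi.norm.const_mul _) fun ξ => ?_
    dsimp only
    rw [norm_mul, norm_ee, mul_one]
    exact (h j).bound (ft_bound _) t ξ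

lemma gS_lev {d : ℕ} [NeZero d] {r : ℝ} (hr : 1 ≤ r) {f : Euc d → ℂ} (hfm : Measurable f) (hf : Integrable f) {M : ℝ} (hM : 0 < M) (x : Euc d) :
    gS r f x ≤ ∑' j, gS r (levf f M j) x := by
  unfold gS
  rw [ENNReal.tsum_comm]
  exact ENNReal.tsum_le_tsum fun k => rVar_hasSum hr fun t _ => levf_pk hfm hf hM false k x t

set_option maxHeartbeats 1000000 in
lemma levf_term {d : ℕ} {f : Euc d → ℂ} (hfm : Measurable f) {M : ℝ} (hM : 0 < M) {u : ℝ} (hu : 0 < u)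
    (hN : nv volume u (fun x => ‖f x‖ₑ) ≤ ENNReal.ofReal M) (j : ℤ) {θ : ℝ} (t0 : 0 ≤ θ) (t1 : θ ≤ 1) :
    (∫⁻ x, ‖levf f M j x‖ₑ) ^ (1 - θ) * (∫⁻ x, ‖levf f M j x‖ₑ ^ 2) ^ (θ / 2) ≤
      2 * ENNReal.ofReal M * 2 ^ (j * (1 - (1 - θ / 2) / u)) := by
  set m := ENNReal.ofReal M with hm
  have hm0 : m ≠ 0 := by rw [hm]; simpa using hM
  have hmt : m ≠ ∞ := by simp [hm]
  set E := volume (lev f M j) with hE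
  have z : ∀ n : ℤ, ENNReal.ofReal ((2 : ℝ) ^ n * M) = 2 ^ (n : ℝ) * m := by
    intro n
    rw [ENNReal.ofReal_mul (by positivity), ← Real.rpow_intCast, ← ENNReal.ofReal_rpow_of_pos (by norm_num)]; simp [hm]
  have hup : ∀ x, ‖levf f M j x‖ₑ ≤ (lev f M j).indicator (fun _ => 2 ^ ((j + 1 : ℤ) : ℝ) * m) x := by
    intro x
    unfold levf
    by_cases hx : x ∈ lev f M j
    · simp only [hx, indicator_of_mem]
      rw [← z, ← ofReal_norm]
      refine ENNReal.ofReal_le_ofReal ?_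
      have := hx.2.le
      rwa [div_le_iff₀ hM] at this
    · simp [hx]
  set h := 2 ^ ((j + 1 : ℤ) : ℝ) * m with hh
  have i1 : ∫⁻ x, ‖levf f M j x‖ₑ ≤ h * E := by
    refine (lintegral_mono hup).trans (le_of_eq ?_)
    rw [lintegral_indicator (lev_meas hfm M j)]; simp [hE]
  have i2 : ∫⁻ x, ‖levf f M j x‖ₑ ^ 2 ≤ h ^ 2 * E := by
    have : ∀ x, ‖levf f M j x‖ₑ ^ 2 ≤ (lev f M j).indicator (fun _ => h ^ 2) x := by
      intro x
      by_cases hx : x ∈ lev f M j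
      · have := hup x
        simp only [hx, indicator_of_mem] at this ⊢
        gcongr
      · have := hup x
        simp only [hx, not_false_eq_true, indicator_of_notMem] at this ⊢
        have := le_antisymm this bot_le
        simp [this]
    refine (lintegral_mono this).trans (le_of_eq ?_)
    rw [lintegral_indicator (lev_meas hfm M j)]; simp [hE]
  have hE1 : E ≤ 2 ^ (-(j / u)) := by
    have a1 : ∫⁻ x, ‖f x‖ₑ ^ (1 / u) ≤ m ^ (1 / u) := by
      have := ENNReal.rpow_le_rpow hN (z := 1 / u) (by positivity)
      unfold nv at this
      rwa [← ENNReal.rpow_mul, mul_one_div_cancel hu.ne', ENNReal.rpow_one] at this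
    have a2 : (2 ^ (j : ℝ) * m) ^ (1 / u) * E ≤ m ^ (1 / u) := by
      refine le_trans ?_ ((mul_meas_ge_le_lintegral (f := fun x => ‖f x‖ₑ ^ (1 / u)) (by fun_prop) ((2 ^ (j : ℝ) * m) ^ (1 / u))).trans a1)
      refine mul_le_mul' le_rfl (measure_mono fun x hx => ?_)
      refine ENNReal.rpow_le_rpow ?_ (by positivity)
      rw [← z, ← ofReal_norm]
      refine ENNReal.ofReal_le_ofReal ?_
      have := hx.1
      rwa [le_div_iff₀ hM] at this
    rw [ENNReal.mul_rpow_of_nonneg _ _ (by positivity), mul_comm (((2 : ℝ≥0∞) ^ (j : ℝ)) ^ (1 / u)) _, mul_assoc] at a2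
    have hmu0 : m ^ (1 / u) ≠ 0 := by simp [hm0, hu.le, hmt]
    have hmut : m ^ (1 / u) ≠ ∞ := ENNReal.rpow_ne_top_of_nonneg (by positivity) hmt
    have a3 : (2 ^ (j : ℝ)) ^ (1 / u) * E ≤ 1 := by
      rw [← ENNReal.mul_le_mul_iff_right hmu0 hmut, mul_one]; exact a2
    rw [← ENNReal.rpow_mul, mul_one_div] at a3
    calc E = 2 ^ (-((j : ℝ) / u)) * (2 ^ ((j : ℝ) / u) * E) := by
          rw [← mul_assoc, ← two_add, neg_add_cancel, ENNReal.rpow_zero, one_mul]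
      _ ≤ 2 ^ (-((j : ℝ) / u)) * 1 := mul_le_mul' le_rfl a3
      _ = _ := mul_one _
  calc _ ≤ (h * E) ^ (1 - θ) * (h ^ 2 * E) ^ (θ / 2) :=
        mul_le_mul' (ENNReal.rpow_le_rpow i1 (by linarith)) (ENNReal.rpow_le_rpow i2 (by linarith))
    _ = (h ^ (1 - θ) * (h ^ 2) ^ (θ / 2)) * (E ^ (1 - θ) * E ^ (θ / 2)) := by
        rw [ENNReal.mul_rpow_of_nonneg h E (by linarith), ENNReal.mul_rpow_of_nonneg (h ^ 2) E (by linarith)]; ring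
    _ = h * E ^ (1 - θ / 2) := by
        rw [← ENNReal.rpow_natCast, ← ENNReal.rpow_mul, ← ENNReal.rpow_add_of_nonneg _ _ (by linarith) (by push_cast; linarith),
          ← ENNReal.rpow_add_of_nonneg _ _ (by linarith) (by linarith)]
        congr 1
        · rw [show 1 - θ + ((2 : ℕ) : ℝ) * (θ / 2) = 1 by push_cast; ring, ENNReal.rpow_one]
        · congr 1; ring
    _ ≤ h * (2 ^ (-(j / u))) ^ (1 - θ / 2) := mul_le_mul' le_rfl (ENNReal.rpow_le_rpow hE1 (by linarith))
    _ = _ := by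
        rw [hh, ← ENNReal.rpow_mul]
        push_cast
        rw [two_add, ENNReal.rpow_one, show (j : ℝ) * (1 - (1 - θ / 2) / u) = j + -(j / u) * (1 - θ / 2) by field_simp; ring, two_add]
        ring

lemma strong_gS {d : ℕ} [NeZero d] {r θ0 θ1 u v : ℝ} (hr : 1 ≤ r) (hv : 0 < v) (hv1 : v ≤ 1)
    (t0 : 0 ≤ θ0) (t0' : θ0 ≤ 1) (t1 : 0 ≤ θ1) (t1' : θ1 ≤ 1) (hu0 : u < 1 - θ0 / 2) (hu1 : 1 - θ1 / 2 < u)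
    (H0 : Est d r θ0 v) (H1 : Est d r θ1 v) :
    ∃ C : ℝ≥0∞, C ≠ ∞ ∧ ∀ f : Euc d → ℂ, Measurable f → Integrable f → ∫⁻ x, ‖f x‖ₑ ^ 2 ≠ ∞ → nv volume u (fun x => ‖f x‖ₑ) ≠ ∞ →
      nv volume v (gS r f) ≤ C * nv volume u (fun x => ‖f x‖ₑ) := by
  obtain ⟨C0, hC0, H0⟩ := H0
  obtain ⟨C1, hC1, H1⟩ := H1
  have hu : 0 < u := by linarith
  set δ0 := (1 - θ0 / 2) / u - 1 with hδ0
  set δ1 := 1 - (1 - θ1 / 2) / u with hδ1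
  have d0 : 0 < δ0 := by rw [hδ0, sub_pos, lt_div_iff₀ hu]; linarith
  have d1 : 0 < δ1 := by rw [hδ1, sub_pos, div_lt_iff₀ hu]; linarith
  refine ⟨2 * (C0 * geo δ0 + C1 * geo δ1), ENNReal.mul_ne_top (by simp) (ENNReal.add_ne_top.2
    ⟨ENNReal.mul_ne_top hC0 (geo_lt_top d0).ne, ENNReal.mul_ne_top hC1 (geo_lt_top d1).ne⟩), fun f hfm hf hf2 hN => ?_⟩
  have key : ∀ M : ℝ, 0 < M → nv volume u (fun x => ‖f x‖ₑ) ≤ ENNReal.ofReal M →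
      nv volume v (gS r f) ≤ 2 * (C0 * geo δ0 + C1 * geo δ1) * ENNReal.ofReal M := by
    intro M hM hNM
    have hl2 : ∀ j, ∫⁻ x, ‖levf f M j x‖ₑ ^ 2 ≠ ∞ := by
      intro j
      refine ((lintegral_mono fun x => ?_).trans_lt hf2.lt_top).ne
      have : ‖levf f M j x‖ₑ ≤ ‖f x‖ₑ := enorm_indicator_le_enorm_self _ _
      gcongr
    have hlm : ∀ j, Measurable (levf f M j) := fun j => hfm.indicator (lev_meas hfm M j)
    calc _ ≤ nv volume v (fun x => ∑' j, gS r (levf f M j) x) := nv_mono hv (gS_lev hr hfm hf hM)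
      _ ≤ ∑' j, nv volume v (gS r (levf f M j)) := nv_tsum hv hv1 fun j => gS_meas hr (levf_int hfm hf M j)
      _ = ∑' j : ℕ, nv volume v (gS r (levf f M j)) + ∑' j : ℕ, nv volume v (gS r (levf f M (-(j + 1)))) :=
          tsum_of_nat_of_neg_add_one ENNReal.summable ENNReal.summable
      _ ≤ ∑' j : ℕ, (C0 * (2 * ENNReal.ofReal M)) * 2 ^ (-(δ0 * j)) + ∑' j : ℕ, (C1 * (2 * ENNReal.ofReal M)) * 2 ^ (-(δ1 * j)) := by
          refine add_le_add (ENNReal.tsum_le_tsum fun j => ?_) (ENNReal.tsum_le_tsum fun j => ?_)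
          · refine (H0 _ (hlm _) (levf_int hfm hf M _) (hl2 _)).trans ?_
            refine (mul_le_mul' le_rfl (levf_term hfm hM hu hNM _ t0 t0')).trans (le_of_eq ?_)
            rw [← mul_assoc]
            congr 2; push_cast; rw [hδ0]; ring
          · refine (H1 _ (hlm _) (levf_int hfm hf M _) (hl2 _)).trans ?_
            refine (mul_le_mul' le_rfl (levf_term hfm hM hu hNM _ t1 t1')).trans ?_
            rw [← mul_assoc]
            refine mul_le_mul' le_rfl (ENNReal.rpow_le_rpow_of_exponent_le (by norm_num) ?_)
            push_cast; rw [← hδ1]; nlinarith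
      _ = _ := by
          rw [ENNReal.tsum_mul_left, ENNReal.tsum_mul_left, ← geo, ← geo]; ring
  set N := nv volume u (fun x => ‖f x‖ₑ) with hNd
  set C := 2 * (C0 * geo δ0 + C1 * geo δ1) with hCd
  have hlim : Filter.Tendsto (fun ε : ℝ => C * ENNReal.ofReal (N.toReal + ε)) (nhdsWithin 0 (Ioi 0)) (nhds (C * ENNReal.ofReal (N.toReal + 0))) := by
    have hCt : C ≠ ∞ := ENNReal.mul_ne_top (by simp) (ENNReal.add_ne_top.2
      ⟨ENNReal.mul_ne_top hC0 (geo_lt_top d0).ne, ENNReal.mul_ne_top hC1 (geo_lt_top d1).ne⟩)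
    refine ENNReal.Tendsto.const_mul ?_ (Or.inr hCt)
    refine (ENNReal.continuous_ofReal.tendsto _).comp ?_
    exact ((by fun_prop : Continuous fun ε : ℝ => N.toReal + ε).tendsto 0).mono_left nhdsWithin_le_nhds
  rw [add_zero, ENNReal.ofReal_toReal hN] at hlim
  refine ge_of_tendsto hlim ?_
  filter_upwards [self_mem_nhdsWithin] with ε hε
  have hε' : 0 < ε := hε
  refine key _ (by positivity) ?_
  nth_rewrite 1 [← ENNReal.ofReal_toReal hN]
  exact ENNReal.ofReal_le_ofReal (by linarith)

/-- Strong type bound on continuous compactly supported functions -/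
def CcB (d : ℕ) (r u v : ℝ) : Prop := ∃ C : ℝ≥0∞, C ≠ ∞ ∧ ∀ f : Euc d → ℂ, Continuous f → HasCompactSupport f →
  nv volume v (VrIA r f) ≤ C * nv volume u (fun x => ‖f x‖ₑ)

lemma cc_bound {d : ℕ} {f : Euc d → ℂ} (hc : Continuous f) (hs : HasCompactSupport f) : ∃ B : ℝ, ∀ x, ‖f x‖ ≤ B :=
  hs.exists_bound_of_continuous hc

lemma cc_nv {d : ℕ} {f : Euc d → ℂ} (hc : Continuous f) (hs : HasCompactSupport f) {u : ℝ} (hu : 0 < u) :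
    nv volume u (fun x => ‖f x‖ₑ) ≠ ∞ := by
  have h := (hc.memLp_of_hasCompactSupport hs (p := ENNReal.ofReal (1 / u)) (μ := volume)).2
  have hp : 0 < 1 / u := by positivity
  rw [eLpNorm_eq_lintegral_rpow_enorm_toReal (by simpa using hu) (by simp), ENNReal.toReal_ofReal hp.le, one_div_one_div] at h
  exact h.ne

lemma VrIA_le_gS {d : ℕ} [NeZero d] {r : ℝ} (hr : 1 ≤ r) {f : Euc d → ℂ} (hc : Continuous f) (hs : HasCompactSupport f) (x : Euc d) :
    VrIA r f x ≤ gS r f x := by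
  obtain ⟨B, hB⟩ := cc_bound hc hs
  exact rVar_tsum hr fun t ht => pk_lim hc (hc.integrable_of_hasCompactSupport hs) hB (by linarith [ht.1]) x

lemma sphAvg_cont {d : ℕ} [NeZero d] {f : Euc d → ℂ} (hc : Continuous f) (hs : HasCompactSupport f) (t : ℝ) : Continuous (sphAvg f t) := by
  obtain ⟨B, hB⟩ := cc_bound hc hs
  refine continuous_of_dominated (bound := fun _ => B) (fun x => ?_) (fun x => Filter.Eventually.of_forall fun y => hB _) (integrable_const _)
    (Filter.Eventually.of_forall fun y => by fun_prop)
  exact (by fun_prop : Continuous fun y => f (x - t • y)).aestronglyMeasurable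

lemma VrIA_meas {d : ℕ} [NeZero d] {r : ℝ} (hr : 1 ≤ r) {f : Euc d → ℂ} (hc : Continuous f) (hs : HasCompactSupport f) : Measurable (VrIA r f) :=
  (rVar_lsc hr fun t _ => sphAvg_cont hc hs t).measurable

lemma ccb_base {d : ℕ} [NeZero d] {r e a b : ℝ} (hd : 3 ≤ d) (hr : 1 ≤ r) (hr2 : r * ((d : ℝ) - 1) ≤ d)
    (he : e = 1 / (r * d)) (hb : b = 1 / (r * ((d : ℝ) - 1))) (ha : a = ((d : ℝ) + 1) / (r * d * ((d : ℝ) - 1)))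
    {l s : ℝ} (l0 : 0 ≤ l) (l1 : l < 1) (s0 : 0 < s) (sa : 3 / 2 * s ≤ 1 / 2 - a) (sb : s ≤ 1 / 2 - b) :
    CcB d r (1 - ((1 - l) * a + l * b) - s) ((1 - l) * e + l * (b + s)) := by
  have hd' : (3 : ℝ) ≤ d := by exact_mod_cast hd
  have hr0 : 0 < r := by linarith
  have hd1 : 0 < (d : ℝ) - 1 := by linarith
  have hd0 : 0 < (d : ℝ) := by linarith
  have e0 : 0 < e := by rw [he]; positivity
  have b0 : 0 < b := by rw [hb]; positivity
  have a0 : 0 < a := by rw [ha]; positivity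
  have hra : r * a = ((d : ℝ) + 1) / (d * ((d : ℝ) - 1)) := by rw [ha]; field_simp
  have hrb : r * b = 1 / ((d : ℝ) - 1) := by rw [hb]; field_simp
  have hrle : r ≤ d / ((d : ℝ) - 1) := by rwa [le_div_iff₀ hd1]
  have hra1 : r * (1 - a) ≤ 1 := by
    have : (d : ℝ) / ((d : ℝ) - 1) - ((d : ℝ) + 1) / (d * ((d : ℝ) - 1)) ≤ 1 := by
      rw [div_sub_div _ _ (by positivity) (by positivity), div_le_one (by positivity)]
      nlinarith [mul_pos hd0 hd1]
    linarith [mul_sub r 1 a]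
  have hrb1 : r * (1 - b) ≤ 1 := by
    have : (d : ℝ) / ((d : ℝ) - 1) - 1 / ((d : ℝ) - 1) = 1 := by rw [← sub_div]; exact div_self hd1.ne'
    linarith [mul_sub r 1 b]
  have A : ∀ s1, 0 < s1 → s1 ≤ 1 / 2 - a → Est d r (2 * (a + s1)) e := by
    intro s1 h1 h2
    rw [he]
    refine estA d (by omega) hr (by positivity) (by linarith) ?_ ?_
    · rw [mul_div_cancel_left₀ _ (by norm_num)]; nlinarith
    · have : 2 * (((d : ℝ) + 1) / ((d : ℝ) - 1)) = 2 * a * (r * d) := by rw [ha]; field_simp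
      rw [this]
      have : 0 < s1 * (r * d) := by positivity
      nlinarith
  have B : Est d r (2 * (b + s)) (b + s) :=
    estB d (by omega) hr (by rw [← hb]; linarith) (by linarith) (by nlinarith)
  have I : ∀ s1, 0 < s1 → s1 ≤ 1 / 2 - a → Est d r ((1 - l) * (2 * (a + s1)) + l * (2 * (b + s))) ((1 - l) * e + l * (b + s)) :=
    fun s1 h1 h2 => est_interp hr e0 (by linarith) l0 l1.le (by linarith) (by linarith) (by linarith) (by linarith) (A s1 h1 h2) B
  have hl : 0 < 1 - l := by linarith
  have e1 : e ≤ 1 := by rw [he, div_le_one (by positivity)]; nlinarith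
  have k1 := mul_pos hl s0
  obtain ⟨C, hC, H⟩ := strong_gS (u := 1 - ((1 - l) * a + l * b) - s) (v := (1 - l) * e + l * (b + s)) hr (by positivity) (by nlinarith)
    (by positivity) (by nlinarith) (by positivity) (by nlinarith) (by nlinarith) (by nlinarith)
    (I (s / 2) (by positivity) (by linarith)) (I (3 / 2 * s) (by positivity) sa)
  refine ⟨C, hC, fun f hc hs => ?_⟩
  refine (nv_mono (by positivity) (VrIA_le_gS hr hc hs)).trans (H f hc.measurable (hc.integrable_of_hasCompactSupport hs) ?_ (cc_nv hc hs ?_))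
  · have := cc_nv hc hs (u := 1 / 2) (by norm_num)
    unfold nv at this
    norm_num at this
    exact this
  · have : l * b ≤ l * (1 / 2 - s) := by gcongr; linarith
    nlinarith

lemma nv_holder {α : Type*} [MeasurableSpace α] {μ : Measure α} {v v0 : ℝ} (h0 : 0 < v0) (h : v0 ≤ v) {g : α → ℝ≥0∞} (hg : Measurable g) :
    nv μ v g ≤ nv μ v0 g * μ univ ^ (v - v0) := by
  have := eLpNorm'_le_eLpNorm'_mul_rpow_measure_univ (p := 1 / v) (q := 1 / v0) (μ := μ) (f := g) (by have := h0.trans_le h; positivity)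
    (one_div_le_one_div_of_le h0 h) hg.aestronglyMeasurable
  unfold eLpNorm' at this
  simp only [enorm_eq_self, one_div_one_div] at this
  exact this

lemma nv_restrict {α : Type*} [MeasurableSpace α] {μ : Measure α} {v : ℝ} (hv : 0 < v) {g : α → ℝ≥0∞} (s : Set α) : nv (μ.restrict s) v g ≤ nv μ v g :=
  ENNReal.rpow_le_rpow (lintegral_mono' Measure.restrict_le_self le_rfl) hv.le

lemma ball_swap {d : ℕ} (ρ : ℝ) {g : Euc d → ℝ≥0∞} (hg : Measurable g) :
    ∫⁻ z, ∫⁻ x in ball z ρ, g x = volume (ball (0 : Euc d) ρ) * ∫⁻ x, g x := by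
  have hm : MeasurableSet {p : Euc d × Euc d | dist p.2 p.1 < ρ} := measurableSet_lt (by fun_prop) (by fun_prop)
  calc ∫⁻ z, ∫⁻ x in ball z ρ, g x = ∫⁻ z, ∫⁻ x, {p : Euc d × Euc d | dist p.2 p.1 < ρ}.indicator (fun p => g p.2) (z, x) := by
        congr 1; ext z
        rw [← lintegral_indicator measurableSet_ball]
        rfl
    _ = ∫⁻ x, ∫⁻ z, {p : Euc d × Euc d | dist p.2 p.1 < ρ}.indicator (fun p => g p.2) (z, x) :=
        lintegral_lintegral_swap (Measurable.indicator (by fun_prop) hm).aemeasurable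
    _ = ∫⁻ x, volume (ball (0 : Euc d) ρ) * g x := by
        congr 1; ext x
        rw [← Measure.addHaar_ball_center volume x ρ, mul_comm, ← setLIntegral_const, ← lintegral_indicator measurableSet_ball]
        congr 1; ext z
        simp only [indicator, mem_setOf_eq, mem_ball, dist_comm x z]
    _ = _ := lintegral_const_mul _ hg

/-- cutoff -/
def cutf {d : ℕ} (z : Euc d) (x : Euc d) : ℝ := max 0 (min 1 (4 - dist x z))

lemma cutf_mul_cont {d : ℕ} {f : Euc d → ℂ} (hc : Continuous f) (z : Euc d) : Continuous (fun x => (cutf z x : ℂ) * f x) := by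
  unfold cutf; fun_prop

lemma VrIA_cut {d : ℕ} [NeZero d] (r : ℝ) (f : Euc d → ℂ) {z x : Euc d} (hx : x ∈ ball z 1) :
    VrIA r (fun x => (cutf z x : ℂ) * f x) x = VrIA r f x := by
  unfold VrIA
  have : ∀ t ∈ Icc (1 : ℝ) 2, sphAvg (fun x => (cutf z x : ℂ) * f x) t x = sphAvg f t x := by
    intro t ht
    unfold sphAvg
    refine integral_congr_ae ?_
    filter_upwards [sph_norm d] with ω hω
    have h1 : dist (x - t • ω) z ≤ 3 := by
      have h2 : dist (x - t • ω) x = t := by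
        rw [dist_eq_norm, sub_sub_cancel_left, norm_neg, norm_smul, hω, mul_one, Real.norm_of_nonneg (by linarith [ht.1])]
      have := dist_triangle (x - t • ω) x z
      have h3 : dist x z < 1 := hx
      linarith [ht.2]
    have : cutf z (x - t • ω) = 1 := by
      unfold cutf
      rw [min_eq_left (by linarith), max_eq_right (by norm_num)]
    rw [this]; simp
  unfold rVar
  refine iSup_congr fun N => iSup_congr fun t => iSup_congr fun ht => iSup_congr fun hE => ?_
  congr 1
  exact Finset.sum_congr rfl fun i _ => by dsimp only; rw [this _ (hE _), this _ (hE _)]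

set_option maxHeartbeats 1000000 in
lemma ccb_local {d : ℕ} [NeZero d] {r u0 v0 u v : ℝ} (hr : 1 ≤ r) (h0 : 0 < v0) (hv : v0 ≤ v) (huv : v ≤ u) (hu : u ≤ u0) (H : CcB d r u0 v0) :
    CcB d r u v := by
  obtain ⟨C, hC, H⟩ := H
  have vp : 0 < v := by linarith
  have up : 0 < u := by linarith
  have u0p : 0 < u0 := by linarith
  set B1 := volume (ball (0 : Euc d) 1) with hB1
  set B4 := volume (ball (0 : Euc d) 4) with hB4
  have b1 : B1 ≠ 0 := (measure_ball_pos volume _ (by norm_num)).ne'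
  have b1' : B1 ≠ ∞ := measure_ball_lt_top.ne
  have b4' : B4 ≠ ∞ := measure_ball_lt_top.ne
  set K := C * B4 ^ (u0 - u) * B1 ^ (v - v0) with hK
  have hKt : K ≠ ∞ := ENNReal.mul_ne_top (ENNReal.mul_ne_top hC (ENNReal.rpow_ne_top_of_nonneg (by linarith) b4')) (ENNReal.rpow_ne_top_of_nonneg (by linarith) b1')
  refine ⟨(B1⁻¹ * (K ^ (1 / v) * B4)) ^ v, ENNReal.rpow_ne_top_of_nonneg vp.le (ENNReal.mul_ne_top (by simp [b1])
    (ENNReal.mul_ne_top (ENNReal.rpow_ne_top_of_nonneg (by positivity) hKt) b4')), fun f hc hs => ?_⟩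
  have hVm := VrIA_meas hr hc hs
  have hfm : Measurable f := hc.measurable
  have l1 : ∀ z : Euc d, nv (volume.restrict (ball z 1)) v (VrIA r f) ≤ K * nv (volume.restrict (ball z 4)) u (fun x => ‖f x‖ₑ) := by
    intro z
    have gc := cutf_mul_cont hc z
    set g : Euc d → ℂ := fun x => (cutf z x : ℂ) * f x with hg
    have gs : HasCompactSupport g := hs.mul_left
    have hgf : ∀ x, ‖g x‖ₑ ≤ (ball z 4).indicator (fun x => ‖f x‖ₑ) x := by
      intro x
      by_cases hx : x ∈ ball z 4
      · rw [indicator_of_mem hx, hg, enorm_mul]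
        refine mul_le_of_le_one_left' ?_
        rw [← ofReal_norm, Complex.norm_real, ENNReal.ofReal_le_one, Real.norm_of_nonneg (by unfold cutf; simp)]
        unfold cutf; simp
      · have : cutf z x = 0 := by
          unfold cutf
          rw [mem_ball, not_lt] at hx
          rw [max_eq_left]; exact (min_le_right _ _).trans (by linarith)
        simp [hg, this]
    calc nv (volume.restrict (ball z 1)) v (VrIA r f) ≤ nv (volume.restrict (ball z 1)) v (VrIA r g) :=
          nv_mono_ae vp ((ae_restrict_mem measurableSet_ball).mono fun x hx => (VrIA_cut r f hx).ge)
      _ ≤ nv (volume.restrict (ball z 1)) v0 (VrIA r g) * (volume.restrict (ball z 1)) univ ^ (v - v0) := nv_holder h0 hv (VrIA_meas hr gc gs)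
      _ = nv (volume.restrict (ball z 1)) v0 (VrIA r g) * B1 ^ (v - v0) := by
          rw [Measure.restrict_apply_univ, Measure.addHaar_ball_center]
      _ ≤ (C * nv volume u0 (fun x => ‖g x‖ₑ)) * B1 ^ (v - v0) := mul_le_mul' ((nv_restrict h0 _).trans (H g gc gs)) le_rfl
      _ ≤ (C * nv (volume.restrict (ball z 4)) u0 (fun x => ‖f x‖ₑ)) * B1 ^ (v - v0) := by
          refine mul_le_mul' (mul_le_mul' le_rfl ?_) le_rfl
          refine (nv_mono u0p hgf).trans (le_of_eq ?_)
          unfold nv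
          rw [← lintegral_indicator measurableSet_ball]
          congr 2; ext x
          have : 0 < 1 / u0 := by positivity
          by_cases hx : x ∈ ball z 4
          · simp only [hx, indicator_of_mem]
          · simp only [hx, not_false_eq_true, indicator_of_notMem, ENNReal.zero_rpow_of_pos this]
      _ ≤ (C * (nv (volume.restrict (ball z 4)) u (fun x => ‖f x‖ₑ) * B4 ^ (u0 - u))) * B1 ^ (v - v0) := by
          refine mul_le_mul' (mul_le_mul' le_rfl ?_) le_rfl
          refine (nv_holder up hu (by fun_prop)).trans (le_of_eq ?_)
          rw [Measure.restrict_apply_univ, Measure.addHaar_ball_center]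
      _ = _ := by rw [hK]; ring
  set J := ∫⁻ x, ‖f x‖ₑ ^ (1 / u) with hJ
  have l2 : ∀ z : Euc d, ∫⁻ x in ball z 1, VrIA r f x ^ (1 / v) ≤ K ^ (1 / v) * (J ^ (u / v - 1) * ∫⁻ x in ball z 4, ‖f x‖ₑ ^ (1 / u)) := by
    intro z
    have := ENNReal.rpow_le_rpow (l1 z) (z := 1 / v) (by positivity)
    unfold nv at this
    rw [← ENNReal.rpow_mul, mul_one_div_cancel vp.ne', ENNReal.rpow_one, ENNReal.mul_rpow_of_nonneg _ _ (by positivity), ← ENNReal.rpow_mul, mul_one_div] at this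
    refine this.trans (mul_le_mul' le_rfl ?_)
    have huv' : 0 ≤ u / v - 1 := by rw [sub_nonneg, one_le_div vp]; exact huv
    set X := ∫⁻ x in ball z 4, ‖f x‖ₑ ^ (1 / u) with hX
    calc X ^ (u / v) = X ^ (u / v - 1) * X ^ (1 : ℝ) := by rw [← ENNReal.rpow_add_of_nonneg _ _ huv' (by norm_num)]; congr 1; ring
      _ ≤ _ := by
        rw [ENNReal.rpow_one]
        exact mul_le_mul' (ENNReal.rpow_le_rpow (lintegral_mono' Measure.restrict_le_self le_rfl) huv') le_rfl
  have l3 : B1 * ∫⁻ x, VrIA r f x ^ (1 / v) ≤ K ^ (1 / v) * (J ^ (u / v - 1) * (B4 * J)) := by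
    rw [hB1, hB4, ← ball_swap 1 (by fun_prop), hJ, ← ball_swap 4 (by fun_prop), ← lintegral_const_mul' , ← lintegral_const_mul']
    · exact lintegral_mono l2
    · exact ENNReal.rpow_ne_top_of_nonneg (by positivity) hKt
    · refine ENNReal.rpow_ne_top_of_nonneg (by rw [sub_nonneg, one_le_div vp]; exact huv) ?_
      have := cc_nv hc hs up
      unfold nv at this
      intro h; rw [h, ENNReal.top_rpow_of_pos up] at this; exact this rfl
  have l4 : ∫⁻ x, VrIA r f x ^ (1 / v) ≤ (B1⁻¹ * (K ^ (1 / v) * B4)) * J ^ (u / v) := by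
    calc _ = B1⁻¹ * (B1 * ∫⁻ x, VrIA r f x ^ (1 / v)) := by rw [← mul_assoc, ENNReal.inv_mul_cancel b1 b1', one_mul]
      _ ≤ B1⁻¹ * (K ^ (1 / v) * (J ^ (u / v - 1) * (B4 * J))) := mul_le_mul' le_rfl l3
      _ = (B1⁻¹ * (K ^ (1 / v) * B4)) * (J ^ (u / v - 1) * J ^ (1 : ℝ)) := by rw [ENNReal.rpow_one]; ring
      _ = _ := by
        rw [← ENNReal.rpow_add_of_nonneg _ _ (by rw [sub_nonneg, one_le_div vp]; exact huv) (by norm_num)]; congr 2; ring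
  calc nv volume v (VrIA r f) ≤ ((B1⁻¹ * (K ^ (1 / v) * B4)) * J ^ (u / v)) ^ v := ENNReal.rpow_le_rpow l4 vp.le
    _ = _ := by
      rw [ENNReal.mul_rpow_of_nonneg _ _ vp.le, ← ENNReal.rpow_mul, div_mul_cancel₀ _ vp.ne']; rfl

lemma ccb_main {d : ℕ} [NeZero d] {r e a b : ℝ} (hd : 3 ≤ d) (hr : 1 ≤ r) (hr2 : r * ((d : ℝ) - 1) ≤ d)
    (he : e = 1 / (r * d)) (hb : b = 1 / (r * ((d : ℝ) - 1))) (ha : a = ((d : ℝ) + 1) / (r * d * ((d : ℝ) - 1)))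
    (a2 : a < 1 / 2) {u v : ℝ} (h1 : e ≤ v) (h2 : v ≤ u) (h3 : u < 1 - b) (h4 : u - 1 + 2 * b < v ∨ u < 1 - a) :
    CcB d r u v := by
  have hd' : (3 : ℝ) ≤ d := by exact_mod_cast hd
  have hr0 : 0 < r := by linarith
  have hd1 : 0 < (d : ℝ) - 1 := by linarith
  have hd0 : 0 < (d : ℝ) := by linarith
  have e0 : 0 < e := by rw [he]; positivity
  have b0 : 0 < b := by rw [hb]; positivity
  have hab : e = 2 * b - a := by rw [he, ha, hb]; field_simp; ring
  have heb : e < b := by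
    rw [he, hb]; apply one_div_lt_one_div_of_lt (by positivity); nlinarith
  rcases lt_or_ge u (1 - a) with hu | hu
  · set s := min (1 - a - u) (min ((1 / 2 - a) / 2) (1 / 2 - b)) with hs
    have s1 : s ≤ 1 - a - u := min_le_left _ _
    have s2 : s ≤ (1 / 2 - a) / 2 := (min_le_right _ _).trans (min_le_left _ _)
    have s3 : s ≤ 1 / 2 - b := (min_le_right _ _).trans (min_le_right _ _)
    have s0 : 0 < s := by refine lt_min (by linarith) (lt_min (by linarith) (by linarith))
    have := ccb_base hd hr hr2 he hb ha le_rfl one_pos s0 (by linarith) s3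
    refine ccb_local hr ?_ ?_ h2 ?_ this <;> nlinarith
  · have h4 : u - 1 + 2 * b < v := by rcases h4 with h | h; exact h; linarith
    set s := min ((1 - b - u) / 2) (min ((v - (u - 1 + 2 * b)) / 2) (min ((1 / 2 - a) / 2) (1 / 2 - b))) with hs
    have s1 : s ≤ (1 - b - u) / 2 := min_le_left _ _
    have s2 : s ≤ (v - (u - 1 + 2 * b)) / 2 := (min_le_right _ _).trans (min_le_left _ _)
    have s3 : s ≤ (1 / 2 - a) / 2 := (min_le_right _ _).trans ((min_le_right _ _).trans (min_le_left _ _))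
    have s4 : s ≤ 1 / 2 - b := (min_le_right _ _).trans ((min_le_right _ _).trans (min_le_right _ _))
    have s0 : 0 < s := by refine lt_min (by linarith) (lt_min (by linarith) (lt_min (by linarith) (by linarith)))
    have hab' : 0 < a - b := by linarith
    set l := (u + s - (1 - a)) / (a - b) with hl
    have hl' : l * (a - b) = u + s - (1 - a) := div_mul_cancel₀ _ hab'.ne'
    have l0 : 0 ≤ l := div_nonneg (by linarith) hab'.le
    have l1 : l < 1 := by rw [hl, div_lt_one hab']; linarith
    have := ccb_base hd hr hr2 he hb ha l0 l1 s0 (by linarith) s4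
    refine ccb_local hr (by have : 0 < 1 - l := by linarith
                            positivity) ?_ h2 ?_ this
    · rw [hab]; nlinarith
    · nlinarith

lemma rVar_pair {r : ℝ} (hr : 1 ≤ r) {E : Set ℝ} (a : ℝ → ℂ) {s t : ℝ} (hs : s ∈ E) (ht : t ∈ E) : ‖a t - a s‖ₑ ≤ rVar r E a := by
  have key : ∀ s ∈ E, ∀ t ∈ E, s < t → ‖a t - a s‖ₑ ≤ rVar r E a := by
    intro s hs t ht hst
    have := rVar_ge (r := r) (E := E) a (N := 1) ![s, t] (by
      intro i j hij
      fin_cases i <;> fin_cases j <;> simp_all) (by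
      intro i
      fin_cases i <;> simp_all)
    simp only [Finset.univ_unique, Fin.default_eq_zero, Finset.sum_singleton] at this
    rw [← ENNReal.rpow_mul, mul_one_div_cancel (by linarith), ENNReal.rpow_one] at this
    exact this
  rcases lt_trichotomy s t with h | h | h
  · exact key s hs t ht h
  · simp [h]
  · rw [← enorm_neg, neg_sub]; exact key t ht s hs h

/-- spherical maximal function -/
def mx {d : ℕ} (g : Euc d → ℝ≥0∞) (x : Euc d) : ℝ≥0∞ := ⨆ t ∈ Icc (1 : ℝ) 2, ∫⁻ ω, g (x - t • ω) ∂(sphereMeasure d)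

lemma ball_meas {d : ℕ} {F : Euc d → ℝ≥0∞} (hF : Measurable F) (ρ : ℝ) : Measurable fun x => ∫⁻ y in ball x ρ, F y := by
  have hm : MeasurableSet {p : Euc d × Euc d | dist p.2 p.1 < ρ} := measurableSet_lt (by fun_prop) (by fun_prop)
  have : Measurable ({p : Euc d × Euc d | dist p.2 p.1 < ρ}.indicator (fun p => F p.2)) := Measurable.indicator (by fun_prop) hm
  have h := this.lintegral_prod_right' (ν := volume)
  have e : (fun x => ∫⁻ y in ball x ρ, F y) = fun x => ∫⁻ y, {p : Euc d × Euc d | dist p.2 p.1 < ρ}.indicator (fun p => F p.2) (x, y) := by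
    ext x
    rw [← lintegral_indicator measurableSet_ball]
    rfl
  rw [e]; exact h

lemma ball_avg {d : ℕ} [NeZero d] {u v : ℝ} (vp : 0 < v) (huv : v ≤ u) (hu : u ≤ 1) : ∃ C : ℝ≥0∞, C ≠ ∞ ∧ ∀ F : Euc d → ℝ≥0∞, Measurable F →
    nv volume u F ≠ ∞ → nv volume v (fun x => ∫⁻ y in ball x 3, F y) ≤ C * nv volume u F := by
  have up : 0 < u := by linarith
  set B := volume (ball (0 : Euc d) 3) with hB
  have b' : B ≠ ∞ := measure_ball_lt_top.ne
  set K := B ^ (1 - u) with hK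
  have hKt : K ≠ ∞ := ENNReal.rpow_ne_top_of_nonneg (by linarith) b'
  refine ⟨(K ^ (1 / v) * B) ^ v, ENNReal.rpow_ne_top_of_nonneg vp.le 
    (ENNReal.mul_ne_top (ENNReal.rpow_ne_top_of_nonneg (by positivity) hKt) b'), fun F hF hFt => ?_⟩
  set J := ∫⁻ x, F x ^ (1 / u) with hJ
  have huv' : 0 ≤ u / v - 1 := by rw [sub_nonneg, one_le_div vp]; exact huv
  have l1 : ∀ z : Euc d, ∫⁻ y in ball z 3, F y ≤ (∫⁻ y in ball z 3, F y ^ (1 / u)) ^ u * K := by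
    intro z
    have := nv_holder (μ := volume.restrict (ball z 3)) up hu hF
    rw [Measure.restrict_apply_univ, Measure.addHaar_ball_center] at this
    simp only [nv, div_one, ENNReal.rpow_one] at this
    exact this
  have l2 : ∀ z : Euc d, (∫⁻ y in ball z 3, F y) ^ (1 / v) ≤ K ^ (1 / v) * (J ^ (u / v - 1) * ∫⁻ x in ball z 3, F x ^ (1 / u)) := by
    intro z
    have := ENNReal.rpow_le_rpow (l1 z) (z := 1 / v) (by positivity)
    rw [ENNReal.mul_rpow_of_nonneg _ _ (by positivity), ← ENNReal.rpow_mul, mul_one_div, mul_comm] at this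
    refine this.trans (mul_le_mul' le_rfl ?_)
    set X := ∫⁻ x in ball z 3, F x ^ (1 / u) with hX
    calc X ^ (u / v) = X ^ (u / v - 1) * X ^ (1 : ℝ) := by rw [← ENNReal.rpow_add_of_nonneg _ _ huv' (by norm_num)]; congr 1; ring
      _ ≤ _ := by
        rw [ENNReal.rpow_one]
        exact mul_le_mul' (ENNReal.rpow_le_rpow (lintegral_mono' Measure.restrict_le_self le_rfl) huv') le_rfl
  have l3 : ∫⁻ z, (∫⁻ y in ball z 3, F y) ^ (1 / v) ≤ K ^ (1 / v) * (J ^ (u / v - 1) * (B * J)) := by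
    rw [hB, hJ, ← ball_swap 3 (by fun_prop), ← lintegral_const_mul', ← lintegral_const_mul']
    · exact lintegral_mono l2
    · exact ENNReal.rpow_ne_top_of_nonneg (by positivity) hKt
    · refine ENNReal.rpow_ne_top_of_nonneg huv' ?_
      unfold nv at hFt
      intro h; rw [h, ENNReal.top_rpow_of_pos up] at hFt; exact hFt rfl
  have l4 : ∫⁻ z, (∫⁻ y in ball z 3, F y) ^ (1 / v) ≤ (K ^ (1 / v) * B) * J ^ (u / v) := by
    calc _ ≤ (K ^ (1 / v) * (J ^ (u / v - 1) * (B * J))) := l3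
      _ = (K ^ (1 / v) * B) * (J ^ (u / v - 1) * J ^ (1 : ℝ)) := by rw [ENNReal.rpow_one]; ring
      _ = _ := by
        rw [← ENNReal.rpow_add_of_nonneg _ _ huv' (by norm_num)]; congr 2; ring
  calc _ ≤ ((K ^ (1 / v) * B) * J ^ (u / v)) ^ v := ENNReal.rpow_le_rpow l4 vp.le
    _ = _ := by
      rw [ENNReal.mul_rpow_of_nonneg _ _ vp.le, ← ENNReal.rpow_mul J, div_mul_cancel₀ _ vp.ne']; rfl

lemma ball_polar {d : ℕ} [NeZero d] {F : Euc d → ℝ≥0∞} (hF : Measurable F) (x : Euc d) :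
    ∫⁻ s in Icc (1 : ℝ) 2, ∫⁻ ω, F (x - s • ω) ∂(sphereMeasure d) ≤ (cSph d)⁻¹ * ∫⁻ y in ball x 3, F y := by
  set G : Euc d → ℝ≥0∞ := fun y => (ball x 3).indicator F (x - y) with hG
  have hGm : Measurable G := (hF.indicator measurableSet_ball).comp (by fun_prop)
  have h1 : ∫⁻ y, G y = ∫⁻ y in ball x 3, F y := by
    rw [hG, lintegral_sub_left_eq_self (fun y => (ball x 3).indicator F y) x, lintegral_indicator measurableSet_ball]
  rw [← h1, polar_lintegral hGm, ← mul_assoc, ENNReal.inv_mul_cancel (cSph_ne_zero d) (cSph_ne_top d), one_mul]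
  calc _ ≤ ∫⁻ s in Icc (1 : ℝ) 2, ENNReal.ofReal (s ^ (d - 1)) * ∫⁻ ω, G (s • ω) ∂(sphereMeasure d) := by
        refine setLIntegral_mono' measurableSet_Icc fun s hs => ?_
        have e : ∫⁻ ω, F (x - s • ω) ∂(sphereMeasure d) = ∫⁻ ω, G (s • ω) ∂(sphereMeasure d) := by
          refine lintegral_congr_ae ?_
          filter_upwards [sph_norm d] with ω hω
          rw [hG]
          dsimp only
          rw [indicator_of_mem]
          rw [mem_ball, dist_eq_norm, sub_sub_cancel_left, norm_neg, norm_smul, hω, mul_one, Real.norm_of_nonneg (by linarith [hs.1])]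
          linarith [hs.2]
        rw [e]
        refine le_mul_of_one_le_left' ?_
        rw [ENNReal.one_le_ofReal]; exact one_le_pow₀ hs.1
    _ ≤ _ := lintegral_mono' (Measure.restrict_mono (fun s hs => by have := hs.1; simp; linarith) le_rfl) le_rfl

lemma cc_ofReal {d : ℕ} {h : Euc d → ℝ} (hs : HasCompactSupport h) : HasCompactSupport (fun x => (h x : ℂ)) := by
  have := hs.comp_left (g := fun y : ℝ => (y : ℂ)) Complex.ofReal_zero
  exact this

lemma cc_enorm {d : ℕ} [NeZero d] {h : Euc d → ℝ} (hc : Continuous h) (hs : HasCompactSupport h) (hp : ∀ x, 0 ≤ h x) (t : ℝ) (x : Euc d) :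
    ∫⁻ ω, ENNReal.ofReal (h (x - t • ω)) ∂(sphereMeasure d) = ‖sphAvg (fun x => (h x : ℂ)) t x‖ₑ := by
  unfold sphAvg
  obtain ⟨B, hB⟩ := hs.exists_bound_of_continuous hc
  have hi : Integrable (fun ω => h (x - t • ω)) (sphereMeasure d) :=
    Integrable.of_bound (by fun_prop) B (Filter.Eventually.of_forall fun ω => hB _)
  dsimp only
  rw [integral_complex_ofReal, ← ofReal_norm, Complex.norm_real, Real.norm_of_nonneg (integral_nonneg fun _ => hp _),
    ofReal_integral_eq_lintegral_ofReal hi (Filter.Eventually.of_forall fun ω => hp _)]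

lemma mx_cc_meas {d : ℕ} [NeZero d] {h : Euc d → ℝ} (hc : Continuous h) (hs : HasCompactSupport h) (hp : ∀ x, 0 ≤ h x) :
    Measurable (mx fun x => ENNReal.ofReal (h x)) := by
  refine LowerSemicontinuous.measurable ?_
  unfold mx
  refine lowerSemicontinuous_iSup fun t => lowerSemicontinuous_iSup fun ht => Continuous.lowerSemicontinuous ?_
  simp_rw [cc_enorm hc hs hp]
  exact continuous_enorm.comp (sphAvg_cont (f := fun x => (h x : ℂ)) (by fun_prop) (cc_ofReal hs) t)

lemma mx_cc {d : ℕ} [NeZero d] {r u v : ℝ} (hr : 1 ≤ r) (vp : 0 < v) (huv : v ≤ u) (hu : u ≤ 1) (H : CcB d r u v) :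
    ∃ C : ℝ≥0∞, C ≠ ∞ ∧ ∀ h : Euc d → ℝ, Continuous h → HasCompactSupport h → (∀ x, 0 ≤ h x) →
      nv volume v (mx fun x => ENNReal.ofReal (h x)) ≤ C * nv volume u (fun x => ENNReal.ofReal (h x)) := by
  obtain ⟨C, hC, H⟩ := H
  obtain ⟨K, hK, HK⟩ := ball_avg (d := d) vp huv hu
  have hc0 : (cSph d)⁻¹ ≠ ∞ := by simp [cSph_ne_zero]
  refine ⟨(cSph d)⁻¹ * K + C, ENNReal.add_ne_top.2 ⟨ENNReal.mul_ne_top hc0 hK, hC⟩, fun h hc hs hp => ?_⟩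
  set f : Euc d → ℂ := fun x => (h x : ℂ) with hf
  have fc : Continuous f := by fun_prop
  have fs : HasCompactSupport f := cc_ofReal hs
  have ef : (fun x => ENNReal.ofReal (h x)) = fun x => ‖f x‖ₑ := by
    ext x; rw [← ofReal_norm, hf, Complex.norm_real, Real.norm_of_nonneg (hp x)]
  have hF : Measurable fun x => ENNReal.ofReal (h x) := by fun_prop
  set F := fun x => ENNReal.ofReal (h x) with hFd
  have pt : ∀ x, mx F x ≤ (cSph d)⁻¹ * (∫⁻ y in ball x 3, F y) + VrIA r f x := by
    intro x
    refine iSup₂_le fun t ht => ?_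
    calc ∫⁻ ω, F (x - t • ω) ∂(sphereMeasure d) = ∫⁻ s in Icc (1 : ℝ) 2, ∫⁻ ω, F (x - t • ω) ∂(sphereMeasure d) := by
          rw [setLIntegral_const]; norm_num
      _ ≤ ∫⁻ s in Icc (1 : ℝ) 2, ((∫⁻ ω, F (x - s • ω) ∂(sphereMeasure d)) + VrIA r f x) := by
          refine setLIntegral_mono' measurableSet_Icc fun s hs' => ?_
          rw [hFd, cc_enorm hc hs hp, cc_enorm hc hs hp]
          calc _ = ‖sphAvg f s x + (sphAvg f t x - sphAvg f s x)‖ₑ := by rw [add_sub_cancel]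
            _ ≤ _ := (enorm_add_le _ _).trans (add_le_add le_rfl (rVar_pair hr (fun t => sphAvg f t x) hs' ht))
      _ = (∫⁻ s in Icc (1 : ℝ) 2, (∫⁻ ω, F (x - s • ω) ∂(sphereMeasure d))) + VrIA r f x := by
          rw [lintegral_add_right _ measurable_const, setLIntegral_const]; norm_num
      _ ≤ _ := add_le_add (ball_polar hF x) le_rfl
  calc _ ≤ nv volume v (fun x => (cSph d)⁻¹ * (∫⁻ y in ball x 3, F y) + VrIA r f x) := nv_mono vp pt
    _ ≤ nv volume v (fun x => (cSph d)⁻¹ * (∫⁻ y in ball x 3, F y)) + nv volume v (VrIA r f) :=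
        nv_add vp (by linarith) ((ball_meas hF 3).const_mul _) (VrIA_meas hr fc fs)
    _ ≤ (cSph d)⁻¹ * (K * nv volume u F) + C * nv volume u F := by
        rw [nv_const_mul vp (ball_meas hF 3)]
        refine add_le_add (mul_le_mul' le_rfl (HK F hF ?_)) ?_
        · rw [ef]; exact cc_nv fc fs (by linarith)
        · rw [ef]; exact H f fc fs
    _ = _ := by ring

/-- increasing limits -/
lemma mx_lim {d : ℕ} [NeZero d] {r u v : ℝ} (hr : 1 ≤ r) (vp : 0 < v) (huv : v ≤ u) (hu : u ≤ 1) (H : CcB d r u v) :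
    ∃ C : ℝ≥0∞, C ≠ ∞ ∧ ∀ (h : ℕ → Euc d → ℝ) (g : Euc d → ℝ≥0∞), (∀ n, Continuous (h n)) → (∀ n, HasCompactSupport (h n)) → (∀ n x, 0 ≤ h n x) →
      (∀ x, Monotone fun n => h n x) → (∀ x, g x = ⨆ n, ENNReal.ofReal (h n x)) →
      Measurable (mx g) ∧ nv volume v (mx g) ≤ C * nv volume u g := by
  obtain ⟨C, hC, H⟩ := mx_cc hr vp huv hu H
  refine ⟨C, hC, fun h g hc hs hp hm hg => ?_⟩
  have e : mx g = fun x => ⨆ n, mx (fun x => ENNReal.ofReal (h n x)) x := by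
    ext x
    unfold mx
    rw [iSup_comm]
    refine iSup_congr fun t => ?_
    rw [iSup_comm]
    refine iSup_congr fun ht => ?_
    simp_rw [hg]
    refine lintegral_iSup (fun n => ?_) (fun i j hij ω => ENNReal.ofReal_le_ofReal (hm _ hij))
    have := (hc n).measurable
    fun_prop
  have hme := fun n => mx_cc_meas (hc n) (hs n) (hp n)
  refine ⟨by rw [e]; exact Measurable.iSup hme, ?_⟩
  rw [e, nv_iSup vp hme]
  · refine iSup_le fun n => (H (h n) (hc n) (hs n) (hp n)).trans (mul_le_mul' le_rfl (nv_mono (by linarith) fun x => ?_))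
    rw [hg]; exact le_iSup (fun n => ENNReal.ofReal (h n x)) n
  · refine Monotone.directed_le fun i j hij x => ?_
    refine iSup₂_mono fun t ht => lintegral_mono fun ω => ENNReal.ofReal_le_ofReal (hm _ hij)

lemma open_lim {d : ℕ} {U : Set (Euc d)} (hU : IsOpen U) (hne : (Uᶜ).Nonempty) : ∃ h : ℕ → Euc d → ℝ, (∀ n, Continuous (h n)) ∧
    (∀ n, HasCompactSupport (h n)) ∧ (∀ n x, 0 ≤ h n x) ∧ (∀ x, Monotone fun n => h n x) ∧ ∀ x, U.indicator 1 x = ⨆ n, ENNReal.ofReal (h n x) := by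
  have hcl : IsClosed Uᶜ := hU.isClosed_compl
  refine ⟨fun n x => min 1 (n * infDist x Uᶜ) * max 0 (min 1 (n - ‖x‖)), fun n => ?_, fun n => ?_, fun n x => ?_, fun x => ?_, fun x => ?_⟩
  · have := continuous_infDist_pt (Uᶜ)
    fun_prop
  · refine HasCompactSupport.intro (isCompact_closedBall (0 : Euc d) n) fun x hx => ?_
    rw [mem_closedBall, dist_zero_right, not_le] at hx
    have : max 0 (min 1 ((n : ℝ) - ‖x‖)) = 0 := max_eq_left ((min_le_right _ _).trans (by linarith))
    dsimp only
    rw [this, mul_zero]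
  · exact mul_nonneg (le_min zero_le_one (mul_nonneg (by positivity) infDist_nonneg)) (le_max_left _ _)
  · intro i j hij
    have hij' : (i : ℝ) ≤ j := by exact_mod_cast hij
    have h0 : 0 ≤ infDist x Uᶜ := infDist_nonneg
    dsimp only
    refine mul_le_mul (min_le_min le_rfl (by gcongr)) (max_le_max le_rfl (min_le_min le_rfl (by linarith))) (le_max_left _ _) (le_min zero_le_one (by positivity))
  · by_cases hx : x ∈ U
    · rw [indicator_of_mem hx, Pi.one_apply]
      refine le_antisymm ?_ (iSup_le fun n => ?_)
      · have hp : 0 < infDist x Uᶜ := by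
          rw [← hcl.notMem_iff_infDist_pos hne]; simpa using hx
        obtain ⟨n, hn⟩ := exists_nat_ge (max (1 / infDist x Uᶜ) (1 + ‖x‖))
        refine le_iSup_of_le n ?_
        have h1 : 1 ≤ n * infDist x Uᶜ := by
          have := (le_max_left _ _).trans hn
          rwa [div_le_iff₀ hp] at this
        have h2 : 1 ≤ (n : ℝ) - ‖x‖ := by linarith [(le_max_right (1 / infDist x Uᶜ) (1 + ‖x‖)).trans hn]
        dsimp only
        rw [min_eq_left h1, min_eq_left h2]; simp
      · rw [ENNReal.ofReal_le_one]
        refine mul_le_one₀ (min_le_left _ _) (le_max_left _ _) (max_le zero_le_one (min_le_left _ _))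
    · have : infDist x Uᶜ = 0 := infDist_zero_of_mem hx
      simp [hx, this]

lemma null_sph {d : ℕ} [NeZero d] {r u v : ℝ} (hr : 1 ≤ r) (vp : 0 < v) (huv : v ≤ u) (hu : u ≤ 1) (H : CcB d r u v)
    {N : Set (Euc d)} (hN : volume N = 0) : ∀ᵐ x, ∀ t ∈ Icc (1 : ℝ) 2, ∀ᵐ ω ∂(sphereMeasure d), x - t • ω ∉ N := by
  obtain ⟨C, hC, H⟩ := mx_lim hr vp huv hu H
  have up : 0 < u := by linarith
  have hex : ∀ m : ℕ, ∃ U, N ⊆ U ∧ IsOpen U ∧ volume U ≤ ((m : ℝ≥0∞) + 1)⁻¹ := by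
    intro m
    obtain ⟨U, h1, h2, h3⟩ := N.exists_isOpen_le_add (volume : Measure (Euc d)) (ε := ((m : ℝ≥0∞) + 1)⁻¹) (by simp)
    exact ⟨U, h1, h2, by rwa [hN, zero_add] at h3⟩
  choose U hNU hUo hUv using hex
  have hUt : ∀ m, volume (U m) ≠ ∞ := fun m => ((hUv m).trans_lt (by simp)).ne
  have hne : ∀ m, ((U m)ᶜ).Nonempty := by
    intro m
    rw [nonempty_compl]
    intro h
    apply hUt m
    rw [h]
    haveI : Nontrivial (Euc d) := by
      haveI : Nonempty (Fin d) := ⟨0⟩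
      infer_instance
    exact measure_univ_of_isAddLeftInvariant volume
  have hG : ∀ m, Measurable (mx ((U m).indicator 1)) ∧ nv volume v (mx ((U m).indicator 1)) ≤ C * (((m : ℝ≥0∞) + 1)⁻¹) ^ u := by
    intro m
    obtain ⟨h, h1, h2, h3, h4, h5⟩ := open_lim (hUo m) (hne m)
    obtain ⟨a, b⟩ := H h _ h1 h2 h3 h4 h5
    refine ⟨a, b.trans (mul_le_mul' le_rfl ?_)⟩
    unfold nv
    refine ENNReal.rpow_le_rpow ?_ up.le
    refine le_trans (le_of_eq ?_) (hUv m)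
    rw [← lintegral_indicator_one (hUo m).measurableSet]
    congr 1; ext x
    by_cases hx : x ∈ U m
    · simp [hx]
    · simp [hx, up]
  have hz : nv volume v (fun x => ⨅ m, mx ((U m).indicator 1) x) = 0 := by
    refine le_antisymm ?_ bot_le
    have hl : Filter.Tendsto (fun m : ℕ => C * (((m : ℝ≥0∞) + 1)⁻¹) ^ u) Filter.atTop (nhds (C * 0 ^ u)) := by
      refine ENNReal.Tendsto.const_mul ?_ (Or.inr hC)
      refine (ENNReal.continuous_rpow_const.tendsto _).comp ?_
      have := (Filter.tendsto_add_atTop_iff_nat 1).2 ENNReal.tendsto_inv_nat_nhds_zero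
      simpa using this
    rw [ENNReal.zero_rpow_of_pos up, mul_zero] at hl
    refine ge_of_tendsto' hl fun m => ?_
    exact (nv_mono vp fun x => iInf_le _ m).trans (hG m).2
  have hmI : Measurable fun x => ⨅ m, mx ((U m).indicator 1) x := Measurable.iInf fun m => (hG m).1
  unfold nv at hz
  rw [ENNReal.rpow_eq_zero_iff_of_pos vp, lintegral_eq_zero_iff (by fun_prop)] at hz
  filter_upwards [hz] with x hx t ht
  have hx' : ⨅ m, mx ((U m).indicator 1) x = 0 := by
    have : (⨅ m, mx ((U m).indicator 1) x) ^ (1 / v) = 0 := hx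
    rwa [ENNReal.rpow_eq_zero_iff_of_pos (by positivity)] at this
  rw [ae_iff]
  refine le_antisymm ?_ bot_le
  rw [← hx']
  refine le_iInf fun m => ?_
  refine le_trans ?_ (le_iSup₂ (f := fun t (_ : t ∈ Icc (1 : ℝ) 2) => ∫⁻ ω, (U m).indicator 1 (x - t • ω) ∂(sphereMeasure d)) t ht)
  have hms : MeasurableSet ((fun ω : Euc d => x - t • ω) ⁻¹' U m) := (hUo m).measurableSet.preimage (by fun_prop)
  have e : (fun ω : Euc d => (U m).indicator (1 : Euc d → ℝ≥0∞) (x - t • ω)) = ((fun ω : Euc d => x - t • ω) ⁻¹' U m).indicator 1 := by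
    ext ω; rfl
  rw [e, lintegral_indicator_one hms]
  refine measure_mono fun ω hω => ?_
  simp only [not_not, mem_setOf_eq] at hω
  exact hNU m hω

lemma nv_eLp {d : ℕ} {u : ℝ} (hu : 0 < u) (g : Euc d → ℂ) : eLpNorm g (ENNReal.ofReal (1 / u)) volume = nv volume u (fun x => ‖g x‖ₑ) := by
  have hp : 0 < 1 / u := by positivity
  rw [eLpNorm_eq_lintegral_rpow_enorm_toReal (by simpa using hu) (by simp), ENNReal.toReal_ofReal hp.le, one_div_one_div]
  rfl

lemma nv_ae_fin {α : Type*} [MeasurableSpace α] {μ : Measure α} {v : ℝ} (vp : 0 < v) {g : α → ℝ≥0∞} (hg : Measurable g) (h : nv μ v g ≠ ∞) :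
    ∀ᵐ x ∂μ, g x < ∞ := by
  unfold nv at h
  have : ∫⁻ x, g x ^ (1 / v) ∂μ ≠ ∞ := by
    intro h'; rw [h', ENNReal.top_rpow_of_pos vp] at h; exact h rfl
  filter_upwards [ae_lt_top (by fun_prop) this] with x hx
  by_contra hh
  rw [not_lt, top_le_iff] at hh
  rw [hh, ENNReal.top_rpow_of_pos (by positivity)] at hx
  exact lt_irrefl _ hx

set_option maxHeartbeats 1000000 in
lemma bdd_of_ccb {d : ℕ} [NeZero d] {r u v : ℝ} (hr : 1 ≤ r) (vp : 0 < v) (huv : v ≤ u) (hu : u ≤ 1) (H : CcB d r u v) :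
    ∃ C : ℝ≥0, ∀ f : Euc d → ℂ, MemLp f (ENNReal.ofReal (1 / u)) volume →
      nv volume v (VrIA r f) ≤ C * eLpNorm f (ENNReal.ofReal (1 / u)) volume := by
  have up : 0 < u := by linarith
  have Hnull := fun N => null_sph hr vp huv hu H (N := N)
  obtain ⟨K, hK, HK⟩ := mx_lim hr vp huv hu H
  obtain ⟨C, hC, H⟩ := H
  refine ⟨C.toNNReal, fun f hf => ?_⟩
  rw [ENNReal.coe_toNNReal hC]
  set p := ENNReal.ofReal (1 / u) with hp
  have hp1 : 1 ≤ p := by rw [hp, ENNReal.one_le_ofReal]; exact one_le_one_div up hu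
  set f' := hf.1.mk f with hf'
  have fm : Measurable f' := hf.1.stronglyMeasurable_mk.measurable
  have fae : f =ᵐ[volume] f' := hf.1.ae_eq_mk
  have hf'p : MemLp f' p volume := (memLp_congr_ae fae).1 hf
  have hex : ∀ m : ℕ, ∃ g : Euc d → ℂ, HasCompactSupport g ∧ eLpNorm (f' - g) p volume ≤ 2⁻¹ ^ m ∧ Continuous g ∧ MemLp g p volume := by
    intro m
    exact hf'p.exists_hasCompactSupport_eLpNorm_sub_le (by simp [hp]) (by simp)
  choose F Fs Fe Fc Fp using hex
  have hgeo : ∑' m : ℕ, (2⁻¹ : ℝ≥0∞) ^ m ≠ ∞ := by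
    rw [ENNReal.tsum_geometric]; norm_num
  have Fm : ∀ m, Measurable (F m) := fun m => (Fc m).measurable
  have hE : ∀ᵐ x, ∑' m, ‖f' x - F m x‖ₑ < ∞ := by
    refine nv_ae_fin up (by fun_prop) (((nv_tsum up hu (fun m => by fun_prop)).trans ?_).trans_lt hgeo.lt_top).ne
    refine ENNReal.tsum_le_tsum fun m => ?_
    have := Fe m
    rw [hp, nv_eLp up] at this
    exact this
  have hconv : ∀ᵐ x, Filter.Tendsto (fun m => F m x) Filter.atTop (nhds (f x)) := by
    filter_upwards [hE, fae] with x hx hx2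
    have := ENNReal.tendsto_atTop_zero_of_tsum_ne_top hx.ne
    rw [hx2, tendsto_iff_edist_tendsto_0]
    refine this.congr fun m => ?_
    rw [edist_comm, edist_eq_enorm_sub]
  set g := fun x => ∑' m, ‖F (m + 1) x - F m x‖ₑ with hg
  have gm : Measurable g := by fun_prop
  have gfin : nv volume u g ≠ ∞ := by
    have h2 : ∑' m : ℕ, (2 * (2⁻¹ : ℝ≥0∞) ^ m) ≠ ∞ := by
      rw [ENNReal.tsum_mul_left]; exact ENNReal.mul_ne_top (by simp) hgeo
    refine (((nv_tsum up hu (fun m => by fun_prop)).trans ?_).trans_lt h2.lt_top).ne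
    refine ENNReal.tsum_le_tsum fun m => ?_
    rw [← nv_eLp up (fun x => F (m + 1) x - F m x), ← hp]
    have e : (fun x => F (m + 1) x - F m x) = (f' - F m) - (f' - F (m + 1)) := by ext x; simp
    rw [e, two_mul]
    refine (eLpNorm_sub_le (hf'p.sub (Fp m)).1 (hf'p.sub (Fp (m + 1))).1 hp1).trans (add_le_add (Fe m) ((Fe (m + 1)).trans ?_))
    exact pow_le_pow_of_le_one (by simp) (by simp) (by omega)
  have hmx := HK (fun n x => ∑ m ∈ Finset.range n, ‖F (m + 1) x - F m x‖) g (fun n => by fun_prop) (fun n => ?_) (fun n x => by positivity)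
    (fun x => ?_) (fun x => ?_)
  rotate_left
  · induction n with
    | zero => simp only [Finset.range_zero, Finset.sum_empty]; exact HasCompactSupport.zero
    | succ n ih =>
      simp only [Finset.sum_range_succ]
      exact ih.add ((Fs (n + 1)).sub (Fs n)).norm
  · exact monotone_nat_of_le_succ fun n => by rw [Finset.sum_range_succ]; linarith [norm_nonneg (F (n + 1) x - F n x)]
  · rw [hg]
    dsimp only
    rw [ENNReal.tsum_eq_iSup_nat]
    refine iSup_congr fun n => ?_
    rw [ENNReal.ofReal_sum_of_nonneg fun _ _ => norm_nonneg _]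
    simp only [ofReal_norm]
  obtain ⟨hmxm, hmxb⟩ := hmx
  have hmxf := nv_ae_fin vp hmxm (hmxb.trans_lt (ENNReal.mul_lt_top hK.lt_top gfin.lt_top)).ne
  have hpt : ∀ᵐ x, VrIA r f x ≤ Filter.liminf (fun m => VrIA r (F m) x) Filter.atTop := by
    filter_upwards [hmxf, Hnull {x | ¬ Filter.Tendsto (fun m => F m x) Filter.atTop (nhds (f x))} hconv] with x hx1 hx2
    refine rVar_tendsto hr fun t ht => ?_
    have hb : ∫⁻ ω, g (x - t • ω) ∂(sphereMeasure d) ≠ ∞ := by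
      refine (lt_of_le_of_lt ?_ hx1).ne
      exact le_iSup₂ (f := fun t (_ : t ∈ Icc (1 : ℝ) 2) => ∫⁻ ω, g (x - t • ω) ∂(sphereMeasure d)) t ht
    have gm' : Measurable fun ω => g (x - t • ω) := gm.comp (by fun_prop)
    unfold sphAvg
    refine tendsto_integral_of_dominated_convergence (fun ω => ‖F 0 (x - t • ω)‖ + (g (x - t • ω)).toReal) (fun m => ?_) ?_ (fun m => ?_) ?_
    · exact ((Fm m).comp (by fun_prop : Measurable fun ω => x - t • ω)).aestronglyMeasurable
    · refine Integrable.add ?_ (integrable_toReal_of_lintegral_ne_top gm'.aemeasurable hb)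
      obtain ⟨B, hB⟩ := cc_bound (Fc 0) (Fs 0)
      have := Fc 0
      exact (Integrable.of_bound (by fun_prop) B (Filter.Eventually.of_forall fun ω => hB _) : Integrable (fun ω => F 0 (x - t • ω)) (sphereMeasure d)).norm
    · filter_upwards [ae_lt_top gm' hb] with ω hω
      set y := x - t • ω with hy
      have h1 : F m y = F 0 y + ∑ j ∈ Finset.range m, (F (j + 1) y - F j y) := by
        rw [Finset.sum_range_sub (fun j => F j y)]; ring
      rw [h1]
      refine (norm_add_le _ _).trans (add_le_add le_rfl ((norm_sum_le _ _).trans ?_))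
      rw [← ENNReal.ofReal_le_iff_le_toReal hω.ne, ENNReal.ofReal_sum_of_nonneg fun _ _ => norm_nonneg _]
      simp only [ofReal_norm]
      exact ENNReal.sum_le_tsum _
    · filter_upwards [hx2 t ht] with ω hω
      simpa using hω
  have hFn : ∀ m, nv volume v (VrIA r (F m)) ≤ C * (eLpNorm f p volume + 2⁻¹ ^ m) := by
    intro m
    refine (H _ (Fc m) (Fs m)).trans (mul_le_mul' le_rfl ?_)
    rw [← nv_eLp up, ← hp, eLpNorm_congr_ae fae]
    have e : F m = f' - (f' - F m) := by simp
    calc eLpNorm (F m) p volume = eLpNorm (f' - (f' - F m)) p volume := by rw [← e]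
      _ ≤ _ := (eLpNorm_sub_le hf'p.1 (hf'p.sub (Fp m)).1 hp1).trans (add_le_add le_rfl (Fe m))
  have hlim : Filter.Tendsto (fun m : ℕ => (C * (eLpNorm f p volume + 2⁻¹ ^ m)) ^ (1 / v)) Filter.atTop (nhds ((C * (eLpNorm f p volume + 0)) ^ (1 / v))) := by
    refine (ENNReal.continuous_rpow_const.tendsto _).comp (ENNReal.Tendsto.const_mul ?_ (Or.inr hC))
    refine Filter.Tendsto.const_add _ ?_
    exact ENNReal.tendsto_pow_atTop_nhds_zero_of_lt_one (by norm_num)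
  rw [add_zero] at hlim
  have main : ∫⁻ x, VrIA r f x ^ (1 / v) ≤ (C * eLpNorm f p volume) ^ (1 / v) := by
    have hVm := fun m => VrIA_meas hr (Fc m) (Fs m)
    calc ∫⁻ x, VrIA r f x ^ (1 / v) ≤ ∫⁻ x, Filter.liminf (fun m => VrIA r (F m) x ^ (1 / v)) Filter.atTop := by
          refine lintegral_mono_ae (hpt.mono fun x hx => ?_)
          refine (ENNReal.rpow_le_rpow hx (by positivity)).trans (le_of_eq ?_)
          exact (ENNReal.monotone_rpow_of_nonneg (by positivity : 0 ≤ 1 / v)).map_liminf_of_continuousAt _ ENNReal.continuous_rpow_const.continuousAt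
      _ ≤ Filter.liminf (fun m => ∫⁻ x, VrIA r (F m) x ^ (1 / v)) Filter.atTop := lintegral_liminf_le fun m => by
          have := hVm m
          fun_prop
      _ ≤ Filter.liminf (fun m => (C * (eLpNorm f p volume + 2⁻¹ ^ m)) ^ (1 / v)) Filter.atTop := by
          refine Filter.liminf_le_liminf (Filter.Eventually.of_forall fun m => ?_)
          have := ENNReal.rpow_le_rpow (hFn m) (z := 1 / v) (by positivity)
          unfold nv at this
          rwa [← ENNReal.rpow_mul, mul_one_div_cancel vp.ne', ENNReal.rpow_one] at this
      _ = _ := hlim.liminf_eq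
  have := ENNReal.rpow_le_rpow main vp.le
  rwa [← ENNReal.rpow_mul, one_div_mul_cancel vp.ne', ENNReal.rpow_one] at this

lemma lq_ge {d : ℕ} {q : ℝ≥0∞} (hq : 1 ≤ q) {g : Euc d → ℝ≥0∞} {T : Set (Euc d)} (hT : MeasurableSet T) (hT0 : volume T ≠ 0) {L : ℝ≥0∞}
    (h : ∀ x ∈ T, L ≤ g x) : L * volume T ^ (q⁻¹.toReal) ≤ lqNorm q g volume := by
  unfold lqNorm
  split_ifs with hq'
  · rw [hq']
    simp only [ENNReal.inv_top, ENNReal.toReal_zero, ENNReal.rpow_zero, mul_one]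
    by_contra hh
    rw [not_le] at hh
    have := ae_lt_of_essSup_lt hh
    rw [ae_iff] at this
    refine hT0 (measure_mono_null (fun x hx => ?_) this)
    simp only [not_lt, mem_setOf_eq]; exact h x hx
  · have hq0 : 0 < q.toReal := ENNReal.toReal_pos (by intro h; simp [h] at hq) hq'
    rw [ENNReal.toReal_inv, ← one_div]
    calc L * volume T ^ (1 / q.toReal) = (L ^ q.toReal * volume T) ^ (1 / q.toReal) := by
          rw [ENNReal.mul_rpow_of_nonneg _ _ (by positivity), ← ENNReal.rpow_mul, mul_one_div_cancel hq0.ne', ENNReal.rpow_one]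
      _ ≤ _ := by
          refine ENNReal.rpow_le_rpow ?_ (by positivity)
          rw [← setLIntegral_const]
          refine (setLIntegral_mono' hT fun x hx => ENNReal.rpow_le_rpow (h x hx) hq0.le).trans (lintegral_mono' Measure.restrict_le_self le_rfl)

lemma lp_le {d : ℕ} (p : ℝ≥0∞) {F : Euc d → ℂ} (hF : ∀ x, ‖F x‖ ≤ 1) (S : Set (Euc d)) :
    eLpNorm (S.indicator F) p volume ≤ volume S ^ (p⁻¹.toReal) := by
  have h1 := eLpNorm_indicator_const_le (μ := (volume : Measure (Euc d))) (s := S) (1 : ℝ) p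
  rw [ENNReal.toReal_inv, ← one_div]
  refine (eLpNorm_mono fun x => ?_).trans (h1.trans (le_of_eq (by simp)))
  by_cases hx : x ∈ S
  · simp only [hx, indicator_of_mem]; simpa using hF x
  · simp [hx]

lemma test_bdd {d : ℕ} {p q : ℝ≥0∞} {r : ℝ} (hq : 1 ≤ q) (hB : IsBddLpLq d p q (VrIA r)) :
    ∃ C : ℝ, 0 < C ∧ ∀ (F : Euc d → ℂ) (S T : Set (Euc d)) (L : ℝ), Measurable F → (∀ x, ‖F x‖ ≤ 1) → MeasurableSet S → volume S ≠ ∞ →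
      MeasurableSet T → volume T ≠ 0 → volume T ≠ ∞ → 0 ≤ L → (∀ x ∈ T, ENNReal.ofReal L ≤ VrIA r (S.indicator F) x) →
      L * (volume T).toReal ^ (q⁻¹.toReal) ≤ C * (volume S).toReal ^ (p⁻¹.toReal) := by
  obtain ⟨C, hC⟩ := hB
  refine ⟨C + 1, by positivity, fun F S T L hFm hF hS hSt hT hT0 hTt hL h => ?_⟩
  have hfm : AEStronglyMeasurable (S.indicator F) volume := (hFm.indicator hS).aestronglyMeasurable
  have he := lp_le p hF S
  have hfin : volume S ^ (p⁻¹.toReal) ≠ ∞ := ENNReal.rpow_ne_top_of_nonneg ENNReal.toReal_nonneg hSt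
  have h1 := (lq_ge hq hT hT0 h).trans ((hC _ ⟨hfm, he.trans_lt hfin.lt_top⟩).trans (mul_le_mul' le_rfl he))
  have h2 := ENNReal.toReal_mono (ENNReal.mul_ne_top (by simp) hfin) h1
  rw [ENNReal.toReal_mul, ENNReal.toReal_mul, ENNReal.toReal_ofReal hL, ← ENNReal.toReal_rpow, ← ENNReal.toReal_rpow, ENNReal.coe_toReal] at h2
  refine h2.trans ?_
  gcongr
  linarith

lemma pow_compare {A C α β : ℝ} (hA : 0 < A) (h : ∀ N : ℕ, 1 ≤ N → A * (N : ℝ) ^ α ≤ C * (N : ℝ) ^ β) : α ≤ β := by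
  by_contra hh
  rw [not_le] at hh
  have ht : Filter.Tendsto (fun N : ℕ => (N : ℝ) ^ (α - β)) Filter.atTop Filter.atTop :=
    (tendsto_rpow_atTop (by linarith)).comp tendsto_natCast_atTop_atTop
  obtain ⟨N, hN, hN1⟩ := ((ht.eventually_gt_atTop (C / A)).and (Filter.eventually_ge_atTop 1)).exists
  have hNp : (0 : ℝ) < N := by exact_mod_cast hN1
  have := h N hN1
  rw [div_lt_iff₀ hA, Real.rpow_sub hNp, div_mul_eq_mul_div, lt_div_iff₀ (by positivity)] at hN
  linarith [mul_comm A ((N : ℝ) ^ α)]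

lemma avg_approx {d : ℕ} [NeZero d] {S : Set (Euc d)} (hS : MeasurableSet S) {F : Euc d → ℂ} (hFm : Measurable F) (hF : ∀ x, ‖F x‖ ≤ 1)
    (x : Euc d) (t : ℝ) (w : ℂ) (h : ∀ ω, ‖ω‖ = 1 → x - t • ω ∈ S → ‖F (x - t • ω) - w‖ ≤ 1 / 4) :
    ‖sphAvg (S.indicator F) t x - ((sphereMeasure d).real {ω | x - t • ω ∈ S} : ℂ) * w‖ ≤ (sphereMeasure d).real {ω | x - t • ω ∈ S} / 4 := by
  have hΩ : MeasurableSet {ω : Euc d | x - t • ω ∈ S} := hS.preimage (by fun_prop)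
  set Ω := {ω : Euc d | x - t • ω ∈ S} with hΩd
  have e1 : sphAvg (S.indicator F) t x = ∫ ω in Ω, F (x - t • ω) ∂(sphereMeasure d) := by
    rw [← integral_indicator hΩ]; rfl
  have e2 : ((sphereMeasure d).real Ω : ℂ) * w = ∫ ω in Ω, w ∂(sphereMeasure d) := by
    rw [setIntegral_const]; simp
  have hi : Integrable (fun ω => F (x - t • ω)) (sphereMeasure d) :=
    Integrable.of_bound (hFm.comp (by fun_prop : Measurable fun ω : Euc d => x - t • ω)).aestronglyMeasurable 1 (Filter.Eventually.of_forall fun ω => hF _)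
  rw [e1, e2, ← integral_sub hi.integrableOn (integrable_const _)]
  refine (norm_setIntegral_le_of_norm_le_const_ae (C := 1 / 4) (measure_lt_top _ _) ?_).trans (le_of_eq (by ring))
  filter_upwards [ae_restrict_of_ae (sph_norm d), ae_restrict_mem hΩ] with ω hω hmem
  exact h ω hω hmem

lemma alt_lower {r L : ℝ} (hr : 1 ≤ r) (hL : 0 ≤ L) {E : Set ℝ} (a : ℝ → ℂ) {N : ℕ} (t : Fin (N + 1) → ℝ) (ht : StrictMono t) (hE : ∀ i, t i ∈ E)
    (m : Fin (N + 1) → ℝ) (hm : ∀ i, L ≤ m i) (w : ℂ) (hw : ‖w‖ = 1) (h : ∀ i, ‖a (t i) - m i * ((-1) ^ (i : ℕ) * w)‖ ≤ m i / 4) :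
    ENNReal.ofReal (L * (N : ℝ) ^ (1 / r)) ≤ rVar r E a := by
  refine le_trans ?_ (rVar_ge a t ht hE)
  have key : ∀ i : Fin N, ENNReal.ofReal L ≤ ‖a (t i.succ) - a (t i.castSucc)‖ₑ := by
    intro i
    rw [← ofReal_norm]
    refine ENNReal.ofReal_le_ofReal ?_
    have h1 := h i.succ
    have h2 := h i.castSucc
    have m1 := hm i.succ
    have m2 := hm i.castSucc
    set z : ℂ := (-1) ^ (i : ℕ) * w with hz
    have hz1 : ‖z‖ = 1 := by simp [hz, hw]
    have e1 : ((-1 : ℂ)) ^ ((i.succ : Fin (N + 1)) : ℕ) * w = -z := by rw [Fin.val_succ, pow_succ, hz]; ring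
    rw [e1] at h1
    rw [Fin.val_castSucc, ← hz] at h2
    set A := a (t i.succ) with hA
    set B := a (t i.castSucc) with hB
    have e3 : ((m i.succ + m i.castSucc : ℝ) : ℂ) * z = (B - m i.castSucc * z) * (-1) + (A - m i.succ * -z) - (A - B) := by push_cast; ring
    have e4 := congrArg norm e3
    rw [norm_mul, hz1, Complex.norm_real, mul_one] at e4
    have e5 : ‖(B - m i.castSucc * z) * (-1) + (A - m i.succ * -z) - (A - B)‖ ≤ ‖B - m i.castSucc * z‖ + ‖A - m i.succ * -z‖ + ‖A - B‖ := by
      refine (norm_sub_le _ _).trans (add_le_add ((norm_add_le _ _).trans (add_le_add (le_of_eq ?_) le_rfl)) le_rfl)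
      rw [norm_mul]; simp
    rw [← e4, Real.norm_of_nonneg (by linarith)] at e5
    linarith
  have hr0 : 0 < r := by linarith
  calc ENNReal.ofReal (L * (N : ℝ) ^ (1 / r)) = (∑ i : Fin N, ENNReal.ofReal L ^ r) ^ (1 / r) := by
        rw [Finset.sum_const, Finset.card_univ, Fintype.card_fin, nsmul_eq_mul, ENNReal.mul_rpow_of_nonneg _ _ (by positivity), ← ENNReal.rpow_mul,
          mul_one_div_cancel hr0.ne', ENNReal.rpow_one, ENNReal.ofReal_mul hL, ← ENNReal.ofReal_rpow_of_nonneg (by positivity) (by positivity),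
          ENNReal.ofReal_natCast, mul_comm]
    _ ≤ _ := ENNReal.rpow_le_rpow (Finset.sum_le_sum fun i _ => ENNReal.rpow_le_rpow (key i) hr0.le) (by positivity)

lemma ee_lip (a b : ℝ) : ‖ee a - ee b‖ ≤ 2 * Real.pi * |a - b| := by
  have h := Real.norm_exp_I_mul_ofReal_sub_one_le (x := 2 * Real.pi * (a - b))
  have e : ee a - ee b = ee b * (ee (a - b) - 1) := by rw [mul_sub, ← ee_add, add_sub_cancel, mul_one]
  rw [e, norm_mul, norm_ee, one_mul]
  have e2 : ee (a - b) = Complex.exp (Complex.I * ((2 * Real.pi * (a - b) : ℝ) : ℂ)) := by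
    unfold ee; congr 1; push_cast; ring
  rw [e2]
  refine h.trans (le_of_eq ?_)
  rw [Real.norm_eq_abs, abs_mul, abs_of_pos (by positivity)]

lemma ee_half (j : ℕ) (a : ℝ) : ee (a + j / 2) = (-1) ^ j * ee a := by
  rw [ee_add, mul_comm]
  congr 1
  unfold ee
  rw [show (((2 * Real.pi * ((j : ℝ) / 2) : ℝ) : ℂ) * Complex.I) = j * (Real.pi * Complex.I) by push_cast; ring, Complex.exp_nat_mul, Complex.exp_pi_mul_I]

lemma vol_ball_toReal (d : ℕ) {ρ : ℝ} (hρ : 0 < ρ) : (volume (ball (0 : Euc d) ρ)).toReal = ρ ^ d * (volume (ball (0 : Euc d) 1)).toReal := by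
  rw [Measure.addHaar_ball_of_pos volume _ hρ, ENNReal.toReal_mul, ENNReal.toReal_ofReal (by positivity)]
  simp

lemma cex_b {d : ℕ} [NeZero d] {p q : ℝ≥0∞} {r : ℝ} (hr : 1 ≤ r) (hq : 1 ≤ q) (hB : IsBddLpLq d p q (VrIA r)) : 1 / (r * d) ≤ q⁻¹.toReal := by
  obtain ⟨C, hC, H⟩ := test_bdd hq hB
  set V := (volume (ball (0 : Euc d) 1)).toReal with hV
  have hVpos : 0 < V := ENNReal.toReal_pos (measure_ball_pos (volume : Measure (Euc d)) 0 one_pos).ne' measure_ball_lt_top.ne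
  set v := q⁻¹.toReal with hv
  have hr0 : 0 < r := by linarith
  have key := pow_compare (α := 1 / r - d * v) (β := 0) (A := ((1 / 16) ^ d * V) ^ v) (C := C * (3 ^ d * V) ^ (p⁻¹.toReal)) (by positivity) ?_
  · have hd : (0 : ℝ) < d := by exact_mod_cast Nat.pos_of_ne_zero (NeZero.ne d)
    rw [div_le_iff₀ (by positivity)]
    have : 1 / r ≤ d * v := by linarith
    rw [div_le_iff₀ hr0] at this
    linarith
  · intro N hN
    have hNp : (0 : ℝ) < N := by exact_mod_cast hN
    have := H (fun x => ee (N / 2 * ‖x‖)) (ball 0 3) (ball 0 (1 / (16 * N))) (1 * (N : ℝ) ^ (1 / r)) (by have := measurable_ee; fun_prop) (fun x => (norm_ee _).le)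
      measurableSet_ball measure_ball_lt_top.ne measurableSet_ball (measure_ball_pos volume _ (by positivity)).ne' measure_ball_lt_top.ne (by positivity) ?_
    · rw [vol_ball_toReal d (ρ := 3) (by norm_num), vol_ball_toReal d (ρ := 1 / (16 * N)) (by positivity), ← hV] at this
      rw [Real.rpow_zero, mul_one]
      refine le_trans (le_of_eq ?_) this
      rw [one_mul, Real.rpow_sub hNp, show (1 / (16 * (N : ℝ))) ^ d * V = ((1 / 16) ^ d * V) * ((N : ℝ) ^ d)⁻¹ by rw [← div_div, div_pow, div_eq_mul_inv]; ring,
        Real.mul_rpow (x := (1 / 16) ^ d * V) (by positivity) (by positivity), Real.inv_rpow (by positivity), ← Real.rpow_natCast (N : ℝ) d, ← Real.rpow_mul hNp.le]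
      ring
    · intro x hx
      rw [mem_ball, dist_zero_right] at hx
      have hx1 : ‖x‖ < 1 := hx.trans_le (by rw [div_le_one (by positivity)]; have : (1 : ℝ) ≤ N := by exact_mod_cast hN
                                            linarith)
      have tE : ∀ i : Fin (N + 1), (1 + (i : ℕ) / N : ℝ) ∈ Icc (1 : ℝ) 2 := by
        intro i
        have : ((i : ℕ) : ℝ) ≤ N := by exact_mod_cast Nat.lt_succ_iff.1 i.2
        have h2 : ((i : ℕ) : ℝ) / N ≤ 1 := by rw [div_le_one hNp]; exact this
        have h3 : 0 ≤ ((i : ℕ) : ℝ) / N := by positivity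
        constructor <;> linarith
      have hnear : ∀ t ∈ Icc (1 : ℝ) 2, ∀ ω : Euc d, ‖ω‖ = 1 → |‖x - t • ω‖ - t| ≤ ‖x‖ := by
        intro t ht ω hω
        have h1 : ‖t • ω‖ = t := by rw [norm_smul, hω, mul_one, Real.norm_of_nonneg (by linarith [ht.1])]
        have := abs_norm_sub_norm_le (x - t • ω) (-(t • ω))
        rw [norm_neg, h1] at this
        simpa using this
      refine alt_lower hr zero_le_one (fun t => sphAvg _ t x) (fun i => 1 + (i : ℕ) / N) ?_ tE (fun _ => 1) (fun _ => le_rfl) (ee (N / 2)) (norm_ee _) ?_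
      · intro i j hij
        have : ((i : ℕ) : ℝ) < (j : ℕ) := by exact_mod_cast hij
        dsimp only
        gcongr
      · intro i
        have := avg_approx (S := ball 0 3) measurableSet_ball (F := fun x => ee (N / 2 * ‖x‖)) (by have := measurable_ee; fun_prop) (fun x => (norm_ee _).le) x
          (1 + (i : ℕ) / N) ((-1) ^ (i : ℕ) * ee (N / 2)) ?_
        · have e : (sphereMeasure d).real {ω | x - (1 + ((i : ℕ) : ℝ) / N) • ω ∈ ball (0 : Euc d) 3} = 1 := by
            have : {ω | x - (1 + ((i : ℕ) : ℝ) / N) • ω ∈ ball (0 : Euc d) 3} =ᵐ[sphereMeasure d] univ := by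
              refine Filter.eventuallyEq_univ.2 ?_
              filter_upwards [sph_norm d] with ω hω
              have h1 := (abs_le.1 (hnear _ (tE i) ω hω)).2
              have h2 := (tE i).2
              change x - (1 + ((i : ℕ) : ℝ) / N) • ω ∈ ball (0 : Euc d) 3
              rw [mem_ball, dist_zero_right]
              linarith
            rw [measureReal_congr this]; simp
          rw [e] at this
          simpa using this
        · intro ω hω _
          rw [← ee_half]
          refine (ee_lip _ _).trans ?_
          have h1 := hnear _ (tE i) ω hω
          rw [show (N : ℝ) / 2 * ‖x - (1 + ((i : ℕ) : ℝ) / N) • ω‖ - (N / 2 + (i : ℕ) / 2) = N / 2 * (‖x - (1 + ((i : ℕ) : ℝ) / N) • ω‖ - (1 + ((i : ℕ) : ℝ) / N)) by field_simp; try ring]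
          rw [abs_mul, abs_of_pos (by positivity)]
          have h2 : (N : ℝ) * (1 / (16 * N)) = 1 / 16 := by field_simp
          have h3 := Real.pi_lt_four
          have h4 : (N : ℝ) * |‖x - (1 + ((i : ℕ) : ℝ) / N) • ω‖ - (1 + ((i : ℕ) : ℝ) / N)| ≤ 1 / 16 := by
            rw [← h2]; gcongr; linarith
          nlinarith [Real.pi_pos, abs_nonneg (‖x - (1 + ((i : ℕ) : ℝ) / N) • ω‖ - (1 + ((i : ℕ) : ℝ) / N))]

lemma phi_nonconst {d : ℕ} [NeZero d] (hd : 2 ≤ d) : ∃ s : ℝ, 0 < s ∧ phi d (2 * s) ≠ phi d s := by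
  by_contra hh
  push Not at hh
  have h1 : ∀ s : ℝ, 0 < s → phi d s = 1 := by
    intro s hs
    have h2 : ∀ n : ℕ, phi d (s * (1 / 2) ^ n) = phi d s := by
      intro n
      induction n with
      | zero => simp
      | succ k ih =>
        rw [← ih, ← hh (s * (1 / 2) ^ (k + 1)) (by positivity)]
        congr 1; rw [pow_succ]; ring
    have h3 : Filter.Tendsto (fun n : ℕ => phi d (s * (1 / 2) ^ n)) Filter.atTop (nhds (phi d (s * 0))) :=
      ((continuous_phi d).tendsto _).comp ((tendsto_pow_atTop_nhds_zero_of_lt_one (by norm_num) (by norm_num)).const_mul s)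
    simp only [h2, mul_zero, phi_zero] at h3
    exact tendsto_nhds_unique tendsto_const_nhds h3
  obtain ⟨C, hC, H⟩ := phi_decay d
  have h2 := (H (C + 1) (by linarith)).1
  rw [h1 _ (by linarith), one_pow, one_mul] at h2
  have h3 : C + 1 ≤ (C + 1) ^ (d - 1) := le_self_pow₀ (by linarith) (by omega)
  linarith

lemma cex_a {d : ℕ} [NeZero d] (hd : 2 ≤ d) {p q : ℝ≥0∞} {r : ℝ} (hr : 1 ≤ r) (hq : 1 ≤ q) (hB : IsBddLpLq d p q (VrIA r)) :
    q⁻¹.toReal ≤ p⁻¹.toReal := by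
  obtain ⟨C, hC, H⟩ := test_bdd hq hB
  obtain ⟨s, hs, hphi⟩ := phi_nonconst hd
  set V := (volume (ball (0 : Euc d) 1)).toReal with hV
  have hVpos : 0 < V := ENNReal.toReal_pos (measure_ball_pos (volume : Measure (Euc d)) 0 one_pos).ne' measure_ball_lt_top.ne
  set v := q⁻¹.toReal with hv
  set u := p⁻¹.toReal with hu
  have hd0 : (0 : ℝ) < d := by exact_mod_cast (by omega : 0 < d)
  set L : ℝ := |phi d (2 * s) - phi d s| with hL
  have hLpos : 0 < L := abs_pos.2 (sub_ne_zero.2 hphi)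
  have key := pow_compare (α := d * v) (β := d * u) (A := L * V ^ v) (C := C * (3 ^ d * V) ^ u) (by positivity) ?_
  · exact le_of_mul_le_mul_left key hd0
  · intro N hN
    have hNp : (0 : ℝ) < N := by exact_mod_cast hN
    have hN1 : (1 : ℝ) ≤ N := by exact_mod_cast hN
    set z : Euc d := EuclideanSpace.single 0 (s / (2 * Real.pi)) with hz
    have hzn : 2 * Real.pi * ‖z‖ = s := by
      rw [hz, EuclideanSpace.norm_single, Real.norm_of_nonneg (by positivity)]; field_simp
    have := H (fun x => ee (inner ℝ z x)) (ball 0 (3 * N)) (ball 0 N) L (by have := measurable_ee; fun_prop) (fun x => (norm_ee _).le)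
      measurableSet_ball measure_ball_lt_top.ne measurableSet_ball (measure_ball_pos volume _ (by positivity)).ne' measure_ball_lt_top.ne hLpos.le ?_
    · rw [vol_ball_toReal d (ρ := 3 * N) (by positivity), vol_ball_toReal d (ρ := N) (by positivity), ← hV] at this
      rw [Real.rpow_mul hNp.le, Real.rpow_mul hNp.le, Real.rpow_natCast]
      rw [Real.mul_rpow (by positivity) (by positivity), mul_pow, mul_right_comm (3 ^ d) _ V, Real.mul_rpow (x := 3 ^ d * V) (by positivity) (by positivity)] at this
      linarith
    · intro x hx
      rw [mem_ball, dist_zero_right] at hx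
      have hA : ∀ t ∈ Icc (1 : ℝ) 2, sphAvg ((ball (0 : Euc d) (3 * N)).indicator fun x => ee (inner ℝ z x)) t x = ee (inner ℝ z x) * phi d (s * t) := by
        intro t ht
        rw [← hzn, mul_right_comm, ← sph_ee t (by linarith [ht.1]) z, ← integral_const_mul]
        refine integral_congr_ae ?_
        filter_upwards [sph_norm d] with ω hω
        rw [indicator_of_mem, ← ee_add]
        · congr 1; rw [inner_sub_right]; ring
        · rw [mem_ball, dist_zero_right]
          refine (norm_sub_le _ _).trans_lt ?_
          rw [norm_smul, hω, Real.norm_of_nonneg (by linarith [ht.1])]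
          linarith [ht.2]
      refine le_trans ?_ (rVar_pair hr _ (s := 1) (t := 2) (by norm_num) (by norm_num))
      rw [hA _ (by norm_num), hA _ (by norm_num), ← ofReal_norm, ← mul_sub, norm_mul, norm_ee, one_mul]
      refine ENNReal.ofReal_le_ofReal (le_of_eq ?_)
      rw [mul_one, mul_comm s 2, ← Complex.ofReal_sub, Complex.norm_real, Real.norm_eq_abs]

/-- boxes elongated in the first coordinate -/
def ebox (n : ℕ) (a b s : ℝ) : Set (Euc (n + 1)) := {x | x 0 ∈ Icc a b ∧ ∀ i : Fin n, x i.succ ∈ Icc (-s) s}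

lemma ebox_eq (n : ℕ) (a b s : ℝ) : ebox n a b s =
    (MeasurableEquiv.toLp 2 (Fin (n + 1) → ℝ)).symm ⁻¹' (Set.pi univ (Fin.cons (α := fun _ => Set ℝ) (Icc a b) fun _ : Fin n => Icc (-s) s)) := by
  ext x
  simp only [ebox, mem_setOf_eq, mem_preimage, Set.mem_univ_pi, Fin.forall_fin_succ, Fin.cons_zero, Fin.cons_succ]
  rfl

lemma ebox_meas (n : ℕ) (a b s : ℝ) : MeasurableSet (ebox n a b s) := by
  rw [ebox_eq]
  refine (MeasurableEquiv.toLp 2 (Fin (n + 1) → ℝ)).symm.measurable (MeasurableSet.univ_pi fun i => ?_)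
  refine Fin.cases ?_ (fun i => ?_) i
  · exact measurableSet_Icc
  · exact measurableSet_Icc

lemma ebox_vol (n : ℕ) (a b s : ℝ) : volume (ebox n a b s) = ENNReal.ofReal (b - a) * ENNReal.ofReal (2 * s) ^ n := by
  rw [ebox_eq, (EuclideanSpace.volume_preserving_symm_measurableEquiv_toLp (Fin (n + 1))).measure_preimage_equiv, volume_pi_pi, Fin.prod_univ_succ]
  simp only [Fin.cons_zero, Fin.cons_succ, Real.volume_Icc, Finset.prod_const, Finset.card_univ, Fintype.card_fin]
  congr 3; ring

lemma nsq_succ {n : ℕ} (x : Euc (n + 1)) : ‖x‖ ^ 2 = x 0 ^ 2 + ∑ i : Fin n, x i.succ ^ 2 := by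
  rw [EuclideanSpace.norm_sq_eq, Fin.sum_univ_succ]; simp

set_option maxHeartbeats 1000000 in
lemma box_lower (n : ℕ) : ∃ c : ℝ, 0 < c ∧ ∀ (r : ℝ) (N : ℕ) (ρ s : ℝ), 1 ≤ r → 1 ≤ N → 0 < ρ → ρ ≤ s → n * s ^ 2 ≤ 1 / 4 → ρ ≤ 1 / 4 →
    80 * N * n * s * ρ ≤ 1 → ∀ x ∈ ebox n (-(1 / 4)) (1 / 4) s,
      ENNReal.ofReal (c * (ρ / 4) ^ n * (N : ℝ) ^ (1 / r)) ≤ VrIA r ((ebox n (1 / 4) 4 ρ).indicator fun y => ee (N * y 0)) x := by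
  obtain ⟨c, hc, hcap⟩ := sph_cap (n + 1)
  refine ⟨c, hc, fun r N ρ s hr hN hρ hρs hns hρ4 hsm x hx => ?_⟩
  have hNp : (0 : ℝ) < N := by exact_mod_cast hN
  set P : ℝ := ∑ i : Fin n, x i.succ ^ 2 with hP
  have hP0 : 0 ≤ P := Finset.sum_nonneg fun i _ => sq_nonneg _
  have hP4 : P ≤ 1 / 4 := by
    refine (Finset.sum_le_card_nsmul _ _ (s ^ 2) fun i _ => ?_).trans (by simpa using hns)
    have := hx.2 i
    exact sq_le_sq' this.1 this.2
  set τ : Fin (N + 1) → ℝ := fun j => 1 + (j : ℕ) / (2 * N) with hτ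
  have hτ1 : ∀ j, 1 ≤ τ j ∧ τ j ≤ 3 / 2 := by
    intro j
    have h1 : ((j : ℕ) : ℝ) ≤ N := by exact_mod_cast Nat.lt_succ_iff.1 j.2
    have h2 : ((j : ℕ) : ℝ) / (2 * N) ≤ 1 / 2 := by rw [div_le_iff₀ (by positivity)]; linarith
    have h3 : 0 ≤ ((j : ℕ) : ℝ) / (2 * N) := by positivity
    simp only [hτ]
    constructor <;> linarith
  set t : Fin (N + 1) → ℝ := fun j => Real.sqrt (P + τ j ^ 2) with ht
  have htsq : ∀ j, t j ^ 2 = P + τ j ^ 2 := fun j => Real.sq_sqrt (by positivity)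
  have htI : ∀ j, t j ∈ Icc (1 : ℝ) 2 := by
    intro j
    obtain ⟨h1, h2⟩ := hτ1 j
    exact ⟨Real.le_sqrt_of_sq_le (by nlinarith), Real.sqrt_le_iff.2 ⟨by norm_num, by nlinarith⟩⟩
  refine alt_lower hr (by positivity) (fun t => sphAvg _ t x) t ?_ htI
    (fun j => (sphereMeasure (n + 1)).real {ω | x - t j • ω ∈ ebox n (1 / 4) 4 ρ}) ?_ (ee (N * (x 0 + 1))) (norm_ee _) ?_
  · intro i j hij
    have h1 : ((i : ℕ) : ℝ) < (j : ℕ) := by exact_mod_cast hij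
    have h2 : τ i < τ j := by simp only [hτ]; gcongr
    refine Real.sqrt_lt_sqrt (by positivity) ?_
    have := (hτ1 i).1
    gcongr
  · intro j
    obtain ⟨h1, h2⟩ := hτ1 j
    have htj := htI j
    have ht0 : 0 < t j := by linarith [htj.1]
    set y : Euc (n + 1) := EuclideanSpace.single 0 (x 0 + τ j) with hy
    set ω₀ : Euc (n + 1) := (t j)⁻¹ • (x - y) with hω₀
    have hxy : ‖x - y‖ = t j := by
      refine (pow_left_inj₀ (norm_nonneg _) ht0.le (by norm_num : 2 ≠ 0)).1 ?_
      rw [nsq_succ, htsq]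
      simp [hy, hP]; ring
    have hω : ‖ω₀‖ = 1 := by
      rw [hω₀, norm_smul, hxy, norm_inv, Real.norm_of_nonneg ht0.le, inv_mul_cancel₀ ht0.ne']
    have h3 := hcap ω₀ hω (ρ / 4) (by positivity) (by linarith)
    have h4 : ball ω₀ (ρ / 4) ⊆ {ω | x - t j • ω ∈ ebox n (1 / 4) 4 ρ} := by
      intro ω hmem
      rw [mem_ball, dist_eq_norm] at hmem
      have e1 : x - t j • ω = y - t j • (ω - ω₀) := by
        rw [hω₀, smul_sub, smul_smul, mul_inv_cancel₀ ht0.ne', one_smul]; abel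
      have h5 : ∀ i, |(t j • (ω - ω₀)) i| ≤ ρ / 2 := by
        intro i
        have h6 : ‖(t j • (ω - ω₀)) i‖ ≤ ‖t j • (ω - ω₀)‖ := PiLp.norm_apply_le _ i
        rw [Real.norm_eq_abs] at h6
        refine h6.trans ?_
        rw [norm_smul, Real.norm_of_nonneg ht0.le]
        nlinarith [htj.2, norm_nonneg (ω - ω₀)]
      change x - t j • ω ∈ ebox n (1 / 4) 4 ρ
      rw [e1]
      have hx0 := hx.1
      refine ⟨?_, fun i => ?_⟩
      · have := abs_le.1 (h5 0)
        have e2 : (y - t j • (ω - ω₀)) 0 = x 0 + τ j - (t j • (ω - ω₀)) 0 := by simp [hy]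
        rw [e2]
        constructor <;> linarith [this.1, this.2, hx0.1, hx0.2]
      · have := abs_le.1 (h5 i.succ)
        have e2 : (y - t j • (ω - ω₀)) i.succ = - (t j • (ω - ω₀)) i.succ := by simp [hy]
        rw [e2]
        constructor <;> linarith [this.1, this.2]
    have h7 := h3.trans (measure_mono h4)
    rw [ENNReal.ofReal_le_iff_le_toReal (measure_ne_top _ _)] at h7
    rw [Nat.add_sub_cancel] at h7
    exact h7
  · intro j
    refine avg_approx (ebox_meas _ _ _ _) (by have := measurable_ee; fun_prop) (fun x => (norm_ee _).le) x (t j) _ ?_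
    intro ω hω hmem
    obtain ⟨h1, h2⟩ := hτ1 j
    have htj := htI j
    rw [← ee_half]
    refine (ee_lip _ _).trans ?_
    set y : Euc (n + 1) := x - t j • ω with hy
    have hxy : ‖x - y‖ ^ 2 = P + τ j ^ 2 := by
      rw [hy, sub_sub_cancel, norm_smul, hω, mul_one, Real.norm_of_nonneg (by linarith [htj.1]), htsq]
    rw [nsq_succ] at hxy
    have h3 : ((x - y) 0) ^ 2 - τ j ^ 2 = ∑ i : Fin n, (2 * x i.succ * y i.succ - y i.succ ^ 2) := by
      have : ∑ i : Fin n, (2 * x i.succ * y i.succ - y i.succ ^ 2) = P - ∑ i : Fin n, ((x - y) i.succ) ^ 2 := by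
        rw [hP, ← Finset.sum_sub_distrib]
        refine Finset.sum_congr rfl fun i _ => ?_
        have e0 : (x - y) i.succ = x i.succ - y i.succ := rfl
        rw [e0]; ring
      rw [this]; linarith
    have h4 : |((x - y) 0) ^ 2 - τ j ^ 2| ≤ n * (3 * s * ρ) := by
      rw [h3]
      refine (Finset.abs_sum_le_sum_abs _ _).trans ((Finset.sum_le_card_nsmul _ _ (3 * s * ρ) fun i _ => ?_).trans (by simp))
      have hxi := abs_le.2 (hx.2 i)
      have hyi := abs_le.2 (hmem.2 i)
      have e1 : |2 * x i.succ * y i.succ - y i.succ ^ 2| ≤ 2 * |x i.succ| * |y i.succ| + |y i.succ| ^ 2 := by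
        refine (abs_sub _ _).trans (le_of_eq ?_)
        rw [abs_mul, abs_mul, abs_pow, abs_of_pos (by norm_num : (0 : ℝ) < 2)]
      refine e1.trans ?_
      have hs0 : 0 ≤ s := hρ.le.trans hρs
      have a1 := abs_nonneg (x i.succ)
      have a2 := abs_nonneg (y i.succ)
      have a3 : |x i.succ| * |y i.succ| ≤ s * ρ := by gcongr
      have a4 : |y i.succ| ^ 2 ≤ s * ρ := by rw [sq]; gcongr; exact hyi.trans hρs
      linarith
    have hy0 := hmem.1
    have hx0 := hx.1
    have h5 : |y 0 - x 0 - τ j| ≤ n * (3 * s * ρ) := by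
      have e : ((x - y) 0) ^ 2 - τ j ^ 2 = (y 0 - x 0 - τ j) * (y 0 - x 0 + τ j) := by rw [PiLp.sub_apply]; ring
      rw [e, abs_mul] at h4
      refine le_trans ?_ h4
      refine le_mul_of_one_le_right (abs_nonneg _) ?_
      refine le_trans ?_ (le_abs_self _)
      linarith [hy0.1, hx0.2]
    have e2 : (N : ℝ) * y 0 - (N * (x 0 + 1) + (j : ℕ) / 2) = N * (y 0 - x 0 - τ j) := by
      simp only [hτ]; field_simp; ring
    rw [e2, abs_mul, abs_of_pos hNp]
    have h6 : (N : ℝ) * |y 0 - x 0 - τ j| ≤ 3 / 80 := by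
      calc (N : ℝ) * |y 0 - x 0 - τ j| ≤ N * (n * (3 * s * ρ)) := by gcongr
        _ = 3 / 80 * (80 * N * n * s * ρ) := by ring
        _ ≤ 3 / 80 * 1 := by gcongr
        _ = _ := by ring
    nlinarith [Real.pi_pos, Real.pi_lt_d2, mul_nonneg hNp.le (abs_nonneg (y 0 - x 0 - τ j))]

lemma box_bdd {n : ℕ} {p q : ℝ≥0∞} {r : ℝ} (hr : 1 ≤ r) (hq : 1 ≤ q) (hB : IsBddLpLq (n + 1) p q (VrIA r)) :
    ∃ A C : ℝ, 0 < A ∧ 0 < C ∧ ∀ (N : ℕ) (ρ s : ℝ), 1 ≤ N → 0 < ρ → ρ ≤ s → n * s ^ 2 ≤ 1 / 4 → ρ ≤ 1 / 4 →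
    80 * N * n * s * ρ ≤ 1 → A * ρ ^ n * (N : ℝ) ^ (1 / r) * (s ^ n) ^ (q⁻¹.toReal) ≤ C * (ρ ^ n) ^ (p⁻¹.toReal) := by
  obtain ⟨C, hC, H⟩ := test_bdd hq hB
  obtain ⟨c, hc, hbox⟩ := box_lower n
  set v := q⁻¹.toReal with hv
  set u := p⁻¹.toReal with hu
  refine ⟨c * (1 / 4) ^ n * (1 / 2 * 2 ^ n) ^ v, C * (15 / 4 * 2 ^ n) ^ u, by positivity, by positivity, ?_⟩
  intro N ρ s hN hρ hρs hns hρ4 hsm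
  have hs : 0 < s := hρ.trans_le hρs
  have hvol : ∀ a b s : ℝ, a < b → 0 < s → (volume (ebox n a b s)).toReal = (b - a) * 2 ^ n * s ^ n := by
    intro a b s hab hs
    rw [ebox_vol, ENNReal.toReal_mul, ENNReal.toReal_pow, ENNReal.toReal_ofReal (by linarith), ENNReal.toReal_ofReal (by positivity), mul_pow, mul_assoc]
  have hfin : ∀ a b s : ℝ, volume (ebox n a b s) ≠ ∞ := by
    intro a b s
    rw [ebox_vol]
    exact ENNReal.mul_ne_top ENNReal.ofReal_ne_top (ENNReal.pow_ne_top ENNReal.ofReal_ne_top)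
  have h := H (fun y => ee (N * y 0)) (ebox n (1 / 4) 4 ρ) (ebox n (-(1 / 4)) (1 / 4) s) (c * (ρ / 4) ^ n * (N : ℝ) ^ (1 / r))
    (by have := measurable_ee; fun_prop) (fun x => (norm_ee _).le) (ebox_meas _ _ _ _) (hfin _ _ _) (ebox_meas _ _ _ _) ?_ (hfin _ _ _) (by positivity)
    (hbox r N ρ s hr hN hρ hρs hns hρ4 hsm)
  · rw [hvol _ _ _ (by norm_num) hs, hvol _ _ _ (by norm_num) hρ, Real.mul_rpow (by positivity) (by positivity), Real.mul_rpow (y := ρ ^ n) (by positivity) (by positivity)] at h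
    norm_num at h ⊢
    refine le_trans (le_of_eq ?_) (h.trans (le_of_eq ?_))
    · rw [div_pow, div_pow, one_pow]; ring
    · ring
  · rw [ebox_vol]
    refine mul_ne_zero ?_ (pow_ne_zero _ ?_)
    · rw [Ne, ENNReal.ofReal_eq_zero]; norm_num
    · rw [Ne, ENNReal.ofReal_eq_zero]; linarith

lemma cex_c {n : ℕ} (hn : 1 ≤ n) {p q : ℝ≥0∞} {r : ℝ} (hr : 1 ≤ r) (hq : 1 ≤ q) (hB : IsBddLpLq (n + 1) p q (VrIA r)) :
    p⁻¹.toReal ≤ 1 - 1 / (r * n) := by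
  obtain ⟨A, C, hA, hC, H⟩ := box_bdd hr hq hB
  set v := q⁻¹.toReal with hv
  set u := p⁻¹.toReal with hu
  have hnp : (0 : ℝ) < n := by exact_mod_cast hn
  have hn1 : (1 : ℝ) ≤ n := by exact_mod_cast hn
  have hr0 : 0 < r := by linarith
  have key := pow_compare (α := 1 / r - n) (β := - (n * u)) (A := A * (1 / (40 * n)) ^ n * ((1 / (2 * n)) ^ n) ^ v) (C := C * ((1 / (40 * n)) ^ n) ^ u) (by positivity) ?_
  · have h1 : (u - 1) * n ≤ - (1 / r) := by linarith
    have h2 : u - 1 ≤ - (1 / r) / n := by rwa [le_div_iff₀ hnp]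
    rw [neg_div, div_div] at h2
    linarith
  · intro N hN
    have hNp : (0 : ℝ) < N := by exact_mod_cast hN
    have hN1 : (1 : ℝ) ≤ N := by exact_mod_cast hN
    have h := H N (1 / (40 * n) / N) (1 / (2 * n)) hN (by positivity) ?_ ?_ ?_ ?_
    · rw [div_pow (1 / (40 * (n : ℝ))) (N : ℝ) n, Real.div_rpow (by positivity) (by positivity)] at h
      rw [Real.rpow_sub hNp, Real.rpow_neg hNp.le, Real.rpow_mul hNp.le, Real.rpow_natCast]
      refine le_trans (le_of_eq ?_) (h.trans (le_of_eq ?_))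
      · ring
      · ring
    · rw [div_div]
      refine one_div_le_one_div_of_le (by positivity) ?_
      nlinarith
    · rw [div_pow, one_pow, mul_one_div, div_le_iff₀ (by positivity)]; nlinarith
    · rw [div_div, div_le_iff₀ (by positivity)]; nlinarith
    · have : 80 * (N : ℝ) * n * (1 / (2 * n)) * (1 / (40 * n) / N) = 1 / n := by field_simp; norm_num
      rw [this, div_le_one hnp]; exact hn1

lemma cex_d {n : ℕ} (hn : 1 ≤ n) {p q : ℝ≥0∞} {r : ℝ} (hr : 1 ≤ r) (hq : 1 ≤ q) (hB : IsBddLpLq (n + 1) p q (VrIA r)) :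
    p⁻¹.toReal - 1 + 2 * (1 / (r * n)) ≤ q⁻¹.toReal := by
  obtain ⟨A, C, hA, hC, H⟩ := box_bdd hr hq hB
  set v := q⁻¹.toReal with hv
  set u := p⁻¹.toReal with hu
  have hnp : (0 : ℝ) < n := by exact_mod_cast hn
  have hn1 : (1 : ℝ) ≤ n := by exact_mod_cast hn
  have hr0 : 0 < r := by linarith
  have key := pow_compare (α := 1 / r - 1 / 2 * n - 1 / 2 * n * v) (β := - (1 / 2 * n * u)) (A := A * (1 / (20 * n)) ^ n * ((1 / (20 * n)) ^ n) ^ v) (C := C * ((1 / (20 * n)) ^ n) ^ u) (by positivity) ?_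
  · have h1 : (u - 1 - v) * n ≤ - (2 * (1 / r)) := by linarith
    have h2 : u - 1 - v ≤ - (2 * (1 / r)) / n := by rwa [le_div_iff₀ hnp]
    rw [neg_div, mul_div_assoc, div_div] at h2
    linarith
  · intro N hN
    have hNp : (0 : ℝ) < N := by exact_mod_cast hN
    have hN1 : (1 : ℝ) ≤ N := by exact_mod_cast hN
    have hq1 : 1 ≤ (N : ℝ) ^ (1 / 2 : ℝ) := Real.one_le_rpow hN1 (by norm_num)
    have hq2 : (N : ℝ) ^ (1 / 2 : ℝ) * (N : ℝ) ^ (1 / 2 : ℝ) = N := by rw [← Real.rpow_add hNp]; norm_num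
    rw [Real.rpow_sub hNp, Real.rpow_sub hNp, Real.rpow_neg hNp.le, Real.rpow_mul hNp.le _ v, Real.rpow_mul hNp.le _ u, Real.rpow_mul hNp.le, Real.rpow_natCast]
    set M : ℝ := (N : ℝ) ^ (1 / 2 : ℝ) with hM
    have hM0 : 0 < M := by linarith
    have hle : 1 / (20 * (n : ℝ)) / M ≤ 1 / (20 * n) := div_le_self (by positivity) hq1
    have h := H N (1 / (20 * n) / M) (1 / (20 * n) / M) hN (by positivity) le_rfl ?_ ?_ ?_
    · rw [div_pow (1 / (20 * (n : ℝ))) M n, Real.div_rpow (by positivity) (by positivity), Real.div_rpow (by positivity) (by positivity)] at h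
      refine le_trans (le_of_eq ?_) (h.trans (le_of_eq ?_))
      · ring
      · ring
    · have : (1 / (20 * (n : ℝ)) / M) ^ 2 ≤ (1 / (20 * n)) ^ 2 := by gcongr
      refine (mul_le_mul_of_nonneg_left this hnp.le).trans ?_
      rw [div_pow, one_pow, mul_one_div, div_le_iff₀ (by positivity)]; nlinarith
    · refine hle.trans ?_
      rw [div_le_iff₀ (by positivity)]; nlinarith
    · rw [← hq2]
      have : 80 * (M * M) * n * (1 / (20 * n) / M) * (1 / (20 * n) / M) = 1 / (5 * n) := by field_simp; norm_num
      rw [this, div_le_one (by positivity)]; linarith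

lemma exists_between_param {x y z : ℝ} (h1 : x ≤ y) (h2 : y ≤ z) : ∃ l : ℝ, 0 ≤ l ∧ l ≤ 1 ∧ y = (1 - l) * x + l * z := by
  rcases (h1.trans h2).eq_or_lt with h | h
  · exact ⟨0, le_rfl, zero_le_one, by linarith⟩
  · refine ⟨(y - x) / (z - x), div_nonneg (by linarith) (by linarith), (div_le_one (by linarith)).2 (by linarith), ?_⟩
    have : z - x ≠ 0 := by linarith
    field_simp
    ring

lemma quad_comb {K : Set (ℝ × ℝ)} (hK : Convex ℝ K) {x1 y1 x2 y2 x y l : ℝ} (h1 : (x1, y1) ∈ K) (h2 : (x2, y2) ∈ K) (l0 : 0 ≤ l) (l1 : l ≤ 1)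
    (hx : x = (1 - l) * x1 + l * x2) (hy : y = (1 - l) * y1 + l * y2) : (x, y) ∈ K := by
  have := hK h1 h2 (sub_nonneg.2 l1) l0 (by ring)
  rw [hx, hy]
  simpa using this

lemma hull_four {e a b : ℝ} (hab : e = 2 * b - a) (heb : e < b) (hb2 : b < 1 / 2) (u v : ℝ) :
    (u, v) ∈ convexHull ℝ ({(e, e), (1 - b, 1 - b), (1 - b, b), (1 - a, e)} : Set (ℝ × ℝ)) ↔
      e ≤ v ∧ v ≤ u ∧ u ≤ 1 - b ∧ u - 1 + 2 * b ≤ v := by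
  constructor
  · intro h
    have hsub : convexHull ℝ ({(e, e), (1 - b, 1 - b), (1 - b, b), (1 - a, e)} : Set (ℝ × ℝ)) ⊆
        {z : ℝ × ℝ | e ≤ z.2 ∧ z.2 ≤ z.1 ∧ z.1 ≤ 1 - b ∧ z.1 - 1 + 2 * b ≤ z.2} := by
      refine convexHull_min ?_ ?_
      · intro z hz
        simp only [mem_insert_iff, mem_singleton_iff] at hz
        rcases hz with rfl | rfl | rfl | rfl <;> refine ⟨?_, ?_, ?_, ?_⟩ <;> dsimp only <;> linarith
      · rintro ⟨x1, y1⟩ ⟨p1, p2, p3, p4⟩ ⟨x2, y2⟩ ⟨q1, q2, q3, q4⟩ α β hα hβ hs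
        dsimp only at p1 p2 p3 p4 q1 q2 q3 q4
        have hα' : α = 1 - β := by linarith
        simp only [Prod.smul_mk, Prod.mk_add_mk, smul_eq_mul, mem_setOf_eq]
        have a1 := mul_le_mul_of_nonneg_left p1 hα
        have a2 := mul_le_mul_of_nonneg_left p2 hα
        have a3 := mul_le_mul_of_nonneg_left p3 hα
        have a4 := mul_le_mul_of_nonneg_left p4 hα
        have b1 := mul_le_mul_of_nonneg_left q1 hβ
        have b2 := mul_le_mul_of_nonneg_left q2 hβ
        have b3 := mul_le_mul_of_nonneg_left q3 hβ
        have b4 := mul_le_mul_of_nonneg_left q4 hβ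
        subst hα'
        refine ⟨?_, ?_, ?_, ?_⟩ <;> nlinarith
    exact hsub h
  · rintro ⟨h1, h2, h3, h4⟩
    set K := convexHull ℝ ({(e, e), (1 - b, 1 - b), (1 - b, b), (1 - a, e)} : Set (ℝ × ℝ)) with hKd
    have hK : Convex ℝ K := convex_convexHull _ _
    have q1 : (e, e) ∈ K := subset_convexHull _ _ (by simp)
    have q2 : (1 - b, 1 - b) ∈ K := subset_convexHull _ _ (by simp)
    have q3 : (1 - b, b) ∈ K := subset_convexHull _ _ (by simp)
    have q4 : (1 - a, e) ∈ K := subset_convexHull _ _ (by simp)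
    obtain ⟨l, l0, l1, hl⟩ := exists_between_param h1 (h2.trans h3)
    have hL : (v, v) ∈ K := quad_comb hK q1 q2 l0 l1 hl hl
    rcases le_total v b with hv | hv
    · obtain ⟨m, m0, m1, hm⟩ := exists_between_param h1 hv
      have hR : (v + 1 - 2 * b, v) ∈ K := quad_comb hK q4 q3 m0 m1 (by linear_combination hm + (1 - m) * hab) hm
      obtain ⟨k, k0, k1, hk⟩ := exists_between_param h2 (by linarith : u ≤ v + 1 - 2 * b)
      exact quad_comb hK hL hR k0 k1 hk (by ring)
    · obtain ⟨m, m0, m1, hm⟩ := exists_between_param hv (h2.trans h3)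
      have hR : (1 - b, v) ∈ K := quad_comb hK q3 q2 m0 m1 (by ring) hm
      obtain ⟨k, k0, k1, hk⟩ := exists_between_param h2 h3
      exact quad_comb hK hL hR k0 k1 hk (by ring)

lemma quad_params {d : ℕ} {r : ℝ} (hdr : (4 ≤ d ∧ 1 ≤ r ∧ r ≤ (d : ℝ) / ((d : ℝ) - 1)) ∨ (d = 3 ∧ 4 / 3 < r ∧ r ≤ 3 / 2)) :
    3 ≤ d ∧ 1 ≤ r ∧ r * ((d : ℝ) - 1) ≤ d ∧ ((d : ℝ) + 1) / (r * d * ((d : ℝ) - 1)) < 1 / 2 := by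
  rcases hdr with ⟨h1, h2, h3⟩ | ⟨rfl, h2, h3⟩
  · have h4 : (4 : ℝ) ≤ d := by exact_mod_cast h1
    have h5 : 0 < (d : ℝ) - 1 := by linarith
    refine ⟨by omega, h2, (le_div_iff₀ h5).1 h3, ?_⟩
    rw [div_lt_div_iff₀ (by positivity) (by norm_num)]
    have h6 : (d : ℝ) * ((d : ℝ) - 1) ≤ r * d * ((d : ℝ) - 1) := by
      rw [mul_assoc]; exact le_mul_of_one_le_left (by positivity) h2
    nlinarith
  · refine ⟨le_rfl, by linarith, by push_cast; linarith, ?_⟩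
    push_cast
    rw [div_lt_div_iff₀ (by nlinarith) (by norm_num)]
    linarith

lemma quad_rel {d : ℕ} {r e a b : ℝ} (hd : 3 ≤ d) (hr : 1 ≤ r) (he : e = 1 / (r * d)) (hb : b = 1 / (r * ((d : ℝ) - 1)))
    (ha : a = ((d : ℝ) + 1) / (r * d * ((d : ℝ) - 1))) (a2 : a < 1 / 2) :
    0 < e ∧ e = 2 * b - a ∧ e < b ∧ b < 1 / 2 ∧ (r * ((d : ℝ) - 1) - 1) / (r * ((d : ℝ) - 1)) = 1 - b := by
  have hd' : (3 : ℝ) ≤ d := by exact_mod_cast hd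
  have hd1 : 0 < (d : ℝ) - 1 := by linarith
  have hd0 : 0 < (d : ℝ) := by linarith
  have hr0 : 0 < r := by linarith
  have h1 : e = 2 * b - a := by rw [he, hb, ha]; field_simp; ring
  have h2 : e < b := by
    rw [he, hb]
    refine one_div_lt_one_div_of_lt (by positivity) ?_
    nlinarith
  refine ⟨by rw [he]; positivity, h1, h2, by linarith, ?_⟩
  rw [hb, sub_div, div_self (by positivity)]

lemma bdd_final {d : ℕ} {r e a b : ℝ} (hd : 3 ≤ d) (hr : 1 ≤ r) (hr2 : r * ((d : ℝ) - 1) ≤ d)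
    (he : e = 1 / (r * d)) (hb : b = 1 / (r * ((d : ℝ) - 1))) (ha : a = ((d : ℝ) + 1) / (r * d * ((d : ℝ) - 1)))
    (a2 : a < 1 / 2) {u v : ℝ} (h1 : e ≤ v) (h2 : v ≤ u) (h3 : u < 1 - b) (h4 : u - 1 + 2 * b < v ∨ u < 1 - a) :
    IsBddR d r (1 / u) (1 / v) := by
  haveI : NeZero d := ⟨by omega⟩
  obtain ⟨e0, hab, heb, hb2, -⟩ := quad_rel hd hr he hb ha a2
  have v0 : 0 < v := by linarith
  obtain ⟨C, hC⟩ := bdd_of_ccb hr v0 h2 (by linarith) (ccb_main hd hr hr2 he hb ha a2 h1 h2 h3 h4)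
  refine ⟨C, fun f hf => ?_⟩
  have e1 : lqNorm (ENNReal.ofReal (1 / v)) (VrIA r f) volume = nv volume v (VrIA r f) := by
    unfold lqNorm nv
    rw [if_neg ENNReal.ofReal_ne_top, ENNReal.toReal_ofReal (by positivity), one_div_one_div]
  rw [e1]
  exact hC f hf

lemma ofReal_one_div_inv_toReal {p : ℝ≥0∞} (hp : 1 ≤ p) (h : 0 < p⁻¹.toReal) : ENNReal.ofReal (1 / p⁻¹.toReal) = p := by
  have h1 : p⁻¹ ≠ ∞ := by
    rw [Ne, ENNReal.inv_eq_top]; rintro rfl; simp at hp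
  rw [one_div, ENNReal.ofReal_inv_of_pos h, ENNReal.ofReal_toReal h1, inv_inv]

/-- Theorem 1.5 (i)-(ii): for `d ≥ 4` and `1 ≤ r ≤ d/(d-1)`, or `d = 3` and
`4/3 < r ≤ 3/2`, the operator `V_r^I A` is `L^p → L^q` bounded in the interior of
`𝔔_d(r)`, unbounded outside `𝔔_d(r)`, and bounded on the half-open segments
`(Q_4(r), Q_1(r)]` and `[Q_1(r), Q_2(r))`. -/
theorem local_variation_quad_small (d : ℕ) (r : ℝ)
    (hdr : (4 ≤ d ∧ 1 ≤ r ∧ r ≤ (d : ℝ) / ((d : ℝ) - 1)) ∨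
      (d = 3 ∧ 4 / 3 < r ∧ r ≤ 3 / 2)) :
    (∀ p q : ℝ≥0∞, 1 ≤ p → 1 ≤ q →
      (((p⁻¹.toReal, q⁻¹.toReal) ∈ interior (quadSmall d r)) →
          IsBddLpLq d p q (VrIA r)) ∧
      (((p⁻¹.toReal, q⁻¹.toReal) ∉ quadSmall d r) →
          ¬ IsBddLpLq d p q (VrIA r))) ∧
    (∀ p q : ℝ, 0 < p → 0 < q →
      ((1 / p, 1 / q) ∈
          segment ℝ ((1 - ((d : ℝ) + 1) / (r * (d : ℝ) * ((d : ℝ) - 1)), 1 / (r * (d : ℝ))))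
            ((1 / (r * (d : ℝ)), 1 / (r * (d : ℝ)))) \
            {((1 - ((d : ℝ) + 1) / (r * (d : ℝ) * ((d : ℝ) - 1)), 1 / (r * (d : ℝ))))} →
        IsBddR d r p q) ∧
      ((1 / p, 1 / q) ∈
          segment ℝ ((1 / (r * (d : ℝ)), 1 / (r * (d : ℝ))))
            (((r * ((d : ℝ) - 1) - 1) / (r * ((d : ℝ) - 1)),
              (r * ((d : ℝ) - 1) - 1) / (r * ((d : ℝ) - 1)))) \
            {(((r * ((d : ℝ) - 1) - 1) / (r * ((d : ℝ) - 1)),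
              (r * ((d : ℝ) - 1) - 1) / (r * ((d : ℝ) - 1))))} →
        IsBddR d r p q)) := by
  obtain ⟨hd, hr, hr2, a2⟩ := quad_params hdr
  set e : ℝ := 1 / (r * d) with he
  set b : ℝ := 1 / (r * ((d : ℝ) - 1)) with hb
  set a : ℝ := ((d : ℝ) + 1) / (r * d * ((d : ℝ) - 1)) with ha
  obtain ⟨e0, hab, heb, hb2, hu3⟩ := quad_rel hd hr he hb ha a2
  have hquad : ∀ u v : ℝ, (u, v) ∈ quadSmall d r ↔ e ≤ v ∧ v ≤ u ∧ u ≤ 1 - b ∧ u - 1 + 2 * b ≤ v := by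
    intro u v
    rw [← hull_four hab heb hb2 u v]
    unfold quadSmall
    rw [hu3]
  have hB : ∀ u v : ℝ, e ≤ v → v ≤ u → u < 1 - b → (u - 1 + 2 * b < v ∨ u < 1 - a) → IsBddR d r (1 / u) (1 / v) :=
    fun u v h1 h2 h3 h4 => bdd_final hd hr hr2 he hb ha a2 h1 h2 h3 h4
  refine ⟨fun p q hp hq => ⟨fun hInt => ?_, fun hnot hbdd => ?_⟩, fun p q hp hq => ⟨?_, ?_⟩⟩
  · set u := p⁻¹.toReal with hu
    set v := q⁻¹.toReal with hv
    obtain ⟨h1, h2, -, -⟩ := (hquad u v).1 (interior_subset hInt)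
    obtain ⟨ε, hε, hball⟩ := Metric.mem_nhds_iff.1 (mem_interior_iff_mem_nhds.1 hInt)
    have hmem : (u + ε / 2, v) ∈ quadSmall d r := by
      refine hball ?_
      rw [Metric.mem_ball, Prod.dist_eq]
      simp only [dist_self, Real.dist_eq, add_sub_cancel_left]
      rw [abs_of_pos (by positivity)]
      exact max_lt (by linarith) hε
    obtain ⟨-, -, h3, h4⟩ := (hquad _ _).1 hmem
    have key := hB u v h1 h2 (by linarith) (Or.inl (by linarith))
    unfold IsBddR at key
    rw [ofReal_one_div_inv_toReal hp (by linarith), ofReal_one_div_inv_toReal hq (by linarith)] at key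
    exact key
  · refine hnot ((hquad _ _).2 ?_)
    obtain ⟨n, rfl⟩ : ∃ n, d = n + 1 := ⟨d - 1, by omega⟩
    have hn : ((n + 1 : ℕ) : ℝ) - 1 = n := by push_cast; ring
    rw [hn] at hb
    have c := cex_c (by omega) hr hq hbdd
    have dd := cex_d (by omega) hr hq hbdd
    rw [← hb] at c dd
    exact ⟨cex_b hr hq hbdd, cex_a (by omega) hr hq hbdd, c, dd⟩
  · rintro ⟨⟨α, β, hα, hβ, hs, hz⟩, hne⟩
    simp only [Prod.smul_mk, Prod.mk_add_mk, smul_eq_mul, Prod.mk.injEq] at hz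
    obtain ⟨hz1, hz2⟩ := hz
    have hβ0 : β ≠ 0 := by
      rintro rfl
      apply hne
      have : α = 1 := by linarith
      subst this
      rw [mem_singleton_iff, ← hz1, ← hz2]
      simp
    have hβ1 : 0 < β := lt_of_le_of_ne hβ (Ne.symm hβ0)
    have hα' : α = 1 - β := by linarith
    subst hα'
    have e1 : 1 / q = e := by rw [← hz2]; ring
    have e2 : 1 / p = (1 - a) - β * (1 - a - e) := by rw [← hz1]; ring
    have h5 : 0 < 1 - a - e := by linarith
    have h6 : 0 < β * (1 - a - e) := by positivity
    have h7 : β * (1 - a - e) ≤ 1 - a - e := mul_le_of_le_one_left h5.le (by linarith)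
    have key := hB (1 / p) (1 / q) (by linarith) (by linarith) (by linarith) (Or.inr (by linarith))
    rwa [one_div_one_div, one_div_one_div] at key
  · rw [hu3]
    rintro ⟨⟨α, β, hα, hβ, hs, hz⟩, hne⟩
    simp only [Prod.smul_mk, Prod.mk_add_mk, smul_eq_mul, Prod.mk.injEq] at hz
    obtain ⟨hz1, hz2⟩ := hz
    have hα0 : α ≠ 0 := by
      rintro rfl
      apply hne
      have : β = 1 := by linarith
      subst this
      rw [mem_singleton_iff, ← hz1, ← hz2]
      simp
    have hα1 : 0 < α := lt_of_le_of_ne hα (Ne.symm hα0)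
    have hβ' : β = 1 - α := by linarith
    subst hβ'
    have e1 : 1 / q = 1 - b - α * (1 - b - e) := by rw [← hz2]; ring
    have e2 : 1 / p = 1 - b - α * (1 - b - e) := by rw [← hz1]; ring
    have h5 : 0 < 1 - b - e := by linarith
    have h6 : 0 < α * (1 - b - e) := by positivity
    have h7 : α * (1 - b - e) ≤ 1 - b - e := mul_le_of_le_one_left h5.le (by linarith)
    have key := hB (1 / p) (1 / q) (by linarith) (by linarith) (by linarith) (Or.inl (by linarith))
    rwa [one_div_one_div, one_div_one_div] at key
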